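/- There exists a universal constant c such that for every polynomial f ∈ ℤ[y_1,y_2,y_3] of total degree d ≥ 5 which is irreducible in ℚ[y_1,y_2,y_3] and NCC over ℚ, and whose homogeneous degree-d part f_d is 2-irreducible over ℚ, one has N_aff(f,B) ≤ c · d^{9/2} · B for all real B ≥ 2. -/

import Mathlib

open MvPolynomial

/-- The number of integral points of height at most `B` on the zero set of `f`. -/
noncomputable def Naff {n : ℕ} (f : MvPolynomial (Fin n) ℤ) (B : ℝ) : ℕ :=
  Set.ncard {x : Fin n → ℤ | MvPolynomial.eval x f = 0 ∧ ∀ i, (|x i| : ℝ) ≤ B}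

/-- The linear form with coefficients `c`. -/
noncomputable def linForm {K : Type*} [CommSemiring K] {n : ℕ} (c : Fin n → K) :
    MvPolynomial (Fin n) K :=
  ∑ i, MvPolynomial.C (c i) * MvPolynomial.X i

/-- `f` is NCC (not cylindrical over a curve) over `K`: it cannot be written as
`g(ℓ₁(x), ℓ₂(x))` for linear forms `ℓ₁, ℓ₂` over `K` and `g ∈ K[y₁,y₂]`. -/
def IsNCC {K : Type*} [CommSemiring K] {n : ℕ} (f : MvPolynomial (Fin n) K) : Prop :=
  ¬ ∃ (c c' : Fin n → K) (g : MvPolynomial (Fin 2) K),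
      f = MvPolynomial.aeval ![linForm c, linForm c'] g

/-- `f` is `r`-irreducible: every divisor of `f` of total degree at most `r` is a unit. -/
def RIrreducible {K : Type*} [CommSemiring K] {n : ℕ} (r : ℕ) (f : MvPolynomial (Fin n) K) : Prop :=
  ∀ g : MvPolynomial (Fin n) K, g ∣ f → g.totalDegree ≤ r → IsUnit g

open scoped Polynomial PowerSeries
open AlgHom (commutes comp_apply)
open Algebra (ofId)
open Chebyshev (theta)
open Derivation (leibniz leibniz_pow map_algebraMap)
open Fin (castSucc cons_succ init lastCases prod_univ_three snoc snoc_castSucc sum_univ_two tail)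
open Finset (Icc Ioc abs_prod card_filter_add_card_filter_not card_image_of_injOn
  card_image_of_injective card_le_card card_le_card_of_injOn card_pos card_range card_univ coe_Icc
  dvd_gcd dvd_sum filter_subset le_sup mem_Icc mem_Ioc mem_coe mem_filter mem_image mem_image_of_mem
  mem_map mem_range mem_singleton mem_univ mul_sum prod_le_prod prod_mul_distrib prod_ne_zero_iff
  prod_pos prod_pow_eq_pow_sum range single_le_sum sum_add_distrib sum_coe_sort sum_comm sum_congr
  sum_const sum_empty sum_eq_single sum_filter sum_image sum_le_card_nsmul sum_le_sum sum_mul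
  sum_range_succ sum_sub_distrib sum_subset univ)
open Finsupp (degree_eq_sum prod_fintype single single_eq_of_ne sum_fintype weight_apply)
open Fintype (card card_coe card_fin card_perm mem_piFinset piFinset sum_option)
open Function (Injective Surjective iterate_succ_apply iterate_succ_apply' ne_iff update)
open Ideal (mem_comap mem_span_singleton mul_mem_left span span_singleton_pow)
open Int (castRingHom cast_injective cast_zero natAbs_pos)
open LinearMap (finrank_range_add_finrank_ker ker mem_ker mulLeft pi proj range_eq_top)
open Matrix (cons_val_one cons_val_zero det det_apply det_mul_column mulVec of_apply swap_mulVec)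
open Module (End finrank)
open Multiset (mem_toFinset)
open MvPowerSeries (nat_le_order order_le order_mul)
open Nat (abs_cast cast_le cast_nonneg le_ceil one_le_pow pow_le_pow_left pow_le_pow_right)
open Or (inl inr)
open Polynomial (IsRoot card_roots' coeToPowerSeries coe_eval₂RingHom derivative_mul eval₂RingHom
  mem_roots natDegree_X_add_C natDegree_sum_le_of_forall_le)
open PowerSeries (X_dvd_iff X_pow_dvd_iff X_pow_order_dvd coeff_X_pow_mul' coeff_order derivative_X
  order_eq_nat)
open Real (exp log log_le_log log_le_rpow_div log_mul log_natCast_nonneg log_nonneg log_pow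
  log_two_gt_d9 mul_rpow one_le_rpow rpow_add rpow_le_rpow rpow_mul rpow_natCast rpow_one sqrt)
open RingHom (injective_int map_det)
open Set (InjOn)
open Submodule (finrank_mono span_le subset_span)
open Subtype (val_injective)
open ZMod (intCast_zmod_eq_zero_iff_dvd)
open DFunLike renaming congr_fun → dcongr
open Fin (last)
open Matrix (of)
open Polynomial renaming X → pX, C → pC
open PowerSeries (derivative)
open PowerSeries renaming X → sX, C → sC, constantCoeff → sconst, coeff → scoeff

local notation:max "MP" n:max R:max => MvPolynomial (Fin n) R
local notation:max "evQ" x:max => eval (fun i => (x i : ℚ))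

variable {R : Type*} [CommRing R] {K : Type*} [Field K] {n m d T s e p S : ℕ} {σ : Type*}

/-- The exponent vectors of the monomials of total degree at most `T`. -/
noncomputable def monoms (n T : ℕ) : Finset (Fin n →₀ ℕ) :=
  (range (T + 1)).biUnion fun k => univ.finsuppAntidiag k

lemma mem_monoms {α : Fin n →₀ ℕ} : α ∈ monoms n T ↔ ∑ i, α i ≤ T := by
  simp [monoms, Finset.mem_finsuppAntidiag]

lemma card_monoms (n T : ℕ) : (monoms (n + 1) T).card = (T + n + 1).choose (n + 1) := by
  rw [monoms, Finset.card_biUnion]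
  · simp_rw [Finset.card_finsuppAntidiag_nat_eq_choose]
    induction T with
    | zero => simp
    | succ T ih =>
      rw [sum_range_succ, ih]
      simp only [card_univ, card_fin]
      rw [show n + 1 + (T + 1) - 1 = T + n + 1 by omega, show T + 1 + n + 1 = (T + n + 1) + 1 by ring,
        Nat.choose_succ_succ (T + n + 1) n, add_comm]
      congr 1
      rw [← Nat.choose_symm (by omega)]
      congr 1
      omega
  · intro a _ b _ hab
    rw [Function.onFun, Finset.disjoint_left]
    intro x hx hy
    simp only [Finset.mem_finsuppAntidiag] at hx hy
    exact hab (hx.1.symm.trans hy.1)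

lemma finsupp_sum_fin (α : Fin n →₀ ℕ) : (α.sum fun _ e => e) = ∑ i, α i :=
  sum_fintype _ _ (fun _ => rfl)

lemma totalDegree_le_iff {R : Type*} [CommSemiring R] {p : MP n R} :
    p.totalDegree ≤ T ↔ p.support ⊆ monoms n T := by
  rw [totalDegree, Finset.sup_le_iff]
  simp only [finsupp_sum_fin, Finset.subset_iff, mem_monoms]

lemma finrank_restrictTotalDegree (K : Type*) [Field K] (n T : ℕ) :
    finrank K (restrictTotalDegree (Fin (n + 1)) K T) = (T + n + 1).choose (n + 1) := by
  rw [← card_monoms]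
  have h : {s : Fin (n + 1) →₀ ℕ | (s.sum fun _ e => e) ≤ T} = ↑(monoms (n + 1) T) := by
    ext s; simp [mem_monoms, finsupp_sum_fin]
  have e := Module.finrank_eq_nat_card_basis (basisRestrictSupport K
    {s : Fin (n + 1) →₀ ℕ | (s.sum fun _ e => e) ≤ T})
  rw [restrictTotalDegree, e, h]
  simp

lemma finrank_map_of_injective' {K V W : Type*} [Field K] [AddCommGroup V] [Module K V]
    [AddCommGroup W] [Module K W] {f : V →ₗ[K] W} (hf : Injective f)
    (p : Submodule K V) : finrank K (p.map f) = finrank K p :=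
  (Submodule.equivMapOfInjective f hf p).finrank_eq.symm

/-- `φ` times the polynomials of degree at most `T`. -/
noncomputable def mulDeg (φ : MP n K) (T : ℕ) : Submodule K (MP n K) :=
  (restrictTotalDegree (Fin n) K T).map (mulLeft K φ)

section
variable {K : Type*} [Field K] {n : ℕ}

lemma mem_mulDeg {φ g : MP n K} : g ∈ mulDeg φ T ↔ ∃ h : MP n K, h.totalDegree ≤ T ∧ φ * h = g := by
  simp [mulDeg, mem_restrictTotalDegree]

instance (φ : MP n K) (T : ℕ) : Module.Finite K (mulDeg φ T) := by
  unfold mulDeg; infer_instance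

lemma finrank_mulDeg {φ : MP (n + 1) K} (hφ : φ ≠ 0) (T : ℕ) :
    finrank K (mulDeg φ T) = (T + n + 1).choose (n + 1) := by
  rw [← finrank_restrictTotalDegree K, mulDeg]
  exact finrank_map_of_injective' (f := mulLeft K φ) (mul_right_injective₀ hφ) _

lemma mulDeg_le {φ : MP n K} (h : φ.totalDegree + T ≤ S) :
    mulDeg φ T ≤ restrictTotalDegree (Fin n) K S := by
  intro g hg
  obtain ⟨q, hq, rfl⟩ := mem_mulDeg.1 hg
  rw [mem_restrictTotalDegree]
  exact (totalDegree_mul _ _).trans (by omega)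

lemma finrank_mulDeg_sup {φ G : MP (n + 1) K} (hφ : φ ≠ 0) (hG : G ≠ 0) (hrel : IsRelPrime φ G) (hT
    : φ.totalDegree + G.totalDegree ≤ T) : (T - φ.totalDegree + n + 1).choose (n + 1) + (T -
    G.totalDegree + n + 1).choose (n + 1) ≤ finrank K ↥(mulDeg φ (T - φ.totalDegree) ⊔ mulDeg G (T -
    G.totalDegree)) + (T - φ.totalDegree - G.totalDegree + n + 1).choose (n + 1) := by
  have h1 := Submodule.finrank_sup_add_finrank_inf_eq (mulDeg φ (T - φ.totalDegree))
    (mulDeg G (T - G.totalDegree))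
  rw [finrank_mulDeg hφ, finrank_mulDeg hG] at h1
  rw [← h1]
  gcongr
  rw [← finrank_mulDeg (mul_ne_zero hφ hG)]
  apply finrank_mono
  rintro g ⟨h2, h3⟩
  obtain ⟨u, hu, rfl⟩ := mem_mulDeg.1 h2
  obtain ⟨w, hw, hw'⟩ := mem_mulDeg.1 h3
  have : G ∣ u := hrel.symm.dvd_of_dvd_mul_left (Dvd.intro _ hw')
  obtain ⟨q, rfl⟩ := this
  refine mem_mulDeg.2 ⟨q, ?_, by ring⟩
  by_cases hq : q = 0
  · simp [hq]
  rw [totalDegree_mul_of_isDomain hG hq] at hu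
  omega

end

lemma choose_two_cast (m : ℕ) : 2 * (m + 2).choose 2 = (m + 1) * (m + 2) := by
  induction m with
  | zero => rfl
  | succ m ih => rw [show m + 1 + 2 = (m + 2) + 1 by ring, Nat.choose_succ_succ' (m + 2) 1]; simp; linarith

lemma choose_three_cast (m : ℕ) : 6 * (m + 3).choose 3 = (m + 1) * (m + 2) * (m + 3) := by
  induction m with
  | zero => rfl
  | succ m ih =>
    rw [show m + 1 + 3 = (m + 3) + 1 by ring, Nat.choose_succ_succ' (m + 3) 2]
    have := choose_two_cast (m + 1)
    rw [show m + 1 + 2 = m + 3 by ring] at this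
    nlinarith

theorem finrank_le_mul_totalDegree {K V : Type*} [Field K] [AddCommGroup V] [Module K V]
    [Module.Finite K V] {φ G : MP 2 K} (hφ : φ ≠ 0) (hG : G ≠ 0) (hrel : IsRelPrime φ G) (L : MP 2 K
    →ₗ[K] V) (hL : Surjective L) (h1 : ∀ h, L (φ * h) = 0) (h2 : ∀ h, L (G * h) = 0) : finrank K V ≤
    φ.totalDegree * G.totalDegree := by
  obtain ⟨s, hs⟩ := Module.Finite.fg_top (R := K) (M := V)
  choose r hr using hL
  set a := φ.totalDegree
  set b := G.totalDegree
  obtain ⟨T, hT1, hT2⟩ : ∃ T, a + b ≤ T ∧ ∀ v ∈ s, (r v).totalDegree ≤ T :=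
    ⟨a + b + ∑ v ∈ s, (r v).totalDegree, by omega, fun v hv =>
      (single_le_sum (f := fun v => (r v).totalDegree) (fun _ _ => Nat.zero_le _) hv).trans
        (by omega)⟩
  have h3 := finrank_mulDeg_sup hφ hG hrel hT1
  set W := mulDeg φ (T - a) ⊔ mulDeg G (T - b)
  set P := restrictTotalDegree (Fin 2) K T
  have hWP : W ≤ P := sup_le (mulDeg_le (by omega)) (mulDeg_le (by omega))
  have hWk : W ≤ ker L := by
    refine sup_le ?_ ?_
    · intro g hg
      obtain ⟨q, -, rfl⟩ := mem_mulDeg.1 hg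
      exact h1 q
    · intro g hg
      obtain ⟨q, -, rfl⟩ := mem_mulDeg.1 hg
      exact h2 q
  let LP : P →ₗ[K] V := L.comp P.subtype
  have hsurj : LinearMap.range LP = ⊤ := by
    rw [eq_top_iff, ← hs, span_le]
    intro v hv
    exact ⟨⟨r v, (mem_restrictTotalDegree _ _ _).2 (hT2 v hv)⟩, hr v⟩
  have h4 := finrank_range_add_finrank_ker LP
  rw [hsurj, finrank_top, finrank_restrictTotalDegree K 1 T] at h4
  have h5 : finrank K W ≤ finrank K (ker LP) := by
    have : W ≤ (ker LP).map P.subtype := by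
      intro g hg
      exact ⟨⟨g, hWP hg⟩, hWk hg, rfl⟩
    refine (finrank_mono this).trans ?_
    exact Submodule.finrank_map_le _ _
  obtain ⟨t, rfl⟩ : ∃ t, T = a + b + t := ⟨T - (a + b), by omega⟩
  have e1 : a + b + t - a = b + t := by omega
  have e2 : a + b + t - b = a + t := by omega
  rw [e1, e2, show b + t - b = t by omega] at h3
  have c1 := choose_two_cast (b + t)
  have c2 := choose_two_cast (a + t)
  have c3 := choose_two_cast t
  have c4 := choose_two_cast (a + b + t)
  simp only [add_assoc, Nat.reduceAdd] at *
  nlinarith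

theorem exists_eliminant {f G : MP 3 K} (hf : f ≠ 0) (hG : G ≠ 0) (hrel : IsRelPrime f G) (ha : 1 ≤
    f.totalDegree) (hb : 1 ≤ G.totalDegree) (e : Fin 2 → Fin 3) (he : Injective e) : ∃ R : MP 2 K, R
    ≠ 0 ∧ R.totalDegree ≤ 2 * f.totalDegree * G.totalDegree ∧ ∃ A B, rename e R = f * A + G * B :=
    by
  set a := f.totalDegree
  set b := G.totalDegree
  set T := 2 * a * b with hT
  have hT1 : a + b ≤ T := by nlinarith
  have h3 := finrank_mulDeg_sup hf hG hrel hT1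
  set W := mulDeg f (T - a) ⊔ mulDeg G (T - b)
  set P := restrictTotalDegree (Fin 3) K T
  have hWP : W ≤ P := sup_le (mulDeg_le (by omega)) (mulDeg_le (by omega))
  let ρ : MP 2 K →ₗ[K] MP 3 K := (rename e).toLinearMap
  have hρ : Injective ρ := rename_injective e he
  let Q := (restrictTotalDegree (Fin 2) K T).map ρ
  have hQP : Q ≤ P := by
    rintro _ ⟨g, hg, rfl⟩
    exact (mem_restrictTotalDegree _ _ _).2
      ((totalDegree_rename_le _ _).trans ((mem_restrictTotalDegree _ _ _).1 hg))
  have hQ : finrank K Q = (T + 2).choose 2 := by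
    rw [finrank_map_of_injective' hρ, finrank_restrictTotalDegree K 1 T]
  have h4 := Submodule.finrank_sup_add_finrank_inf_eq W Q
  have h5 : finrank K ↥(W ⊔ Q) ≤ (T + 3).choose 3 := by
    rw [← finrank_restrictTotalDegree K 2 T]
    exact finrank_mono (sup_le hWP hQP)
  have h6 : 0 < finrank K ↥(W ⊓ Q) := by
    obtain ⟨t, ht⟩ : ∃ t, T = a + b + t := ⟨T - (a + b), by omega⟩
    have e1 : T - a = b + t := by omega
    have e2 : T - b = a + t := by omega
    rw [e1, e2, show b + t - b = t by omega] at h3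
    have c1 := choose_three_cast (b + t)
    have c2 := choose_three_cast (a + t)
    have c3 := choose_three_cast t
    have c4 := choose_three_cast T
    have c5 := choose_two_cast T
    simp only [add_assoc, Nat.reduceAdd] at *
    have key : 6 * (T + 3).choose 3 + 6 * (t + 3).choose 3 + 1 ≤ 6 * (b + (t + 3)).choose 3 +
      6 * (a + (t + 3)).choose 3 + 3 * (2 * (T + 2).choose 2) := by
      rw [c1, c2, c3, c4, c5]
      have e3 : (T : ℤ) = 2 * a * b := by rw [hT]; push_cast; ring
      have e4 : (t : ℤ) = T - a - b := by rw [ht]; push_cast; ring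
      zify
      have e5 : (0 : ℤ) ≤ a * b * (a + b) := by positivity
      have e6 : (0 : ℤ) ≤ T := by positivity
      rw [e4]
      have e7 : (a : ℤ) * b * (2 * T) = T * T := by rw [e3]; ring
      nlinarith
    omega
  obtain ⟨⟨g, hg1, hg2⟩, hg0⟩ := (Module.finrank_pos_iff_exists_ne_zero (R := K)).1 h6
  obtain ⟨R, hR, rfl⟩ := hg2
  refine ⟨R, ?_, (mem_restrictTotalDegree _ _ _).1 hR, ?_⟩
  · rintro rfl
    exact hg0 (by ext1; simp)
  · obtain ⟨y, hy, z, hz, hyz⟩ := Submodule.mem_sup.1 hg1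
    obtain ⟨A, -, rfl⟩ := mem_mulDeg.1 hy
    obtain ⟨B, -, rfl⟩ := mem_mulDeg.1 hz
    exact ⟨A, B, hyz.symm⟩

section Newton
open Polynomial

lemma mem_pow_of_sub_mem {B : Type*} [CommRing B] {J : Ideal B} {x r : B} {N : ℕ} (j : B)
    (hj : j ∈ J) (h : x + j * x ∈ J ^ N) (hr : x = r) : r ∈ J ^ N := by
  subst hr
  induction N with
  | zero => simp
  | succ N ih =>
    have h1 : x ∈ J ^ N := ih (Ideal.pow_le_pow_right (Nat.le_succ N) h)
    have h2 : j * x ∈ J ^ (N + 1) := by rw [pow_succ']; exact Ideal.mul_mem_mul hj h1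
    simpa using Ideal.sub_mem _ h h2

lemma newton_unique {B : Type*} [CommRing B] {J : Ideal B} {G : B[X]} {a l v w : B}
    (h1 : l * G.derivative.eval a - 1 ∈ J) (hv : v - a ∈ J) (hw : w - a ∈ J) {N : ℕ}
    (h : G.eval v - G.eval w ∈ J ^ N) : v - w ∈ J ^ N := by
  obtain ⟨q, hq⟩ := G.evalSubFactor v w
  obtain ⟨k, hk⟩ := G.binomExpansion w (v - w)
  have e0 : G.eval v - G.eval w = (v - w) * (G.derivative.eval w + k * (v - w)) := by
    rw [show v = w + (v - w) by ring, hk]; ring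
  have e1 : G.derivative.eval w - G.derivative.eval a ∈ J := by
    obtain ⟨q', hq'⟩ := G.derivative.evalSubFactor w a
    rw [hq']; exact J.mul_mem_left _ hw
  have e2 : v - w ∈ J := by
    have := J.sub_mem hv hw
    simpa using this
  refine mem_pow_of_sub_mem (x := v - w)
    (l * (G.derivative.eval w + k * (v - w)) - 1) ?_ ?_ rfl
  · have : l * (G.derivative.eval w + k * (v - w)) - 1 =
      (l * G.derivative.eval a - 1) + l * (G.derivative.eval w - G.derivative.eval a) +
        (l * k) * (v - w) := by ring
    rw [this]
    exact J.add_mem (J.add_mem h1 (J.mul_mem_left _ e1)) (J.mul_mem_left _ e2)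
  · have : (v - w) + (l * (G.derivative.eval w + k * (v - w)) - 1) * (v - w) =
      l * (G.eval v - G.eval w) := by rw [e0]; ring
    rw [this]
    exact mul_mem_left _ _ h

lemma newton_approx {B : Type*} [CommRing B] {J : Ideal B} {G : B[X]} {a l : B} (h0 : G.eval a ∈ J)
    (h1 : l * G.derivative.eval a - 1 ∈ J) (N : ℕ) : ∃ v, v - a ∈ J ∧ G.eval v ∈ J ^ N := by
  induction N with
  | zero => exact ⟨a, by simp, by simp⟩
  | succ N ih =>
    rcases Nat.eq_zero_or_pos N with rfl | hN
    · exact ⟨a, by simp, by simpa using h0⟩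
    obtain ⟨v, hv, hGv⟩ := ih
    obtain ⟨k, hk⟩ := G.binomExpansion v (-(l * G.eval v))
    obtain ⟨q', hq'⟩ := G.derivative.evalSubFactor v a
    have hJ : G.eval v ∈ J := Ideal.pow_le_self hN.ne' hGv
    refine ⟨v + -(l * G.eval v), ?_, ?_⟩
    · have : v + -(l * G.eval v) - a = (v - a) - l * G.eval v := by ring
      rw [this]
      exact J.sub_mem hv (J.mul_mem_left _ hJ)
    · rw [hk]
      have : G.eval v + G.derivative.eval v * -(l * G.eval v) + k * (-(l * G.eval v)) ^ 2 =
        -((l * G.derivative.eval a - 1) + l * (G.derivative.eval v - G.derivative.eval a)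
          - k * l ^ 2 * G.eval v) * G.eval v := by ring
      rw [this, pow_succ']
      refine Ideal.mul_mem_mul (J.neg_mem ?_) hGv
      rw [hq']
      exact J.sub_mem (J.add_mem h1 (J.mul_mem_left _ (J.mul_mem_left _ hv)))
        (J.mul_mem_left _ hJ)

end Newton

/-- `f` restricted to the line through `b` in the direction of the last coordinate. -/
noncomputable def lastPoly {R A : Type*} [CommRing R] [CommRing A] [Algebra R A]
    (b : Fin m → A) (f : MP (m + 1) R) : A[X] :=
  aeval (snoc (fun i => pC (b i)) pX : Fin (m + 1) → A[X]) f

section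
variable {R A : Type*} [CommRing R] [CommRing A] [Algebra R A] {m : ℕ}

lemma eval_lastPoly (b : Fin m → A) (f : MP (m + 1) R) (t : A) :
    (lastPoly b f).eval t = aeval (snoc b t : Fin (m + 1) → A) f := by
  have : ((Polynomial.aeval t : A[X] →ₐ[A] A).restrictScalars R).comp
      (aeval (snoc (fun i => pC (b i)) pX : Fin (m + 1) → A[X])) =
      aeval (snoc b t : Fin (m + 1) → A) := by
    ext i
    refine lastCases ?_ (fun i => ?_) i <;> simp
  have h := congrArg (fun g => g f) this
  simpa [lastPoly, Polynomial.coe_aeval_eq_eval] using h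

lemma derivative_lastPoly (b : Fin m → A) (f : MP (m + 1) R) :
    (lastPoly b f).derivative = lastPoly b (pderiv (last m) f) := by
  unfold lastPoly
  induction f using MvPolynomial.induction_on with
  | C r => simp [Polynomial.algebraMap_apply]
  | add p q hp hq => simp [hp, hq]
  | mul_X p i hp =>
    rw [map_mul, derivative_mul, hp, leibniz, map_add]
    refine lastCases ?_ (fun j => ?_) i
    · simp [smul_eq_mul]; ring
    · rw [pderiv_X_of_ne (Fin.castSucc_lt_last j).ne]
      simp [smul_eq_mul]; ring

end

lemma exists_param (g : MP (m + 1) ℤ) (p : ℕ) (hp : p.Prime) (a : Fin (m + 1) → ℤ) (ha : (p : ℤ) ∣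
    eval a g) (ha' : ¬ (p : ℤ) ∣ eval a (pderiv (last m) g)) (N : ℕ) : ∃ Φ : MP m ℤ, (Φ - C (a (last
    m)) ∈ span ({C (p : ℤ)} ∪ Set.range X : Set (MP m ℤ))) ∧ aeval (snoc (fun i => X i + C (a
    i.castSucc)) Φ : Fin (m + 1) → MP m ℤ) g ∈ (span ({C (p : ℤ)} ∪ Set.range X : Set (MP m ℤ))) ^ N
    ∧ ∀ x : Fin (m + 1) → ℤ, (∀ i, (p : ℤ) ∣ x i - a i) → (p : ℤ) ^ N ∣ eval x g → (p : ℤ) ^ N ∣ x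
    (last m) - eval (fun i => x (castSucc i) - a (castSucc i)) Φ := by
  set J := span ({C (p : ℤ)} ∪ Set.range X : Set (MP m ℤ)) with hJ
  set b : Fin m → MP m ℤ := fun i => X i + C (a i.castSucc)
  -- evaluation at a point congruent to `0` modulo `p` maps `J` into `(p)`
  have hmap : ∀ t : Fin m → ℤ, (∀ i, (p : ℤ) ∣ t i) → J ≤ (span {(p : ℤ)}).comap (eval t) := by
    intro t ht
    rw [hJ, Ideal.span_le]
    rintro _ (rfl | ⟨i, rfl⟩)
    · simp [mem_span_singleton]
    · simpa [mem_span_singleton] using ht i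
  have hJ0 : ∀ q : MP m ℤ, (p : ℤ) ∣ eval 0 q → q ∈ J := by
    intro q hq
    have h1 : q - C (eval 0 q) ∈ J := by
      clear hq
      induction q using MvPolynomial.induction_on with
      | C r => simp
      | add p q hp hq =>
        have := J.add_mem hp hq
        convert this using 1
        simp; ring
      | mul_X q i hq =>
        simp only [map_mul, eval_X, Pi.zero_apply, mul_zero, map_zero, sub_zero]
        exact J.mul_mem_left _ (Ideal.subset_span (inr ⟨i, rfl⟩))
    obtain ⟨c, hc⟩ := hq
    rw [hc, C_mul] at h1
    have h2 : C (p : ℤ) * C c ∈ J := J.mul_mem_right _ (Ideal.subset_span (inl rfl))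
    simpa using J.add_mem h1 h2
  have hev0 : ∀ f : MP (m + 1) ℤ, eval 0 ((lastPoly b f).eval (C (a (last m)))) = eval a f := by
    intro f
    rw [eval_lastPoly]
    have : (aeval (R := ℤ) (0 : Fin m → ℤ)).comp (aeval (snoc b (C (a (last m))) :
        Fin (m + 1) → MP m ℤ)) = aeval (R := ℤ) a := by
      ext i
      refine lastCases ?_ (fun i => ?_) i <;> simp [b]
    have h := congrArg (fun g => g f) this
    simpa [coe_aeval_eq_eval] using h
  obtain ⟨l, hl⟩ : ∃ l : ℤ, (p : ℤ) ∣ l * eval a (pderiv (last m) g) - 1 := by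
    have : IsCoprime (eval a (pderiv (last m) g)) (p : ℤ) :=
      ((Nat.prime_iff_prime_int.1 hp).coprime_iff_not_dvd.2 ha').symm
    obtain ⟨u, v, huv⟩ := this
    exact ⟨u, -v, by linear_combination huv⟩
  obtain ⟨Φ, h1, h2⟩ := newton_approx (J := J) (G := lastPoly b g) (a := C (a (last m)))
    (l := C l) (hJ0 _ (by rw [hev0]; exact ha)) (hJ0 _ (by
      rw [derivative_lastPoly, map_sub, map_mul, hev0]; simpa using hl)) N
  refine ⟨Φ, h1, by rwa [eval_lastPoly] at h2, ?_⟩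
  intro x hx hgx
  set t : Fin m → ℤ := fun i => x i.castSucc - a i.castSucc with ht
  have hmt := hmap t (fun i => hx _)
  rw [← mem_span_singleton, ← span_singleton_pow]
  have hev : ∀ f : MP (m + 1) ℤ, ∀ v : MP m ℤ, eval t ((lastPoly b f).eval v) =
      (lastPoly (fun i : Fin m => x i.castSucc) f).eval (eval t v) := by
    intro f v
    rw [eval_lastPoly, eval_lastPoly]
    have : (aeval (R := ℤ) t).comp (aeval (snoc b v : Fin (m + 1) → MP m ℤ)) =
        aeval (R := ℤ) (snoc (fun i : Fin m => x i.castSucc) (eval t v) : Fin (m + 1) → ℤ) := by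
      ext i
      refine lastCases ?_ (fun i => ?_) i <;> simp [b, ht, coe_aeval_eq_eval]
    have h := congrArg (fun g => g f) this
    simpa [coe_aeval_eq_eval] using h
  refine newton_unique (J := span {(p : ℤ)})
    (G := lastPoly (fun i : Fin m => x i.castSucc) g) (a := a (last m)) (l := l) ?_ ?_ ?_ ?_
  · have : C l * (lastPoly b (pderiv (last m) g)).eval (C (a (last m))) - 1 ∈ J :=
      hJ0 _ (by rw [map_sub, map_mul, hev0]; simpa using hl)
    have := hmt this
    rw [mem_comap, map_sub, map_mul, hev] at this
    simpa [derivative_lastPoly] using this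
  · simpa [mem_span_singleton] using hx (last m)
  · have := hmt h1
    simpa using this
  · refine Ideal.sub_mem _ ?_ ?_
    · rw [eval_lastPoly, span_singleton_pow, mem_span_singleton]
      have : (snoc (fun i : Fin m => x i.castSucc) (x (last m)) : Fin (m + 1) → ℤ) = x := by
        ext i; refine lastCases ?_ (fun i => ?_) i <;> simp
      rw [this]; simpa [coe_aeval_eq_eval] using hgx
    · rw [← hev]
      have h3 := Ideal.pow_right_mono hmt N h2
      have h4 := Ideal.le_comap_pow (K := span {(p : ℤ)}) (eval t) N h3
      exact h4

/-- `∑_{|α| < k} (k - |α|)` over exponent vectors in `m` variables. -/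
noncomputable def kap (m k : ℕ) : ℕ := ∑ α ∈ monoms m (k - 1), (k - ∑ i, α i)

lemma det_pow_dvd {ι : Type*} [DecidableEq ι] (p : ℤ) (k : ℕ) (M : Matrix (Fin s) (Fin s) ℤ) (good :
    Finset (Fin s)) (c : Fin s → ι) (τ : Fin s → (Fin m →₀ ℕ) → ℤ) (V : ι → (Fin m →₀ ℕ) → Fin s →
    ℤ) (U : Fin s → Fin s → ℤ) (hM : ∀ j ∈ good, ∀ i, M j i = ∑ α ∈ monoms m (k - 1), p ^ (∑ i, α i)
    * τ j α * V (c j) α i + p ^ k * U j i) : p ^ (k * good.card - (good.image c).card * kap m k) ∣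
    M.det := by
  classical
  set A := monoms m (k - 1)
  -- weights, coefficients and vectors of the multilinear expansion
  let wt : Fin s → Option A → ℕ := fun j a =>
    if j ∈ good then (match a with | none => k | some α => ∑ i, α.1 i) else 0
  let co : Fin s → Option A → ℤ := fun j a =>
    if j ∈ good then (match a with | none => 1 | some α => τ j α.1) else
      (match a with | none => 1 | some _ => 0)
  let ve : Fin s → Option A → Fin s → ℤ := fun j a =>
    if j ∈ good then (match a with | none => U j | some α => V (c j) α.1) else M j
  have hrow : M = fun j => ∑ a : Option A, (p ^ wt j a * co j a) • ve j a := by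
    funext j
    rw [sum_option]
    by_cases hj : j ∈ good
    · simp only [wt, co, ve, hj, if_true]
      ext i
      rw [hM j hj i, ← sum_coe_sort A]
      simp [Finset.sum_apply, add_comm]
    · simp [wt, co, ve, hj]
  have hdet : M.det = ∑ r : Fin s → Option A,
      det (fun j => (p ^ wt j (r j) * co j (r j)) • ve j (r j)) := by
    conv_lhs => rw [hrow]
    exact (Matrix.detRowAlternating (R := ℤ) (n := Fin s)).toMultilinearMap.map_sum
      (fun j a => (p ^ wt j a * co j a) • ve j a)
  rw [hdet]
  refine dvd_sum fun r _ => ?_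
  have hfac : det (fun j => (p ^ wt j (r j) * co j (r j)) • ve j (r j)) =
      (∏ j, (p ^ wt j (r j) * co j (r j))) * det (fun j => ve j (r j)) :=
    det_mul_column (fun j => p ^ wt j (r j) * co j (r j)) (fun j => ve j (r j))
  rw [hfac]
  by_cases hinj : ∃ j ∈ good, ∃ j' ∈ good, j ≠ j' ∧ c j = c j' ∧ r j = r j' ∧ (r j).isSome
  · obtain ⟨j, hj, j', hj', hne, hc, hr, hs⟩ := hinj
    have : det (fun j => ve j (r j)) = 0 := by
      apply Matrix.det_zero_of_row_eq hne
      obtain ⟨α, hα⟩ := Option.isSome_iff_exists.1 hs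
      have hα' : r j' = some α := hr ▸ hα
      simp only [hα, hα', ve, hj, hj', if_true, hc]
    rw [this, mul_zero]
    exact dvd_zero _
  · push Not at hinj
    refine Dvd.dvd.mul_right ?_ _
    rw [prod_mul_distrib, prod_pow_eq_pow_sum]
    refine Dvd.dvd.mul_right (pow_dvd_pow _ ?_) _
    have h1 : ∑ j ∈ good, wt j (r j) ≤ ∑ j, wt j (r j) :=
      Finset.sum_le_sum_of_subset (Finset.subset_univ _)
    refine le_trans ?_ h1
    rw [tsub_le_iff_right]
    -- total deficiency
    let def' : Option A → ℕ := fun a => match a with | none => 0 | some α => k - ∑ i, α.1 i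
    have h2 : k * good.card ≤ ∑ j ∈ good, wt j (r j) + ∑ j ∈ good, def' (r j) := by
      rw [← sum_add_distrib, mul_comm, ← smul_eq_mul]
      refine Finset.card_nsmul_le_sum _ _ _ fun j hj => ?_
      simp only [wt, hj, if_true, def']
      rcases r j with _ | α
      · simp
      · dsimp only; omega
    refine h2.trans (Nat.add_le_add_left ?_ _)
    set good' := good.filter fun j => (r j).isSome
    have h3 : ∑ j ∈ good, def' (r j) = ∑ j ∈ good', def' (r j) := by
      symm
      apply sum_subset (filter_subset _ _)
      intro j hj hj'
      have : r j = none := by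
        simp only [good', mem_filter, not_and, hj, true_implies] at hj'
        simpa using hj'
      simp [this, def']
    have h4 : ∑ j ∈ good', def' (r j) = ∑ x ∈ good'.image (fun j => (c j, r j)), def' x.2 := by
      rw [sum_image]
      intro j hj j' hj' he
      simp only [good', Finset.coe_filter, Set.mem_ofPred_eq] at hj hj'
      by_contra hne
      have he1 := congrArg Prod.fst he
      have he2 := congrArg Prod.snd he
      exact absurd hj.2 (hinj j hj.1 j' hj'.1 hne he1 he2)
    have h5 : ∑ x ∈ good'.image (fun j => (c j, r j)), def' x.2 ≤
        ∑ x ∈ (good.image c) ×ˢ (univ : Finset (Option A)), def' x.2 := by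
      apply Finset.sum_le_sum_of_subset
      intro x hx
      obtain ⟨j, hj, rfl⟩ := mem_image.1 hx
      simp only [Finset.mem_product, mem_univ, and_true]
      exact mem_image_of_mem _ (mem_filter.1 hj).1
    rw [h3, h4]
    refine h5.trans ?_
    rw [Finset.sum_product]
    simp only [sum_option, def', zero_add, sum_const, smul_eq_mul]
    rw [sum_coe_sort A (fun α => k - ∑ i, α i), kap]

lemma eval_expansion (p : ℤ) (k : ℕ) (H : MP m ℤ) (t : Fin m → ℤ) : ∃ u : ℤ, eval (fun i => p * t i)
    H = ∑ α ∈ monoms m (k - 1), p ^ (∑ i, α i) * (∏ i, t i ^ α i) * coeff α H + p ^ k * u := by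
  classical
  have h1 : eval (fun i => p * t i) H =
      ∑ α ∈ H.support ∪ monoms m (k - 1), p ^ (∑ i, α i) * (∏ i, t i ^ α i) * coeff α H := by
    rw [eval_eq']
    refine (sum_subset (s₂ := H.support ∪ monoms m (k - 1)) Finset.subset_union_left ?_).trans ?_
    · intro α _ hα
      rw [notMem_support_iff.1 hα]; simp
    · refine sum_congr rfl fun α _ => ?_
      simp only [mul_pow, prod_mul_distrib, prod_pow_eq_pow_sum]
      ring
  rcases Nat.eq_zero_or_pos k with rfl | hk
  · exact ⟨eval (fun i => p * t i) H - ∑ α ∈ monoms m (0 - 1),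
      p ^ (∑ i, α i) * (∏ i, t i ^ α i) * coeff α H, by simp⟩
  have h2 : p ^ k ∣ ∑ α ∈ (H.support ∪ monoms m (k - 1)) \ monoms m (k - 1),
      p ^ (∑ i, α i) * (∏ i, t i ^ α i) * coeff α H := by
    refine dvd_sum fun α hα => ?_
    have : k ≤ ∑ i, α i := by
      have := (Finset.mem_sdiff.1 hα).2
      rw [mem_monoms] at this
      omega
    rw [mul_assoc]
    exact (pow_dvd_pow p this).mul_right _
  obtain ⟨u, hu⟩ := h2
  refine ⟨u, ?_⟩
  rw [h1, ← hu, add_comm, Finset.sum_sdiff Finset.subset_union_right]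

lemma dvd_eval_sub_eval {σ R : Type*} [CommRing R] {q : R} {x y : σ → R} (h : ∀ i, q ∣ x i - y i)
    (g : MvPolynomial σ R) : q ∣ eval x g - eval y g := by
  induction g using MvPolynomial.induction_on with
  | C r => simp
  | add p r hp hr =>
    have := dvd_add hp hr
    convert this using 1
    simp only [map_add]; ring
  | mul_X p i hp =>
    have := dvd_add (hp.mul_right (x i)) ((h i).mul_left (eval y p))
    convert this using 1
    simp only [map_mul, eval_X]; ring

lemma exists_local_expansion (g : MP (m + 1) ℤ) (p : ℕ) (hp : p.Prime) (k : ℕ) (a : Fin (m + 1) → ℤ)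
    (ha' : ¬ (p : ℤ) ∣ eval a (pderiv (last m) g)) : ∃ V : MP (m + 1) ℤ → (Fin m →₀ ℕ) → ℤ, ∀ x :
    Fin (m + 1) → ℤ, (∀ i, (p : ℤ) ∣ x i - a i) → (p : ℤ) ^ k ∣ eval x g → ∀ F, ∃ u : ℤ, eval x F =
    ∑ α ∈ monoms m (k - 1), (p : ℤ) ^ (∑ i, α i) * (∏ i, ((x i.castSucc - a i.castSucc) / p) ^ α i)
    * V F α + (p : ℤ) ^ k * u := by
  rcases Nat.eq_zero_or_pos k with rfl | hk
  · exact ⟨fun _ _ => 0, fun x _ _ F => ⟨eval x F, by simp⟩⟩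
  by_cases ha : (p : ℤ) ∣ eval a g
  swap
  · refine ⟨fun _ _ => 0, fun x hx hg => absurd ?_ ha⟩
    have := (dvd_pow_self (p : ℤ) hk.ne').trans hg
    rw [← sub_sub_cancel (eval x g) (eval a g)]
    exact dvd_sub this (dvd_eval_sub_eval hx g)
  obtain ⟨Φ, -, -, hΦ⟩ := exists_param g p hp a ha ha' k
  set W : MP (m + 1) ℤ → MP m ℤ := fun F => aeval (snoc (fun i => X i + C (a i.castSucc)) Φ :
          Fin (m + 1) → MP m ℤ) F with hW
  refine ⟨fun F α => coeff α (W F), fun x hx hg F => ?_⟩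
  obtain ⟨u, hu⟩ := eval_expansion (p : ℤ) k (W F) (fun i => (x i.castSucc - a i.castSucc) / p)
  have ht : (fun i : Fin m => (p : ℤ) * ((x i.castSucc - a i.castSucc) / p)) =
      fun i => x i.castSucc - a i.castSucc := funext fun i => Int.mul_ediv_cancel' (hx _)
  rw [ht] at hu
  set t : Fin m → ℤ := fun i => x i.castSucc - a i.castSucc
  have hev : eval t (W F) = eval (snoc (fun i => x i.castSucc) (eval t Φ)) F := by
    have : (aeval (R := ℤ) t).comp (aeval (snoc (fun i => X i + C (a i.castSucc)) Φ :
          Fin (m + 1) → MP m ℤ)) =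
        aeval (R := ℤ) (snoc (fun i : Fin m => x i.castSucc) (eval t Φ) : Fin (m + 1) → ℤ) := by
      ext i
      refine lastCases ?_ (fun i => ?_) i <;> simp [t]
    have h := congrArg (fun g => g F) this
    simpa [W, coe_aeval_eq_eval] using h
  have hd : (p : ℤ) ^ k ∣ eval x F - eval t (W F) := by
    rw [hev]
    refine dvd_eval_sub_eval (fun i => ?_) F
    refine lastCases ?_ (fun i => ?_) i
    · simpa using hΦ x hx hg
    · simp
  obtain ⟨w, hw⟩ := hd
  exact ⟨u + w, by rw [← sub_add_cancel (eval x F) (eval t (W F)), hw, hu]; ring⟩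

lemma det_eval_dvd (g : MP (m + 1) ℤ) (p : ℕ) (hp : p.Prime) (k : ℕ) (x : Fin s → Fin (m + 1) → ℤ)
    (F : Fin s → MP (m + 1) ℤ) (good : Finset (Fin s)) (hg : ∀ j ∈ good, (p : ℤ) ^ k ∣ eval (x j) g)
    (hgood : ∀ j ∈ good, ¬ (p : ℤ) ∣ eval (x j) (pderiv (last m) g)) (M : Matrix (Fin s) (Fin s) ℤ)
    (μ : Fin s → ℤ) (hM : ∀ j ∈ good, ∀ i, (p : ℤ) ^ k ∣ M j i - μ j * eval (x j) (F i)) (hn :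
    (good.image fun j => fun i => ((x j i : ℤ) : ZMod p)).card ≤ n) : (p : ℤ) ^ (k * good.card - n *
    kap m k) ∣ M.det := by
  classical
  have hex : ∀ c : Fin (m + 1) → ZMod p, ∃ a : Fin (m + 1) → ℤ, ∃ V : Fin s → (Fin m →₀ ℕ) → ℤ,
      (∃ j ∈ good, (fun i => ((x j i : ℤ) : ZMod p)) = c) → 
      ∀ j ∈ good, (fun i => ((x j i : ℤ) : ZMod p)) = c → ∀ i, ∃ u : ℤ,
        eval (x j) (F i) = ∑ α ∈ monoms m (k - 1), (p : ℤ) ^ (∑ i, α i) *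
          (∏ i, ((x j i.castSucc - a i.castSucc) / p) ^ α i) * V i α + (p : ℤ) ^ k * u := by
    intro c
    by_cases h : ∃ j ∈ good, (fun i => ((x j i : ℤ) : ZMod p)) = c
    swap
    · exact ⟨0, 0, fun h' => absurd h' h⟩
    obtain ⟨j₀, hj₀, hc⟩ := h
    obtain ⟨V, hV⟩ := exists_local_expansion g p hp k (x j₀) (hgood j₀ hj₀)
    refine ⟨x j₀, fun i => V (F i), fun _ j hj hjc i => ?_⟩
    refine hV (x j) (fun i => ?_) (hg j hj) (F i)
    rw [← hc] at hjc
    have := congrFun hjc i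
    rw [← (intCast_zmod_eq_zero_iff_dvd (x j i - x j₀ i) p).symm.symm]
    push_cast
    exact sub_eq_zero.2 this
  choose a V hV using hex
  have hfin : ∀ j ∈ good, ∀ i, ∃ u : ℤ, M j i = ∑ α ∈ monoms m (k - 1), (p : ℤ) ^ (∑ i, α i) *
        (μ j * ∏ l, ((x j l.castSucc - a (fun i => ((x j i : ℤ) : ZMod p)) l.castSucc) / p) ^ α l) *
        V (fun i => ((x j i : ℤ) : ZMod p)) i α + (p : ℤ) ^ k * u := by
    intro j hj i
    obtain ⟨u, hu⟩ := hV _ ⟨j, hj, rfl⟩ j hj rfl i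
    obtain ⟨w, hw⟩ := hM j hj i
    refine ⟨μ j * u + w, ?_⟩
    rw [← sub_add_cancel (M j i) (μ j * eval (x j) (F i)), hw, hu, mul_add, mul_sum]
    have : ∀ α : Fin m →₀ ℕ, μ j * ((p : ℤ) ^ (∑ i, α i) *
          (∏ l, ((x j l.castSucc - a (fun i => ((x j i : ℤ) : ZMod p)) l.castSucc) / p) ^ α l) *
          V (fun i => ((x j i : ℤ) : ZMod p)) i α) = (p : ℤ) ^ (∑ i, α i) *
        (μ j * ∏ l, ((x j l.castSucc - a (fun i => ((x j i : ℤ) : ZMod p)) l.castSucc) / p) ^ α l) *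
        V (fun i => ((x j i : ℤ) : ZMod p)) i α := fun α => by ring
    simp only [this]
    ring
  have hU : ∃ U : Fin s → Fin s → ℤ, ∀ j ∈ good, ∀ i, M j i =
      ∑ α ∈ monoms m (k - 1), (p : ℤ) ^ (∑ i, α i) *
        (μ j * ∏ l, ((x j l.castSucc - a (fun i => ((x j i : ℤ) : ZMod p)) l.castSucc) / p) ^ α l) *
        V (fun i => ((x j i : ℤ) : ZMod p)) i α + (p : ℤ) ^ k * U j i := by
    have : ∀ j i, ∃ u : ℤ, j ∈ good → M j i = ∑ α ∈ monoms m (k - 1), (p : ℤ) ^ (∑ i, α i) *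
        (μ j * ∏ l, ((x j l.castSucc - a (fun i => ((x j i : ℤ) : ZMod p)) l.castSucc) / p) ^ α l) *
        V (fun i => ((x j i : ℤ) : ZMod p)) i α + (p : ℤ) ^ k * u := by
      intro j i
      by_cases hj : j ∈ good
      · obtain ⟨u, hu⟩ := hfin j hj i
        exact ⟨u, fun _ => hu⟩
      · exact ⟨0, fun h => absurd h hj⟩
    choose U hU using this
    exact ⟨U, fun j hj i => hU j i hj⟩
  obtain ⟨U, hU⟩ := hU
  refine dvd_trans (pow_dvd_pow _ ?_) (det_pow_dvd (p : ℤ) k M good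
    (fun j => fun i => ((x j i : ℤ) : ZMod p)) _ (fun c α i => V c i α) U hU)
  exact Nat.sub_le_sub_left (Nat.mul_le_mul_right _ hn) _

lemma kap_zero (m : ℕ) : kap m 0 = 0 := by simp [kap]

lemma kap_succ (m k : ℕ) : kap m (k + 1) = kap m k + (monoms m k).card := by
  have h : kap m k = ∑ α ∈ monoms m k, (k - ∑ i, α i) := by
    refine sum_subset ?_ ?_
    · intro α hα
      rw [mem_monoms] at hα ⊢
      omega
    · intro α h1 h2
      rw [mem_monoms] at h1 h2
      omega
  rw [h, Finset.card_eq_sum_ones, ← sum_add_distrib, kap]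
  refine sum_congr (by simp) fun α hα => ?_
  rw [mem_monoms] at hα
  omega

lemma kap_one (k : ℕ) : 2 * kap 1 k = k * (k + 1) := by
  induction k with
  | zero => simp [kap_zero]
  | succ k ih => rw [kap_succ, mul_add, ih, card_monoms]; simp; ring

lemma kap_two (k : ℕ) : 6 * kap 2 k = k * (k + 1) * (k + 2) := by
  induction k with
  | zero => simp [kap_zero]
  | succ k ih =>
    rw [kap_succ, mul_add, ih, card_monoms]
    have := choose_two_cast k
    linear_combination 3 * this

lemma exists_minor_ne_zero {K ι : Type*} [Field K] (A : ι → Fin s → K)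
    (h : ∀ c : Fin s → K, (∀ i, ∑ j, c j * A i j = 0) → c = 0) :
    ∃ e : Fin s → ι, det (fun j => A (e j) : Matrix (Fin s) (Fin s) K) ≠ 0 := by
  classical
  obtain ⟨κ, a, ha, hspan, hli⟩ := exists_linearIndependent' K A
  have htop : Submodule.span K (Set.range (A ∘ a)) = ⊤ := by
    rw [hspan]
    by_contra hne
    obtain ⟨f, hf, hle⟩ := Submodule.exists_le_ker_of_lt_top _ (lt_top_iff_ne_top.2 hne)
    apply hf
    have hc := h (fun j => f (Pi.single j 1)) (fun i => by
      have h1 : f (A i) = 0 := hle (subset_span ⟨i, rfl⟩)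
      rw [LinearMap.pi_apply_eq_sum_univ f (A i)] at h1
      rw [← h1]
      refine sum_congr rfl fun j _ => ?_
      rw [smul_eq_mul, mul_comm]
      congr 2
      funext l
      simp [Pi.single_apply, eq_comm])
    refine LinearMap.pi_ext' fun j => LinearMap.ext_ring ?_
    simpa using congrFun hc j
  let b := Module.Basis.mk hli htop.ge
  haveI : Fintype κ := FiniteDimensional.fintypeBasisIndex b
  have hcard : card κ = s := by
    rw [← Module.finrank_eq_card_basis b, Module.finrank_fin_fun]
  let e := (Fintype.equivFinOfCardEq hcard).symm
  refine ⟨fun j => a (e j), ?_⟩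
  have hli' : LinearIndependent K (fun j => A (a (e j))) := hli.comp e e.injective
  have := (Matrix.linearIndependent_rows_iff_isUnit (A := (fun j => A (a (e j)) :
    Matrix (Fin s) (Fin s) K))).1 hli'
  exact ((Matrix.isUnit_iff_isUnit_det _).1 this).ne_zero

attribute [local instance] Matrix.seminormedAddCommGroup in
lemma exists_small_kernel {ι β : Type*} [Finite ι] [Fintype β] (A : ι → β → ℤ) (H κ : ℕ) (hH : 1 ≤
    H) (hA : ∀ i j, |A i j| ≤ H) (L : Submodule ℚ (β → ℚ)) (hL : ∀ c ∈ L, ∀ i, ∑ j, c j * (A i j :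
    ℚ) = 0) (h0 : 0 < finrank ℚ L) (hdim : card β ≤ (κ + 1) * finrank ℚ L) : ∃ t : β → ℤ, t ≠ 0 ∧ (∀
    i, ∑ j, t j * A i j = 0) ∧ ∀ j, |t j| ≤ (card β * H : ℕ) ^ κ := by
  classical
  set AQ : ι → β → ℚ := fun i j => A i j with hAQ
  obtain ⟨μ, a, ha, hspan, hli⟩ := exists_linearIndependent' ℚ AQ
  have hfin : Finite μ := Finite.of_injective a ha
  have := Fintype.ofFinite μ
  have hrank : card μ + finrank ℚ L ≤ card β := by
    let M : Matrix μ β ℚ := fun i j => A (a i) j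
    have h1 : M.rank = card μ := LinearIndependent.rank_matrix (M := M) hli
    have h2 : L ≤ ker M.mulVecLin := by
      intro c hc
      rw [mem_ker]
      ext i
      have := hL c hc (a i)
      rw [Matrix.mulVecLin_apply]
      simpa [M, Matrix.mulVecLin_apply, mulVec, dotProduct, mul_comm] using this
    have h3 := finrank_mono h2
    have h4 := finrank_range_add_finrank_ker M.mulVecLin
    rw [Module.finrank_fintype_fun_eq_card] at h4
    have h5 : finrank ℚ (LinearMap.range M.mulVecLin) = card μ := h1
    omega
  have hback : ∀ t : β → ℤ, (∀ i : μ, ∑ j, t j * A (a i) j = 0) → ∀ i, ∑ j, t j * A i j = 0 := by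
    intro t ht i
    let φ : (β → ℚ) →ₗ[ℚ] ℚ := ∑ j, (t j : ℚ) • proj j
    have hφ : ∀ v, φ v = ∑ j, (t j : ℚ) * v j := fun v => by simp [φ]
    have hle : Submodule.span ℚ (Set.range AQ) ≤ ker φ := by
      rw [← hspan, span_le]
      rintro _ ⟨i, rfl⟩
      simp only [SetLike.mem_coe, mem_ker, hφ, hAQ, Function.comp]
      exact_mod_cast ht i
    have := hle (subset_span ⟨i, rfl⟩)
    rw [mem_ker, hφ] at this
    simp only [hAQ] at this
    exact_mod_cast this
  have hβ : 0 < card β := by omega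
  rcases Nat.eq_zero_or_pos (card μ) with hμ | hμ
  · have hemp : IsEmpty μ := Fintype.card_eq_zero_iff.1 hμ
    have hne : Nonempty β := Fintype.card_pos_iff.1 hβ
    refine ⟨fun _ => 1, fun h => ?_, hback _ (fun i => hemp.elim i), fun j => ?_⟩
    · simpa using congrFun h (Classical.arbitrary β)
    · have : 1 ≤ (card β * H) ^ κ := one_le_pow _ _ (Nat.mul_pos hβ hH)
      simpa using (mod_cast this : (1 : ℤ) ≤ ((card β * H : ℕ) : ℤ) ^ κ)
  let M : Matrix μ β ℤ := fun i j => A (a i) j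
  obtain ⟨t, ht0, htM, htn⟩ := Int.Matrix.exists_ne_zero_int_vec_norm_le M (by omega) hμ
  refine ⟨t, ht0, hback t (fun i => ?_), fun j => ?_⟩
  · have := congrFun htM i
    simpa [M, mulVec, dotProduct, mul_comm] using this
  have hM : max 1 ‖M‖ ≤ H := by
    refine max_le (mod_cast hH) ?_
    rw [Matrix.norm_le_iff (by positivity)]
    intro i j
    rw [Int.norm_eq_abs]
    exact_mod_cast hA (a i) j
  have hexp : ((card μ : ℝ) / (card β - card μ)) ≤ κ := by
    have hpos : (0 : ℝ) < (card β : ℝ) - card μ := by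
      have : card μ < card β := by omega
      have : (card μ : ℝ) < card β := mod_cast this
      linarith
    rw [div_le_iff₀ hpos]
    have h1 : (card β : ℝ) ≤ (κ + 1) * finrank ℚ L := mod_cast hdim
    have h2 : (card μ : ℝ) + finrank ℚ L ≤ card β := mod_cast hrank
    have hκ : (0 : ℝ) ≤ κ := cast_nonneg _
    nlinarith
  have hbase : (1 : ℝ) ≤ card β * H := by
    have : 1 ≤ card β * H := Nat.mul_pos hβ hH
    exact_mod_cast this
  have h1 : ‖t j‖ ≤ ((card β : ℝ) * H) ^ κ := by
    refine (norm_le_pi_norm t j).trans (htn.trans ?_)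
    refine (rpow_le_rpow (by positivity)
      (mul_le_mul_of_nonneg_left hM (cast_nonneg _)) ?_).trans ?_
    · apply div_nonneg (cast_nonneg _)
      have : card μ ≤ card β := by omega
      have : (card μ : ℝ) ≤ card β := mod_cast this
      linarith
    · rw [← rpow_natCast]
      exact Real.rpow_le_rpow_of_exponent_le hbase hexp
  rw [Int.norm_eq_abs] at h1
  exact_mod_cast h1

lemma abs_det_le (M : Matrix (Fin s) (Fin s) ℤ) (b : Fin s → ℤ)
    (h : ∀ j i, |M j i| ≤ b i) : |M.det| ≤ s.factorial * ∏ i, b i := by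
  rw [det_apply]
  refine (Finset.abs_sum_le_sum_abs _ _).trans ?_
  have : ∀ σ ∈ (univ : Finset (Equiv.Perm (Fin s))),
      |Equiv.Perm.sign σ • ∏ i, M (σ i) i| ≤ ∏ i, b i := by
    intro σ _
    have h1 : |Equiv.Perm.sign σ • ∏ i, M (σ i) i| = |∏ i, M (σ i) i| := by
      rcases Int.units_eq_one_or (Equiv.Perm.sign σ) with h | h <;> simp [h]
    rw [h1, abs_prod]
    exact prod_le_prod (fun _ _ => abs_nonneg _) (fun i _ => h _ _)
  refine (sum_le_sum this).trans ?_
  simp [card_perm]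

lemma support_sum_monomial {σ R : Type*} [CommSemiring R] [DecidableEq σ] (E : Finset (σ →₀ ℕ)) (c : (σ →₀ ℕ) → R) :
    (∑ α ∈ E, monomial α (c α)).support ⊆ E := by
  intro β hβ
  rw [mem_support_iff, coeff_sum] at hβ
  by_contra hn
  apply hβ
  refine Finset.sum_eq_zero fun α hα => ?_
  rw [coeff_monomial, if_neg]
  rintro rfl
  exact hn hα

lemma coeff_sum_monomial {σ R : Type*} [CommSemiring R] [DecidableEq σ] (E : Finset (σ →₀ ℕ)) (c : (σ →₀ ℕ) → R)
    {α : σ →₀ ℕ} (hα : α ∈ E) : coeff α (∑ α ∈ E, monomial α (c α)) = c α := by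
  rw [coeff_sum, sum_eq_single α]
  · simp
  · intro β _ hβ
    rw [coeff_monomial, if_neg hβ]
  · exact fun h => absurd hα h

lemma exists_poly_of_minors {P : Type*} (E : Finset (Fin n →₀ ℕ)) (S : Set P) (val : P → (Fin n →₀
    ℕ) → ℤ) (h : ∀ e : Fin E.card → P, (∀ j, e j ∈ S) → det (fun j i => val (e j) (E.equivFin.symm
    i).1 : Matrix (Fin E.card) (Fin E.card) ℤ) = 0) : ∃ g : MP n ℚ, g ≠ 0 ∧ g.support ⊆ E ∧ ∀ x ∈ S,
    ∑ α ∈ E, coeff α g * val x α = 0 := by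
  classical
  by_contra hcon
  push Not at hcon
  obtain ⟨e, he⟩ := exists_minor_ne_zero (K := ℚ) (ι := S)
    (fun x i => (val x.1 (E.equivFin.symm i).1 : ℚ)) (fun c hc => by
      by_contra hc0
      set c' : (Fin n →₀ ℕ) → ℚ := fun α => if hα : α ∈ E then c (E.equivFin ⟨α, hα⟩) else 0
      obtain ⟨x, hx, hne⟩ := hcon (∑ α ∈ E, monomial α (c' α)) (fun h0 => hc0 (by
        funext i
        have := coeff_sum_monomial E c' (E.equivFin.symm i).2
        rw [h0] at this
        simpa [c'] using this.symm)) (support_sum_monomial _ _)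
      apply hne
      rw [← hc ⟨x, hx⟩, ← sum_coe_sort E, ← E.equivFin.symm.sum_comp]
      refine sum_congr rfl fun i _ => ?_
      rw [coeff_sum_monomial E c' (E.equivFin.symm i).2]
      simp [c'])
  apply he
  have := h (fun j => (e j).1) (fun j => (e j).2)
  have h2 := congrArg (Int.cast : ℤ → ℚ) this
  have h3 := Int.cast_det (R := ℚ) (fun j i => val (e j) (E.equivFin.symm i).1 :
    Matrix (Fin E.card) (Fin E.card) ℤ)
  rw [h2, cast_zero] at h3
  exact h3.symm

lemma abs_prod_pow_le (x : Fin n → ℤ) (B : ℕ) (hx : ∀ i, |x i| ≤ B) (α : Fin n →₀ ℕ) :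
    |∏ i, x i ^ α i| ≤ (B : ℤ) ^ (∑ i, α i) := by
  rw [abs_prod, ← prod_pow_eq_pow_sum]
  refine prod_le_prod (fun _ _ => abs_nonneg _) fun i _ => ?_
  rw [abs_pow]
  exact pow_le_pow_left₀ (abs_nonneg _) (hx i) _

lemma card_monoms_le_two_pow (m T : ℕ) : (monoms (m + 1) T).card ≤ 2 ^ (T + m + 1) := by
  rw [card_monoms]; exact Nat.choose_le_two_pow _ _

lemma card_monoms_double_two (hd : 1 ≤ d) :
    (monoms 2 (2 * d - 1)).card ≤ 8 * (monoms 2 (d - 1)).card := by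
  obtain ⟨e, rfl⟩ : ∃ e, d = e + 1 := ⟨d - 1, by omega⟩
  rw [card_monoms, card_monoms, show 2 * (e + 1) - 1 = 2 * e + 1 by omega, Nat.add_sub_cancel]
  have h1 := choose_two_cast (2 * e + 1)
  have h2 := choose_two_cast e
  norm_num at *
  nlinarith

lemma card_monoms_double_three (hd : 1 ≤ d) :
    (monoms 3 (2 * d - 1)).card ≤ 8 * (monoms 3 (d - 1)).card := by
  obtain ⟨e, rfl⟩ : ∃ e, d = e + 1 := ⟨d - 1, by omega⟩
  rw [card_monoms, card_monoms, show 2 * (e + 1) - 1 = 2 * e + 1 by omega, Nat.add_sub_cancel]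
  have h1 := choose_three_cast (2 * e + 1)
  have h2 := choose_three_cast e
  norm_num at *
  nlinarith [mul_nonneg (Nat.zero_le e) (Nat.zero_le e)]

/-- The value at `(w, v)` of the homogenization of `g` in degree `T`. -/
noncomputable def hval (T : ℕ) (w : R) (v : Fin n → R) (g : MP n R) : R :=
  ∑ α ∈ g.support, coeff α g * (w ^ (T - ∑ i, α i) * ∏ i, v i ^ α i)

lemma hval_one (T : ℕ) (v : Fin n → R) (g : MP n R) : hval T 1 v g = eval v g := by
  simp [hval, eval_eq']

lemma map_hval {R A : Type*} [CommRing R] [CommRing A] (φ : R →+* A) {w : R} {u : A}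
    (hu : φ w * u = 1) (v : Fin n → R) (g : MP n R) (hT : g.totalDegree ≤ T) :
    φ (hval T w v g) = φ w ^ T * eval₂ φ (fun i => u * φ (v i)) g := by
  rw [hval, eval₂_eq', map_sum, mul_sum]
  refine sum_congr rfl fun α hα => ?_
  have hα' : ∑ i, α i ≤ T := mem_monoms.1 (totalDegree_le_iff.1 hT hα)
  simp only [map_mul, map_pow, map_prod, mul_pow, prod_mul_distrib, prod_pow_eq_pow_sum]
  have h1 : φ w ^ T = φ w ^ (T - ∑ i, α i) * φ w ^ (∑ i, α i) := by
    rw [← pow_add, Nat.sub_add_cancel hα']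
  have h2 : φ w ^ (∑ i, α i) * u ^ (∑ i, α i) = 1 := by rw [← mul_pow, hu, one_pow]
  rw [h1]
  linear_combination (- φ (coeff α g) * φ w ^ (T - ∑ i, α i) * (∏ i, φ (v i) ^ α i)) * h2

lemma abs_hval_le (g : MP n ℤ) (hg : g.totalDegree ≤ T) (A : ℤ) (hA : ∀ α, |coeff α g| ≤ A) (w : ℤ)
    (v : Fin n → ℤ) (B : ℕ) (hB : 1 ≤ B) (hw : |w| ≤ B) (hv : ∀ i, |v i| ≤ B) : |hval T w v g| ≤
    (monoms n T).card * (A * (B : ℤ) ^ T) := by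
  have hA0 : 0 ≤ A := (abs_nonneg _).trans (hA 0)
  have hsub := totalDegree_le_iff.1 hg
  refine (Finset.abs_sum_le_sum_abs _ _).trans ?_
  refine (sum_le_card_nsmul _ _ (A * (B : ℤ) ^ T) fun α hα => ?_).trans ?_
  · rw [abs_mul, abs_mul, abs_pow]
    refine mul_le_mul (hA α) ?_ (by positivity) hA0
    have hα' := mem_monoms.1 (hsub hα)
    calc _ ≤ (B : ℤ) ^ (T - ∑ i, α i) * (B : ℤ) ^ (∑ i, α i) :=
          mul_le_mul (pow_le_pow_left₀ (abs_nonneg _) hw _) (abs_prod_pow_le v B hv α)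
            (abs_nonneg _) (by positivity)
      _ = _ := by rw [← pow_add, Nat.sub_add_cancel hα']
  · rw [nsmul_eq_mul]
    exact mul_le_mul_of_nonneg_right (mod_cast card_le_card hsub) (by positivity)

lemma exists_small_vanishing {κ : ℕ} (f : MP (m + 1) ℚ) (hf : f ≠ 0) (hT : f.totalDegree + e ≤ T)
    (hcard : (monoms (m + 1) T).card ≤ (κ + 1) * (monoms (m + 1) e).card) (B : ℕ) (hB : 1 ≤ B) (S :
    Set (ℤ × (Fin (m + 1) → ℤ))) (hSf : S.Finite) (hS : ∀ x ∈ S, x.1 ≠ 0 ∧ eval (fun i => (x.1 :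
    ℚ)⁻¹ * x.2 i) f = 0 ∧ |x.1| ≤ B ∧ ∀ i, |x.2 i| ≤ B) : ∃ g : MP (m + 1) ℤ, g ≠ 0 ∧ g.totalDegree
    ≤ T ∧ (∀ x ∈ S, eval (fun i => (x.1 : ℚ)⁻¹ * x.2 i) (map (castRingHom ℚ) g) = 0) ∧ ∀ α, |coeff α
    g| ≤ (((monoms (m + 1) T).card * B ^ T : ℕ) : ℤ) ^ κ := by
  classical
  set E := monoms (m + 1) T with hE
  have := hSf.to_subtype
  let cm : MP (m + 1) ℚ →ₗ[ℚ] (E → ℚ) := pi fun α => lcoeff ℚ α.1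
  let ψ := cm.domRestrict (mulDeg f e)
  have hdeg : ∀ q ∈ mulDeg f e, q.support ⊆ E := by
    intro q hq
    have := mulDeg_le (S := T) hT hq
    rw [mem_restrictTotalDegree] at this
    exact totalDegree_le_iff.1 this
  have hinj : Injective ψ := by
    rw [← LinearMap.ker_eq_bot, LinearMap.ker_eq_bot']
    rintro ⟨q, hq⟩ h0
    ext α
    by_cases hα : α ∈ E
    · have := congrFun h0 ⟨α, hα⟩
      simpa [ψ, cm] using this
    · simpa using notMem_support_iff.1 (fun h => hα (hdeg q hq h))
  have hrank : finrank ℚ (LinearMap.range ψ) = (monoms (m + 1) e).card := by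
    rw [LinearMap.finrank_range_of_inj hinj, finrank_mulDeg hf, card_monoms]
  obtain ⟨t, ht0, htS, htb⟩ := exists_small_kernel (ι := S) (β := E)
    (fun x α => x.1.1 ^ (T - ∑ i, α.1 i) * ∏ i, x.1.2 i ^ α.1 i) (B ^ T) κ (one_le_pow _ _ hB)
    (fun x α => by
      obtain ⟨h0, h1, h2, h3⟩ := hS x.1 x.2
      have hα' := mem_monoms.1 α.2
      rw [abs_mul, abs_pow]
      push_cast
      calc _ ≤ (B : ℤ) ^ (T - ∑ i, α.1 i) * (B : ℤ) ^ (∑ i, α.1 i) :=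
          mul_le_mul (pow_le_pow_left₀ (abs_nonneg _) h2 _) (abs_prod_pow_le _ B h3 α.1)
            (abs_nonneg _) (by positivity)
        _ = _ := by rw [← pow_add, Nat.sub_add_cancel hα'])
    (LinearMap.range ψ) (by
      rintro _ ⟨⟨q, hq⟩, rfl⟩ x
      obtain ⟨h, _, rfl⟩ := mem_mulDeg.1 hq
      have hx0 : (x.1.1 : ℚ) ≠ 0 := mod_cast (hS x.1 x.2).1
      have h1 : eval (fun i => (x.1.1 : ℚ)⁻¹ * x.1.2 i) (f * h) = 0 := by
        rw [map_mul, (hS x.1 x.2).2.1, zero_mul]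
      have h2 := map_hval (T := T) (RingHom.id ℚ) (w := (x.1.1 : ℚ)) (u := (x.1.1 : ℚ)⁻¹)
        (mul_inv_cancel₀ hx0) (fun i => (x.1.2 i : ℚ)) (f * h) (totalDegree_le_iff.2 (hdeg _ hq))
      change hval T _ _ _ = _ * eval _ _ at h2
      simp only [RingHom.id_apply] at h2
      rw [h1, mul_zero, hval, sum_subset (hdeg _ hq)] at h2
      · rw [← h2, ← sum_coe_sort E]
        refine sum_congr rfl fun α _ => ?_
        simp [ψ, cm]
      · intro α _ hα
        rw [notMem_support_iff.1 hα, zero_mul])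
    (by rw [hrank]; exact card_pos.2 ⟨0, by simp [mem_monoms]⟩)
    (by rw [hrank, card_coe]; exact hcard)
  let c : (Fin (m + 1) →₀ ℕ) → ℤ := fun α => if hα : α ∈ E then t ⟨α, hα⟩ else 0
  have hsupp := support_sum_monomial E c
  have hcoeff : ∀ α, coeff α (∑ α ∈ E, monomial α (c α)) = c α := by
    intro α
    by_cases hα : α ∈ E
    · exact coeff_sum_monomial E c hα
    · rw [notMem_support_iff.1 (fun h => hα (hsupp h))]; simp [c, hα]
  refine ⟨∑ α ∈ E, monomial α (c α), fun h0 => ht0 ?_, totalDegree_le_iff.2 hsupp, ?_, ?_⟩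
  · funext α
    have := hcoeff α.1
    rw [h0] at this
    simpa [c] using this.symm
  · intro x hx
    have hx0 : (x.1 : ℚ) ≠ 0 := mod_cast (hS x hx).1
    have h2 := map_hval (T := T) (castRingHom ℚ) (w := x.1) (u := (x.1 : ℚ)⁻¹)
        (mul_inv_cancel₀ hx0) x.2 _ (totalDegree_le_iff.2 hsupp)
    have h3 : hval T x.1 x.2 (∑ α ∈ E, monomial α (c α)) = 0 := by
      rw [hval, sum_subset hsupp]
      · have := htS ⟨x, hx⟩
        rw [← this, ← sum_coe_sort E]
        refine sum_congr rfl fun α _ => ?_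
        rw [hcoeff]
        simp [c]
      · intro α _ hα
        rw [notMem_support_iff.1 hα, zero_mul]
    rw [h3, map_zero] at h2
    rw [eval_map]
    exact (mul_eq_zero.1 h2.symm).resolve_left (pow_ne_zero _ hx0)
  · intro α
    rw [hcoeff]
    by_cases hα : α ∈ E
    · simp only [c, hα, dif_pos]
      have := htb ⟨α, hα⟩
      rw [card_coe] at this
      exact_mod_cast this
    · simp only [c, hα, dif_neg, not_false_eq_true, abs_zero]
      positivity

lemma totalDegree_pderiv_le {σ R : Type*} [CommRing R] (i : σ) (f : MvPolynomial σ R) :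
    (pderiv i f).totalDegree ≤ f.totalDegree - 1 := by
  classical
  rw [f.as_sum, map_sum, ← f.as_sum]
  refine totalDegree_finsetSum_le fun α hα => ?_
  rw [pderiv_monomial]
  have h1 : (α.sum fun _ e => e) ≤ f.totalDegree := le_totalDegree hα
  rcases Nat.eq_zero_or_pos (α i) with h0 | h0
  · simp [h0]
  · refine (totalDegree_monomial_le _ _).trans ?_
    have h2 : α = (α - single i 1) + single i 1 := by
      rw [tsub_add_cancel_of_le]
      rw [Finsupp.single_le_iff]; exact h0
    have h3 : (α.sum fun _ e => e) = ((α - single i 1).sum fun _ e => e) + 1 := by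
      conv_lhs => rw [h2]
      rw [Finsupp.sum_add_index' (fun _ => rfl) (fun _ _ _ => rfl)]
      simp
    have h4 : ((α - single i 1).sum fun _ => id) = ((α - single i 1).sum fun _ e => e) := rfl
    omega

lemma totalDegree_map_intCast (f : MvPolynomial σ ℤ) :
    (map (castRingHom ℚ) f).totalDegree = f.totalDegree := by
  rw [totalDegree, totalDegree, support_map_of_injective _ (injective_int _)]

lemma eval_map_intCast (f : MvPolynomial σ ℤ) (x : σ → ℤ) :
    evQ x (map (castRingHom ℚ) f) = ((eval x f : ℤ) : ℚ) := by
  rw [eval_map]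
  exact (eval₂_comp_left (castRingHom ℚ) (RingHom.id ℤ) x f).symm

lemma not_dvd_of_totalDegree_lt {σ K : Type*} [Field K] {f q : MvPolynomial σ K} (hq : q ≠ 0)
    (h : q.totalDegree < f.totalDegree) : ¬ f ∣ q := by
  rintro ⟨r, rfl⟩
  have hf := left_ne_zero_of_mul hq
  have hr := right_ne_zero_of_mul hq
  rw [totalDegree_mul_of_isDomain hf hr] at h
  omega

lemma exists_smooth_multiple (hm : m ≤ 2) (f : MP (m + 1) ℚ) (hf : Irreducible f) (hd :
    f.totalDegree = d) (hd1 : 1 ≤ d) (hder : pderiv (last m) f ≠ 0) (hcard : (monoms (m + 1) (2 * d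
    - 1)).card ≤ 8 * (monoms (m + 1) (d - 1)).card) (B : ℕ) (hB : 2 ≤ B) (S : Set (ℤ × (Fin (m + 1)
    → ℤ))) (hSf : S.Finite) (hS : ∀ x ∈ S, x.1 ≠ 0 ∧ eval (fun i => (x.1 : ℚ)⁻¹ * x.2 i) f = 0 ∧
    |x.1| ≤ B ∧ ∀ i, |x.2 i| ≤ B) : ∃ g h : MP (m + 1) ℤ, g.totalDegree ≤ 2 * d ∧ h.totalDegree ≤ 2
    * d ∧ (∀ α, |coeff α g| ≤ (B : ℤ) ^ (80 * d)) ∧ ¬ f ∣ map (castRingHom ℚ) h ∧ (∀ x ∈ S, |hval (2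
    * d) x.1 x.2 h| ≤ (B : ℤ) ^ (80 * d)) ∧ ((h = pderiv (last m) g ∧ f ∣ map (castRingHom ℚ) g) ∨ ∀
    x ∈ S, eval (fun i => (x.1 : ℚ)⁻¹ * x.2 i) (map (castRingHom ℚ) h) = 0) := by
  classical
  obtain ⟨g, hg0, hgd, hgS, hgc⟩ := exists_small_vanishing f hf.ne_zero (by omega) hcard B
    (by omega) S hSf hS
  have hM' : (monoms (m + 1) (2 * d - 1)).card ≤ B ^ (2 * d + 2) :=
    (card_monoms_le_two_pow _ _).trans ((pow_le_pow_left hB _).trans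
      (pow_le_pow_right (by omega) (by omega)))
  have hgB : ∀ α, |coeff α g| ≤ (B : ℤ) ^ (80 * d) := by
    intro α
    have h1 : ((monoms (m + 1) (2 * d - 1)).card * B ^ (2 * d - 1)) ^ 7 ≤ B ^ (80 * d) :=
      calc _ ≤ (B ^ (2 * d + 2) * B ^ (2 * d - 1)) ^ 7 :=
            pow_le_pow_left (Nat.mul_le_mul_right _ hM') _
        _ = B ^ ((2 * d + 2 + (2 * d - 1)) * 7) := by rw [← pow_add, ← pow_mul]
        _ ≤ _ := pow_le_pow_right (by omega) (by omega)
    exact (hgc α).trans (mod_cast h1)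
  by_cases hdvd : f ∣ map (castRingHom ℚ) g
  swap
  · refine ⟨g, g, by omega, by omega, hgB, hdvd, fun x hx => ?_, inr hgS⟩
    have hx0 : (x.1 : ℚ) ≠ 0 := mod_cast (hS x hx).1
    have h2 := map_hval (T := 2 * d) (castRingHom ℚ) (w := x.1) (u := (x.1 : ℚ)⁻¹)
      (mul_inv_cancel₀ hx0) x.2 g (by omega)
    have h3 := hgS x hx
    rw [eval_map] at h3
    rw [show eval₂ (castRingHom ℚ) (fun i => (x.1 : ℚ)⁻¹ * (castRingHom ℚ) (x.2 i)) g = 0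
      from h3, mul_zero] at h2
    have h4 : hval (2 * d) x.1 x.2 g = 0 := by
      simpa using h2
    rw [h4, abs_zero]; positivity
  have hprime := hf.prime
  refine ⟨g, pderiv (last m) g, by omega, (totalDegree_pderiv_le _ _).trans (by omega), hgB, ?_, ?_,
    inl ⟨rfl, hdvd⟩⟩
  · obtain ⟨q, hq⟩ := hdvd
    have hgQ : map (castRingHom ℚ) g ≠ 0 := by
      rw [Ne, map_eq_zero_iff _ (map_injective _ (injective_int _))]
      exact hg0
    have hq0 : q ≠ 0 := by rintro rfl; exact hgQ (by rw [hq, mul_zero])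
    have hqd : q.totalDegree < f.totalDegree := by
      have := totalDegree_mul_of_isDomain hf.ne_zero hq0
      rw [← hq, totalDegree_map_intCast] at this
      omega
    rw [← pderiv_map, hq, leibniz, smul_eq_mul, smul_eq_mul]
    intro hdv
    have h1 : f ∣ q * pderiv (last m) f := (dvd_add_right (dvd_mul_right _ _)).1 hdv
    rcases hprime.dvd_or_dvd h1 with h | h
    · exact not_dvd_of_totalDegree_lt hq0 hqd h
    · refine not_dvd_of_totalDegree_lt hder ?_ h
      have := totalDegree_pderiv_le (last m) f
      omega
  · intro x hx
    set A : ℕ := ((monoms (m + 1) (2 * d - 1)).card * B ^ (2 * d - 1)) ^ 7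
    have hcd : ∀ α, |coeff α (pderiv (last m) g)| ≤ ((A * (2 * d) : ℕ) : ℤ) := by
      intro α
      rw [coeff_pderiv]
      by_cases hz : coeff (α + single (last m) 1) g = 0
      · rw [hz, zero_mul, abs_zero]; positivity
      have h1 : α (last m) + 1 ≤ 2 * d := by
        have := le_totalDegree (mem_support_iff.2 hz)
        have h2 : (α + single (last m) 1 : Fin (m + 1) →₀ ℕ) (last m) ≤
            (α + single (last m) 1 : Fin (m + 1) →₀ ℕ).sum fun _ e => e := by
          rw [finsupp_sum_fin]
          exact single_le_sum (f := fun i => (α + single (last m) 1 : Fin (m + 1) →₀ ℕ) i)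
            (fun _ _ => Nat.zero_le _) (mem_univ _)
        simp at h2
        omega
      rw [abs_mul]
      push_cast
      refine mul_le_mul (mod_cast hgc _) ?_ (abs_nonneg _) (by positivity)
      rw [abs_of_nonneg (by positivity)]
      exact_mod_cast h1
    refine (abs_hval_le _ ((totalDegree_pderiv_le _ _).trans (by omega)) _ hcd x.1 x.2 B
      (by omega) (hS x hx).2.2.1 (hS x hx).2.2.2).trans ?_
    have hM : (monoms (m + 1) (2 * d)).card ≤ B ^ (2 * d + 3) :=
      (card_monoms_le_two_pow _ _).trans ((pow_le_pow_left hB _).trans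
        (pow_le_pow_right (by omega) (by omega)))
    have h2d : 2 * d ≤ B ^ (2 * d) := (Nat.lt_two_pow_self).le.trans (pow_le_pow_left hB _)
    have hA : A ≤ (B ^ (2 * d + 2) * B ^ (2 * d)) ^ 7 :=
      pow_le_pow_left (Nat.mul_le_mul hM' (pow_le_pow_right (by omega) (by omega))) _
    have hfin : (monoms (m + 1) (2 * d)).card * (A * (2 * d) * B ^ (2 * d)) ≤ B ^ (80 * d) := by
      calc _ ≤ B ^ (2 * d + 3) * ((B ^ (2 * d + 2) * B ^ (2 * d)) ^ 7 * B ^ (2 * d) * B ^ (2 * d)) :=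
            Nat.mul_le_mul hM (Nat.mul_le_mul (Nat.mul_le_mul hA h2d)
              (pow_le_pow_right (by omega) (by omega)))
        _ = B ^ (2 * d + 3 + ((2 * d + 2 + 2 * d) * 7 + 2 * d + 2 * d)) := by
            rw [← pow_add, ← pow_mul, ← pow_add, ← pow_add, ← pow_add]
        _ ≤ _ := pow_le_pow_right (by omega) (by omega)
    exact_mod_cast hfin

lemma natDegree_lastPoly_le {R A : Type*} [CommRing R] [CommRing A] [Algebra R A] (b : Fin m → A) (f : MP (m + 1) R) :
    (lastPoly b f).natDegree ≤ f.totalDegree := by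
  rw [lastPoly, aeval_def, eval₂_eq']
  refine natDegree_sum_le_of_forall_le _ _ fun α hα => ?_
  have h1 : α (last m) ≤ f.totalDegree := by
    refine le_trans ?_ (le_totalDegree hα)
    rw [finsupp_sum_fin]
    exact single_le_sum (f := fun i => α i) (fun _ _ => Nat.zero_le _) (mem_univ _)
  refine le_trans ?_ h1
  rw [Fin.prod_univ_castSucc, ← mul_assoc]
  simp only [snoc_castSucc, Fin.snoc_last, ← Polynomial.C_pow]
  rw [← map_prod pC, Polynomial.algebraMap_apply, ← Polynomial.C_mul]
  refine (Polynomial.natDegree_C_mul_le _ _).trans ?_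
  exact Polynomial.natDegree_X_pow_le _

lemma eval_lastPoly_init (f : MP (m + 1) R)
    (x : Fin (m + 1) → R) : (lastPoly (init x) f).eval (x (last m)) = eval x f := by
  rw [eval_lastPoly, Fin.snoc_init_self]; simp [aeval_eq_eval]

lemma card_le_mul_card_init [IsDomain R] [DecidableEq R] (f : MP (m + 1) R) (hd : f.totalDegree ≤ d)
    (T : Finset (Fin (m + 1) → R)) (hT : ∀ x ∈ T, eval x f = 0) (hne : ∀ x ∈ T, lastPoly (init x) f
    ≠ 0) : T.card ≤ d * (T.image init).card := by
  refine Finset.card_le_mul_card_image _ _ fun b hb => ?_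
  obtain ⟨x, hx, rfl⟩ := mem_image.1 hb
  have hinj : InjOn (fun y : Fin (m + 1) → R => y (last m))
      (T.filter fun y => init y = (init x : Fin m → R)) := by
    intro y hy z hz hyz
    have h1 := (mem_filter.1 hy).2
    have h2 := (mem_filter.1 hz).2
    rw [← Fin.snoc_init_self y, ← Fin.snoc_init_self z, h1, h2]
    exact congrArg _ hyz
  rw [← card_image_of_injOn hinj]
  have hsub : (T.filter fun y => init y = (init x : Fin m → R)).image
      (fun y => y (last m)) ⊆ (lastPoly (init x) f).roots.toFinset := by
    intro t ht
    obtain ⟨y, hy, rfl⟩ := mem_image.1 ht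
    rw [mem_filter] at hy
    rw [mem_toFinset, mem_roots (hne x hx), IsRoot, ← hy.2, eval_lastPoly_init]
    exact hT y hy.1
  refine (card_le_card hsub).trans ((Multiset.toFinset_card_le _).trans ?_)
  exact (card_roots' _).trans ((natDegree_lastPoly_le _ _).trans hd)

lemma card_smooth_zeros_le [Fintype K] [DecidableEq K] (f : MP (m + 1) K) (hd : f.totalDegree ≤ d)
    (T : Finset (Fin (m + 1) → K)) (hT : ∀ x ∈ T, eval x f = 0) (hne : ∀ x ∈ T, eval x (pderiv (last
    m) f) ≠ 0) : T.card ≤ d * card K ^ m := by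
  refine (card_le_mul_card_init f hd T hT fun x hx h0 => hne x hx ?_).trans
    (Nat.mul_le_mul_left _ ?_)
  · rw [← eval_lastPoly_init, ← derivative_lastPoly, h0]; simp
  · refine (Finset.card_le_univ _).trans ?_
    simp

lemma totalDegree_map_le' {σ R S : Type*} [CommSemiring R] [CommSemiring S] (φ : R →+* S)
    (q : MvPolynomial σ R) : (map φ q).totalDegree ≤ q.totalDegree := by
  rw [totalDegree, totalDegree]
  exact Finset.sup_mono (support_map_subset _ _)

lemma eval_map_zmod (p : ℕ) (q : MvPolynomial σ ℤ) (y : σ → ℤ) :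
    eval (fun i => (y i : ZMod p)) (map (castRingHom (ZMod p)) q) = ((eval y q : ℤ) : ZMod p) := by
  rw [eval_map]
  exact (eval₂_comp_left (castRingHom (ZMod p)) (RingHom.id ℤ) y q).symm

lemma card_image_smooth_le {ι : Type*} (g : MP (m + 1) ℤ) (hd : g.totalDegree ≤ d) (p : ℕ) (hp :
    p.Prime) (good : Finset ι) (x : ι → Fin (m + 1) → ℤ) (hg : ∀ j ∈ good, (p : ℤ) ∣ eval (x j) g)
    (hgood : ∀ j ∈ good, ¬ (p : ℤ) ∣ eval (x j) (pderiv (last m) g)) : (good.image fun j => fun i =>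
    ((x j i : ℤ) : ZMod p)).card ≤ d * p ^ m := by
  have := Fact.mk hp
  have hd' : (map (castRingHom (ZMod p)) g).totalDegree ≤ d := (totalDegree_map_le' _ _).trans hd
  have h1 : ∀ y ∈ good.image fun j => fun i => ((x j i : ℤ) : ZMod p),
      eval y (map (castRingHom (ZMod p)) g) = 0 := by
    intro y hy
    obtain ⟨j, hj, rfl⟩ := mem_image.1 hy
    rw [eval_map_zmod]
    exact (intCast_zmod_eq_zero_iff_dvd _ p).2 (hg j hj)
  have h2 : ∀ y ∈ good.image fun j => fun i => ((x j i : ℤ) : ZMod p),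
      eval y (pderiv (last m) (map (castRingHom (ZMod p)) g)) ≠ 0 := by
    intro y hy
    obtain ⟨j, hj, rfl⟩ := mem_image.1 hy
    rw [pderiv_map, eval_map_zmod]
    exact fun h => hgood j hj ((intCast_zmod_eq_zero_iff_dvd _ p).1 h)
  have h := card_smooth_zeros_le _ hd' _ h1 h2
  rwa [ZMod.card] at h

lemma exists_theta_gap : ∃ K : ℕ, 2 ≤ K ∧ ∀ P : ℕ, 1 ≤ P →
    (P : ℝ) ≤ theta ((K * P : ℕ) : ℝ) - theta (P : ℝ) := by
  refine ⟨10 ^ 8, by norm_num, fun P hP => ?_⟩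
  set n : ℕ := 10 ^ 8 * P with hn
  have h1 := Chebyshev.theta_ge n
  have h2 := Chebyshev.theta_le_log4_mul_x (x := (P : ℝ)) (cast_nonneg _)
  have hP' : (1 : ℝ) ≤ P := mod_cast hP
  have hn' : (n : ℝ) = 10 ^ 8 * P := by rw [hn]; push_cast; ring
  have hn0 : (0 : ℝ) < n := by rw [hn']; positivity
  set q : ℝ := (n : ℝ) ^ ((1 : ℝ) / 4) with hq
  have hq4 : q ^ 4 = n := by
    rw [hq, ← rpow_natCast, ← rpow_mul hn0.le]; norm_num
  have hq0 : 0 < q := Real.rpow_pos_of_pos hn0 _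
  have hq100 : 100 ≤ q := by
    by_contra hlt
    push Not at hlt
    have : q ^ 4 < 100 ^ 4 := pow_lt_pow_left₀ hlt hq0.le (by norm_num)
    rw [hq4, hn'] at this
    nlinarith
  have hsq : √(n : ℝ) = q ^ 2 := by
    rw [← hq4, show q ^ 4 = (q ^ 2) ^ 2 by ring, Real.sqrt_sq (by positivity)]
  have hlog : log n ≤ 4 * q := by
    have := log_le_rpow_div hn0.le (ε := 1 / 4) (by norm_num)
    rw [← hq] at this
    linarith
  have hlog1 : log (n + 1) ≤ n / 100 := by
    have h3 : log (n + 1) ≤ 4 * ((n : ℝ) + 1) ^ ((1 : ℝ) / 4) := by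
      have := log_le_rpow_div (x := (n : ℝ) + 1) (by positivity) (ε := 1 / 4) (by norm_num)
      linarith
    have h4 : ((n : ℝ) + 1) ^ ((1 : ℝ) / 4) ≤ 2 * q := by
      have : (2 * q) = (16 * (n : ℝ)) ^ ((1 : ℝ) / 4) := by
        rw [mul_rpow (by norm_num) hn0.le, ← hq]
        congr 1
        rw [show (16 : ℝ) = 2 ^ (4 : ℝ) by norm_num, ← rpow_mul (by norm_num)]
        norm_num
      rw [this]
      apply rpow_le_rpow (by positivity) _ (by norm_num)
      nlinarith
    have h5 : 100 ^ 3 * q ≤ q ^ 4 := by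
      have : (100 : ℝ) ^ 3 ≤ q ^ 3 := pow_le_pow_left₀ (by norm_num) hq100 _
      nlinarith
    rw [hq4] at h5
    linarith
  have h6 : 2 * √(n : ℝ) * log n ≤ n * (8 / 100) := by
    rw [hsq]
    have h7 : 100 * q ^ 3 ≤ q ^ 4 := by
      have : 0 ≤ q ^ 3 := by positivity
      nlinarith
    have h8 : q ^ 2 * log n ≤ q ^ 2 * (4 * q) := mul_le_mul_of_nonneg_left hlog (by positivity)
    have h9 : (n : ℝ) * (8 / 100) = q ^ 4 * (8 / 100) := by rw [hq4]
    rw [h9]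
    nlinarith
  have hl2 := log_two_gt_d9
  have hl4 : log 4 ≤ 2 := by
    rw [show (4 : ℝ) = 2 ^ 2 by norm_num, log_pow]
    have := Real.log_two_lt_d9
    push_cast; linarith
  have h9 : log 4 * P ≤ 2 * P := mul_le_mul_of_nonneg_right hl4 (by positivity)
  have h10 : (n : ℝ) * (1 / 2) ≤ n * log 2 := mul_le_mul_of_nonneg_left (by linarith) hn0.le
  have h11 : (10 : ℝ) ^ 8 * P * (3 / 10) ≤ theta n := by
    rw [← hn']; linarith
  nlinarith

lemma sum_log_primes_dvd_le (s : Finset ℕ) (a : ℤ) (ha : a ≠ 0) (hs : ∀ p ∈ s, p.Prime)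
    (hd : ∀ p ∈ s, (p : ℤ) ∣ a) : ∑ p ∈ s, log p ≤ log |(a : ℝ)| := by
  rw [← Real.log_prod (fun p hp => mod_cast (hs p hp).ne_zero)]
  have h1 : ∏ p ∈ s, p ∣ a.natAbs :=
    Finset.prod_primes_dvd _ (fun p hp => (hs p hp).prime) fun p hp => Int.natCast_dvd.1 (hd p hp)
  have h2 : ∏ p ∈ s, p ≤ a.natAbs := Nat.le_of_dvd (natAbs_pos.2 ha) h1
  have h3 : ((∏ p ∈ s, p : ℕ) : ℝ) ≤ |(a : ℝ)| := by
    rw [← Int.cast_abs, Int.abs_eq_natAbs]; exact_mod_cast h2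
  push_cast at h3
  exact log_le_log (prod_pos fun p hp => mod_cast (hs p hp).pos) h3

lemma exists_prime_avoiding : ∃ K : ℕ, 2 ≤ K ∧ ∀ {ι : Type} (X : Finset ι) (A : ι → ℤ) (Λ : ℝ)
    (P : ℕ), 1 ≤ P → (∀ x ∈ X, A x ≠ 0) → (∀ x ∈ X, log |(A x : ℝ)| ≤ Λ) → 2 * Λ ≤ P →
    ∃ p : ℕ, p.Prime ∧ P < p ∧ p ≤ K * P ∧ 2 * (X.filter fun x => (p : ℤ) ∣ A x).card ≤ X.card := by
  classical
  obtain ⟨K, hK, hgap⟩ := exists_theta_gap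
  refine ⟨K, hK, fun {ι} X A Λ P hP hA hlog hΛ => ?_⟩
  set Q := (Ioc P (K * P)).filter Nat.Prime with hQ
  have hPK : P ≤ K * P := Nat.le_mul_of_pos_left _ (by omega)
  have hsum : (P : ℝ) ≤ ∑ p ∈ Q, log p := by
    refine (hgap P hP).trans (le_of_eq ?_)
    rw [theta, theta, Nat.floor_natCast, Nat.floor_natCast, sub_eq_iff_eq_add]
    rw [hQ, ← Finset.sum_union]
    · congr 1
      ext p
      simp only [Finset.mem_union, mem_filter, mem_Ioc]
      constructor
      · rintro ⟨h1, h2⟩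
        by_cases h : P < p
        · exact inl ⟨⟨h, h1.2⟩, h2⟩
        · exact inr ⟨⟨h1.1, by omega⟩, h2⟩
      · rintro (⟨h1, h2⟩ | ⟨h1, h2⟩)
        · exact ⟨⟨by omega, h1.2⟩, h2⟩
        · exact ⟨⟨h1.1, by omega⟩, h2⟩
    · rw [Finset.disjoint_left]
      intro p hp1 hp2
      simp only [mem_filter, mem_Ioc] at hp1 hp2
      omega
  by_contra hcon
  push Not at hcon
  have hX : 0 < X.card := by
    rcases Q.eq_empty_or_nonempty with h0 | ⟨p, hp⟩
    · rw [h0, sum_empty] at hsum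
      have : (1 : ℝ) ≤ P := mod_cast hP
      linarith
    · simp only [hQ, mem_filter, mem_Ioc] at hp
      by_contra h
      have h1 := hcon p hp.2 hp.1.1 hp.1.2
      have h2 := Finset.card_filter_le X (fun x => (p : ℤ) ∣ A x)
      omega
  have hlow : ∑ p ∈ Q, log p * X.card < 2 * ∑ p ∈ Q, log p * (X.filter fun x => (p : ℤ) ∣ A x).card := by
    rw [mul_sum]
    refine Finset.sum_lt_sum_of_nonempty ?_ fun p hp => ?_
    · by_contra h
      rw [Finset.not_nonempty_iff_eq_empty] at h
      rw [h, sum_empty] at hsum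
      have : (1 : ℝ) ≤ P := mod_cast hP
      linarith
    · simp only [hQ, mem_filter, mem_Ioc] at hp
      have h1 := hcon p hp.2 hp.1.1 hp.1.2
      have h2 : 0 < log p := Real.log_pos (mod_cast hp.2.one_lt)
      have h3 : (X.card : ℝ) < 2 * (X.filter fun x => (p : ℤ) ∣ A x).card := mod_cast h1
      nlinarith
  have hswap : ∑ p ∈ Q, log p * ((X.filter fun x => (p : ℤ) ∣ A x).card : ℝ) =
      ∑ x ∈ X, ∑ p ∈ Q.filter (fun p : ℕ => (p : ℤ) ∣ A x), log p := by
    simp_rw [sum_filter]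
    rw [sum_comm]
    refine sum_congr rfl fun p _ => ?_
    rw [Finset.card_filter]
    push_cast
    rw [mul_sum]
    refine sum_congr rfl fun x _ => ?_
    split_ifs <;> simp
  have hup : ∀ x ∈ X, ∑ p ∈ Q.filter (fun p : ℕ => (p : ℤ) ∣ A x), log p ≤ Λ := by
    intro x hx
    refine (sum_log_primes_dvd_le _ (A x) (hA x hx) ?_ ?_).trans (hlog x hx)
    · intro p hp; exact (mem_filter.1 (mem_filter.1 hp).1).2
    · intro p hp; exact (mem_filter.1 hp).2
  have h1 := sum_le_card_nsmul X _ Λ hup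
  rw [nsmul_eq_mul] at h1
  rw [hswap, ← sum_mul] at hlow
  have hX' : (0 : ℝ) < X.card := mod_cast hX
  nlinarith

lemma jets_bezout (Z : Finset (Fin 2 → K)) (M : ℕ) (ev : (Fin 2 → K) → MP 2 K →ₐ[K] K⟦X⟧) (hc : ∀ a
    ∈ Z, ∀ P, sconst (ev a P) = eval a P) (hX : ∀ a ∈ Z, ev a (X 0 - C (a 0)) = sX) {φ G : MP 2 K}
    (hφ : φ ≠ 0) (hG : G ≠ 0) (hrel : IsRelPrime φ G) (h1 : ∀ a ∈ Z, (sX : K⟦X⟧) ^ M ∣ ev a φ) (h2 :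
    ∀ a ∈ Z, (sX : K⟦X⟧) ^ M ∣ ev a G) : Z.card * M ≤ φ.totalDegree * G.totalDegree := by
  classical
  let L : MP 2 K →ₗ[K] (Z × Fin M → K) :=
    { toFun := fun P q => scoeff q.2 (ev q.1 P)
      map_add' := fun P Q => by ext q; simp
      map_smul' := fun c P => by ext q; simp }
  have hker : ∀ (a : Z) (P : MP 2 K), (sX : K⟦X⟧) ^ M ∣ ev a P →
      ∀ k : Fin M, scoeff k (ev a P) = 0 := fun a P h k =>
    X_pow_dvd_iff.1 h k k.2
  let I : (Fin 2 → K) → Ideal (MP 2 K) := fun a => (span {(sX : K⟦X⟧) ^ M}).comap (ev a)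
  have hI : ∀ a ∈ Z, ∀ i, (X i - C (a i)) ^ M ∈ I a := by
    intro a ha i
    rw [mem_comap, mem_span_singleton, map_pow]
    apply pow_dvd_pow_of_dvd
    rw [X_dvd_iff, hc a ha]
    simp
  have hL : Surjective L := by
    intro v
    obtain ⟨r, hr⟩ := Ideal.exists_forall_sub_mem_ideal (I := fun a : Z => I a)
      (by
        rintro ⟨a, ha⟩ ⟨b, hb⟩ hab
        replace hab : a ≠ b := fun h => hab (Subtype.ext h)
        change IsCoprime (I a) (I b)
        obtain ⟨i, hi⟩ := ne_iff.1 hab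
        rw [Ideal.isCoprime_iff_exists]
        have hcop : IsCoprime ((X i - C (a i) : MP 2 K) ^ M) ((X i - C (b i)) ^ M) := by
          apply IsCoprime.pow
          refine ⟨C (b i - a i)⁻¹, - C (b i - a i)⁻¹, ?_⟩
          have : b i - a i ≠ 0 := sub_ne_zero.2 (Ne.symm hi)
          rw [neg_mul, ← sub_eq_add_neg, ← mul_sub, sub_sub_sub_cancel_left, ← C_sub, ← C_mul,
            inv_mul_cancel₀ this, C_1]
        obtain ⟨u, w, huw⟩ := hcop
        exact ⟨_, mul_mem_left _ u (hI a ha i), _, mul_mem_left _ w (hI b hb i), huw⟩)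
      (fun a => ∑ k : Fin M, C (v (a, k)) * (X 0 - C (a.1 0)) ^ (k : ℕ))
    refine ⟨r, ?_⟩
    ext ⟨⟨a, ha⟩, k⟩
    have h := hr ⟨a, ha⟩
    rw [mem_comap, mem_span_singleton, X_pow_dvd_iff] at h
    have h := h k k.2
    rw [map_sub, map_sub, sub_eq_zero] at h
    change scoeff k (ev a r) = _
    rw [h, map_sum, map_sum]
    simp_rw [map_mul, map_pow, hX a ha, ← algebraMap_eq, commutes]
    rw [sum_eq_single k]
    · simp [PowerSeries.algebraMap_apply, PowerSeries.coeff_X_pow]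
    · intro j _ hj
      simp [PowerSeries.algebraMap_apply, PowerSeries.coeff_X_pow, Fin.val_ne_iff.2 hj.symm]
    · simp
  have h := finrank_le_mul_totalDegree hφ hG hrel L hL
    (fun Q => by
      ext ⟨a, k⟩
      exact hker a _ (by rw [map_mul]; exact (h1 a a.2).mul_right _) k)
    (fun Q => by
      ext ⟨a, k⟩
      exact hker a _ (by rw [map_mul]; exact (h2 a a.2).mul_right _) k)
  simpa using h

lemma plane_bezout (Z : Finset (Fin 2 → K)) {φ G : MP 2 K} (hφ : φ ≠ 0) (hG : G ≠ 0) (hrel :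
    IsRelPrime φ G) (h1 : ∀ a ∈ Z, eval a φ = 0) (h2 : ∀ a ∈ Z, eval a G = 0) : Z.card ≤
    φ.totalDegree * G.totalDegree := by
  have hc : ∀ (a : Fin 2 → K) (P : MP 2 K), sconst
      (aeval ![sX + sC (a 0), sC (a 1)] P) = eval a P := by
    intro a P
    induction P using MvPolynomial.induction_on with
    | C c => simp
    | add p q hp hq => simp [hp, hq]
    | mul_X p i hp => fin_cases i <;> simp [hp]
  have := jets_bezout Z 1
    (fun a => aeval ![sX + sC (a 0), sC (a 1)])
    (fun a _ P => hc a P) (fun a _ => by simp) hφ hG hrel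
    (fun a ha => by rw [pow_one, X_dvd_iff, hc, h1 a ha])
    (fun a ha => by rw [pow_one, X_dvd_iff, hc, h2 a ha])
  simpa using this

lemma dvd_of_X_pow_dvd {φ G : MP 2 K} (hφ : Irreducible φ) (ev : MP 2 K →ₐ[K] K⟦X⟧) (a : Fin 2 → K)
    (hc : ∀ P, sconst (ev P) = eval a P) (hX : ev (X 0 - C (a 0)) = sX) (h1 : ev φ = 0) {M : ℕ} (hM
    : φ.totalDegree * G.totalDegree < M) (h2 : (sX : K⟦X⟧) ^ M ∣ ev G) : φ ∣ G := by
  by_contra hnd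
  have hG : G ≠ 0 := by rintro rfl; exact hnd (dvd_zero _)
  have hrel : IsRelPrime φ G := hφ.isRelPrime_iff_not_dvd.2 hnd
  have := jets_bezout {a} M (fun _ => ev) (by simpa using hc) (by simpa using hX) hφ.ne_zero hG hrel
    (fun _ _ => by rw [h1]; exact dvd_zero _) (fun _ _ => h2)
  simp at this
  omega

lemma dvd_of_eval_branch_eq_zero {φ G : MP 2 K} (hφ : Irreducible φ) (ev : MP 2 K →ₐ[K] K⟦X⟧) (a :
    Fin 2 → K) (hc : ∀ P, sconst (ev P) = eval a P) (hX : ev (X 0 - C (a 0)) = sX) (h1 : ev φ = 0)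
    (h2 : ev G = 0) : φ ∣ G :=
  dvd_of_X_pow_dvd hφ ev a hc hX h1 (Nat.lt_succ_self _) (by rw [h2]; exact dvd_zero _)

lemma exists_strictMono_order (s : ℕ) : ∀ (W : Submodule K K⟦X⟧), Module.Finite K W → finrank K W =
    s → ∃ (w : Fin s → K⟦X⟧) (n : Fin s → ℕ), StrictMono n ∧ (∀ i, w i ∈ W) ∧ (∀ i,
    PowerSeries.order (w i) = n i) := by
  induction s with
  | zero => exact fun W _ _ => ⟨Fin.elim0, Fin.elim0, fun i => i.elim0, fun i => i.elim0,
      fun i => i.elim0⟩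
  | succ s ih =>
    intro W hfin hW
    classical
    have hex : ∃ N, ∃ w ∈ W, scoeff N w ≠ 0 := by
      by_contra hcon
      push Not at hcon
      have : W = ⊥ := by
        rw [eq_bot_iff]
        intro w hw
        rw [Submodule.mem_bot]
        ext N
        simpa using hcon N w hw
      rw [this, finrank_bot] at hW
      omega
    set N := Nat.find hex
    obtain ⟨w0, hw0, hN⟩ := Nat.find_spec hex
    have hmin : ∀ k < N, ∀ w ∈ W, scoeff k w = 0 := by
      intro k hk w hw
      by_contra h
      exact Nat.find_min hex hk ⟨w, hw, h⟩
    let W' : Submodule K K⟦X⟧ := W ⊓ ker (scoeff (R := K) N)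
    let ψ : W →ₗ[K] K := (scoeff (R := K) N).comp W.subtype
    have hψ : Surjective ψ := LinearMap.surjective (f := ψ) (fun h => hN (by
      have := LinearMap.congr_fun h ⟨w0, hw0⟩
      simpa [ψ] using this))
    have hrk := finrank_range_add_finrank_ker ψ
    rw [range_eq_top.2 hψ, finrank_top, Module.finrank_self, hW] at hrk
    have hW' : W' = (ker ψ).map W.subtype := by
      ext w
      simp only [W', ψ, Submodule.mem_inf, mem_ker, Submodule.mem_map]
      constructor
      · rintro ⟨h1, h2⟩; exact ⟨⟨w, h1⟩, by simpa using h2, rfl⟩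
      · rintro ⟨y, h1, rfl⟩; exact ⟨y.2, by simpa using h1⟩
    have hfr : finrank K W' = s := by
      rw [hW', finrank_map_of_injective']
      · omega
      · exact val_injective
    have hle : W' ≤ W := inf_le_left
    obtain ⟨w, n, hn, hw, ho⟩ := ih W' (Submodule.finiteDimensional_of_le hle) hfr
    refine ⟨Fin.cons w0 w, Fin.cons N n, ?_, ?_, ?_⟩
    · intro i j hij
      have hNn : ∀ j, N < n j := by
        intro j
        have h1 : scoeff (n j) (w j) ≠ 0 := by
          exact ((order_eq_nat).1 (ho j)).1
        by_contra hcon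
        rcases (not_lt.1 hcon).lt_or_eq with h | h
        · exact h1 (hmin _ h _ (hle (hw j)))
        · rw [h] at h1; exact h1 (hw j).2
      induction i using Fin.cases with
      | zero =>
        induction j using Fin.cases with
        | zero => exact absurd hij (lt_irrefl _)
        | succ j => simpa using hNn j
      | succ i =>
        induction j using Fin.cases with
        | zero => exact absurd hij (by simp)
        | succ j => simpa using hn (by simpa using hij)
    · intro i
      induction i using Fin.cases with
      | zero => simpa using hw0
      | succ i => simpa using hle (hw i)
    · intro i
      induction i using Fin.cases with
      | zero =>
        simp only [Fin.cons_zero]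
        exact order_eq_nat.2 ⟨hN, fun k hk => hmin k hk _ hw0⟩
      | succ i => simpa using ho i

lemma exists_root_powerSeries (G : K⟦X⟧[X]) (a : K) (h0 : sconst (G.eval (sC a)) = 0) (h1 : sconst
    (G.derivative.eval (sC a)) ≠ 0) : ∃ v : K⟦X⟧, sconst v = a ∧ G.eval v = 0 := by
  set J : Ideal K⟦X⟧ := span {sX} with hJ
  have hmem : ∀ w : K⟦X⟧, w ∈ J ↔ sconst w = 0 := fun w => by
    rw [hJ, mem_span_singleton, X_dvd_iff]
  have hpow : ∀ (N : ℕ) (w : K⟦X⟧), w ∈ J ^ N ↔ ∀ k < N, scoeff k w = 0 := by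
    intro N w
    rw [hJ, span_singleton_pow, mem_span_singleton, X_pow_dvd_iff]
  set l : K⟦X⟧ := sC (sconst (G.derivative.eval (sC a)))⁻¹
  have h1' : l * G.derivative.eval (sC a) - 1 ∈ J := by
    rw [hmem]; simp [l, h1]
  choose v hv hGv using newton_approx (J := J) (G := G) (a := sC a) (l := l)
    ((hmem _).2 h0) h1'
  have hcomp : ∀ N M, N ≤ M → v M - v N ∈ J ^ N := fun N M h =>
    newton_unique h1' (hv M) (hv N) (sub_mem (Ideal.pow_le_pow_right h (hGv M)) (hGv N))
  set w : K⟦X⟧ := PowerSeries.mk fun n => scoeff n (v (n + 1)) with hw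
  have hwv : ∀ N, w - v N ∈ J ^ N := by
    intro N
    rw [hpow]
    intro k hk
    have := (hpow _ _).1 (hcomp (k + 1) N (by omega)) k (by omega)
    rw [map_sub] at this ⊢
    rw [hw, PowerSeries.coeff_mk]
    rw [sub_eq_zero] at this ⊢
    exact this.symm
  refine ⟨w, ?_, ?_⟩
  · have h2 := (hpow 1 _).1 (hwv 1) 0 (by omega)
    have h3 := (hmem _).1 (hv 1)
    simp only [map_sub, PowerSeries.constantCoeff_C, PowerSeries.coeff_zero_eq_constantCoeff_apply]
      at h2 h3
    rw [sub_eq_zero] at h2 h3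
    rw [h2, h3]
  · ext N
    have h2 : G.eval w - G.eval (v (N + 1)) ∈ J ^ (N + 1) :=
      Ideal.mem_of_dvd _ (Polynomial.sub_dvd_eval_sub _ _ G) (hwv (N + 1))
    have h3 := add_mem h2 (hGv (N + 1))
    rw [sub_add_cancel] at h3
    simpa using (hpow _ _).1 h3 N (by omega)

lemma exists_branch (g : MP 2 K) (a : Fin 2 → K) (h0 : eval a g = 0) (h1 : eval a (pderiv 1 g) ≠ 0)
    : ∃ ev : MP 2 K →ₐ[K] K⟦X⟧, (∀ P, sconst (ev P) = eval a P) ∧ ev (X 0 - C (a 0)) = sX ∧ ev g = 0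
    := by
  set b : Fin 1 → K⟦X⟧ := fun _ => sX + sC (a 0)
  have hc : ∀ (t : K⟦X⟧), sconst t = a 1 → ∀ P : MP 2 K,
      sconst (aeval (snoc b t : Fin 2 → K⟦X⟧) P) = eval a P := by
    intro t ht P
    induction P using MvPolynomial.induction_on with
    | C c => simp
    | add p q hp hq => simp [hp, hq]
    | mul_X p i hp =>
      rw [map_mul, map_mul, hp, map_mul, aeval_X, eval_X]
      congr 1
      fin_cases i
      · change sconst ((snoc b t : Fin 2 → K⟦X⟧) (castSucc 0)) = _
        rw [snoc_castSucc]; simp [b]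
      · change sconst ((snoc b t : Fin 2 → K⟦X⟧) (last 1)) = _
        rw [Fin.snoc_last]; exact ht
  obtain ⟨v, hv, hgv⟩ := exists_root_powerSeries (lastPoly b g) (a 1)
    (by rw [eval_lastPoly, hc _ (by simp), h0])
    (by rw [derivative_lastPoly, eval_lastPoly, hc _ (by simp)]; exact h1)
  refine ⟨aeval (snoc b v : Fin 2 → K⟦X⟧), hc v hv, ?_, by rwa [← eval_lastPoly]⟩
  rw [map_sub, aeval_X]
  change (snoc b v : Fin 2 → K⟦X⟧) (castSucc 0) - _ = _
  rw [snoc_castSucc]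
  simp [b]

/-- The derivation along the level curves of `g`. -/
noncomputable def curveDer (g P : MP 2 R) : MP 2 R :=
  pderiv 1 g * pderiv 0 P - pderiv 0 g * pderiv 1 P

lemma curveDer_chain {R A : Type*} [CommRing R] [CommRing A] [Algebra R A] (δ : Derivation R A A)
    (ev : MP 2 R →ₐ[R] A) (h0 : δ (ev (X 0)) = 1) (g P : MP 2 R) :
    ev (pderiv 1 g) * δ (ev P) = ev (curveDer g P) + ev (pderiv 1 P) * δ (ev g) := by
  have key : ∀ Q : MP 2 R, δ (ev Q) = ev (pderiv 0 Q) + ev (pderiv 1 Q) * δ (ev (X 1)) := by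
    intro Q
    induction Q using MvPolynomial.induction_on with
    | C c =>
      rw [← algebraMap_eq, commutes, map_algebraMap]; simp
    | add p q hp hq => simp only [map_add, hp, hq]; ring
    | mul_X p i hp =>
      rw [map_mul, leibniz, hp]
      fin_cases i
      · simp only [Fin.zero_eta, leibniz, smul_eq_mul, map_add, map_mul, h0,
          pderiv_X_self, pderiv_X_of_ne (show (0 : Fin 2) ≠ 1 by decide), map_one, map_zero]
        ring
      · simp only [Fin.mk_one, leibniz, smul_eq_mul, map_add, map_mul, 
          pderiv_X_self, pderiv_X_of_ne (show (1 : Fin 2) ≠ 0 by decide), map_one, map_zero]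
        ring
  rw [key P, key g, curveDer, map_sub, map_mul, map_mul]
  ring

lemma map_curveDer {R S : Type*} [CommRing R] [CommRing S] (φ : R →+* S)
    (g P : MP 2 R) : map φ (curveDer g P) = curveDer (map φ g) (map φ P) := by
  simp [curveDer, pderiv_map]

lemma map_curveDer_iterate {R S : Type*} [CommRing R] [CommRing S] (φ : R →+* S) (g P : MP 2 R) (j :
    ℕ) : map φ ((curveDer g)^[j] P) = (curveDer (map φ g))^[j] (map φ P) := by
  induction j with
  | zero => rfl
  | succ j ih => rw [iterate_succ_apply', map_curveDer, ih, iterate_succ_apply']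

/-- The Wronskian of the polynomials `F i` along the level curves of `g`. -/
noncomputable def curveWronskian (g : MP 2 R) (F : Fin s → MP 2 R) : MP 2 R :=
  det (of fun i j : Fin s => (curveDer g)^[(j : ℕ)] (F i))

lemma iterate_mul_derivative_eq (h w : K⟦X⟧) (n : ℕ) (r₀ : K⟦X⟧) (hw : w = sX ^ n * r₀) (j : ℕ) : ∃
    r, sX ^ j * (fun p => h * derivative K p)^[j] w = sX ^ n * r ∧ sconst r = sconst r₀ * sconst h ^
    j * (descPochhammer K j).eval (n : K) := by
  induction j with
  | zero => exact ⟨r₀, by simpa using hw, by simp⟩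
  | succ j ih =>
    obtain ⟨r, h1, h2⟩ := ih
    set W := (fun p => h * derivative K p)^[j] w
    refine ⟨h * ((n : K⟦X⟧) - (j : K⟦X⟧)) * r + sX * h * derivative K r, ?_, ?_⟩
    · rw [iterate_succ_apply']
      change sX ^ (j + 1) * (h * derivative K W) = _
      have h3 := congrArg (fun p => sX * derivative K p) h1
      simp only [leibniz, leibniz_pow, smul_eq_mul, derivative_X, nsmul_eq_mul, mul_one] at h3
      have hpow : ∀ k : ℕ, (sX : K⟦X⟧) * ((k : K⟦X⟧) * (sX : K⟦X⟧) ^ (k - 1)) =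
          (k : K⟦X⟧) * (sX : K⟦X⟧) ^ k := by
        intro k
        rcases k with _ | k
        · simp
        · simp only [Nat.add_sub_cancel, pow_succ]; ring
      have e1 := hpow j
      have e2 := hpow n
      linear_combination h * h3 - h * W * e1 + h * r * e2 - h * j * h1
    · rw [descPochhammer_succ_right]
      simp [h2]
      ring

lemma wronskian_ne_zero [CharZero K] (h : K⟦X⟧) (hh : sconst h ≠ 0) (f : Fin s → K⟦X⟧) (hf :
    LinearIndependent K f) : det (of fun i j : Fin s => (fun p => h * derivative K p)^[(j : ℕ)] (f
    i)) ≠ 0 := by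
  classical
  set dd : K⟦X⟧ →ₗ[K] K⟦X⟧ := (mulLeft K h).comp (derivative K).toLinearMap with hd
  have hdd : (fun p => h * derivative K p) = dd := by ext p; simp [hd]
  obtain ⟨w, n, hn, hw, ho⟩ := exists_strictMono_order s (Submodule.span K (Set.range f))
    (FiniteDimensional.span_of_finite K (Set.finite_range f)) (by
      rw [finrank_span_eq_card hf, card_fin])
  have hc : ∀ i, ∃ c : Fin s → K, ∑ k, c k • f k = w i := fun i =>
    (Submodule.mem_span_range_iff_exists_fun K).1 (hw i)
  choose c hc using hc
  intro h0
  have h1 : det (of fun i j : Fin s => (fun p => h * derivative K p)^[(j : ℕ)] (w i)) = 0 := by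
    have : (of fun i j : Fin s =>
      (fun p => h * derivative K p)^[(j : ℕ)] (w i)) = (of fun i k => sC (c i k)) *
        (of fun i j : Fin s =>
      (fun p => h * derivative K p)^[(j : ℕ)] (f i)) := by
      ext1 i j
      rw [Matrix.mul_apply, of_apply, hdd, ← hc i, ← End.pow_apply, map_sum]
      refine sum_congr rfl fun k _ => ?_
      rw [map_smul, End.pow_apply, of_apply, of_apply, PowerSeries.smul_eq_C_mul]
    rw [this, Matrix.det_mul, h0, mul_zero]
  have hw' : ∀ i, ∃ r, w i = sX ^ n i * r ∧ sconst r ≠ 0 := by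
    intro i
    obtain ⟨h2, h3⟩ := order_eq_nat.1 (ho i)
    obtain ⟨r, hr⟩ := X_pow_dvd_iff.2 h3
    refine ⟨r, hr, fun h4 => h2 ?_⟩
    rw [hr, coeff_X_pow_mul']
    simpa using h4
  choose r₀ hr₀ hr₀' using hw'
  choose r hr hr' using fun i => iterate_mul_derivative_eq h (w i) (n i) (r₀ i) (hr₀ i)
  have h2 : det (of fun i j : Fin s => r i (j : ℕ)) = 0 := by
    have e1 := det_mul_column (fun i => sX ^ n i)
      (of fun i j : Fin s => r i (j : ℕ))
    have e2 := Matrix.det_mul_row (fun j : Fin s => (sX : K⟦X⟧) ^ (j : ℕ))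
      (of fun i j : Fin s =>
      (fun p => h * derivative K p)^[(j : ℕ)] (w i))
    rw [h1, mul_zero] at e2
    have e3 : (of fun i j : Fin s => sX ^ n i * r i (j : ℕ)) =
        of fun i j : Fin s => (sX : K⟦X⟧) ^ (j : ℕ) *
          (fun p => h * derivative K p)^[(j : ℕ)] (w i) := by
      ext1 i j
      exact (hr i j).symm
    refine (mul_eq_zero.1 (e1.symm.trans ((congrArg det e3).trans e2))).resolve_left ?_
    exact prod_ne_zero_iff.2 fun i _ => pow_ne_zero _ PowerSeries.X_ne_zero
  have h3 := congrArg sconst h2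
  replace h3 := (map_det (sconst (R := K)) _).symm.trans h3
  rw [map_zero] at h3
  have h4 : (sconst (R := K)).mapMatrix
      (of fun i j : Fin s => r i (j : ℕ)) =
      of fun i j : Fin s => sconst (r₀ i) * (of fun i j : Fin s => sconst h ^ (j : ℕ) *
          (of fun i j : Fin s => (descPochhammer K (j : ℕ)).eval (n i : K)) i j) i j := by
    ext1 i j
    simp only [RingHom.mapMatrix_apply, Matrix.map_apply, of_apply]
    rw [hr', mul_assoc]
  rw [h4, det_mul_column, Matrix.det_mul_row,
    ← Matrix.det_eval_matrixOfPolynomials_eq_det_vandermonde _ _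
      (fun i => descPochhammer_natDegree _ _) (fun i => monic_descPochhammer _ _)] at h3
  refine absurd h3 (mul_ne_zero (prod_ne_zero_iff.2 fun i _ => hr₀' i) (mul_ne_zero
    (prod_ne_zero_iff.2 fun i _ => pow_ne_zero _ hh) ?_))
  rw [Matrix.det_vandermonde_ne_zero_iff]
  exact fun i j hij => hn.injective (Nat.cast_injective (R := K) hij)

lemma not_dvd_curveWronskian [CharZero K] {φ g : MP 2 K} (hφ : Irreducible φ) (hg : φ ∣ g) (a : Fin
    2 → K) (ha : eval a φ = 0) (ha' : eval a (pderiv 1 g) ≠ 0) (F : Fin s → MP 2 K) (hF : ∀ c : Fin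
    s → K, φ ∣ ∑ i, C (c i) * F i → c = 0) : ¬ φ ∣ curveWronskian g F := by
  obtain ⟨q, rfl⟩ := hg
  obtain ⟨ev, hc, hX, h0⟩ := exists_branch (φ * q) a (by simp [ha]) ha'
  have hqa : eval a q ≠ 0 := by
    intro h
    apply ha'
    rw [leibniz]
    simp [ha, h]
  have hevφ : ev φ = 0 := by
    rw [map_mul] at h0
    refine (mul_eq_zero.1 h0).resolve_right fun h => hqa ?_
    rw [← hc, h, map_zero]
  set g := φ * q
  set hh := ev (pderiv 1 g)
  have hchain : ∀ P, hh * derivative K (ev P) = ev (curveDer g P) := by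
    intro P
    have hX0 : derivative K (ev (X 0)) = 1 := by
      have : ev (X 0) = sX + sC (a 0) := by
        rw [← hX, map_sub, sub_add_eq_add_sub, eq_sub_iff_add_eq]
        have := ev.commutes (a 0)
        rw [algebraMap_eq] at this
        rw [this]
        rfl
      rw [this]; simp
    have := curveDer_chain (derivative K) ev hX0 g P
    rwa [h0, map_zero, mul_zero, add_zero] at this
  have hiter : ∀ (j : ℕ) P, (fun p => hh * derivative K p)^[j] (ev P) =
      ev ((curveDer g)^[j] P) := by
    intro j
    induction j with
    | zero => intro P; rfl
    | succ j ih =>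
      intro P
      rw [iterate_succ_apply, hchain, ih, iterate_succ_apply]
  have hlin : LinearIndependent K fun i => ev (F i) := by
    rw [Fintype.linearIndependent_iff]
    intro c hc0
    have h1 : ev (∑ i, C (c i) * F i) = 0 := by
      rw [map_sum, ← hc0]
      refine sum_congr rfl fun i _ => ?_
      rw [map_mul, ← algebraMap_eq, commutes, Algebra.smul_def]
    exact congrFun (hF c (dvd_of_eval_branch_eq_zero hφ ev a hc hX hevφ h1))
  have hW := wronskian_ne_zero hh (by rw [hc]; exact ha') _ hlin
  rintro ⟨r, hr⟩
  apply hW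
  have h2 : ev (curveWronskian g F) = 0 := by rw [hr, map_mul, hevφ, zero_mul]
  rw [curveWronskian, AlgHom.map_det] at h2
  rw [← h2]
  congr 1
  ext1 i j
  simp [hiter]

lemma pow_dvd_right_of_not_dvd {p a b : ℤ} (hp : Prime p) {L M : ℕ} (ha : ¬ p ^ L ∣ a)
    (h : p ^ (L + M) ∣ a * b) : p ^ M ∣ b := by
  rw [pow_dvd_iff_le_emultiplicity, emultiplicity_mul hp] at h
  rw [pow_dvd_iff_le_emultiplicity, not_le] at ha
  rw [pow_dvd_iff_le_emultiplicity]
  by_contra! hb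
  have := ENat.add_lt_add ha hb
  push_cast at h
  exact absurd h (not_le.2 this)

lemma X_pow_dvd_map_of_roots (p : ℕ) (hp : p.Prime) (L : ℕ) : ∀ (s N : ℕ) (H : ℤ[X]) (u : Fin s →
    ℤ), (∀ j, (p : ℤ) ∣ u j) → (∀ j k, j ≠ k → ¬ (p : ℤ) ^ L ∣ u j - u k) → (∀ j, (p : ℤ) ^ N ∣
    H.eval (u j)) → s * L < N → (pX : Polynomial (ZMod p)) ^ s ∣ H.map (castRingHom (ZMod p)) := by
  intro s
  induction s with
  | zero => intros; simp
  | succ s ih =>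
    intro N H u hu hne hH hN
    have hpp : Prime (p : ℤ) := Nat.prime_iff_prime_int.1 hp
    obtain ⟨Q, hQ⟩ := Polynomial.X_sub_C_dvd_sub_C_eval (p := H) (a := u 0)
    have hNL : (s + 1) * L = s * L + L := by ring
    have h1 := ih (N - L) Q (fun j => u j.succ) (fun j => hu _)
      (fun j k hjk => hne _ _ (by simpa using hjk)) (fun j => by
        have h2 : (p : ℤ) ^ N ∣ (u j.succ - u 0) * Q.eval (u j.succ) := by
          have h3 := congrArg (Polynomial.eval (u j.succ)) hQ
          simp only [Polynomial.eval_sub, Polynomial.eval_C, Polynomial.eval_mul,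
            Polynomial.eval_X] at h3
          rw [← h3]
          exact dvd_sub (hH _) (hH _)
        have h4 := hne j.succ 0 (Fin.succ_ne_zero j)
        have h5 : N = (L + (N - L)) := by omega
        rw [h5] at h2
        exact pow_dvd_right_of_not_dvd hpp h4 h2) (by omega)
    obtain ⟨R, hR⟩ := h1
    refine ⟨R, ?_⟩
    have h0 : ((H.eval (u 0) : ℤ) : ZMod p) = 0 := by
      rw [intCast_zmod_eq_zero_iff_dvd]
      exact (dvd_pow_self _ (by omega)).trans (hH 0)
    have h0' : ((u 0 : ℤ) : ZMod p) = 0 := by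
      rw [intCast_zmod_eq_zero_iff_dvd]; exact hu 0
    have h3 := congrArg (Polynomial.map (castRingHom (ZMod p))) hQ
    rw [Polynomial.map_sub, Polynomial.map_mul, Polynomial.map_sub, Polynomial.map_C,
      Polynomial.map_C, Polynomial.map_X, eq_intCast, eq_intCast, h0, h0', map_zero, sub_zero,
      sub_zero] at h3
    rw [h3, hR, pow_succ']
    ring

lemma curveDer_sum_C_mul {R ι : Type*} [CommRing R] (t : Finset ι) (g : MP 2 R) (c : ι → R) (F : ι →
    MP 2 R) : curveDer g (∑ i ∈ t, C (c i) * F i) = ∑ i ∈ t, C (c i) * curveDer g (F i) := by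
  simp only [curveDer, map_sum, leibniz, pderiv_C, smul_eq_mul, mul_zero, add_zero,
    mul_sum, ← sum_sub_distrib]
  exact sum_congr rfl fun i _ => by ring

lemma curveDer_iterate_sum_C_mul {R ι : Type*} [CommRing R] (t : Finset ι)
    (g : MP 2 R) (c : ι → R) (F : ι → MP 2 R) (j : ℕ) :
    (curveDer g)^[j] (∑ i ∈ t, C (c i) * F i) = ∑ i ∈ t, C (c i) * (curveDer g)^[j] (F i) := by
  induction j generalizing F with
  | zero => rfl
  | succ j ih => rw [iterate_succ_apply, curveDer_sum_C_mul, ih]; rfl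

lemma dvd_eval_curveWronskian (g : MP 2 ℤ) (p : ℕ) (hp : p.Prime) (N L : ℕ) (F : Fin s → MP 2 ℤ) (x
    : Fin s → Fin 2 → ℤ) (a : Fin 2 → ℤ) (hcong : ∀ j i, (p : ℤ) ∣ x j i - a i) (hg : ∀ j, (p : ℤ) ^
    N ∣ eval (x j) g) (ha : (p : ℤ) ∣ eval a g) (hgy : ¬ (p : ℤ) ∣ eval a (pderiv 1 g)) (hdist : ∀ j
    k, j ≠ k → ¬ ∀ i, (p : ℤ) ^ L ∣ x j i - x k i) (hL : 1 ≤ L) (hLN : s * L < N) (c : Fin s → ℤ)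
    (hc : ∃ i, ¬ (p : ℤ) ∣ c i) (hcF : ∀ j, (p : ℤ) ^ N ∣ ∑ i, c i * eval (x j) (F i)) : (p : ℤ) ∣
    eval a (curveWronskian g F) := by
  classical
  have := Fact.mk hp
  have hsN : s < N := lt_of_le_of_lt (Nat.le_mul_of_pos_right s hL) hLN
  obtain ⟨Φ, hΦ1, hΦ2, hΦ3⟩ := exists_param (m := 1) g p hp a ha hgy N
  set J := span ({C (p : ℤ)} ∪ Set.range X : Set (MP 1 ℤ))
  set b : Fin 2 → MP 1 ℤ := snoc (fun i : Fin 1 => X i + C (a i.castSucc)) Φ with hb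
  let ψ₀ : MP 1 ℤ →ₐ[ℤ] ℤ[X] := aeval fun _ => pX
  let ρ : ℤ[X] →ₐ[ℤ] Polynomial (ZMod p) := Polynomial.mapAlgHom (ofId ℤ (ZMod p))
  have hρ : ∀ P, ρ P = P.map (castRingHom (ZMod p)) := fun P => rfl
  let ev : MP 2 ℤ →ₐ[ℤ] Polynomial (ZMod p) := (ρ.comp ψ₀).comp (aeval b)
  have hJ : J ≤ (span {(pX : Polynomial (ZMod p))}).comap
      (ρ.comp ψ₀ : MP 1 ℤ →ₐ[ℤ] Polynomial (ZMod p)) := by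
    rw [Ideal.span_le]
    rintro _ (rfl | ⟨i, rfl⟩)
    · simp [ψ₀, hρ]
    · simp [ψ₀, hρ, mem_span_singleton]
  have hevg : (pX : Polynomial (ZMod p)) ^ N ∣ ev g := by
    rw [← mem_span_singleton, ← span_singleton_pow]
    have h1 := Ideal.mem_map_of_mem (ρ.comp ψ₀ : MP 1 ℤ →ₐ[ℤ] _) hΦ2
    rw [Ideal.map_pow] at h1
    exact Ideal.pow_right_mono (Ideal.map_le_iff_le_comap.2 hJ) _ h1
  have hconst : ∀ Q : MP 2 ℤ, (ev Q).eval 0 = ((eval a Q : ℤ) : ZMod p) := by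
    intro Q
    induction Q using MvPolynomial.induction_on with
    | C r => simp [ev]
    | add p q hp hq => simp only [map_add, Polynomial.eval_add, hp, hq, Int.cast_add]
    | mul_X P i hP =>
      rw [map_mul, Polynomial.eval_mul, hP, map_mul, eval_X, Int.cast_mul]
      congr 1
      fin_cases i
      · have : b 0 = X 0 + C (a 0) := rfl
        simp [ev, this, ψ₀, hρ]
      · have h1 : b 1 = Φ := rfl
        have h2 := mem_span_singleton.1 (hJ hΦ1)
        obtain ⟨q, hq⟩ := h2
        have h3 := congrArg (Polynomial.eval 0) hq
        simp only [map_sub, Polynomial.eval_sub, Polynomial.eval_mul, Polynomial.eval_X, zero_mul,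
          sub_eq_zero] at h3
        change Polynomial.eval 0 (ev (X 1)) = ((a 1 : ℤ) : ZMod p)
        simp only [ev, comp_apply, aeval_X, h1]
        refine (h3 : _).trans ?_
        simp [ψ₀, hρ]
  set FF := ∑ i, C (c i) * F i with hFF
  have hevF : (pX : Polynomial (ZMod p)) ^ s ∣ ev FF := by
    have heval : ∀ (Q : MP 2 ℤ) (j : Fin s),
        (p : ℤ) ^ N ∣ eval (x j) Q - (ψ₀ (aeval b Q)).eval (x j 0 - a 0) := by
      intro Q j
      have h1 : (ψ₀ (aeval b Q)).eval (x j 0 - a 0) =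
          eval (fun i => eval (fun _ => x j 0 - a 0) (b i)) Q := by
        have h2 : ((Polynomial.aeval (x j 0 - a 0) : ℤ[X] →ₐ[ℤ] ℤ).comp ψ₀) =
          (aeval (fun _ => x j 0 - a 0) : MP 1 ℤ →ₐ[ℤ] ℤ) := by
          ext i; simp [ψ₀]
        have h3 : (aeval (fun _ => x j 0 - a 0) : MP 1 ℤ →ₐ[ℤ] ℤ).comp (aeval b) =
          (aeval (fun i => eval (fun _ => x j 0 - a 0) (b i)) : MP 2 ℤ →ₐ[ℤ] ℤ) := by
          ext i; simp
        have h4 := congrArg (fun φ : MP 1 ℤ →ₐ[ℤ] ℤ => φ (aeval b Q)) h2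
        have h5 := congrArg (fun φ : MP 2 ℤ →ₐ[ℤ] ℤ => φ Q) h3
        simp only [comp_apply] at h4 h5
        rw [← Polynomial.coe_aeval_eq_eval]
        exact h4.trans (h5.trans (by rw [← coe_aeval_eq_eval]; rfl))
      rw [h1]
      refine dvd_eval_sub_eval (fun i => ?_) Q
      fin_cases i
      · have : b 0 = X 0 + C (a 0) := rfl
        simp [this]
      · have h1 : b 1 = Φ := rfl
        have h2 := hΦ3 (x j) (hcong j) (hg j)
        have h3 : (fun i : Fin 1 => x j i.castSucc - a i.castSucc) = fun _ => x j 0 - a 0 := by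
          ext i; fin_cases i; rfl
        rw [h3] at h2
        simpa [h1] using h2
    have hroots := X_pow_dvd_map_of_roots p hp L s N (ψ₀ (aeval b FF)) (fun j => x j 0 - a 0)
      (fun j => hcong j 0) (fun j k hjk h => hdist j k hjk fun i => ?_) (fun j => ?_) hLN
    · exact hroots
    · have h0 : (p : ℤ) ^ L ∣ x j 0 - x k 0 := by simpa using h
      fin_cases i
      · exact h0
      · have hLN' : (p : ℤ) ^ L ∣ (p : ℤ) ^ N := pow_dvd_pow _ (by
          have := j.pos
          nlinarith)
        have h2 := hLN'.trans (hΦ3 (x j) (hcong j) (hg j))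
        have h3 := hLN'.trans (hΦ3 (x k) (hcong k) (hg k))
        have h4 : (p : ℤ) ^ L ∣ eval (fun i : Fin 1 => x j i.castSucc - a i.castSucc) Φ -
            eval (fun i : Fin 1 => x k i.castSucc - a i.castSucc) Φ := by
          refine dvd_eval_sub_eval (fun i => ?_) Φ
          fin_cases i
          simpa using h0
        have h5 := dvd_add (dvd_sub h2 h3) h4
        have h6 : ∀ A B C D : ℤ, A - B - (C - D) + (B - D) = A - C := fun _ _ _ _ => by ring
        rw [h6] at h5
        exact h5
    · have h1 := heval FF j
      have h2 : (p : ℤ) ^ N ∣ eval (x j) FF := by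
        simpa [hFF, map_sum] using hcF j
      exact (dvd_sub_right h2).1 h1
  have hX0 : Polynomial.derivative (ev (X 0)) = 1 := by
    have : b 0 = X 0 + C (a 0) := rfl
    simp [ev, this, ψ₀, hρ]
  have hpd : ∀ (M : ℕ) (Q : Polynomial (ZMod p)), pX ^ M ∣ Q →
      pX ^ (M - 1) ∣ Polynomial.derivative Q := by
    rintro M _ ⟨R, rfl⟩
    rw [derivative_mul, Polynomial.derivative_X_pow]
    refine dvd_add (Dvd.dvd.mul_right (Dvd.intro_left _ rfl) _) (Dvd.dvd.mul_right (pow_dvd_pow _ (Nat.sub_le _ _)) _)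
  let δ : Derivation ℤ (Polynomial (ZMod p)) (Polynomial (ZMod p)) :=
    Polynomial.derivative'.restrictScalars ℤ
  have hδ : ∀ Q, δ Q = Polynomial.derivative Q := fun Q => rfl
  have hD : ∀ j ≤ s, (pX : Polynomial (ZMod p)) ^ (s - j) ∣ ev ((curveDer g)^[j] FF) := by
    intro j
    induction j with
    | zero => intro _; exact hevF
    | succ j ih =>
      intro hj
      rw [iterate_succ_apply']
      have h1 := curveDer_chain δ ev hX0 g ((curveDer g)^[j] FF)
      rw [hδ, hδ] at h1
      rw [← sub_eq_iff_eq_add] at h1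
      rw [← h1]
      refine dvd_sub (Dvd.dvd.mul_left (hpd (s - j) _ (ih (by omega))) _) (Dvd.dvd.mul_left
        ((pow_dvd_pow _ ?_).trans (hpd N _ hevg)) _)
      omega
  rw [← intCast_zmod_eq_zero_iff_dvd, curveWronskian, map_det]
  have h1 := map_det (castRingHom (ZMod p))
    ((eval a).mapMatrix (of fun i j : Fin s => (curveDer g)^[(j : ℕ)] (F i)))
  refine h1.trans ?_
  rw [← Matrix.exists_vecMul_eq_zero_iff]
  refine ⟨fun i => (c i : ZMod p), fun h => ?_, ?_⟩
  · obtain ⟨i, hi⟩ := hc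
    exact hi ((intCast_zmod_eq_zero_iff_dvd _ _).1 (congrFun h i))
  · ext j
    have h2 := hD j j.2.le
    have h3 : (ev ((curveDer g)^[(j : ℕ)] FF)).eval 0 = 0 := by
      obtain ⟨r, hr⟩ := h2
      rw [hr, Polynomial.eval_mul, Polynomial.eval_pow, Polynomial.eval_X, zero_pow, zero_mul]
      have := j.2
      omega
    rw [hconst, hFF, curveDer_iterate_sum_C_mul] at h3
    simpa [Matrix.vecMul, dotProduct] using h3

lemma dvd_hval_iff (q : ℕ) {w u : ℤ} (hu : (q : ℤ) ∣ w * u - 1) (v : Fin n → ℤ) (g : MP n ℤ) (hT :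
    g.totalDegree ≤ T) : (q : ℤ) ∣ hval T w v g ↔ (q : ℤ) ∣ eval (fun i => u * v i) g := by
  have hu' : (w : ZMod q) * (u : ZMod q) = 1 := by
    have := (intCast_zmod_eq_zero_iff_dvd _ q).2 hu
    push_cast at this
    exact sub_eq_zero.1 this
  have h1 := map_hval (castRingHom (ZMod q)) (w := w) (u := (u : ZMod q)) hu' v g hT
  have h2 : eval₂ (castRingHom (ZMod q)) (fun i => (u : ZMod q) * (castRingHom (ZMod q)) (v i)) g
      = ((eval (fun i => u * v i) g : ℤ) : ZMod q) := by
    have := eval_map_zmod q g (fun i => u * v i)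
    rw [← this, eval_map]
    congr 1
    ext i
    simp
  rw [h2] at h1
  rw [← intCast_zmod_eq_zero_iff_dvd, ← intCast_zmod_eq_zero_iff_dvd]
  have h3 : IsUnit ((castRingHom (ZMod q)) w ^ T) := (IsUnit.of_mul_eq_one _ hu').pow T
  change ((castRingHom (ZMod q)) (hval T w v g)) = 0 ↔ _
  rw [h1, h3.mul_right_eq_zero]

lemma hval_eq_zero_iff {w : ℤ} (hw : w ≠ 0) (v : Fin n → ℤ) (g : MP n ℤ) (hT : g.totalDegree ≤ T) :
    hval T w v g = 0 ↔ eval (fun i => (w : ℚ)⁻¹ * v i) (map (castRingHom ℚ) g) = 0 := by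
  have hw' : (w : ℚ) ≠ 0 := mod_cast hw
  have h1 := map_hval (castRingHom ℚ) (w := w) (u := (w : ℚ)⁻¹) (mul_inv_cancel₀ hw') v g hT
  rw [eval_map]
  have h2 : (castRingHom ℚ) (hval T w v g) = 0 ↔ hval T w v g = 0 := by simp
  rw [← h2, h1, mul_eq_zero, or_iff_right]
  · rfl
  · exact pow_ne_zero _ hw'

lemma exists_inv_mod (p : ℕ) (hp : p.Prime) (N : ℕ) (w : ℤ) (hw : ¬ (p : ℤ) ∣ w) :
    ∃ u : ℤ, ((p ^ N : ℕ) : ℤ) ∣ w * u - 1 := by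
  have h1 : IsCoprime ((p : ℤ) ^ N) w :=
    IsCoprime.pow_left ((Prime.coprime_iff_not_dvd (Nat.prime_iff_prime_int.1 hp)).2 hw)
  obtain ⟨a, b, hab⟩ := h1
  exact ⟨b, -a, by push_cast; linarith⟩

lemma hval_monomial (w : ℤ) (v : Fin n → ℤ) (α : Fin n →₀ ℕ) :
    hval T w v (monomial α 1) = w ^ (T - ∑ i, α i) * ∏ i, v i ^ α i := by
  simp [hval, support_monomial]

lemma dvd_hval_curveWronskian {t : ℕ} (g : MP 2 ℤ) (p : ℕ) (hp : p.Prime) (α : Fin s → Fin 2 →₀ ℕ)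
    (hα : ∀ i, ∑ k, α i k ≤ e) (x : Fin s → ℤ × (Fin 2 → ℤ)) (j₀ : Fin s) (hx0 : ∀ j, ¬ (p : ℤ) ∣ (x
    j).1) {H₀ H : ℕ} (hH : H₀ ≤ H) (hxH₀ : ∀ j, |(x j).1| ≤ H₀) (hxH : ∀ j i, |(x j).2 i| ≤ H)
    (hcong : ∀ j i, (p : ℤ) ∣ (x j).2 i * (x j₀).1 - (x j₀).2 i * (x j).1) (hdist : ∀ j k, j ≠ k → ∃
    i, (x j).2 i * (x k).1 - (x k).2 i * (x j).1 ≠ 0) (hg : ∀ j, hval g.totalDegree (x j).1 (x j).2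
    g = 0) {T' : ℕ} (hT' : (pderiv 1 g).totalDegree ≤ T') (hgy : ∀ j, ¬ (p : ℤ) ∣ hval T' (x j).1 (x
    j).2 (pderiv 1 g)) (ht : 2 * t + s = s * s) (hsize : s.factorial * ∏ i, H₀ ^ (e - ∑ k, α i k) *
    H ^ (∑ k, α i k) < p ^ t) (hT : (curveWronskian g fun i => monomial (α i) 1).totalDegree ≤ T) :
    (p : ℤ) ∣ hval T (x j₀).1 (x j₀).2 (curveWronskian g fun i => monomial (α i) 1) := by
  classical
  have hpp : Prime (p : ℤ) := Nat.prime_iff_prime_int.1 hp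
  set L := 2 * H ^ 2 + 1 with hLdef
  set N := s * L + 1 with hN
  have hsN : s ≤ N := by nlinarith
  have hN1 : 1 ≤ N := by omega
  choose u hu using fun j => exists_inv_mod p hp N (x j).1 (hx0 j)
  have hu1 : ∀ j, (p : ℤ) ∣ (x j).1 * u j - 1 := fun j =>
    (mod_cast (dvd_pow_self (p : ℤ) (by omega : N ≠ 0)) : (p : ℤ) ∣ ((p ^ N : ℕ) : ℤ)).trans (hu j)
  set y : Fin s → Fin 2 → ℤ := fun j i => u j * (x j).2 i with hy
  set F : Fin s → MP 2 ℤ := fun i => monomial (α i) 1 with hF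
  have hFdeg : ∀ i, (F i).totalDegree ≤ e := fun i => by
    rw [totalDegree_le_iff]
    intro β hβ
    have := support_monomial_subset hβ
    rw [mem_singleton] at this
    rw [this, mem_monoms]
    exact hα i
  have hgN : ∀ j, (p : ℤ) ^ N ∣ eval (y j) g := fun j => by
    have := (dvd_hval_iff (p ^ N) (hu j) (x j).2 g le_rfl).1 (by rw [hg]; exact dvd_zero _)
    exact_mod_cast this
  have hgy' : ∀ j, ¬ (p : ℤ) ∣ eval (y j) (pderiv 1 g) := fun j h =>
    hgy j ((dvd_hval_iff p (hu1 j) (x j).2 _ hT').2 h)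
  rw [dvd_hval_iff p (hu1 j₀) _ _ hT]
  -- differences of the affine representatives
  have hydiff : ∀ j k i, (p : ℤ) ^ N ∣ (x j).1 * (x k).1 * (y j i - y k i) -
      ((x j).2 i * (x k).1 - (x k).2 i * (x j).1) := by
    intro j k i
    have h1 := (hu j).mul_right ((x j).2 i * (x k).1)
    have h2 := (hu k).mul_right ((x k).2 i * (x j).1)
    have h3 := dvd_sub h1 h2
    push_cast at h3
    refine (dvd_of_eq rfl).trans (h3.trans (dvd_of_eq ?_))
    simp only [hy]; ring
  set M : Matrix (Fin s) (Fin s) ℤ := of fun j i => hval e (x j).1 (x j).2 (F i) with hM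
  have hMF : ∀ j i, (p : ℤ) ^ N ∣ M j i - (x j).1 ^ e * eval (y j) (F i) := by
    intro j i
    have hu' : (((x j).1 : ℤ) : ZMod (p ^ N)) * ((u j : ℤ) : ZMod (p ^ N)) = 1 := by
      have := (intCast_zmod_eq_zero_iff_dvd _ (p ^ N)).2 (hu j)
      push_cast at this
      exact sub_eq_zero.1 this
    have h1 := map_hval (castRingHom (ZMod (p ^ N))) (w := (x j).1) hu' (x j).2 (F i) (hFdeg i)
    have h2 : eval₂ (castRingHom (ZMod (p ^ N)))
        (fun i => ((u j : ℤ) : ZMod (p ^ N)) * (castRingHom (ZMod (p ^ N))) ((x j).2 i)) (F i)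
        = ((eval (y j) (F i) : ℤ) : ZMod (p ^ N)) := by
      rw [← eval_map_zmod, eval_map]
      congr 1
      ext i
      simp [hy]
    rw [h2] at h1
    have h3 : (((p ^ N : ℕ) : ℤ)) ∣ M j i - (x j).1 ^ e * eval (y j) (F i) := by
      rw [← intCast_zmod_eq_zero_iff_dvd]
      rw [Int.cast_sub, sub_eq_zero, Int.cast_mul, Int.cast_pow]
      exact h1
    exact_mod_cast h3
  have hycong : ∀ j i, (p : ℤ) ∣ y j i - y j₀ i := by
    intro j i
    have h1 := (dvd_pow_self (p : ℤ) (by omega : N ≠ 0)).trans (hydiff j j₀ i)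
    have h2 := (dvd_sub_left (hcong j i)).1 h1
    rcases hpp.dvd_or_dvd h2 with h | h
    · rcases hpp.dvd_or_dvd h with h | h
      · exact absurd h (hx0 _)
      · exact absurd h (hx0 _)
    · exact h
  have hdet : M.det = 0 := by
    have h1 := det_eval_dvd (m := 1) g p hp s y F univ
      (fun j _ => (pow_dvd_pow _ hsN).trans (hgN j)) (fun j _ => hgy' j) M (fun j => (x j).1 ^ e)
      (fun j _ i => (pow_dvd_pow _ hsN).trans (hMF j i)) (n := 1) (by
        rw [Finset.card_le_one]
        intro a ha b hb
        obtain ⟨j, _, rfl⟩ := mem_image.1 ha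
        obtain ⟨k, _, rfl⟩ := mem_image.1 hb
        ext i
        refine ((ZMod.intCast_eq_intCast_iff_dvd_sub _ _ _).2 ?_)
        have := dvd_sub (hycong k i) (hycong j i)
        rwa [sub_sub_sub_cancel_right] at this)
    have hk := kap_one s
    rw [card_univ, card_fin, one_mul] at h1
    have hexp : s * s - kap 1 s = t := by
      have : s * (s + 1) = s * s + s := by ring
      omega
    rw [hexp] at h1
    have h2 := abs_det_le M (fun i => ((H₀ ^ (e - ∑ k, α i k) * H ^ (∑ k, α i k) : ℕ) : ℤ)) (by
      intro j i
      rw [hM, of_apply, hF]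
      simp only [hval_monomial]
      rw [abs_mul, abs_pow]
      push_cast
      exact mul_le_mul (pow_le_pow_left₀ (abs_nonneg _) (hxH₀ j) _) (abs_prod_pow_le _ _ (hxH j) _)
        (abs_nonneg _) (by positivity))
    refine Int.eq_zero_of_abs_lt_dvd h1 (h2.trans_lt ?_)
    exact_mod_cast hsize
  obtain ⟨c', hc'0, hc'⟩ := Matrix.exists_mulVec_eq_zero_iff.2 hdet
  obtain ⟨c, hc1, hc2⟩ := Finset.extract_gcd c' (s := univ) ⟨j₀, mem_univ _⟩
  have hgcd : univ.gcd c' ≠ 0 := by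
    intro h
    apply hc'0
    ext i
    simpa using Finset.gcd_eq_zero_iff.1 h i (mem_univ _)
  have hMc : ∀ j, ∑ i, c i * M j i = 0 := by
    intro j
    have h1 := congrFun hc' j
    simp only [mulVec, dotProduct, Pi.zero_apply] at h1
    refine (mul_eq_zero.1 (Eq.trans ?_ h1)).resolve_left hgcd
    rw [mul_sum]
    refine sum_congr rfl fun i hi => ?_
    rw [hc1 i hi]; ring
  refine dvd_eval_curveWronskian g p hp N L F y (y j₀) hycong hgN
    ((dvd_pow_self _ (by omega)).trans (hgN j₀)) (hgy' j₀) ?_ (by omega) (by omega) c ?_ ?_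
  · intro j k hjk hall
    obtain ⟨i, hi⟩ := hdist j k hjk
    apply hi
    have h1 : (p : ℤ) ^ L ∣ (p : ℤ) ^ N := pow_dvd_pow _ (by
      have := j₀.pos
      nlinarith)
    have h2 := (dvd_sub_right ((hall i).mul_left ((x j).1 * (x k).1))).1 (h1.trans (hydiff j k i))
    refine Int.eq_zero_of_abs_lt_dvd h2 ?_
    have h3 : (L : ℤ) < (p : ℤ) ^ L := by
      exact_mod_cast Nat.lt_pow_self hp.one_lt
    refine lt_of_le_of_lt ?_ h3
    have hHH : (H₀ : ℤ) ≤ H := mod_cast hH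
    have h4 : ∀ j k, |(x j).2 i * (x k).1| ≤ (H : ℤ) ^ 2 := fun j k => by
      rw [abs_mul, sq]
      exact mul_le_mul (hxH j i) ((hxH₀ k).trans hHH) (abs_nonneg _) (by positivity)
    have h5 := abs_sub ((x j).2 i * (x k).1) ((x k).2 i * (x j).1)
    have h6 := h4 j k
    have h7 := h4 k j
    rw [hLdef]; push_cast
    linarith
  · by_contra! h
    have := dvd_gcd (s := univ) (f := c) (a := (p : ℤ)) fun i _ => h i
    rw [hc2] at this
    exact hpp.not_unit (isUnit_of_dvd_one this)
  · intro j
    have h1 : (p : ℤ) ^ N ∣ (x j).1 ^ e * ∑ i, c i * eval (y j) (F i) := by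
      have h2 : (p : ℤ) ^ N ∣ ∑ i, c i * (M j i - (x j).1 ^ e * eval (y j) (F i)) :=
        dvd_sum fun i _ => (hMF j i).mul_left _
      have h3 : ∑ i, c i * (M j i - (x j).1 ^ e * eval (y j) (F i)) =
          0 - (x j).1 ^ e * ∑ i, c i * eval (y j) (F i) := by
        rw [← hMc j, mul_sum, ← sum_sub_distrib]
        exact sum_congr rfl fun i _ => by ring
      rw [h3, zero_sub, dvd_neg] at h2
      exact h2
    refine IsCoprime.dvd_of_dvd_mul_left ?_ h1
    exact (IsCoprime.pow ((Prime.coprime_iff_not_dvd hpp).2 (hx0 j)))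

/-- The sum of the absolute values of the coefficients. -/
noncomputable def coeffNorm (g : MvPolynomial σ ℤ) : ℤ := ∑ α ∈ g.support, |coeff α g|

lemma coeffNorm_eq_sum {g : MvPolynomial σ ℤ} {E : Finset (σ →₀ ℕ)}
    (h : g.support ⊆ E) : coeffNorm g = ∑ α ∈ E, |coeff α g| :=
  sum_subset h fun α _ hα => by rw [notMem_support_iff.1 hα, abs_zero]

lemma coeffNorm_nonneg (g : MvPolynomial σ ℤ) : 0 ≤ coeffNorm g :=
  Finset.sum_nonneg fun _ _ => abs_nonneg _

lemma coeffNorm_add_le (f g : MvPolynomial σ ℤ) :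
    coeffNorm (f + g) ≤ coeffNorm f + coeffNorm g := by
  classical
  rw [coeffNorm_eq_sum (support_add (p := f) (q := g)),
    coeffNorm_eq_sum (Finset.subset_union_left (s₁ := f.support) (s₂ := g.support)),
    coeffNorm_eq_sum (Finset.subset_union_right (s₁ := f.support) (s₂ := g.support)),
    ← sum_add_distrib]
  exact sum_le_sum fun α _ => by rw [coeff_add]; exact abs_add_le _ _

lemma coeffNorm_neg (f : MvPolynomial σ ℤ) : coeffNorm (-f) = coeffNorm f := by
  simp [coeffNorm, support_neg]

lemma coeffNorm_zero : coeffNorm (0 : MvPolynomial σ ℤ) = 0 := by simp [coeffNorm]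

lemma coeffNorm_sum_le {σ ι : Type*} (t : Finset ι) (f : ι → MvPolynomial σ ℤ) :
    coeffNorm (∑ i ∈ t, f i) ≤ ∑ i ∈ t, coeffNorm (f i) :=
  Finset.le_sum_of_subadditive _ coeffNorm_zero.le coeffNorm_add_le _ _

lemma coeffNorm_monomial_le (α : σ →₀ ℕ) (c : ℤ) : coeffNorm (monomial α c) ≤ |c| := by
  classical
  rw [coeffNorm_eq_sum support_monomial_subset]
  simp

lemma coeffNorm_mul_le (f g : MvPolynomial σ ℤ) :
    coeffNorm (f * g) ≤ coeffNorm f * coeffNorm g := by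
  have h : coeffNorm f * coeffNorm g =
      ∑ α ∈ f.support, ∑ β ∈ g.support, |coeff α f| * |coeff β g| := by
    rw [coeffNorm, coeffNorm, Finset.sum_mul_sum]
  rw [h]
  conv_lhs => rw [f.as_sum, g.as_sum, Finset.sum_mul_sum]
  refine (coeffNorm_sum_le _ _).trans (sum_le_sum fun α _ => ?_)
  refine (coeffNorm_sum_le _ _).trans (sum_le_sum fun β _ => ?_)
  rw [monomial_mul, ← abs_mul]
  exact coeffNorm_monomial_le _ _

lemma coeffNorm_prod_le {σ ι : Type*} (t : Finset ι) (f : ι → MvPolynomial σ ℤ) :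
    coeffNorm (∏ i ∈ t, f i) ≤ ∏ i ∈ t, coeffNorm (f i) := by
  classical
  induction t using Finset.induction_on with
  | empty =>
    simp only [Finset.prod_empty]
    simpa using coeffNorm_monomial_le (σ := σ) 0 1
  | insert a t ha ih =>
    rw [Finset.prod_insert ha, Finset.prod_insert ha]
    exact (coeffNorm_mul_le _ _).trans (mul_le_mul_of_nonneg_left ih (coeffNorm_nonneg _))

lemma coeffNorm_pderiv_le (i : Fin n) (g : MP n ℤ)
    (hT : g.totalDegree ≤ T) : coeffNorm (pderiv i g) ≤ T * coeffNorm g := by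
  have h : (T : ℤ) * coeffNorm g = ∑ α ∈ g.support, (T : ℤ) * |coeff α g| := by
    rw [coeffNorm, mul_sum]
  rw [h]
  conv_lhs => rw [g.as_sum, map_sum]
  refine (coeffNorm_sum_le _ _).trans (sum_le_sum fun α hα => ?_)
  rw [pderiv_monomial]
  refine (coeffNorm_monomial_le _ _).trans ?_
  rw [abs_mul, mul_comm]
  refine mul_le_mul_of_nonneg_right ?_ (abs_nonneg _)
  have h1 := mem_monoms.1 (totalDegree_le_iff.1 hT hα)
  have h2 := single_le_sum (f := fun i => α i) (fun _ _ => Nat.zero_le _) (mem_univ i)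
  rw [abs_cast]
  exact_mod_cast h2.trans h1

lemma abs_hval_le_coeffNorm (g : MP n ℤ) (hg : g.totalDegree ≤ T) (w : ℤ) (v : Fin n → ℤ) (B : ℕ)
    (hw : |w| ≤ B) (hv : ∀ i, |v i| ≤ B) : |hval T w v g| ≤ coeffNorm g * (B : ℤ) ^ T := by
  have hsub := totalDegree_le_iff.1 hg
  refine (Finset.abs_sum_le_sum_abs _ _).trans ?_
  rw [coeffNorm, sum_mul]
  refine sum_le_sum fun α hα => ?_
  rw [abs_mul, abs_mul, abs_pow]
  refine mul_le_mul_of_nonneg_left ?_ (abs_nonneg _)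
  have hα' := mem_monoms.1 (hsub hα)
  calc _ ≤ (B : ℤ) ^ (T - ∑ i, α i) * (B : ℤ) ^ (∑ i, α i) :=
        mul_le_mul (pow_le_pow_left₀ (abs_nonneg _) hw _) (abs_prod_pow_le v B hv α)
          (abs_nonneg _) (by positivity)
    _ = _ := by rw [← pow_add, Nat.sub_add_cancel hα']

lemma coeffNorm_le_card_mul (g : MP n ℤ) (hg : g.totalDegree ≤ T) (A : ℤ)
    (hA : ∀ α, |coeff α g| ≤ A) : coeffNorm g ≤ (monoms n T).card * A := by
  rw [coeffNorm_eq_sum (totalDegree_le_iff.1 hg)]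
  exact (sum_le_card_nsmul _ _ A fun α _ => hA α).trans (by rw [nsmul_eq_mul])

lemma coeffNorm_det_le (M : Matrix (Fin s) (Fin s) (MvPolynomial σ ℤ)) (b : ℤ)
    (hb : ∀ i j, coeffNorm (M i j) ≤ b) : coeffNorm M.det ≤ s.factorial * b ^ s := by
  rw [Matrix.det_apply']
  refine (coeffNorm_sum_le _ _).trans ((sum_le_card_nsmul _ _ (b ^ s) fun τ _ => ?_).trans ?_)
  · have h1 : coeffNorm (∏ i, M (τ i) i) ≤ b ^ s := by
      refine (coeffNorm_prod_le _ _).trans ?_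
      refine (prod_le_prod (fun i _ => coeffNorm_nonneg _) fun i _ => hb (τ i) i).trans ?_
      simp
    rcases Int.units_eq_one_or (Equiv.Perm.sign τ) with h | h
    · simpa [h] using h1
    · simpa [h, coeffNorm_neg] using h1
  · rw [nsmul_eq_mul, card_univ, card_perm, card_fin]

lemma totalDegree_det_le {σ R : Type*} [CommRing R] (M : Matrix (Fin s) (Fin s) (MvPolynomial σ R))
    (D : ℕ) (hD : ∀ i j, (M i j).totalDegree ≤ D) : M.det.totalDegree ≤ s * D := by
  rw [det_apply]
  refine totalDegree_finsetSum_le fun τ _ => ?_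
  have h1 : (∏ i, M (τ i) i).totalDegree ≤ s * D := by
    refine (totalDegree_finsetProd _ _).trans ?_
    refine (sum_le_card_nsmul _ _ D fun i _ => hD _ _).trans ?_
    simp
  rcases Int.units_eq_one_or (Equiv.Perm.sign τ) with h | h
  · simpa [h] using h1
  · simpa [h] using h1

lemma totalDegree_curveDer_le (g P : MP 2 R) :
    (curveDer g P).totalDegree ≤ g.totalDegree + P.totalDegree := by
  have h := fun i => totalDegree_pderiv_le i g
  have h' := fun i => totalDegree_pderiv_le i P
  refine (totalDegree_sub _ _).trans (max_le ?_ ?_)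
  · have := totalDegree_mul (pderiv 1 g) (pderiv 0 P)
    have h1 := h 1
    have h2 := h' 0
    omega
  · have := totalDegree_mul (pderiv 0 g) (pderiv 1 P)
    have h1 := h 0
    have h2 := h' 1
    omega

lemma coeffNorm_curveDer_le (g P : MP 2 ℤ) {a b : ℕ} (ha : g.totalDegree ≤ a) (hb : P.totalDegree ≤
    b) : coeffNorm (curveDer g P) ≤ 2 * a * b * coeffNorm g * coeffNorm P := by
  have h : ∀ i j, coeffNorm (pderiv i g * pderiv j P) ≤ (a * coeffNorm g) * (b * coeffNorm P) :=
    fun i j => (coeffNorm_mul_le _ _).trans (mul_le_mul (coeffNorm_pderiv_le i g ha)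
      (coeffNorm_pderiv_le j P hb) (coeffNorm_nonneg _)
      (mul_nonneg (cast_nonneg _) (coeffNorm_nonneg _)))
  rw [curveDer, sub_eq_add_neg]
  refine (coeffNorm_add_le _ _).trans ?_
  rw [coeffNorm_neg]
  have h1 := h 1 0
  have h2 := h 0 1
  linarith

lemma curveDer_iterate_bounds (g P : MP 2 ℤ) {a : ℕ} (ha : g.totalDegree ≤ a) (he : P.totalDegree ≤
    e) (hP : coeffNorm P ≤ 1) (j : ℕ) (hj : j ≤ s) : ((curveDer g)^[j] P).totalDegree ≤ e + j * a ∧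
    coeffNorm ((curveDer g)^[j] P) ≤ (2 * a * ((e + s * a : ℕ) : ℤ) * coeffNorm g) ^ j := by
  induction j with
  | zero => simpa using ⟨he, hP⟩
  | succ j ih =>
    obtain ⟨h1, h2⟩ := ih (by omega)
    rw [iterate_succ_apply']
    have hja : j * a ≤ s * a := Nat.mul_le_mul_right _ (by omega)
    refine ⟨(totalDegree_curveDer_le _ _).trans ?_, ?_⟩
    · rw [Nat.succ_mul]; omega
    · refine (coeffNorm_curveDer_le g _ ha (h1.trans (by omega : _ ≤ e + s * a))).trans ?_
      rw [pow_succ']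
      exact mul_le_mul_of_nonneg_left h2 (mul_nonneg (by positivity) (coeffNorm_nonneg _))

lemma curveWronskian_bounds {δ : ℕ} (hδ : 1 ≤ δ) (g : MP 2 ℤ) (hgd : g.totalDegree ≤ 2 * δ) (H : ℕ)
    (hH : 2 ≤ H) (hg : ∀ α, |coeff α g| ≤ (H : ℤ) ^ (80 * δ)) (α : Fin s → Fin 2 →₀ ℕ) (hα : ∀ i, ∑
    k, α i k ≤ e) : (curveWronskian g fun i => monomial (α i) 1).totalDegree ≤ s * (e + s * (2 * δ))
    ∧ ∀ (w : ℤ) (v : Fin 2 → ℤ), |w| ≤ H → (∀ i, |v i| ≤ H) → |hval (s * (e + s * (2 * δ))) w v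
    (curveWronskian g fun i => monomial (α i) 1)| ≤ (H : ℤ) ^ ((s * s * (88 + e + 2 * s) + s * (e +
    2 * s)) * δ) := by
  have hFd : ∀ i, (monomial (α i) (1 : ℤ)).totalDegree ≤ e := fun i => by
    rw [totalDegree_le_iff]
    intro β hβ
    rw [mem_singleton.1 (support_monomial_subset hβ), mem_monoms]
    exact hα i
  have hb := fun i (j : Fin s) => curveDer_iterate_bounds (s := s) g (monomial (α i) 1) hgd (hFd i)
    (by simpa using coeffNorm_monomial_le (α i) 1) j j.2.le
  have hdeg : (curveWronskian g fun i => monomial (α i) 1).totalDegree ≤ s * (e + s * (2 * δ)) :=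
    totalDegree_det_le _ _ fun i j => (hb i j).1.trans
      (Nat.add_le_add_left (Nat.mul_le_mul_right _ j.2.le) _)
  refine ⟨hdeg, fun w v hw hv => ?_⟩
  have hH1 : 1 ≤ H := by omega
  have hp : ∀ n : ℕ, n ≤ H ^ n := fun n => Nat.lt_two_pow_self.le.trans (pow_le_pow_left hH n)
  set τ := e + s * (2 * δ) with hτ
  have hτ' : τ ≤ (e + 2 * s) * δ := by
    rw [hτ, add_mul]
    have : e * 1 ≤ e * δ := Nat.mul_le_mul_left _ hδ
    have h2 : s * (2 * δ) = 2 * s * δ := by ring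
    omega
  have hcg : coeffNorm g ≤ ((H ^ (84 * δ) : ℕ) : ℤ) := by
    refine (coeffNorm_le_card_mul g hgd _ hg).trans ?_
    have h1 : (monoms 2 (2 * δ)).card * H ^ (80 * δ) ≤ H ^ (84 * δ) := by
      calc _ ≤ H ^ (2 * δ + 1 + 1) * H ^ (80 * δ) := Nat.mul_le_mul_right _
            ((card_monoms_le_two_pow 1 _).trans (pow_le_pow_left hH _))
        _ = H ^ (2 * δ + 1 + 1 + 80 * δ) := (pow_add _ _ _).symm
        _ ≤ _ := pow_le_pow_right hH1 (by omega)
    exact_mod_cast h1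
  have hstep : 2 * ((2 * δ : ℕ) : ℤ) * (τ : ℤ) * coeffNorm g ≤ ((H ^ ((87 + e + 2 * s) * δ) : ℕ) : ℤ) := by
    have h1 : 2 * (2 * δ) * τ * H ^ (84 * δ) ≤ H ^ ((87 + e + 2 * s) * δ) := by
      calc _ ≤ H ^ 1 * H ^ (2 * δ) * H ^ τ * H ^ (84 * δ) := by
            gcongr
            · simpa using hH
            · exact hp _
            · exact hp _
        _ = H ^ (1 + 2 * δ + τ + 84 * δ) := by rw [← pow_add, ← pow_add, ← pow_add]
        _ ≤ _ := pow_le_pow_right hH1 (by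
            have h3 : (87 + e + 2 * s) * δ = 87 * δ + (e + 2 * s) * δ := by ring
            omega)
    calc _ ≤ 2 * ((2 * δ : ℕ) : ℤ) * (τ : ℤ) * ((H ^ (84 * δ) : ℕ) : ℤ) :=
          mul_le_mul_of_nonneg_left hcg (by positivity)
      _ ≤ _ := mod_cast h1
  set G : ℕ := H ^ ((87 + e + 2 * s) * δ) with hG
  have hG1 : 1 ≤ G := one_le_pow _ _ hH1
  have hent : ∀ i j : Fin s, coeffNorm ((curveDer g)^[(j : ℕ)] (monomial (α i) 1)) ≤ (G : ℤ) ^ s := by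
    intro i j
    refine (hb i j).2.trans ((pow_le_pow_left₀ (mul_nonneg (by positivity) (coeffNorm_nonneg _))
      hstep _).trans ?_)
    exact pow_le_pow_right₀ (mod_cast hG1) j.2.le
  have hW := coeffNorm_det_le (of fun i j : Fin s => (curveDer g)^[(j : ℕ)] (monomial (α i) 1))
    _ hent
  refine (abs_hval_le_coeffNorm _ hdeg w v H hw hv).trans ?_
  refine (mul_le_mul_of_nonneg_right hW (by positivity)).trans ?_
  have hfac : s.factorial ≤ H ^ (s * s) := by
    calc s.factorial ≤ s ^ s := Nat.factorial_le_pow s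
      _ ≤ (H ^ s) ^ s := pow_le_pow_left (hp s) _
      _ = _ := by rw [← pow_mul]
  have hfin : s.factorial * (G ^ s) ^ s * H ^ (s * τ) ≤
      H ^ ((s * s * (88 + e + 2 * s) + s * (e + 2 * s)) * δ) := by
    calc _ ≤ H ^ (s * s) * (G ^ s) ^ s * H ^ (s * τ) := by gcongr
      _ = H ^ (s * s + (87 + e + 2 * s) * δ * (s * s) + s * τ) := by
          rw [hG, ← pow_mul, ← pow_mul, ← pow_add, ← pow_add]
      _ ≤ _ := pow_le_pow_right hH1 (by
          have h1 : s * τ ≤ s * ((e + 2 * s) * δ) := Nat.mul_le_mul_left _ hτ'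
          have h2 : s * s * 1 ≤ s * s * δ := Nat.mul_le_mul_left _ hδ
          nlinarith)
  exact_mod_cast hfin

/-- The affine point with homogeneous coordinates `(v.1 : v.2)`. -/
noncomputable def affPt (v : ℤ × (Fin n → ℤ)) : Fin n → ℚ := fun i => (v.1 : ℚ)⁻¹ * v.2 i

lemma card_filter_zero_le {φ G : MP 2 ℚ} (hφ : Irreducible φ) (hG : ¬ φ ∣ G) (X : Finset (ℤ × (Fin 2
    → ℤ))) (hX : ∀ v ∈ X, eval (affPt v) φ = 0) (hinj : InjOn affPt (X : Set (ℤ × (Fin 2 → ℤ)))) :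
    (X.filter fun v => eval (affPt v) G = 0).card ≤ φ.totalDegree * G.totalDegree := by
  classical
  rw [← card_image_of_injOn (f := affPt) (hinj.mono fun v hv => (mem_filter.1 (mem_coe.1 hv)).1)]
  refine plane_bezout _ hφ.ne_zero ?_ (hφ.isRelPrime_iff_not_dvd.2 hG) ?_ ?_
  · rintro rfl
    exact hG (dvd_zero _)
  · intro a ha
    obtain ⟨v, hv, rfl⟩ := mem_image.1 ha
    exact hX v (mem_filter.1 hv).1
  · intro a ha
    obtain ⟨v, hv, rfl⟩ := mem_image.1 ha
    exact (mem_filter.1 hv).2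

lemma card_le_add_card_filter_not {ι : Type*} (X : Finset ι) (P : ι → Prop) [DecidablePred P] (h : (X.filter P).card ≤ n) : X.card ≤ n + (X.filter fun x => ¬ P x).card := by
  have := card_filter_add_card_filter_not (s := X) P
  omega

lemma card_le_of_not_dvd_wronskian {t D : ℕ} (hs : 1 ≤ s) (g : MP 2 ℤ) (hgD : g.totalDegree ≤ D) (p
    : ℕ) (hp : p.Prime) (α : Fin s → Fin 2 →₀ ℕ) (hα : ∀ i, ∑ k, α i k ≤ e) {H₀ H : ℕ} (hH : H₀ ≤ H)
    (X : Finset (ℤ × (Fin 2 → ℤ))) (hX : ∀ v ∈ X, ¬ (p : ℤ) ∣ v.1 ∧ |v.1| ≤ H₀ ∧ (∀ i, |v.2 i| ≤ H)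
    ∧ eval (affPt v) (map (castRingHom ℚ) g) = 0) (hinj : InjOn affPt (X : Set (ℤ × (Fin 2 → ℤ))))
    {T' : ℕ} (hT' : (pderiv 1 g).totalDegree ≤ T') (hgy : ∀ v ∈ X, ¬ (p : ℤ) ∣ hval T' v.1 v.2
    (pderiv 1 g)) (ht : 2 * t + s = s * s) (hsize : s.factorial * ∏ i, H₀ ^ (e - ∑ k, α i k) * H ^
    (∑ k, α i k) < p ^ t) (hT : (curveWronskian g fun i => monomial (α i) 1).totalDegree ≤ T) (hW :
    ∀ v ∈ X, ¬ (p : ℤ) ∣ hval T v.1 v.2 (curveWronskian g fun i => monomial (α i) 1)) : X.card ≤ (s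
    - 1) * (D * p) := by
  have hne : ∀ v ∈ X, v.1 ≠ 0 := fun v hv h0 => (hX v hv).1 (by simp [h0])
  have hex : ∀ v : ℤ × (Fin 2 → ℤ), ∃ u : ℤ, v ∈ X → (p : ℤ) ∣ v.1 * u - 1 := by
    intro v
    by_cases hv : v ∈ X
    · obtain ⟨u, hu⟩ := exists_inv_mod p hp 1 v.1 (hX v hv).1
      exact ⟨u, fun _ => by simpa using hu⟩
    · exact ⟨0, fun h => absurd h hv⟩
  choose u hu using hex
  set r : ℤ × (Fin 2 → ℤ) → Fin 2 → ZMod p := fun v i => ((u v * v.2 i : ℤ) : ZMod p) with hr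
  have himg : (X.image r).card ≤ D * p := by
    have := card_image_smooth_le (m := 1) g hgD p hp X (fun v i => u v * v.2 i) ?_ ?_
    · rw [pow_one] at this
      exact this
    · intro v hv
      rw [← dvd_hval_iff p (hu v hv) v.2 g le_rfl,
        (hval_eq_zero_iff (hne v hv) v.2 g le_rfl).2 (hX v hv).2.2.2]
      exact dvd_zero _
    · intro v hv
      rw [show (last 1 : Fin 2) = 1 from rfl, ← dvd_hval_iff (T := T') p (hu v hv) v.2 _ hT']
      exact hgy v hv
  refine (Finset.card_le_mul_card_image (f := r) X (s - 1) fun a _ => ?_).trans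
    (Nat.mul_le_mul_left _ himg)
  by_contra hlt
  obtain ⟨Y, hYs, hYc⟩ := Finset.exists_subset_card_eq (show s ≤ (X.filter fun v => r v = a).card by omega)
  let x : Fin s → ℤ × (Fin 2 → ℤ) := fun j => ((Y.equivFin.trans (finCongr hYc)).symm j : Y)
  have hx : ∀ j, x j ∈ X ∧ r (x j) = a := fun j => mem_filter.1 (hYs (Subtype.prop _))
  have hxinj : Injective x := val_injective.comp (Equiv.injective _)
  refine hW (x ⟨0, hs⟩) (hx _).1 (dvd_hval_curveWronskian g p hp α hα x ⟨0, hs⟩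
    (fun j => (hX _ (hx j).1).1) hH (fun j => (hX _ (hx j).1).2.1)
    (fun j => (hX _ (hx j).1).2.2.1) ?_ ?_ ?_ hT' (fun j => hgy _ (hx j).1) ht hsize hT)
  · intro j i
    have h1 := hu _ (hx j).1
    have h2 := hu _ (hx ⟨0, hs⟩).1
    have h3 : ((u (x j) * (x j).2 i : ℤ) : ZMod p) = ((u (x ⟨0, hs⟩) * (x ⟨0, hs⟩).2 i : ℤ) : ZMod p) :=
      congrFun ((hx j).2.trans (hx ⟨0, hs⟩).2.symm) i
    rw [← intCast_zmod_eq_zero_iff_dvd] at h1 h2 ⊢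
    push_cast at h1 h2 h3 ⊢
    linear_combination (-((x j).2 i : ZMod p) * (x ⟨0, hs⟩).1) * h1 +
      (((x ⟨0, hs⟩).2 i : ZMod p) * (x j).1) * h2 + ((x j).1 : ZMod p) * (x ⟨0, hs⟩).1 * h3
  · intro j k hjk
    by_contra hall
    push Not at hall
    refine hjk (hxinj (hinj (hx j).1 (hx k).1 ?_))
    funext i
    have h1 : ((x j).1 : ℚ) ≠ 0 := mod_cast hne _ (hx j).1
    have h2 : ((x k).1 : ℚ) ≠ 0 := mod_cast hne _ (hx k).1
    have h3 : ((x j).2 i : ℚ) * (x k).1 - (x k).2 i * (x j).1 = 0 := mod_cast hall i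
    simp only [affPt]
    field_simp
    linear_combination h3
  · intro j
    exact (hval_eq_zero_iff (hne _ (hx j).1) _ g le_rfl).2 (hX _ (hx j).1).2.2.2

/-- The constant in the size condition on the auxiliary prime. -/
def curveConst (s e : ℕ) : ℕ := 81 + (s * s * (88 + e + 2 * s) + s * (e + 2 * s))

theorem card_curve_points_le : ∃ K : ℕ, 2 ≤ K ∧ ∀ {s e t δ : ℕ} (α : Fin s → Fin 2 →₀ ℕ) (_ : ∀ i, ∑
    k, α i k ≤ e) (φ : MP 2 ℚ) (_ : Irreducible φ) (_ : φ.totalDegree = δ) (_ : 1 ≤ δ) (_ : pderiv 1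
    φ ≠ 0) (_ : ∀ c : Fin s → ℚ, φ ∣ ∑ i, C (c i) * monomial (α i) 1 → c = 0) (H₀ H : ℕ) (_ : H₀ ≤
    H) (_ : 2 ≤ H) (X : Finset (ℤ × (Fin 2 → ℤ))) (_ : ∀ v ∈ X, v.1 ≠ 0 ∧ eval (affPt v) φ = 0 ∧
    |v.1| ≤ H₀ ∧ ∀ i, |v.2 i| ≤ H) (_ : InjOn affPt (X : Set (ℤ × (Fin 2 → ℤ)))) (P : ℕ) (_ : 1 ≤ P)
    (_ : 2 * t + s = s * s) (_ : s.factorial * ∏ i, H₀ ^ (e - ∑ k, α i k) * H ^ (∑ k, α i k) < P ^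
    t) (_ : 2 * (curveConst s e * δ * log H) ≤ P), X.card ≤ 2 * ((s - 1) * (2 * δ * (K * P))) + 2 *
    δ * δ + δ * (s * (e + s * (2 * δ))) := by
  obtain ⟨K, hK, hprime⟩ := exists_prime_avoiding
  refine ⟨K, hK, ?_⟩
  intro s e t δ α hα φ hφ hδ hδ1 hder hF H₀ H hH hH2 X hX hinj P hP ht hsize hlog
  have hs : 1 ≤ s := by
    rcases Nat.eq_zero_or_pos s with rfl | h
    · obtain rfl : t = 0 := by omega
      simp at hsize
    · exact h
  have hXle : ∀ v ∈ X, |v.1| ≤ (H : ℤ) := fun v hv => (hX v hv).2.2.1.trans (mod_cast hH)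
  obtain ⟨g, h, hgd, hhd, hgc, hφh, hhv, hcase⟩ := exists_smooth_multiple (m := 1) (by norm_num) φ hφ hδ hδ1
    hder (card_monoms_double_two hδ1) H hH2 X X.finite_toSet (fun v hv =>
      ⟨(hX v hv).1, (hX v hv).2.1, hXle v hv, (hX v hv).2.2.2⟩)
  have hφX : ∀ v ∈ X, eval (affPt v) φ = 0 := fun v hv => (hX v hv).2.1
  have hXh : (X.filter fun v => eval (affPt v) (map (castRingHom ℚ) h) = 0).card ≤ 2 * δ * δ := by
    refine (card_filter_zero_le hφ hφh X hφX hinj).trans ?_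
    rw [hδ, totalDegree_map_intCast]
    nlinarith
  rcases hcase with ⟨hh, hφg⟩ | hall
  swap
  · rw [Finset.filter_true_of_mem (fun v hv => by exact hall v hv)] at hXh
    omega
  have hlast : (last 1 : Fin 2) = 1 := rfl
  rw [hlast] at hh
  subst hh
  set X₁ := X.filter fun v => ¬ eval (affPt v) (map (castRingHom ℚ) (pderiv 1 g)) = 0 with hX₁
  have hcard1 : X.card ≤ 2 * δ * δ + X₁.card := card_le_add_card_filter_not X _ hXh
  rcases X₁.eq_empty_or_nonempty with hemp | ⟨v₀, hv₀⟩
  · rw [hemp, Finset.card_empty] at hcard1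
    omega
  set W := curveWronskian g fun i => monomial (α i) 1 with hW
  obtain ⟨hWd, hWv⟩ := curveWronskian_bounds hδ1 g hgd H hH2 hgc α hα
  rw [← hW] at hWd hWv
  have hφW : ¬ φ ∣ map (castRingHom ℚ) W := by
    have h1 := not_dvd_curveWronskian hφ hφg (affPt v₀) (hφX _ (mem_filter.1 hv₀).1)
      (by rw [pderiv_map]; exact (mem_filter.1 hv₀).2) (fun i => monomial (α i) 1) hF
    have h2 : map (castRingHom ℚ) W =
        curveWronskian (map (castRingHom ℚ) g) fun i => monomial (α i) 1 := by
      rw [hW, curveWronskian, curveWronskian, map_det]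
      congr 1
      ext i j
      simp [map_curveDer_iterate]
    rwa [h2]
  set X₂ := X₁.filter fun v => ¬ eval (affPt v) (map (castRingHom ℚ) W) = 0 with hX₂
  have hX₁X : X₁ ⊆ X := filter_subset _ _
  have hX₂X : X₂ ⊆ X := (filter_subset _ _).trans hX₁X
  have hcard2 : X₁.card ≤ δ * (s * (e + s * (2 * δ))) + X₂.card := by
    have h1 := card_filter_zero_le hφ hφW X₁ (fun v hv => hφX v (hX₁X hv)) (hinj.mono (mod_cast hX₁X))
    rw [hδ, totalDegree_map_intCast] at h1
    have h2 := Nat.mul_le_mul_left δ hWd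
    exact card_le_add_card_filter_not X₁ _ (h1.trans h2)
  set TW := s * (e + s * (2 * δ)) with hTW
  have hne2 : ∀ v ∈ X₂, hval (2 * δ) v.1 v.2 (pderiv 1 g) ≠ 0 ∧ hval TW v.1 v.2 W ≠ 0 := by
    intro v hv
    have h1 := mem_filter.1 hv
    refine ⟨fun h => (mem_filter.1 h1.1).2 ?_, fun h => h1.2 ?_⟩
    · exact (hval_eq_zero_iff (hX v (hX₂X hv)).1 _ _ hhd).1 h
    · exact (hval_eq_zero_iff (hX v (hX₂X hv)).1 _ _ hWd).1 h
  obtain ⟨p, hp, hPp, hpK, hhalf⟩ := hprime X₂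
    (fun v => v.1 * hval (2 * δ) v.1 v.2 (pderiv 1 g) * hval TW v.1 v.2 W)
    (curveConst s e * δ * log H) P hP
    (fun v hv => mul_ne_zero (mul_ne_zero (hX v (hX₂X hv)).1 (hne2 v hv).1) (hne2 v hv).2) (by
      intro v hv
      have h1 : |v.1 * hval (2 * δ) v.1 v.2 (pderiv 1 g) * hval TW v.1 v.2 W| ≤
          (H : ℤ) ^ (curveConst s e * δ) := by
        rw [abs_mul, abs_mul]
        calc _ ≤ (H : ℤ) ^ δ * (H : ℤ) ^ (80 * δ) *
              (H : ℤ) ^ ((s * s * (88 + e + 2 * s) + s * (e + 2 * s)) * δ) := by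
              gcongr
              · exact (hXle v (hX₂X hv)).trans (le_self_pow₀ (mod_cast (by omega : 1 ≤ H)) (by omega))
              · exact hhv v (hX₂X hv)
              · exact hWv _ _ (hXle v (hX₂X hv)) (hX v (hX₂X hv)).2.2.2
          _ = _ := by
              rw [← pow_add, ← pow_add, curveConst]
              congr 1
              ring
      have h2 : (0 : ℤ) < |v.1 * hval (2 * δ) v.1 v.2 (pderiv 1 g) * hval TW v.1 v.2 W| :=
        abs_pos.2 (mul_ne_zero (mul_ne_zero (hX v (hX₂X hv)).1 (hne2 v hv).1) (hne2 v hv).2)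
      have h3 : log |((v.1 * hval (2 * δ) v.1 v.2 (pderiv 1 g) * hval TW v.1 v.2 W : ℤ) : ℝ)| ≤
          log ((H : ℝ) ^ (curveConst s e * δ)) := by
        apply log_le_log
        · exact_mod_cast h2
        · exact_mod_cast h1
      rw [log_pow] at h3
      simpa using h3) hlog
  set A : ℤ × (Fin 2 → ℤ) → ℤ :=
    fun v => v.1 * hval (2 * δ) v.1 v.2 (pderiv 1 g) * hval TW v.1 v.2 W with hA
  have h4 := card_le_of_not_dvd_wronskian (t := t) hs g hgd p hp α hα hH (X₂.filter fun v => ¬ (p : ℤ) ∣ A v)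
    (fun v hv => ⟨fun h => (mem_filter.1 hv).2 (Dvd.dvd.mul_right (Dvd.dvd.mul_right h _) _),
      (hX v (hX₂X (mem_filter.1 hv).1)).2.2.1,
      (hX v (hX₂X (mem_filter.1 hv).1)).2.2.2, by
        obtain ⟨q, hq⟩ := hφg
        rw [hq, map_mul, hφX v (hX₂X (mem_filter.1 hv).1), zero_mul]⟩)
    (hinj.mono (by
      intro v hv
      exact hX₂X (mem_filter.1 (mem_coe.1 hv)).1))
    hhd (fun v hv h => (mem_filter.1 hv).2 (Dvd.dvd.mul_right (Dvd.dvd.mul_left h _) _)) ht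
    (hsize.trans_le (pow_le_pow_left hPp.le _)) hWd
    (fun v hv h => (mem_filter.1 hv).2 (Dvd.dvd.mul_left h _))
  have h5 : 2 * X₂.card ≤ X₂.card + 2 * (X₂.filter fun v => ¬ (p : ℤ) ∣ A v).card := by
    have := card_le_add_card_filter_not X₂ (fun v => (p : ℤ) ∣ A v) le_rfl
    have h7 : 2 * (X₂.filter fun v => (p : ℤ) ∣ A v).card ≤ X₂.card := hhalf
    omega
  have h8 := (Nat.mul_le_mul_left 2 h4)
  have h6 : (s - 1) * (2 * δ * p) ≤ (s - 1) * (2 * δ * (K * P)) := by gcongr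
  omega

lemma eval_aeval {R σ τ : Type*} [CommRing R] (p : σ → MvPolynomial τ R) (x : τ → R)
    (f : MvPolynomial σ R) : eval x (aeval p f) = eval (fun i => eval x (p i)) f := by
  have h : (aeval x).comp (aeval p) =
      (aeval (fun i => eval x (p i)) : MvPolynomial σ R →ₐ[R] R) := by
    ext i
    simp [coe_aeval_eq_eval]
  simpa [coe_aeval_eq_eval] using dcongr h f

lemma totalDegree_aeval_le {R σ τ : Type*} [CommRing R] (p : σ → MvPolynomial τ R) (k : ℕ)
    (hp : ∀ i, (p i).totalDegree ≤ k) (f : MvPolynomial σ R) :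
    (aeval p f).totalDegree ≤ k * f.totalDegree := by
  rw [aeval_def, eval₂_eq]
  refine totalDegree_finsetSum_le fun α hα => ?_
  refine (totalDegree_mul _ _).trans ?_
  rw [algebraMap_eq, totalDegree_C, zero_add]
  refine (totalDegree_finsetProd _ _).trans ?_
  calc ∑ i ∈ α.support, (p i ^ α i).totalDegree ≤ ∑ i ∈ α.support, k * α i :=
        sum_le_sum fun i _ => (totalDegree_pow _ _).trans (by
          rw [mul_comm]; exact Nat.mul_le_mul_right _ (hp i))
    _ = k * ∑ i ∈ α.support, α i := by rw [mul_sum]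
    _ ≤ _ := Nat.mul_le_mul_left _ (le_totalDegree hα)

lemma totalDegree_linForm_le (c : Fin n → R) : (linForm c).totalDegree ≤ 1 :=
  totalDegree_finsetSum_le fun i _ => (isHomogeneous_C_mul_X (c i) i).totalDegree_le

/-- The linear change of variables with matrix `M`. -/
noncomputable def linSub (M : Matrix (Fin n) (Fin n) R) : MP n R →ₐ[R] MP n R := aeval fun i => linForm (M i)

lemma eval_linForm (c x : Fin n → R) : eval x (linForm c) = ∑ i, c i * x i := by
  simp [linForm]

lemma eval_linSub (M : Matrix (Fin n) (Fin n) R)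
    (x : Fin n → R) (f : MP n R) : eval x (linSub M f) = eval (M.mulVec x) f := by
  rw [linSub, eval_aeval]
  simp only [eval_linForm]
  rfl

lemma linSub_mul (M N : Matrix (Fin n) (Fin n) R) :
    (linSub N).comp (linSub M) = linSub (M * N) := by
  ext i : 1
  simp only [linSub, comp_apply, aeval_X, linForm, map_sum, map_mul, algHom_C, mul_sum,
    Matrix.mul_apply, sum_mul]
  rw [sum_comm]
  simp [mul_assoc]

lemma linSub_one : linSub (1 : Matrix (Fin n) (Fin n) R) = AlgHom.id R _ := by
  ext i : 1
  simp [linSub, linForm, Matrix.one_apply]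

/-- An invertible linear change of variables as an automorphism of the polynomial ring. -/
noncomputable def linEquiv (M N : Matrix (Fin n) (Fin n) R) (h : M * N = 1) : MP n R ≃ₐ[R] MP n R :=
  AlgEquiv.ofAlgHom (linSub M) (linSub N) (by rw [linSub_mul, mul_eq_one_comm.1 h, linSub_one])
    (by rw [linSub_mul, h, linSub_one])

lemma irreducible_linSub {M N : Matrix (Fin n) (Fin n) R}
    (h : M * N = 1) {f : MP n R} (hf : Irreducible f) : Irreducible (linSub M f) :=
  (MulEquiv.irreducible_iff (linEquiv M N h)).2 hf

lemma linSub_linSub_of_mul {M N : Matrix (Fin n) (Fin n) R}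
    (h : M * N = 1) (f : MP n R) : linSub N (linSub M f) = f := by
  have := linSub_mul M N
  rw [h, linSub_one] at this
  exact dcongr this f

lemma linSub_dvd_iff {M N : Matrix (Fin n) (Fin n) R}
    (h : M * N = 1) {f g : MP n R} : linSub M f ∣ linSub M g ↔ f ∣ g :=
  map_dvd_iff (linEquiv M N h)

lemma linSub_ne_zero {M N : Matrix (Fin n) (Fin n) R}
    (h : M * N = 1) {f : MP n R} (hf : f ≠ 0) : linSub M f ≠ 0 := by
  intro h0
  have := linSub_linSub_of_mul h f
  rw [h0, map_zero] at this
  exact hf this.symm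

lemma totalDegree_linSub_le (M : Matrix (Fin n) (Fin n) R)
    (f : MP n R) : (linSub M f).totalDegree ≤ f.totalDegree :=
  (totalDegree_aeval_le _ 1 (fun i => totalDegree_linForm_le (M i)) f).trans (one_mul _).le

lemma totalDegree_linSub {M N : Matrix (Fin n) (Fin n) R}
    (h : M * N = 1) (f : MP n R) : (linSub M f).totalDegree = f.totalDegree := by
  refine le_antisymm (totalDegree_linSub_le M f) ?_
  have := totalDegree_linSub_le N (linSub M f)
  rwa [linSub_linSub_of_mul h] at this

lemma isHomogeneous_linSub (M : Matrix (Fin n) (Fin n) R)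
    {f : MP n R} (hf : f.IsHomogeneous d) : (linSub M f).IsHomogeneous d := by
  have := hf.aeval (fun i => linForm (M i)) (n := 1) (fun i =>
    IsHomogeneous.sum _ _ _ fun j _ => isHomogeneous_C_mul_X _ _)
  rwa [one_mul] at this

lemma homogeneousComponent_linSub (M : Matrix (Fin n) (Fin n) R) (f : MP n R) (d : ℕ) :
    homogeneousComponent d (linSub M f) = linSub M (homogeneousComponent d f) := by
  conv_lhs => rw [← sum_homogeneousComponent f]
  rw [map_sum, map_sum]
  have h : ∀ i, homogeneousComponent d (linSub M (homogeneousComponent i f)) =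
      if i = d then linSub M (homogeneousComponent d f) else 0 := by
    intro i
    rw [homogeneousComponent_of_mem (isHomogeneous_linSub M (homogeneousComponent_isHomogeneous i f))]
    by_cases hi : i = d
    · simp [hi]
    · simp [hi, Ne.symm hi]
  simp only [h, Finset.sum_ite_eq', mem_range]
  split_ifs with hd
  · rfl
  · rw [homogeneousComponent_eq_zero d f (by omega), map_zero]

lemma coeff_single_eq_eval (k : Fin n) (f : MP n R) :
    coeff (single k d) f = eval (Pi.single k 1) (homogeneousComponent d f) := by
  classical
  rw [eval_eq']
  have h : ∀ α ∈ (homogeneousComponent d f).support, α ≠ single k d →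
      coeff α (homogeneousComponent d f) * ∏ i, (Pi.single k 1 : Fin n → R) i ^ α i = 0 := by
    intro α hα hne
    have hdeg : α.degree = d := by
      by_contra hdeg
      exact mem_support_iff.1 hα ((homogeneousComponent_isHomogeneous d f).coeff_eq_zero hdeg)
    have : ∃ i, i ≠ k ∧ α i ≠ 0 := by
      by_contra hall
      push Not at hall
      apply hne
      ext i
      by_cases hi : i = k
      · subst hi
        rw [Finsupp.single_eq_same, ← hdeg, degree_eq_sum]
        exact (sum_eq_single i (fun j _ hj => hall j hj) (by simp)).symm
      · rw [hall i hi, single_eq_of_ne hi]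
    obtain ⟨i, hi, hαi⟩ := this
    rw [Finset.prod_eq_zero (mem_univ i), mul_zero]
    rw [Pi.single_eq_of_ne hi, zero_pow hαi]
  rw [sum_eq_single (single k d) h]
  · rw [coeff_homogeneousComponent, if_pos (by simp)]
    rw [Finset.prod_eq_one, mul_one]
    intro i _
    by_cases hi : i = k
    · subst hi; simp
    · rw [single_eq_of_ne hi, pow_zero]
  · intro h0
    rw [notMem_support_iff.1 h0, zero_mul]

/-- The shear `x ↦ x + x_k v`. -/
def shearMat {R : Type*} [CommRing R] {n : ℕ} (k : Fin n) (v : Fin n → R) : Matrix (Fin n) (Fin n) R :=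
  1 + Matrix.vecMulVec v (Pi.single k 1)

lemma shearMat_mulVec (k : Fin n) (v x : Fin n → R) :
    (shearMat k v).mulVec x = fun i => x i + v i * x k := by
  ext i
  simp [shearMat, Matrix.add_mulVec, Matrix.vecMulVec_mulVec, mul_comm]

lemma shearMat_mul (k : Fin n) (v : Fin n → R) (hv : v k = 0) :
    shearMat k v * shearMat k (-v) = 1 := by
  refine Matrix.mulVec_injective (funext fun x => ?_)
  rw [← Matrix.mulVec_mulVec, shearMat_mulVec, shearMat_mulVec, Matrix.one_mulVec]
  funext i
  simp [hv]

lemma coeff_single_shear (k : Fin n) (v : Fin n → R) (f : MP n R) : coeff (single k d) (linSub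
    (shearMat k v) f) = eval (fun i => (Pi.single k 1 : Fin n → _) i + v i) (homogeneousComponent d
    f) := by
  rw [coeff_single_eq_eval, homogeneousComponent_linSub, eval_linSub, shearMat_mulVec]
  simp

lemma exists_eval_ne_zero_of_isHomogeneous (k : Fin n) {F : MP n ℚ}
    (hF : F.IsHomogeneous d) (hF0 : F ≠ 0) :
    ∃ v : Fin n → ℕ, v k = 0 ∧ (∀ i, v i ≤ d) ∧ eval (fun i => (Pi.single k 1 : Fin n → _) i + (v i : ℚ)) F ≠ 0 := by
  classical
  set G : MP n ℚ := aeval (fun i => if i = k then 1 else X i) F with hG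
  have hev : ∀ x : Fin n → ℚ, eval x G = eval (fun i => if i = k then 1 else x i) F := by
    intro x
    rw [hG, eval_aeval]
    congr 2
    funext i
    split_ifs <;> simp
  have hG0 : G ≠ 0 := by
    intro h0
    have h1 : X k * F = 0 := by
      apply MvPolynomial.funext
      intro x
      rw [map_mul, eval_X, map_zero]
      by_cases hx : x k = 0
      · rw [hx, zero_mul]
      have h2 := hev (fun i => (x k)⁻¹ * x i)
      rw [h0, map_zero] at h2
      have h3 : (fun i => if i = k then (1 : ℚ) else (x k)⁻¹ * x i) = fun i => (x k)⁻¹ * x i := by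
        funext i
        split_ifs with h
        · subst h; rw [inv_mul_cancel₀ hx]
        · rfl
      rw [h3] at h2
      have h4 : eval (fun i => (x k)⁻¹ * x i) F = (x k)⁻¹ ^ d * eval x F := by
        rw [eval_eq', eval_eq', mul_sum]
        refine sum_congr rfl fun α hα => ?_
        have : ∑ i, α i = d := by
          rw [← degree_eq_sum]
          by_contra hne
          exact mem_support_iff.1 hα (hF.coeff_eq_zero hne)
        simp only [mul_pow, prod_mul_distrib, prod_pow_eq_pow_sum, this]
        ring
      rw [h4] at h2
      rw [(mul_eq_zero.1 h2.symm).resolve_left (by positivity), mul_zero]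
    rcases mul_eq_zero.1 h1 with h | h
    · exact X_ne_zero k h
    · exact hF0 h
  have hGd : G.totalDegree ≤ d := by
    refine (totalDegree_aeval_le _ 1 (fun i => ?_) F).trans (by simpa using hF.totalDegree_le)
    split_ifs
    · simp
    · simp
  by_contra hall
  push Not at hall
  refine hG0 (eq_zero_of_eval_zero_at_prod_finset G
    (fun _ => (range (d + 1)).image fun m : ℕ => (m : ℚ)) (fun i => ?_) (fun x hx => ?_))
  · rw [card_image_of_injective _ Nat.cast_injective, card_range]
    exact Nat.lt_succ_of_le ((degreeOf_le_totalDegree _ _).trans hGd)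
  · have hx' : ∀ i, ∃ m : ℕ, m ≤ d ∧ (m : ℚ) = x i := by
      intro i
      obtain ⟨m, hm, h⟩ := mem_image.1 (hx i)
      exact ⟨m, by simpa [Nat.lt_succ_iff] using hm, h⟩
    choose m hm hmx using hx'
    have := hall (fun i => if i = k then 0 else m i) (by simp) (fun i => by split_ifs <;> simp [hm])
    rw [hev, ← this]
    congr 2
    funext i
    by_cases hi : i = k
    · subst hi; simp
    · simp [hi, hmx]

/-- The exponents of the monomials `x ^ i`, `i ≤ m`, and `x ^ i * y`, `i < m`. -/
noncomputable def linearExponents (m : ℕ) (i : Fin (2 * m + 1)) : Fin 2 →₀ ℕ :=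
  if (i : ℕ) ≤ m then single 0 (i : ℕ)
  else single 0 ((i : ℕ) - m - 1) + single 1 1

lemma linearExponents_sum (m : ℕ) (i : Fin (2 * m + 1)) :
    ∑ k, linearExponents m i k = if (i : ℕ) ≤ m then (i : ℕ) else (i : ℕ) - m := by
  rw [linearExponents]
  split_ifs with h
  · simp [sum_univ_two]
  · simp [sum_univ_two]
    omega

lemma linearExponents_injective (m : ℕ) : Injective (linearExponents m) := by
  intro i j h
  have h0 := dcongr h 0
  have h1 := dcongr h 1
  simp only [linearExponents] at h0 h1
  apply Fin.ext
  split_ifs at h0 h1 <;> simp at h0 h1 <;> omega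

lemma sum_linearExponents (m : ℕ) : ∑ i, ∑ k, linearExponents m i k = m * (m + 1) := by
  simp only [linearExponents_sum]
  rw [Fin.sum_univ_eq_sum_range (fun i => if i ≤ m then i else i - m),
    show 2 * m + 1 = (m + 1) + m by ring, Finset.sum_range_add]
  have h1 : ∀ i ∈ range (m + 1), (if i ≤ m then i else i - m) = i := by
    intro i hi
    rw [if_pos (by simpa [Nat.lt_succ_iff] using hi)]
  have h2 : ∀ i ∈ range m, (if m + 1 + i ≤ m then m + 1 + i else m + 1 + i - m) = i + 1 := by
    intro i hi
    rw [if_neg (by omega)]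
    omega
  rw [sum_congr rfl h1, sum_congr rfl h2, Finset.sum_range_succ', add_zero, ← sum_add_distrib]
  have h3 : ∀ n : ℕ, ∑ i ∈ range n, (i + 1 + (i + 1)) = n * (n + 1) := by
    intro n
    induction n with
    | zero => simp
    | succ n ih => rw [sum_range_succ, ih]; ring
  exact h3 m

lemma eq_zero_of_dvd_sum_monomial {α : Fin s → Fin 2 →₀ ℕ} (hinj : Injective α)
    {φ : MP 2 ℚ} (hφ : ∀ i, α i 1 < φ.degreeOf 1)
    (c : Fin s → ℚ) (hc : φ ∣ ∑ i, C (c i) * monomial (α i) 1) : c = 0 := by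
  classical
  set F : MP 2 ℚ := ∑ i, C (c i) * monomial (α i) 1 with hF
  have hF0 : F = 0 := by
    by_contra hne
    obtain ⟨q, hq⟩ := hc
    have hq0 : q ≠ 0 := by rintro rfl; exact hne (by rw [hq, mul_zero])
    have hφ0 : φ ≠ 0 := by rintro rfl; exact hne (by rw [hq, zero_mul])
    have hle : φ.degreeOf 1 ≤ F.degreeOf 1 := by
      rw [hq, degreeOf_mul_eq (n := 1) hφ0 hq0]
      exact Nat.le_add_right _ _
    obtain ⟨β, hβ, hβF⟩ : ∃ β ∈ F.support, F.degreeOf 1 = β 1 := by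
      rw [degreeOf_eq_sup]
      exact Finset.exists_mem_eq_sup _ (support_nonempty.2 hne) fun m => m 1
    obtain ⟨i, -, hi⟩ := Finset.exists_ne_zero_of_sum_ne_zero
      (show ∑ i, coeff β (C (c i) * monomial (α i) (1 : ℚ)) ≠ 0 by
        rw [← coeff_sum]; exact mem_support_iff.1 hβ)
    rw [coeff_C_mul, coeff_monomial] at hi
    have hαβ : α i = β := by
      by_contra h
      simp [h] at hi
    have := hφ i
    rw [hαβ] at this
    omega
  funext i
  have h1 : coeff (α i) F = c i := by
    rw [hF, coeff_sum]
    rw [sum_eq_single i]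
    · simp
    · intro j _ hj
      rw [coeff_C_mul, coeff_monomial, if_neg (fun h => hj (hinj h)), mul_zero]
    · simp
  rw [← h1, hF0, coeff_zero, Pi.zero_apply]

lemma affPt_one (x : Fin n → ℤ) : affPt (1, x) = fun i => (x i : ℚ) := by
  funext i; simp [affPt]

lemma pderiv_ne_zero_of_degreeOf [CharZero K] (i : Fin n)
    {φ : MP n K} (h : φ.degreeOf i ≠ 0) : pderiv i φ ≠ 0 := by
  classical
  intro h0
  obtain ⟨α, hα, hαi⟩ : ∃ α ∈ φ.support, α i ≠ 0 := by
    by_contra hall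
    push Not at hall
    exact h (Nat.le_zero.1 (degreeOf_le_iff.2 fun α hα => (hall α hα).le))
  have hle : single i 1 ≤ α := by
    rw [Finsupp.single_le_iff]; omega
  have h1 : coeff (α - single i 1) (pderiv i φ) = 0 := by rw [h0, coeff_zero]
  rw [coeff_pderiv, tsub_add_cancel_of_le hle] at h1
  rcases mul_eq_zero.1 h1 with h2 | h2
  · exact mem_support_iff.1 hα h2
  · norm_cast at h2

lemma affine_curve_aux (m : ℕ) (hm : 1 ≤ m) (θ : ℝ) (hθ : (m + 1 : ℝ) ≤ θ * (2 * m + 1)) : ∃ C : ℝ,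
    0 ≤ C ∧ ∀ (φ : MP 2 ℚ) (_ : Irreducible φ) (_ : 2 ≤ φ.degreeOf 1) (B : ℕ) (_ : 2 ≤ B) (X :
    Finset (Fin 2 → ℤ)) (_ : ∀ x ∈ X, evQ x φ = 0 ∧ ∀ i, |x i| ≤ B), (X.card : ℝ) ≤ C *
    φ.totalDegree * ((B : ℝ) ^ θ + φ.totalDegree * log B) := by
  obtain ⟨K, hK, hmain⟩ := card_curve_points_le
  set s := 2 * m + 1 with hs
  set cc := curveConst s m with hcc
  refine ⟨4 * (s - 1) * K * (s + 1 + 2 * cc) + 4 + s * m + 4 * s * s, ?_, ?_⟩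
  · have : (1 : ℝ) ≤ s := mod_cast (by omega : 1 ≤ s)
    have : (0 : ℝ) ≤ s - 1 := by linarith
    positivity
  intro φ hφ hdeg B hB X hX
  set δ := φ.totalDegree with hδ
  have hδ2 : 2 ≤ δ := hdeg.trans (degreeOf_le_totalDegree _ _)
  have hBr : (2 : ℝ) ≤ B := mod_cast hB
  have hlog : 1 / 2 ≤ log B := by
    have h1 := log_two_gt_d9
    have h2 : log 2 ≤ log B := log_le_log (by norm_num) hBr
    linarith
  have hθ0 : 0 < θ := by
    by_contra h
    push Not at h
    have : θ * (2 * m + 1) ≤ 0 := mul_nonpos_of_nonpos_of_nonneg h (by positivity)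
    have : (0 : ℝ) ≤ m := by positivity
    linarith
  have hBθ : 1 ≤ (B : ℝ) ^ θ := one_le_rpow (by linarith) hθ0.le
  set Y : ℝ := s * (B : ℝ) ^ θ + 2 * (cc * δ * log B) with hY
  set P := ⌈Y⌉₊ with hP
  have hδr : (2 : ℝ) ≤ δ := mod_cast hδ2
  have hs1 : (1 : ℝ) ≤ s := mod_cast (by omega : 1 ≤ s)
  have hccp : (1 : ℝ) ≤ cc := by
    have : 1 ≤ cc := by rw [hcc, curveConst]; omega
    exact_mod_cast this
  have hpos : 0 < 2 * (cc * δ * log B) := by positivity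
  have hYP : Y ≤ P := le_ceil Y
  have hY1 : s * (B : ℝ) ^ θ < Y := by linarith
  have hsB : 1 ≤ s * (B : ℝ) ^ θ := one_le_mul_of_one_le_of_one_le hs1 hBθ
  have hP1 : 1 ≤ P := by
    have : (1 : ℝ) ≤ P := by linarith
    exact_mod_cast this
  have hPY : (P : ℝ) ≤ Y + 1 := (Nat.ceil_lt_add_one (by linarith)).le
  have hinj : Injective fun x : Fin 2 → ℤ => ((1 : ℤ), x) := fun x y h => (Prod.ext_iff.1 h).2
  have hsize : s.factorial * ∏ i, 1 ^ (m - ∑ k, linearExponents m i k) *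
      B ^ (∑ k, linearExponents m i k) < P ^ (m * (2 * m + 1)) := by
    simp only [one_pow, one_mul]
    rw [prod_pow_eq_pow_sum, sum_linearExponents]
    have h1 : (s.factorial : ℝ) * (B : ℝ) ^ (m * (m + 1)) ≤ (s * (B : ℝ) ^ θ) ^ (m * (2 * m + 1)) := by
      rw [mul_pow]
      refine mul_le_mul ?_ ?_ (by positivity) (by positivity)
      · have h2 : s.factorial ≤ s ^ (m * (2 * m + 1)) :=
          (Nat.factorial_le_pow s).trans (pow_le_pow_right (by omega) (by nlinarith))
        exact_mod_cast h2
      · rw [← rpow_natCast, ← rpow_natCast, ← rpow_mul (by positivity)]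
        refine Real.rpow_le_rpow_of_exponent_le (by linarith) ?_
        push_cast
        have : (0 : ℝ) ≤ m := by positivity
        nlinarith
    have h2 : (s * (B : ℝ) ^ θ) ^ (m * (2 * m + 1)) < (P : ℝ) ^ (m * (2 * m + 1)) := by
      refine pow_lt_pow_left₀ (by linarith) (by positivity) ?_
      have : 0 < m * (2 * m + 1) := by positivity
      omega
    exact_mod_cast h1.trans_lt h2
  have h := hmain (t := m * (2 * m + 1)) (δ := δ) (linearExponents m) (e := m) (fun i => by
      rw [linearExponents_sum]
      split_ifs with h
      · exact h
      · have := i.2; omega) φ hφ rfl (by omega)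
    (pderiv_ne_zero_of_degreeOf 1 (by omega)) (fun c hc =>
      eq_zero_of_dvd_sum_monomial (linearExponents_injective m) (fun i => hdeg.trans_lt' (by
        rw [linearExponents]; split_ifs <;> simp)) c hc)
    1 B (by omega) hB (X.map ⟨_, hinj⟩) (by
      intro v hv
      obtain ⟨x, hx, rfl⟩ := mem_map.1 hv
      refine ⟨one_ne_zero, ?_, by simp, (hX x hx).2⟩
      simpa [affPt_one] using (hX x hx).1) (by
      intro v hv w hw hvw
      obtain ⟨x, hx, rfl⟩ := mem_map.1 (mem_coe.1 hv)
      obtain ⟨y, hy, rfl⟩ := mem_map.1 (mem_coe.1 hw)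
      congr 1
      have h1 : (fun i => (x i : ℚ)) = fun i => (y i : ℚ) := by
        simpa [affPt_one] using hvw
      funext i
      exact_mod_cast congrFun h1 i) P hP1 (by ring) hsize (by
      rw [← hcc]; linarith)
  rw [Finset.card_map] at h
  have h' : (X.card : ℝ) ≤ 2 * ((s - 1) * (2 * δ * (K * P))) + 2 * δ * δ + δ * (s * (m + s * (2 * δ))) := by
    have h2 : ((2 * m + 1 - 1 : ℕ) : ℝ) = s - 1 := by rw [hs]; push_cast; simp
    have h3 : (X.card : ℝ) ≤ _ := cast_le.2 h
    push_cast [h2] at h3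
    simpa [hs] using h3
  refine h'.trans ?_
  have hL : (δ : ℝ) * δ ≤ 2 * (δ * (δ * log B)) := by nlinarith [mul_pos (show (0:ℝ) < δ by linarith) (show (0:ℝ) < δ by linarith)]
  set L : ℝ := δ * log B with hLdef
  have hL0 : 0 ≤ L := by positivity
  have hs0 : (0 : ℝ) ≤ s - 1 := by linarith
  have hP2 : (P : ℝ) ≤ (s + 1 + 2 * cc) * ((B : ℝ) ^ θ + L) := by
    have e1 : Y = s * (B : ℝ) ^ θ + 2 * cc * L := by rw [hY, hLdef]; ring
    have e2 : 0 ≤ (s : ℝ) * L := by positivity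
    have e3 : 0 ≤ (cc : ℝ) * (B : ℝ) ^ θ := by positivity
    have e4 : ((s : ℝ) + 1 + 2 * cc) * ((B : ℝ) ^ θ + L) = s * (B : ℝ) ^ θ + (B : ℝ) ^ θ +
      2 * (cc * (B : ℝ) ^ θ) + s * L + L + 2 * cc * L := by ring
    rw [e4]
    linarith
  have t1 : 2 * (((s : ℝ) - 1) * (2 * δ * (K * P))) ≤
      4 * (s - 1) * K * (s + 1 + 2 * cc) * (δ * ((B : ℝ) ^ θ + L)) := by
    have := mul_le_mul_of_nonneg_left hP2 (show 0 ≤ 4 * ((s : ℝ) - 1) * K * δ by positivity)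
    calc _ = 4 * ((s : ℝ) - 1) * K * δ * P := by ring
      _ ≤ _ := this
      _ = _ := by ring
  have hm0 : (0 : ℝ) ≤ s * m := by positivity
  have t2 : (δ : ℝ) * (s * m) ≤ s * m * (δ * ((B : ℝ) ^ θ + L)) := by
    have : (δ : ℝ) * 1 ≤ δ * ((B : ℝ) ^ θ + L) := mul_le_mul_of_nonneg_left (by linarith) (by positivity)
    calc _ = s * m * (δ * 1 : ℝ) := by ring
      _ ≤ _ := mul_le_mul_of_nonneg_left this hm0
  have t3 : (δ : ℝ) * L ≤ δ * ((B : ℝ) ^ θ + L) := mul_le_mul_of_nonneg_left (by linarith) (by positivity)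
  have hss : (0 : ℝ) ≤ s * s := by positivity
  have t4 : (s : ℝ) * s * (δ * δ) ≤ s * s * (2 * (δ * ((B : ℝ) ^ θ + L))) :=
    mul_le_mul_of_nonneg_left (by linarith) hss
  have e5 : (4 * ((s : ℝ) - 1) * K * (s + 1 + 2 * cc) + 4 + s * m + 4 * s * s) * δ * ((B : ℝ) ^ θ + L) =
      4 * (s - 1) * K * (s + 1 + 2 * cc) * (δ * ((B : ℝ) ^ θ + L)) + 4 * (δ * ((B : ℝ) ^ θ + L)) +
      s * m * (δ * ((B : ℝ) ^ θ + L)) + 2 * (s * s * (2 * (δ * ((B : ℝ) ^ θ + L)))) := by ring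
  have e6 : (δ : ℝ) * (s * (m + s * (2 * δ))) = δ * (s * m) + 2 * (s * s * (δ * δ)) := by ring
  rw [e5, e6]
  linarith

lemma card_le_mul_totalDegree_of_factors {σ ι : Type*} [Finite σ] (pt : ι → σ → K) (c : ℝ) {G :
    MvPolynomial σ K} (hG : G ≠ 0) (X : Finset ι) (hX : ∀ x ∈ X, eval (pt x) G = 0) (h : ∀ φ,
    Irreducible φ → φ ∣ G → ∀ Y ⊆ X, (∀ x ∈ Y, eval (pt x) φ = 0) → (Y.card : ℝ) ≤ c *
    φ.totalDegree) : (X.card : ℝ) ≤ c * G.totalDegree := by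
  classical
  induction G using WfDvdMonoid.induction_on_irreducible generalizing X with
  | zero => exact absurd rfl hG
  | unit u hu =>
    have : X = ∅ := by
      refine Finset.eq_empty_of_forall_notMem fun x hx => ?_
      have := hX x hx
      exact (hu.map (eval (pt x))).ne_zero this
    subst this
    rw [MvPolynomial.isUnit_iff_totalDegree_of_isReduced.1 hu |>.2]
    simp
  | mul a φ ha hφ ih =>
    have h1 : (X.filter fun x => eval (pt x) φ = 0).card ≤ c * φ.totalDegree :=
      h φ hφ (dvd_mul_right _ _) _ (filter_subset _ _) (by simp)
    have h2 : (X.filter fun x => ¬ eval (pt x) φ = 0).card ≤ c * a.totalDegree := by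
      refine ih ha _ (fun x hx => ?_) fun ψ hψ hd Y hY hY' =>
        h ψ hψ (hd.mul_left _) Y (hY.trans (filter_subset _ _)) hY'
      rw [mem_filter] at hx
      have := hX x hx.1
      rw [map_mul] at this
      exact (mul_eq_zero.1 this).resolve_left hx.2
    rw [totalDegree_mul_of_isDomain hφ.ne_zero ha, ← card_filter_add_card_filter_not
      (fun x => eval (pt x) φ = 0)]
    push_cast
    linarith

lemma homogeneousComponent_totalDegree_ne_zero
    {f : MP n R} (hf : f ≠ 0) : homogeneousComponent f.totalDegree f ≠ 0 := by
  obtain ⟨α, hα, h⟩ := Finset.exists_mem_eq_sup _ (support_nonempty.2 hf) fun s => s.sum fun _ e => e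
  intro h0
  have := congrArg (coeff α) h0
  rw [coeff_homogeneousComponent, if_pos, coeff_zero] at this
  · exact mem_support_iff.1 hα this
  · rw [totalDegree, h]
    rfl

lemma eq_of_degreeOf_le_one {δ : ℕ} (hδ : 1 ≤ δ) {F : MP 2 K} (hF : F.IsHomogeneous δ) (h :
    F.degreeOf 1 ≤ 1) (t : K) : eval ![t, 1] F = t ^ (δ - 1) * (coeff (single 0 δ) F * t + coeff
    (single 0 (δ - 1) + single 1 1) F) := by
  classical
  have hne : (single 0 δ : Fin 2 →₀ ℕ) ≠ single 0 (δ - 1) + single 1 1 := by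
    intro h
    simpa using dcongr h 1
  rw [eval_eq']
  have hsub : F.support ⊆
      {single 0 δ, single 0 (δ - 1) + single 1 1} := by
    intro α hα
    have h1 := hF (mem_support_iff.1 hα)
    have h2 := degreeOf_le_iff.1 h α hα
    rw [weight_apply, sum_fintype _ _ (by simp)] at h1
    simp only [sum_univ_two, Pi.one_apply, smul_eq_mul, mul_one] at h1
    simp only [Finset.mem_insert, mem_singleton]
    rcases Nat.le_one_iff_eq_zero_or_eq_one.1 h2 with h2 | h2
    · left
      ext i; fin_cases i <;> simp <;> omega
    · right
      ext i; fin_cases i <;> simp <;> omega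
  rw [sum_subset hsub (fun α _ hα => by rw [notMem_support_iff.1 hα, zero_mul]),
    Finset.sum_pair hne]
  obtain ⟨k, rfl⟩ := Nat.exists_eq_add_of_le' hδ
  simp [Fin.prod_univ_two, pow_succ]
  ring

lemma eq_zero_of_degreeOf_le_one {δ : ℕ} {F : MP 2 K}
    (hF : F.IsHomogeneous δ) (h : F.degreeOf 1 ≤ 1) (h0 : coeff (single 0 δ) F = 0)
    (h1 : coeff (single 0 (δ - 1) + single 1 1) F = 0) : F = 0 := by
  ext α
  rw [coeff_zero]
  by_contra hα
  have hw := hF hα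
  have h2 := degreeOf_le_iff.1 h α (mem_support_iff.2 hα)
  rw [weight_apply, sum_fintype _ _ (by simp)] at hw
  simp only [sum_univ_two, Pi.one_apply, smul_eq_mul, mul_one] at hw
  rcases Nat.le_one_iff_eq_zero_or_eq_one.1 h2 with h2 | h2
  · refine hα ?_
    convert h0 using 2
    ext i; fin_cases i <;> simp <;> omega
  · refine hα ?_
    convert h1 using 2
    ext i; fin_cases i <;> simp <;> omega

theorem affine_curve : ∃ C : ℝ, 0 ≤ C ∧ ∀ (φ : MP 2 ℚ) (_ : Irreducible φ) (_ : 2 ≤ φ.totalDegree)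
    (B : ℕ) (_ : 2 ≤ B) (X : Finset (Fin 2 → ℤ)) (_ : ∀ x ∈ X, evQ x φ = 0 ∧ ∀ i, |x i| ≤ B),
    (X.card : ℝ) ≤ C * φ.totalDegree * ((B : ℝ) ^ (51 / 100 : ℝ) + φ.totalDegree * log B) := by
  classical
  obtain ⟨C, hC, h⟩ := affine_curve_aux 50 (by norm_num) (51 / 100) (by norm_num)
  refine ⟨3 * C, by positivity, fun φ hφ hdeg B hB X hX => ?_⟩
  have hB2 : (2 : ℝ) ≤ B := mod_cast hB
  have hlog : 0 ≤ log B := log_nonneg (by linarith)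
  by_cases hy : 2 ≤ φ.degreeOf 1
  · refine (h φ hφ hy B hB X hX).trans ?_
    have : 0 ≤ C * φ.totalDegree * ((B : ℝ) ^ (51 / 100 : ℝ) + φ.totalDegree * log B) := by
      positivity
    linarith
  set δ := φ.totalDegree with hδ
  obtain ⟨t, ht2, ht⟩ : ∃ t : ℕ, t ≤ 2 ∧ eval ![(t : ℚ), 1] (homogeneousComponent δ φ) ≠ 0 := by
    have hF := homogeneousComponent_isHomogeneous δ φ
    have hF0 : homogeneousComponent δ φ ≠ 0 := homogeneousComponent_totalDegree_ne_zero hφ.ne_zero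
    have hFd : (homogeneousComponent δ φ).degreeOf 1 ≤ 1 := by
      rw [degreeOf_le_iff]
      intro α hα
      have : α ∈ φ.support := by
        rw [mem_support_iff, coeff_homogeneousComponent] at hα
        rw [mem_support_iff]
        intro h0
        simp [h0] at hα
      exact (degreeOf_le_iff.1 le_rfl α this).trans (by omega)
    by_contra! hcon
    have h1 := hcon 1 (by norm_num)
    have h2 := hcon 2 (by norm_num)
    rw [eq_of_degreeOf_le_one (by omega) hF hFd] at h1 h2
    have h1' := (mul_eq_zero.1 h1).resolve_left (by positivity)
    have h2' := (mul_eq_zero.1 h2).resolve_left (by positivity)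
    push_cast at h1' h2'
    exact hF0 (eq_zero_of_degreeOf_le_one hF hFd (by linarith) (by linarith))
  set v : Fin 2 → ℚ := ![(t : ℚ), 0] with hv
  have hv0 : v 1 = 0 := rfl
  have hinv := shearMat_mul 1 v hv0
  set ψ := linSub (shearMat 1 v) φ with hψ
  have hψdeg : ψ.totalDegree = δ := totalDegree_linSub hinv φ
  have hcoe : coeff (single 1 δ) ψ ≠ 0 := by
    rw [hψ, coeff_single_shear]
    have : (fun i => (Pi.single 1 1 : Fin 2 → ℚ) i + v i) = ![(t : ℚ), 1] := by
      funext i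
      fin_cases i <;> simp [hv]
    rw [this]
    exact ht
  have hψ1 : 2 ≤ ψ.degreeOf 1 := by
    have := degreeOf_le_iff.1 (le_refl (ψ.degreeOf 1)) _ (mem_support_iff.2 hcoe)
    simp at this
    omega
  set e : (Fin 2 → ℤ) → (Fin 2 → ℤ) := fun x => ![x 0 - t * x 1, x 1] with he
  have hinj : Injective e := by
    intro x y hxy
    have h0 := congrFun hxy 0
    have h1 := congrFun hxy 1
    simp only [he, cons_val_zero, cons_val_one] at h0 h1
    funext i
    fin_cases i
    · simpa [h1] using h0
    · exact h1
  have hmain := h ψ (irreducible_linSub hinv hφ) hψ1 (3 * B) (by omega) (X.image e) (by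
    intro y hy'
    obtain ⟨x, hx, rfl⟩ := mem_image.1 hy'
    obtain ⟨hx0, hxB⟩ := hX x hx
    constructor
    · rw [hψ, eval_linSub, shearMat_mulVec]
      have : (fun i => (e x i : ℚ) + v i * (e x 1 : ℚ)) = fun i => (x i : ℚ) := by
        funext i
        fin_cases i <;> simp [he, hv]
      rw [this]
      exact hx0
    · have ha := abs_le.1 (hxB 0)
      have hb := abs_le.1 (hxB 1)
      have ht' : (t : ℤ) = 0 ∨ (t : ℤ) = 1 ∨ (t : ℤ) = 2 := by omega
      have h0 : |x 0 - t * x 1| ≤ 3 * B := by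
        rw [abs_le]
        rcases ht' with ht' | ht' | ht' <;> rw [ht'] <;> constructor <;> linarith
      have h1 : |x 1| ≤ 3 * B := by
        rw [abs_le]
        constructor <;> linarith
      intro i
      fin_cases i
      · simpa [he] using h0
      · simpa [he] using h1)
  rw [card_image_of_injective _ hinj, hψdeg] at hmain
  refine hmain.trans ?_
  have h3 : ((3 * B : ℕ) : ℝ) ^ (51 / 100 : ℝ) ≤ 3 * (B : ℝ) ^ (51 / 100 : ℝ) := by
    push_cast
    rw [mul_rpow (by norm_num) (by linarith)]
    gcongr
    calc (3 : ℝ) ^ (51 / 100 : ℝ) ≤ 3 ^ (1 : ℝ) :=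
          Real.rpow_le_rpow_of_exponent_le (by norm_num) (by norm_num)
      _ = 3 := rpow_one 3
  have h4 : log ((3 * B : ℕ) : ℝ) ≤ 3 * log B := by
    rw [← Real.log_rpow (by linarith) 3] 
    apply log_le_log (by positivity)
    push_cast
    norm_num
    nlinarith [mul_nonneg (sub_nonneg.2 hB2) (sub_nonneg.2 hB2)]
  calc C * δ * (((3 * B : ℕ) : ℝ) ^ (51 / 100 : ℝ) + δ * log ((3 * B : ℕ) : ℝ))
      ≤ C * δ * (3 * (B : ℝ) ^ (51 / 100 : ℝ) + δ * (3 * log B)) := by gcongr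
    _ = _ := by ring

lemma eval_mul_of_isHomogeneous {K : Type*} [CommRing K] {F : MP n K} (hF : F.IsHomogeneous d) (c :
    K) (x : Fin n → K) : eval (fun i => c * x i) F = c ^ d * eval x F := by
  rw [eval_eq', eval_eq', mul_sum]
  refine sum_congr rfl fun α hα => ?_
  have h := hF (mem_support_iff.1 hα)
  rw [weight_apply, sum_fintype _ _ (by simp)] at h
  simp only [Pi.one_apply, smul_eq_mul, mul_one] at h
  simp only [mul_pow, prod_mul_distrib, prod_pow_eq_pow_sum, h]
  ring

/-- Setting the first variable equal to `1`. -/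
noncomputable def dehom {K : Type*} [CommRing K] : MP (n + 1) K →ₐ[K] MP n K := aeval (Fin.cons 1 X)

lemma eval_dehom {K : Type*} [CommRing K] (x : Fin n → K) (F : MP (n + 1) K) :
    eval x (dehom F) = eval (Fin.cons 1 x : Fin (n + 1) → K) F := by
  rw [dehom, eval_aeval]
  congr 2
  funext i
  refine Fin.cases ?_ (fun j => ?_) i <;> simp

lemma totalDegree_dehom_le {K : Type*} [CommRing K] (F : MP (n + 1) K) :
    (dehom F).totalDegree ≤ F.totalDegree := by
  refine (totalDegree_aeval_le _ 1 (fun i => ?_) F).trans (one_mul _).le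
  refine Fin.cases ?_ (fun j => ?_) i
  · simp
  · rw [cons_succ]
    exact (isHomogeneous_X K j).totalDegree_le

lemma exists_homogenization {N : ℕ} {K : Type*} [CommRing K] (p : MP n K) (hp : p.totalDegree ≤ N) :
    ∃ P : MP (n + 1) K, P.IsHomogeneous N ∧ dehom P = p := by
  refine ⟨∑ α ∈ p.support, C (coeff α p) * (X 0 ^ (N - ∑ i, α i) * ∏ i, X (Fin.succ i) ^ α i), ?_, ?_⟩
  · refine IsHomogeneous.sum _ _ _ fun α hα => ?_
    have h1 : ∑ i, α i ≤ N := mem_monoms.1 (totalDegree_le_iff.1 hp hα)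
    refine IsHomogeneous.C_mul ?_ _
    have := (isHomogeneous_X_pow (R := K) (0 : Fin (n + 1)) (N - ∑ i, α i)).mul
      (IsHomogeneous.prod univ (fun i => X (R := K) (Fin.succ i) ^ α i) (fun i => α i)
        fun i _ => isHomogeneous_X_pow _ _)
    rwa [Nat.sub_add_cancel h1] at this
  · conv_rhs => rw [as_sum p]
    rw [map_sum]
    refine sum_congr rfl fun α _ => ?_
    simp only [dehom, map_mul, algHom_C, algebraMap_eq, map_pow, aeval_X, Fin.cons_zero, one_pow,
      one_mul, map_prod, cons_succ]
    rw [monomial_eq, prod_fintype _ _ (by simp)]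

lemma eq_of_dehom_eq [Infinite K] {F G : MP (n + 1) K}
    (hF : F.IsHomogeneous d) (hG : G.IsHomogeneous d) (h : dehom F = dehom G) : F = G := by
  have h0 : X 0 * (F - G) = 0 := by
    refine MvPolynomial.funext fun x => ?_
    rw [map_mul, map_zero, eval_X]
    by_cases hx : x 0 = 0
    · rw [hx, zero_mul]
    · have hx' : x = fun i => x 0 * (Fin.cons 1 (fun j => (x 0)⁻¹ * x (Fin.succ j)) :
          Fin (n + 1) → K) i := by
        funext i
        refine Fin.cases ?_ (fun j => ?_) i
        · simp
        · simp [mul_inv_cancel_left₀ hx]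
      rw [map_sub, hx', eval_mul_of_isHomogeneous hF, eval_mul_of_isHomogeneous hG, ← eval_dehom,
        ← eval_dehom, h]
      simp
  exact sub_eq_zero.1 ((mul_eq_zero.1 h0).resolve_left (X_ne_zero _))

lemma RIrreducible.linSub {r : ℕ} {M N : Matrix (Fin n) (Fin n) K} (h : M * N = 1) {F : MP n K} (hF
    : RIrreducible r F) : RIrreducible r (linSub M F) := by
  intro g hg hgr
  have h1 : _root_.linSub N g ∣ F := by
    have := map_dvd (_root_.linSub N) hg
    rwa [linSub_linSub_of_mul h] at this
  have h2 := hF _ h1 ((totalDegree_linSub_le _ _).trans hgr)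
  have h3 := h2.map (_root_.linSub M)
  rwa [linSub_linSub_of_mul (mul_eq_one_comm.1 h)] at h3

lemma lt_totalDegree_of_dvd_dehom {r : ℕ} [Infinite K] {F : MP (n + 1) K} (hF : F.IsHomogeneous d)
    (hr : RIrreducible r F) {ψ : MP n K} (hψ : ¬ IsUnit ψ) (hdvd : ψ ∣ dehom F) (h0 : dehom F ≠ 0) :
    r < ψ.totalDegree := by
  by_contra hcon
  push Not at hcon
  obtain ⟨χ, hχ⟩ := hdvd
  have hψ0 : ψ ≠ 0 := by rintro rfl; exact h0 (by rw [hχ, zero_mul])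
  have hχ0 : χ ≠ 0 := by rintro rfl; exact h0 (by rw [hχ, mul_zero])
  have hdeg := totalDegree_mul_of_isDomain hψ0 hχ0
  have hle := (totalDegree_dehom_le F).trans hF.totalDegree_le
  rw [hχ, hdeg] at hle
  obtain ⟨P, hP, hPψ⟩ := exists_homogenization ψ le_rfl
  obtain ⟨Q, hQ, hQχ⟩ := exists_homogenization χ (N := d - ψ.totalDegree) (by omega)
  have hPQ : F = P * Q := by
    refine eq_of_dehom_eq hF (d := d) ?_ ?_
    · have := hP.mul hQ
      rwa [Nat.add_sub_cancel' (by omega)] at this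
    · rw [map_mul, hPψ, hQχ, hχ]
  have hu := hr P ⟨Q, hPQ⟩ (hP.totalDegree_le.trans hcon)
  refine hψ ?_
  rw [← hPψ]
  exact hu.map dehom

lemma coeff_dehom {K : Type*} [CommRing K] {F : MP 3 K} (hF : F.IsHomogeneous d) : coeff (single 1
    d) (dehom F) = coeff (single 2 d) F := by
  classical
  have hmon : ∀ (α : Fin 3 →₀ ℕ) (c : K), dehom (monomial α c) =
      monomial (single 0 (α 1) + single 1 (α 2)) c := by
    intro α c
    rw [dehom, aeval_monomial, prod_fintype _ _ (by simp), prod_univ_three]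
    simp only [algebraMap_eq, Fin.cons_zero, one_pow, one_mul]
    rw [show (1 : Fin 3) = Fin.succ 0 from rfl, show (2 : Fin 3) = Fin.succ 1 from rfl, cons_succ,
      cons_succ, X_pow_eq_monomial, X_pow_eq_monomial, monomial_mul, C_mul_monomial]
    simp
  conv_lhs => rw [as_sum F, map_sum, coeff_sum]
  rw [sum_eq_single (single 2 d)]
  · rw [hmon]
    simp
  · intro α hα hne
    rw [hmon, coeff_monomial, if_neg]
    intro h
    have h0 := dcongr h 0
    have h1 := dcongr h 1
    have hw := hF (mem_support_iff.1 hα)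
    rw [weight_apply, sum_fintype _ _ (by simp)] at hw
    simp only [Fin.sum_univ_three, Pi.one_apply, smul_eq_mul, mul_one] at hw
    simp at h0 h1
    refine hne ?_
    ext i
    fin_cases i <;> simp <;> omega
  · intro h
    rw [notMem_support_iff.1 h]
    simp

/-- The exponents of the monomials of degree at most two in two variables. -/
noncomputable def quadraticExponents (i : Fin 6) : Fin 2 →₀ ℕ :=
  single 0 (![0, 1, 0, 2, 1, 0] i) + single 1 (![0, 0, 1, 0, 1, 2] i)

lemma quadraticExponents_injective : Injective quadraticExponents := by
  intro i j h
  have h0 := dcongr h 0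
  have h1 := dcongr h 1
  simp [quadraticExponents] at h0 h1
  clear h
  revert i j
  decide

lemma card_rational_points_le : ∃ C : ℝ, 0 ≤ C ∧ ∀ (φ : MP 2 ℚ) (_ : Irreducible φ) (_ : 3 ≤
    φ.degreeOf 1) (H : ℕ) (_ : 2 ≤ H) (X : Finset (ℤ × (Fin 2 → ℤ))) (_ : ∀ v ∈ X, v.1 ≠ 0 ∧ eval
    (affPt v) φ = 0 ∧ |v.1| ≤ H ∧ ∀ i, |v.2 i| ≤ H) (_ : InjOn affPt (X : Set (ℤ × (Fin 2 → ℤ)))),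
    (X.card : ℝ) ≤ C * φ.totalDegree * ((H : ℝ) ^ (4 / 5 : ℝ) + φ.totalDegree * log H) := by
  obtain ⟨K, hK, hmain⟩ := card_curve_points_le
  set cc := curveConst 6 2 with hcc
  refine ⟨20 * K * (3 + 2 * cc) + 4 + 12 + 144, by positivity, ?_⟩
  intro φ hφ hdeg H hH X hX hinj
  set δ := φ.totalDegree with hδ
  have hδ3 : 3 ≤ δ := hdeg.trans (degreeOf_le_totalDegree _ _)
  have hHr : (2 : ℝ) ≤ H := mod_cast hH
  have hlog : 1 / 2 ≤ log H := by
    have h1 := log_two_gt_d9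
    have h2 : log 2 ≤ log H := log_le_log (by norm_num) hHr
    linarith
  have hHθ : 1 ≤ (H : ℝ) ^ (4 / 5 : ℝ) := one_le_rpow (by linarith) (by norm_num)
  set Y : ℝ := 2 * (H : ℝ) ^ (4 / 5 : ℝ) + 2 * (cc * δ * log H) with hY
  set P := ⌈Y⌉₊ with hP
  have hδr : (3 : ℝ) ≤ δ := mod_cast hδ3
  have hccp : (1 : ℝ) ≤ cc := by
    have : 1 ≤ cc := by rw [hcc, curveConst]; omega
    exact_mod_cast this
  have hpos : 0 < 2 * (cc * δ * log H) := by positivity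
  have hYP : Y ≤ P := le_ceil Y
  have hP1 : 1 ≤ P := by
    have : (1 : ℝ) ≤ P := by linarith
    exact_mod_cast this
  have hPY : (P : ℝ) ≤ Y + 1 := (Nat.ceil_lt_add_one (by linarith)).le
  have hsize : (6 : ℕ).factorial * ∏ i, H ^ (2 - ∑ k, quadraticExponents i k) *
      H ^ (∑ k, quadraticExponents i k) < P ^ 15 := by
    have e1 : (6 : ℕ).factorial * ∏ i, H ^ (2 - ∑ k, quadraticExponents i k) *
      H ^ (∑ k, quadraticExponents i k) = 720 * H ^ 12 := by
      simp [Fin.prod_univ_six, quadraticExponents, Nat.factorial]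
      ring
    rw [e1]
    have h1 : (720 : ℝ) * (H : ℝ) ^ 12 < (2 * (H : ℝ) ^ (4 / 5 : ℝ)) ^ 15 := by
      rw [mul_pow, ← rpow_natCast ((H : ℝ) ^ (4 / 5 : ℝ)), ← rpow_mul (by positivity)]
      norm_num
      rw [← rpow_natCast]
      have : (0 : ℝ) < (H : ℝ) ^ (12 : ℝ) := by positivity
      norm_num at this ⊢
      linarith
    have h2 : (2 * (H : ℝ) ^ (4 / 5 : ℝ)) ^ 15 ≤ (P : ℝ) ^ 15 :=
      pow_le_pow_left₀ (by positivity) (by linarith) _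
    exact_mod_cast h1.trans_le h2
  have h := hmain (t := 15) (δ := δ) quadraticExponents (e := 2) (fun i => by
      fin_cases i <;> simp [quadraticExponents]) φ hφ rfl (by omega)
    (pderiv_ne_zero_of_degreeOf 1 (by omega)) (fun c hc =>
      eq_zero_of_dvd_sum_monomial quadraticExponents_injective (fun i => hdeg.trans_lt' (by
        fin_cases i <;> simp [quadraticExponents])) c hc)
    H H le_rfl hH X hX hinj P hP1 (by norm_num) hsize (by linarith)
  have h' : (X.card : ℝ) ≤ 2 * (5 * (2 * δ * (K * P))) + 2 * δ * δ + δ * (6 * (2 + 6 * (2 * δ))) := by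
    exact_mod_cast h
  refine h'.trans ?_
  have hX1 : 0 ≤ (H : ℝ) ^ (4 / 5 : ℝ) := by linarith
  set Z := (H : ℝ) ^ (4 / 5 : ℝ) with hZ
  set l := log H with hl
  have hPle : (P : ℝ) ≤ (3 + 2 * cc) * (Z + δ * l) := by
    have : 0 ≤ (3 : ℝ) * (δ * l) := by positivity
    have : 0 ≤ (cc : ℝ) * Z := by positivity
    have e : (3 + 2 * (cc : ℝ)) * (Z + δ * l) = 3 * Z + 3 * (δ * l) + 2 * (cc * Z) + 2 * (cc * δ * l) := by
      ring
    rw [e]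
    linarith
  have hδl : (δ : ℝ) ≤ 2 * (Z + δ * l) := by
    have : (δ : ℝ) * (1 / 2) ≤ δ * l := by gcongr
    linarith
  calc 2 * (5 * (2 * (δ : ℝ) * (K * P))) + 2 * δ * δ + δ * (6 * (2 + 6 * (2 * δ)))
      = 20 * K * δ * P + (2 * δ + 72 * δ) * δ + 12 * δ * 1 := by ring
    _ ≤ 20 * K * δ * ((3 + 2 * cc) * (Z + δ * l)) + (2 * δ + 72 * δ) * (2 * (Z + δ * l)) +
        12 * δ * (Z + δ * l) := by
        gcongr
        have : 0 ≤ (δ : ℝ) * l := by positivity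
        linarith
    _ ≤ _ := by
        have : 0 ≤ (δ : ℝ) * (Z + δ * l) := by positivity
        have e : (20 * K * (3 + 2 * cc) + 4 + 12 + 144) * δ * (Z + δ * l) =
          20 * K * δ * ((3 + 2 * cc) * (Z + δ * l)) + 160 * (δ * (Z + δ * l)) := by ring
        rw [e]
        linarith

/-- No two distinct members of the set are proportional. -/
def NonProportional {n : ℕ} (V : Finset (Fin n → ℤ)) : Prop :=
  ∀ v ∈ V, ∀ w ∈ V, ∀ a b : ℤ, a ≠ 0 → b ≠ 0 → (∀ i, a * v i = b * w i) → v = w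

lemma card_chart_le : ∃ C : ℝ, 0 ≤ C ∧ ∀ (d : ℕ) (F : MP 3 ℚ) (_ : F.IsHomogeneous d) (_ : 1 ≤ d) (_
    : coeff (single 2 d) F ≠ 0) (_ : RIrreducible 2 F) (H : ℕ) (_ : 2 ≤ H) (V : Finset (Fin 3 → ℤ))
    (_ : NonProportional V) (_ : ∀ v ∈ V, v 0 ≠ 0 ∧ evQ v F = 0 ∧ ∀ i, |v i| ≤ H), (V.card : ℝ) ≤ C
    * d * ((H : ℝ) ^ (4 / 5 : ℝ) + d * log H) := by
  classical
  obtain ⟨C, hC, hmain⟩ := card_rational_points_le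
  refine ⟨C, hC, fun d F hF hd hcoe hr H hH V hV hVF => ?_⟩
  have hHr : (2 : ℝ) ≤ H := mod_cast hH
  have hlog : 0 ≤ log H := log_nonneg (by linarith)
  set q := dehom F with hq
  have hqd : q.totalDegree ≤ d := (totalDegree_dehom_le F).trans hF.totalDegree_le
  have hqc : coeff (single 1 d) q ≠ 0 := by rwa [hq, coeff_dehom hF]
  have hq0 : q ≠ 0 := by rintro h; rw [h] at hqc; exact hqc (coeff_zero _)
  have hq1 : d ≤ q.degreeOf 1 := by
    have := degreeOf_le_iff.1 (le_refl (q.degreeOf 1)) _ (mem_support_iff.2 hqc)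
    simpa using this
  set pr : (Fin 3 → ℤ) → ℤ × (Fin 2 → ℤ) := fun v => (v 0, tail v) with hpr
  have hpt : ∀ v : Fin 3 → ℤ, v 0 ≠ 0 → evQ v F = 0 → eval (affPt (pr v)) q = 0 := by
    intro v hv0 hvF
    have hv0' : (v 0 : ℚ) ≠ 0 := mod_cast hv0
    rw [hq, eval_dehom]
    have e : (Fin.cons 1 (affPt (pr v)) : Fin 3 → ℚ) = fun i => (v 0 : ℚ)⁻¹ * (v i : ℚ) := by
      funext i
      refine Fin.cases ?_ (fun j => ?_) i
      · simp [hv0']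
      · simp [affPt, hpr, tail]
    rw [e, eval_mul_of_isHomogeneous hF, hvF, mul_zero]
  have hprinj : Injective pr := by
    intro v w h
    have h1 := (Prod.ext_iff.1 h).1
    have h2 := (Prod.ext_iff.1 h).2
    rw [← Fin.cons_self_tail v, ← Fin.cons_self_tail w]
    simp only [hpr] at h1 h2
    rw [h1, h2]
  have hinj : InjOn affPt (V.image pr : Set (ℤ × (Fin 2 → ℤ))) := by
    intro x hx y hy hxy
    rw [mem_coe, mem_image] at hx hy
    obtain ⟨v, hv, rfl⟩ := hx
    obtain ⟨w, hw, rfl⟩ := hy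
    have hv0 : (v 0 : ℚ) ≠ 0 := mod_cast (hVF v hv).1
    have hw0 : (w 0 : ℚ) ≠ 0 := mod_cast (hVF w hw).1
    rw [hV v hv w hw (w 0) (v 0) (hVF w hw).1 (hVF v hv).1 ?_]
    intro i
    refine Fin.cases (mul_comm _ _) (fun j => ?_) i
    have := congrFun hxy j
    simp only [affPt, hpr, tail] at this
    field_simp at this
    have h' : (w 0 : ℚ) * v j.succ = v 0 * w j.succ := by linarith
    exact_mod_cast h'
  have key := card_le_mul_totalDegree_of_factors (pt := affPt)
    (C * ((H : ℝ) ^ (4 / 5 : ℝ) + d * log H)) hq0 (V.image pr) (by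
      intro x hx
      obtain ⟨v, hv, rfl⟩ := mem_image.1 hx
      exact hpt v (hVF v hv).1 (hVF v hv).2.1) (by
      intro ψ hψ hψq Y hY hYψ
      obtain ⟨χ, hχ⟩ := hψq
      have hχ0 : χ ≠ 0 := by rintro rfl; exact hq0 (by rw [hχ, mul_zero])
      have h1 : q.degreeOf 1 = ψ.degreeOf 1 + χ.degreeOf 1 := by
        rw [hχ, degreeOf_mul_eq hψ.ne_zero hχ0]
      have h2 : q.totalDegree = ψ.totalDegree + χ.totalDegree := by
        rw [hχ, totalDegree_mul_of_isDomain hψ.ne_zero hχ0]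
      have h3 := degreeOf_le_totalDegree χ 1
      have h4 := lt_totalDegree_of_dvd_dehom hF hr hψ.not_isUnit ⟨χ, hχ⟩ hq0
      have hle : ψ.totalDegree ≤ d := by omega
      refine (hmain ψ hψ (by omega) H hH Y (fun x hx => ?_) (hinj.mono (mod_cast hY))).trans ?_
      · obtain ⟨v, hv, rfl⟩ := mem_image.1 (hY hx)
        exact ⟨(hVF v hv).1, hYψ _ hx, (hVF v hv).2.2 0, fun i => (hVF v hv).2.2 _⟩
      · have : (ψ.totalDegree : ℝ) ≤ d := mod_cast hle
        calc C * ψ.totalDegree * ((H : ℝ) ^ (4 / 5 : ℝ) + ψ.totalDegree * log H)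
            ≤ C * ψ.totalDegree * ((H : ℝ) ^ (4 / 5 : ℝ) + d * log H) := by gcongr
          _ = _ := by ring)
  rw [card_image_of_injective _ hprinj] at key
  refine key.trans ?_
  have : (q.totalDegree : ℝ) ≤ d := mod_cast hqd
  calc C * ((H : ℝ) ^ (4 / 5 : ℝ) + d * log H) * q.totalDegree
      ≤ C * ((H : ℝ) ^ (4 / 5 : ℝ) + d * log H) * d := by gcongr
    _ = _ := by ring

theorem card_points_at_infinity_le : ∃ C : ℝ, 0 ≤ C ∧ ∀ (d : ℕ) (F : MP 3 ℚ) (_ : F.IsHomogeneous d)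
    (_ : 1 ≤ d) (_ : F ≠ 0) (_ : RIrreducible 2 F) (H : ℕ) (_ : 1 ≤ H) (V : Finset (Fin 3 → ℤ)) (_ :
    NonProportional V) (_ : ∀ v ∈ V, v ≠ 0 ∧ evQ v F = 0 ∧ ∀ i, |v i| ≤ H), (V.card : ℝ) ≤ C * (d :
    ℝ) ^ (5 / 2 : ℝ) * (H : ℝ) ^ (4 / 5 : ℝ) := by
  classical
  obtain ⟨C, hC, hmain⟩ := card_chart_le
  refine ⟨14 * C, by positivity, fun d F hF hd hF0 hr H hH V hV hVF => ?_⟩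
  obtain ⟨v₀, hv₀2, hv₀d, hv₀⟩ := exists_eval_ne_zero_of_isHomogeneous 2 hF hF0
  set u : Fin 3 → ℚ := fun i => v₀ i with hu
  have hu2 : u 2 = 0 := by simp [hu, hv₀2]
  have hinv := shearMat_mul 2 u hu2
  set G := linSub (shearMat 2 u) F with hG
  have hGh : G.IsHomogeneous d := isHomogeneous_linSub _ hF
  have hGr : RIrreducible 2 G := hr.linSub hinv
  have hGc : coeff (single 2 d) G ≠ 0 := by
    rw [hG, coeff_single_shear, homogeneousComponent_of_mem ((mem_homogeneousSubmodule _ _).2 hF), if_pos rfl]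
    exact hv₀
  set e : (Fin 3 → ℤ) → (Fin 3 → ℤ) := fun x i => x i - v₀ i * x 2 with he
  have hev : ∀ x : Fin 3 → ℤ, eval (fun i => (e x i : ℚ)) G = evQ x F := by
    intro x
    rw [hG, eval_linSub, shearMat_mulVec]
    congr 2
    funext i
    simp [he, hu, hv₀2]
  have he2 : ∀ x, e x 2 = x 2 := fun x => by simp [he, hv₀2]
  have hback : ∀ x i, x i = e x i + v₀ i * e x 2 := by
    intro x i
    rw [he2]; simp [he]
  have heinj : Injective e := by
    intro x y hxy
    funext i
    rw [hback x, hback y, hxy]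
  set H' := (d + 1) * H with hH'
  have hH'2 : 2 ≤ H' := by nlinarith
  have hbox : ∀ v ∈ V, ∀ i, |e v i| ≤ H' := by
    intro v hv i
    have h1 := (hVF v hv).2.2 i
    have h2 := (hVF v hv).2.2 2
    have h3 : (v₀ i : ℤ) ≤ d := mod_cast hv₀d i
    calc |e v i| ≤ |v i| + |(v₀ i : ℤ) * v 2| := abs_sub _ _
      _ = |v i| + v₀ i * |v 2| := by rw [abs_mul, abs_cast]
      _ ≤ H + d * H := by gcongr
      _ = H' := by rw [hH']; push_cast; ring
  have hprop : ∀ v ∈ V, ∀ w ∈ V, ∀ a b : ℤ, a ≠ 0 → b ≠ 0 → (∀ i, a * e v i = b * e w i) → v = w := by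
    intro v hv w hw a b ha hb h
    refine hV v hv w hw a b ha hb fun i => ?_
    rw [hback v, hback w, mul_add, mul_add, h i, mul_left_comm, h 2]
    ring
  have bound0 := hmain d G hGh hd hGc hGr H' hH'2 ((V.filter fun v => e v 0 ≠ 0).image e) (by
      intro x hx y hy a b ha hb h
      obtain ⟨v, hv, rfl⟩ := mem_image.1 hx
      obtain ⟨w, hw, rfl⟩ := mem_image.1 hy
      rw [hprop v (mem_filter.1 hv).1 w (mem_filter.1 hw).1 a b ha hb h]) (by
      intro x hx
      obtain ⟨v, hv, rfl⟩ := mem_image.1 hx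
      rw [mem_filter] at hv
      exact ⟨hv.2, by rw [hev]; exact (hVF v hv.1).2.1, hbox v hv.1⟩)
  set M := Matrix.swap ℚ (0 : Fin 3) 1 with hM
  have hMM : M * M = 1 := Matrix.swap_mul_self _ _
  set σ : (Fin 3 → ℤ) → (Fin 3 → ℤ) := fun x => x ∘ Equiv.swap 0 1 with hσ
  have hσinj : Injective σ := by
    intro x y h
    funext i
    have := congrFun h (Equiv.swap 0 1 i)
    simpa [hσ] using this
  have bound1 := hmain d (linSub M G) (isHomogeneous_linSub _ hGh) hd (by
      rw [coeff_single_eq_eval, homogeneousComponent_linSub, eval_linSub, swap_mulVec]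
      rw [coeff_single_eq_eval] at hGc
      convert hGc using 3
      have : (Pi.single 2 1 : Fin 3 → ℚ) ∘ Equiv.swap 0 1 = Pi.single 2 1 := by
        funext i
        fin_cases i <;> simp [Equiv.swap_apply_def]
      rw [this]) (hGr.linSub hMM) H' hH'2 (((V.filter fun v => ¬ e v 0 ≠ 0).image e).image σ) (by
      intro x hx y hy a b ha hb h
      obtain ⟨x', hx', rfl⟩ := mem_image.1 hx
      obtain ⟨v, hv, rfl⟩ := mem_image.1 hx'
      obtain ⟨y', hy', rfl⟩ := mem_image.1 hy
      obtain ⟨w, hw, rfl⟩ := mem_image.1 hy'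
      rw [hprop v (mem_filter.1 hv).1 w (mem_filter.1 hw).1 a b ha hb fun i => by
        simpa [hσ] using h (Equiv.swap 0 1 i)]) (by
      intro x hx
      obtain ⟨x', hx', rfl⟩ := mem_image.1 hx
      obtain ⟨v, hv, rfl⟩ := mem_image.1 hx'
      rw [mem_filter, not_not] at hv
      refine ⟨fun h => ?_, ?_, fun i => hbox v hv.1 _⟩
      · have h1 : e v 1 = 0 := by simpa [hσ] using h
        have h2 : e v 2 ≠ 0 := by
          intro h2
          refine (hVF v hv.1).1 (funext fun i => ?_)
          rw [hback v, h2]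
          fin_cases i <;> simp [hv.2, h1, h2]
        have h3 : eval (fun i => (e v i : ℚ)) G = 0 := by rw [hev]; exact (hVF v hv.1).2.1
        have h4 : (fun i => (e v i : ℚ)) = fun i => (e v 2 : ℚ) * (Pi.single 2 1 : Fin 3 → ℚ) i := by
          funext i
          fin_cases i <;> simp [hv.2, h1]
        rw [h4, eval_mul_of_isHomogeneous hGh] at h3
        rw [coeff_single_eq_eval, homogeneousComponent_of_mem ((mem_homogeneousSubmodule _ _).2 hGh), if_pos rfl] at hGc
        exact mul_ne_zero (pow_ne_zero _ (mod_cast h2)) hGc h3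
      · rw [eval_linSub, swap_mulVec]
        have : (fun i => ((σ (e v) i : ℤ) : ℚ)) ∘ Equiv.swap 0 1 = fun i => (e v i : ℚ) := by
          funext i
          simp [hσ]
        rw [this, hev]
        exact (hVF v hv.1).2.1)
  rw [card_image_of_injective _ hσinj, card_image_of_injective _ heinj] at bound1
  rw [card_image_of_injective _ heinj] at bound0
  have hsum := card_filter_add_card_filter_not (s := V) (fun v => e v 0 ≠ 0)
  have hcard : (V.card : ℝ) ≤ 2 * (C * d * ((H' : ℝ) ^ (4 / 5 : ℝ) + d * log H')) := by
    rw [← hsum]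
    push_cast
    linarith
  refine hcard.trans ?_
  have hdr : (1 : ℝ) ≤ d := mod_cast hd
  have hHr : (1 : ℝ) ≤ H := mod_cast hH
  have hd1 : ((d : ℝ) + 1) ≤ 2 * d := by linarith
  have hHp : 1 ≤ (H : ℝ) ^ (4 / 5 : ℝ) := one_le_rpow hHr (by norm_num)
  have hdp : (1 : ℝ) ≤ (d : ℝ) ^ (1 / 2 : ℝ) := one_le_rpow hdr (by norm_num)
  have h1 : (H' : ℝ) ^ (4 / 5 : ℝ) ≤ 2 * d * (H : ℝ) ^ (4 / 5 : ℝ) := by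
    rw [hH']
    push_cast
    rw [mul_rpow (by positivity) (by positivity)]
    gcongr
    calc ((d : ℝ) + 1) ^ (4 / 5 : ℝ) ≤ (2 * d) ^ (1 : ℝ) :=
          (rpow_le_rpow (by positivity) hd1 (by norm_num)).trans
            (Real.rpow_le_rpow_of_exponent_le (by linarith) (by norm_num))
      _ = 2 * d := rpow_one _
  have h2 : log H' ≤ 5 * (d : ℝ) ^ (1 / 2 : ℝ) * (H : ℝ) ^ (4 / 5 : ℝ) := by
    rw [hH']
    push_cast
    rw [log_mul (by positivity) (by positivity)]
    have a1 := log_le_rpow_div (x := (d : ℝ) + 1) (by positivity) (ε := 1 / 2) (by norm_num)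
    have a2 := log_le_rpow_div (x := (H : ℝ)) (by positivity) (ε := 4 / 5) (by norm_num)
    have a3 : ((d : ℝ) + 1) ^ (1 / 2 : ℝ) ≤ 3 / 2 * (d : ℝ) ^ (1 / 2 : ℝ) := by
      calc ((d : ℝ) + 1) ^ (1 / 2 : ℝ) ≤ ((9 / 4) * d) ^ (1 / 2 : ℝ) :=
            rpow_le_rpow (by positivity) (by linarith) (by norm_num)
        _ = 3 / 2 * (d : ℝ) ^ (1 / 2 : ℝ) := by
            rw [mul_rpow (by norm_num) (by positivity), ← Real.sqrt_eq_rpow,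
              show (9 / 4 : ℝ) = (3 / 2) ^ 2 by norm_num, Real.sqrt_sq (by norm_num)]
    have a4 : (H : ℝ) ^ (4 / 5 : ℝ) ≤ (d : ℝ) ^ (1 / 2 : ℝ) * (H : ℝ) ^ (4 / 5 : ℝ) :=
      le_mul_of_one_le_left (by positivity) hdp
    have a5 : (d : ℝ) ^ (1 / 2 : ℝ) ≤ (d : ℝ) ^ (1 / 2 : ℝ) * (H : ℝ) ^ (4 / 5 : ℝ) :=
      le_mul_of_one_le_right (by positivity) hHp
    have a6 : 0 ≤ (d : ℝ) ^ (1 / 2 : ℝ) * (H : ℝ) ^ (4 / 5 : ℝ) := by positivity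
    rw [show (5 : ℝ) * (d : ℝ) ^ (1 / 2 : ℝ) * (H : ℝ) ^ (4 / 5 : ℝ) = 5 * ((d : ℝ) ^ (1 / 2 : ℝ) * (H : ℝ) ^ (4 / 5 : ℝ)) by ring]
    norm_num at a1 a2 a3 a4 a5 a6 ⊢
    linarith
  have h3 : (d : ℝ) ^ (5 / 2 : ℝ) = d * d * (d : ℝ) ^ (1 / 2 : ℝ) := by
    rw [show (5 / 2 : ℝ) = 2 + 1 / 2 by norm_num, rpow_add (by positivity), Real.rpow_two]
    ring
  calc 2 * (C * d * ((H' : ℝ) ^ (4 / 5 : ℝ) + d * log H'))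
      ≤ 2 * (C * d * (2 * d * (H : ℝ) ^ (4 / 5 : ℝ) * (d : ℝ) ^ (1 / 2 : ℝ) +
        d * (5 * (d : ℝ) ^ (1 / 2 : ℝ) * (H : ℝ) ^ (4 / 5 : ℝ)))) := by
        gcongr
        exact h1.trans (le_mul_of_one_le_right (by positivity) hdp)
    _ = 14 * (C * (d * d * (d : ℝ) ^ (1 / 2 : ℝ)) * (H : ℝ) ^ (4 / 5 : ℝ)) := by ring
    _ = _ := by rw [h3]; ring

lemma polynomial_eval_aeval {R σ : Type*} [CommRing R] (p : σ → R[X]) (s : R)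
    (f : MvPolynomial σ R) : (aeval p f).eval s = eval (fun i => (p i).eval s) f := by
  have h : (Polynomial.aeval s).comp (aeval p) =
      (aeval (fun i => (p i).eval s) : MvPolynomial σ R →ₐ[R] R) := by
    ext i
    simp [Polynomial.coe_aeval_eq_eval]
  simpa [coe_aeval_eq_eval, Polynomial.coe_aeval_eq_eval] using dcongr h f

lemma finSuccEquiv_rename_succ (φ : MP n R) : finSuccEquiv R n (rename Fin.succ φ) = pC φ := by
  induction φ using MvPolynomial.induction_on with
  | C a =>
    rw [rename_C, ← RingHom.comp_apply]
    exact ((AlgEquiv.symm_apply_eq _).1 (dcongr (finSuccEquiv_comp_C_eq_C n) a)).symm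
  | add p q hp hq => rw [map_add, map_add, hp, hq, Polynomial.C_add]
  | mul_X p i hp =>
    rw [map_mul, map_mul, hp, rename_X, finSuccEquiv_X_succ, Polynomial.C_mul]

lemma eval_homogeneousComponent_eq_zero_of_line {f : MP n ℚ}
    (hf : f.totalDegree ≤ d) {x v : Fin n → ℚ} (h : ∀ t : ℚ, eval (fun i => x i + t * v i) f = 0) :
    eval v (homogeneousComponent d f) = 0 := by
  let Q : ℚ[X] := ∑ k ∈ range (d + 1), pX ^ (d - k) * aeval (fun i => pC (v i) + pX * pC (x i))
      (homogeneousComponent k f)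
  have hQ : ∀ s : ℚ, Q.eval s = ∑ k ∈ range (d + 1), s ^ (d - k) *
      eval (fun i => v i + s * x i) (homogeneousComponent k f) := by
    intro s
    simp only [Q, Polynomial.eval_finsetSum, Polynomial.eval_mul, Polynomial.eval_pow,
      Polynomial.eval_X]
    refine sum_congr rfl fun k _ => ?_
    congr 1
    rw [polynomial_eval_aeval]
    simp only [Polynomial.eval_add, Polynomial.eval_mul, Polynomial.eval_C, Polynomial.eval_X]
  have hsum : ∀ y : Fin n → ℚ, eval y f =
      ∑ k ∈ range (d + 1), eval y (homogeneousComponent k f) := by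
    intro y
    conv_lhs => rw [← sum_homogeneousComponent f]
    rw [map_sum]
    refine sum_subset (Finset.range_subset_range.2 (by omega)) fun k _ hk => ?_
    rw [homogeneousComponent_eq_zero _ _ (by simpa using hk), map_zero]
  have h0 : ∀ s : ℚ, s ≠ 0 → Q.eval s = 0 := by
    intro s hs
    rw [hQ]
    have h1 := h s⁻¹
    rw [hsum] at h1
    rw [← mul_zero (s ^ d), ← h1, mul_sum]
    refine sum_congr rfl fun k hk => ?_
    have hk' : k ≤ d := by simpa [Nat.lt_succ_iff] using hk
    have e : (fun i => v i + s * x i) = fun i => s * (x i + s⁻¹ * v i) := by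
      funext i
      field_simp
      ring
    rw [e, eval_mul_of_isHomogeneous (homogeneousComponent_isHomogeneous k f), ← mul_assoc,
      ← pow_add, Nat.sub_add_cancel hk']
  have hQ0 : Q = 0 := by
    refine Polynomial.eq_zero_of_infinite_isRoot _ (Set.Infinite.mono (s := {0}ᶜ) ?_ ?_)
    · exact fun s hs => h0 s hs
    · exact (Set.finite_singleton _).infinite_compl
  have h2 := hQ 0
  rw [hQ0, Polynomial.eval_zero, sum_eq_single d] at h2
  · simpa using h2.symm
  · intro k hk hkd
    have : d - k ≠ 0 := by
      have : k < d + 1 := by simpa using hk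
      omega
    simp [this]
  · simp

lemma card_axis_lines_le {f : MP 3 ℚ} (hf : Irreducible f) (hr : ¬ ∃ g : MP 2 ℚ, f = rename Fin.succ
    g) (Y : Finset (Fin 2 → ℚ)) (hY : ∀ z ∈ Y, ∀ t : ℚ, eval (Fin.cons t z : Fin 3 → ℚ) f = 0) :
    Y.card ≤ f.totalDegree ^ 2 := by
  classical
  have hc : ∀ j, ∀ z ∈ Y, eval z ((finSuccEquiv ℚ 2 f).coeff j) = 0 := by
    intro j z hz
    have : Polynomial.map (eval z) (finSuccEquiv ℚ 2 f) = 0 := by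
      refine Polynomial.funext fun t => ?_
      rw [← eval_eq_eval_mv_eval', hY z hz t, Polynomial.eval_zero]
    have := congrArg (fun p => Polynomial.coeff p j) this
    simpa using this
  have hdeg : ∀ j, (finSuccEquiv ℚ 2 f).coeff j ≠ 0 →
      ((finSuccEquiv ℚ 2 f).coeff j).totalDegree ≤ f.totalDegree := fun j hj =>
    (Nat.le_add_right _ _).trans (totalDegree_coeff_finSuccEquiv_add_le f j hj)
  have hne : finSuccEquiv ℚ 2 f ≠ 0 := by
    simpa using hf.ne_zero
  obtain ⟨j₀, hj₀⟩ : ∃ j, (finSuccEquiv ℚ 2 f).coeff j ≠ 0 := by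
    by_contra! h
    exact hne (Polynomial.ext h)
  have key := card_le_mul_totalDegree_of_factors (fun z : Fin 2 → ℚ => z) f.totalDegree hj₀ Y
    (hc j₀) ?_
  · have : (Y.card : ℝ) ≤ f.totalDegree * f.totalDegree :=
      key.trans (mul_le_mul_of_nonneg_left (mod_cast hdeg j₀ hj₀) (by positivity))
    rw [sq]
    exact_mod_cast this
  intro φ hφ _ Z hZ hZφ
  obtain ⟨j, hj⟩ : ∃ j, ¬ φ ∣ (finSuccEquiv ℚ 2 f).coeff j := by
    by_contra! h
    obtain ⟨q, hq⟩ := Polynomial.C_dvd_iff_dvd_coeff φ _ |>.2 h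
    have h1 : f = rename Fin.succ φ * (finSuccEquiv ℚ 2).symm q := by
      apply (finSuccEquiv ℚ 2).injective
      rw [map_mul, AlgEquiv.apply_symm_apply, hq, finSuccEquiv_rename_succ]
    rcases hf.isUnit_or_isUnit h1 with h2 | h2
    · exact hφ.not_isUnit (by
        have := h2.map (finSuccEquiv ℚ 2)
        rw [finSuccEquiv_rename_succ, Polynomial.isUnit_C] at this
        exact this)
    · obtain ⟨a, _, ha⟩ := isUnit_iff_eq_C_of_isReduced.1 h2
      exact hr ⟨φ * C a, by rw [h1, ha, map_mul, rename_C]⟩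
  have hj0 : (finSuccEquiv ℚ 2 f).coeff j ≠ 0 := fun h => hj (h ▸ dvd_zero _)
  have h1 := (plane_bezout Z hφ.ne_zero hj0 (hφ.isRelPrime_iff_not_dvd.2 hj) hZφ
    fun z hz => hc j z (hZ hz)).trans (Nat.mul_le_mul_left _ (hdeg j hj0))
  rw [mul_comm]
  exact_mod_cast h1

lemma card_lines_le {f : MP 3 ℚ} (hf : Irreducible f) (hN : IsNCC f) {v : Fin 3 → ℚ} (i : Fin 3) (hv
    : v i ≠ 0) (Y : Finset (Fin 3 → ℚ)) (hY : ∀ y ∈ Y, y i = 0 ∧ ∀ t : ℚ, eval (fun j => y j + t * v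
    j) f = 0) : Y.card ≤ f.totalDegree ^ 2 := by
  classical
  let w : Fin 3 → ℚ := fun j => if j = i then 0 else v j / v i
  let σ := Equiv.swap 0 i
  let M := shearMat i w * Matrix.swap ℚ 0 i
  let N := Matrix.swap ℚ 0 i * shearMat i (-w)
  have hMN : M * N = 1 := by
    simp only [M, N]
    rw [Matrix.mul_assoc, ← Matrix.mul_assoc (Matrix.swap ℚ 0 i), Matrix.swap_mul_self,
      Matrix.one_mul, shearMat_mul i w (by simp [w])]
  have hM : ∀ y : Fin 3 → ℚ, y i = 0 → ∀ t : ℚ,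
      M.mulVec (Fin.cons t fun k : Fin 2 => y (σ k.succ)) = fun j => y j + t / v i * v j := by
    intro y hy t
    have hc : (Fin.cons t fun k : Fin 2 => y (σ k.succ) : Fin 3 → ℚ) = update (y ∘ σ) 0 t := by
      funext k
      refine Fin.cases ?_ (fun k => ?_) k <;> simp
    simp only [M]
    rw [← Matrix.mulVec_mulVec, swap_mulVec, shearMat_mulVec, hc]
    funext j
    by_cases hj : j = i
    · subst hj
      simp [w, hy, hv]
    · have h1 : σ j ≠ 0 := by
        intro h
        have h' := congrArg σ h
        simp only [σ, Equiv.swap_apply_self, Equiv.swap_apply_left] at h'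
        exact hj h'
      have h2 : (update (y ∘ σ) 0 t) (σ j) = y j := by
        rw [Function.update_of_ne h1]
        simp [σ]
      simp only [Function.comp_apply]
      rw [h2]
      simp [w, hj]
      ring
  have key := card_axis_lines_le (irreducible_linSub hMN hf) ?_
    (Y.image fun y => fun k : Fin 2 => y (σ k.succ)) ?_
  · rw [totalDegree_linSub hMN, card_image_of_injOn] at key
    · exact key
    · intro y hy y' hy' h
      have h1 := hM y (hY y hy).1 0
      have h2 := hM y' (hY y' hy').1 0
      simp only at h
      rw [h, h2] at h1
      funext j
      simpa using (congrFun h1 j).symm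
  · rintro ⟨g, hg⟩
    refine hN ⟨N 1, N 2, g, ?_⟩
    rw [← linSub_linSub_of_mul hMN f, hg, linSub, aeval_rename]
    congr 2
    funext k
    fin_cases k <;> rfl
  · intro z hz t
    obtain ⟨y, hy, rfl⟩ := mem_image.1 hz
    rw [eval_linSub, hM y (hY y hy).1]
    exact (hY y hy).2 _

lemma exists_int_mul_of_rat_mul {v : Fin n → ℤ} (hv : ∀ b : ℤ, (∀ i, b ∣ v i) → IsUnit b)
    {w : Fin n → ℤ} {q : ℚ} (h : ∀ i, (w i : ℚ) = q * v i) : ∃ t : ℤ, ∀ i, w i = t * v i := by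
  have h1 : ∀ i, w i * q.den = q.num * v i := by
    intro i
    have h2 : (w i : ℚ) * q.den = q.num * v i := by
      rw [h i, mul_right_comm, Rat.mul_den_eq_num]
    exact_mod_cast h2
  have h2 : IsUnit (q.den : ℤ) := hv _ fun i => (Int.isCoprime_iff_gcd_eq_one.2 (by
      rw [Int.gcd_comm]; exact q.reduced)).dvd_of_dvd_mul_left (Dvd.intro_left _ (h1 i))
  have h3 : q.den = 1 := by simpa [Int.isUnit_iff_natAbs_eq] using h2
  refine ⟨q.num, fun i => ?_⟩
  simpa [h3] using h1 i

lemma card_direction_points_le {f : MP 3 ℚ} (hf : Irreducible f) (hN : IsNCC f) {v : Fin 3 → ℤ} (hv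
    : ∀ b : ℤ, (∀ i, b ∣ v i) → IsUnit b) (i : Fin 3) (hvi : v i ≠ 0) {B : ℕ} (hB : (v i).natAbs ≤
    B) (X : Finset (Fin 3 → ℤ)) (hX : ∀ x ∈ X, (∀ j, |x j| ≤ B) ∧ ∀ t : ℚ, eval (fun j => (x j : ℚ)
    + t * v j) f = 0) : (X.card : ℝ) ≤ 5 * (f.totalDegree : ℝ) ^ 2 * B / (v i).natAbs := by
  classical
  set h := (v i).natAbs with hh
  have hpos : 0 < h := natAbs_pos.2 hvi
  have hviQ : (v i : ℚ) ≠ 0 := mod_cast hvi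
  let π : (Fin 3 → ℤ) → Fin 3 → ℚ := fun x j => (x j : ℚ) - x i / v i * v j
  have h1 : (X.image π).card ≤ f.totalDegree ^ 2 := by
    refine card_lines_le hf hN (v := fun j => (v j : ℚ)) i hviQ _ fun y hy => ?_
    obtain ⟨x, hx, rfl⟩ := mem_image.1 hy
    refine ⟨by simp [π, hviQ], fun t => ?_⟩
    rw [← (hX x hx).2 (t - x i / v i)]
    congr 2
    funext j
    simp only [π]
    ring
  have h2 : ∀ b ∈ X.image π, (X.filter fun x => π x = b).card ≤ 2 * (2 * B / h) + 1 := by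
    intro b hb
    obtain ⟨x₀, hx₀, hb⟩ := mem_image.1 hb
    have hdiff : ∀ x ∈ X.filter fun x => π x = b, ∃ t : ℤ, ∀ j, x j - x₀ j = t * v j := by
      intro x hx
      have hx' := (mem_filter.1 hx).2
      refine exists_int_mul_of_rat_mul hv (q := (x i - x₀ i) / v i) fun j => ?_
      have h3 := congrFun (hx'.trans hb.symm) j
      simp only [π] at h3
      push_cast
      rw [sub_div, sub_mul]
      linarith
    choose! t ht using hdiff
    have hcard : (X.filter fun x => π x = b).card ≤
        (Icc (-((2 * B / h : ℕ) : ℤ)) ((2 * B / h : ℕ) : ℤ)).card := by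
      refine card_le_card_of_injOn t (fun x hx => ?_) fun x hx y hy hxy => ?_
      · have h3 := ht x hx i
        have h4 : (t x).natAbs ≤ 2 * B / h := by
          rw [Nat.le_div_iff_mul_le hpos, hh, ← Int.natAbs_mul, ← h3]
          have h5 := (hX x (mem_filter.1 hx).1).1 i
          have h6 := (hX x₀ hx₀).1 i
          rw [abs_le] at h5 h6
          omega
        simp only [coe_Icc, Set.mem_Icc]
        generalize 2 * B / h = m at h4
        omega
      · funext j
        have h3 := ht x hx j
        have h4 := ht y hy j
        rw [hxy, ← h4] at h3
        linarith
    refine hcard.trans (le_of_eq ?_)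
    rw [Int.card_Icc]
    generalize 2 * B / h = m
    omega
  have h3 := Finset.card_le_mul_card_image X _ h2
  have hR : (0 : ℝ) < h := mod_cast hpos
  have hBR : (h : ℝ) ≤ B := mod_cast hB
  have h4 : ((2 * B / h : ℕ) : ℝ) ≤ 2 * B / h := by
    simpa using Nat.cast_div_le (α := ℝ) (m := 2 * B) (n := h)
  have h5 : (1 : ℝ) ≤ B / h := by rwa [le_div_iff₀ hR, one_mul]
  calc (X.card : ℝ) ≤ (2 * ((2 * B / h : ℕ) : ℝ) + 1) * (f.totalDegree : ℝ) ^ 2 := by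
        have h6 := h3.trans (Nat.mul_le_mul_left _ h1)
        exact_mod_cast h6
    _ ≤ (5 * (B / h)) * (f.totalDegree : ℝ) ^ 2 := by
        refine mul_le_mul_of_nonneg_right ?_ (by positivity)
        have e : (2 * B / h : ℝ) = 2 * (B / h) := by ring
        rw [e] at h4
        linarith
    _ = _ := by ring

lemma sum_inv_le_of_card_le : ∃ C : ℝ, 0 ≤ C ∧ ∀ {ι : Type} (V : Finset ι) (N : ι → ℕ) (_ : ∀ v ∈ V,
    1 ≤ N v) (A : ℝ) (_ : 0 ≤ A) (_ : ∀ H : ℕ, 1 ≤ H → ((V.filter fun v => N v ≤ H).card : ℝ) ≤ A *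
    (H : ℝ) ^ (4 / 5 : ℝ)), ∑ v ∈ V, (1 : ℝ) / N v ≤ C * A := by
  classical
  set r : ℝ := 2 ^ (-(1 / 5) : ℝ) with hr
  have hr0 : 0 < r := by positivity
  have hr1 : r < 1 := Real.rpow_lt_one_of_one_lt_of_neg (by norm_num) (by norm_num)
  have hr2 : 0 < 1 - r := by linarith
  refine ⟨2 * (1 / (1 - r)), by positivity, fun {ι} V N hN A hA h => ?_⟩
  set J := V.sup (fun v => Nat.log 2 (N v)) + 1 with hJ
  rw [← Finset.sum_fiberwise_of_maps_to (s := V) (t := range J) (g := fun v => Nat.log 2 (N v))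
    (fun v hv => mem_range.2 (Nat.lt_succ_of_le (le_sup (f := fun v => Nat.log 2 (N v)) hv)))]
  have hj : ∀ j : ℕ, ∑ v ∈ V.filter (fun v => Nat.log 2 (N v) = j), (1 : ℝ) / N v ≤
      2 * A * r ^ j := by
    intro j
    have h1 : ∀ v ∈ V.filter (fun v => Nat.log 2 (N v) = j), (1 : ℝ) / N v ≤ 1 / 2 ^ j := by
      intro v hv
      obtain ⟨hv, hj⟩ := mem_filter.1 hv
      have h2 := Nat.pow_log_le_self 2 (x := N v) (by have := hN v hv; omega)
      rw [hj] at h2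
      refine one_div_le_one_div_of_le (by positivity) ?_
      exact_mod_cast h2
    have h2 : (V.filter (fun v => Nat.log 2 (N v) = j)).card ≤
        (V.filter fun v => N v ≤ 2 ^ (j + 1)).card := by
      refine card_le_card fun v hv => ?_
      obtain ⟨hv, hj⟩ := mem_filter.1 hv
      refine mem_filter.2 ⟨hv, ?_⟩
      rw [← hj]
      exact (Nat.lt_pow_succ_log_self (by norm_num) _).le
    have h3 := h (2 ^ (j + 1)) Nat.one_le_two_pow
    have h4 : ((V.filter (fun v => Nat.log 2 (N v) = j)).card : ℝ) ≤
        A * ((2 ^ (j + 1) : ℕ) : ℝ) ^ (4 / 5 : ℝ) := le_trans (mod_cast h2) h3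
    refine (sum_le_card_nsmul _ _ _ h1).trans ?_
    rw [nsmul_eq_mul]
    refine (mul_le_mul_of_nonneg_right h4 (by positivity)).trans ?_
    have e1 : ((2 ^ (j + 1) : ℕ) : ℝ) ^ (4 / 5 : ℝ) = 2 ^ ((j + 1 : ℝ) * (4 / 5)) := by
      rw [rpow_mul (by norm_num)]
      norm_cast
    have e2 : (1 : ℝ) / 2 ^ j = 2 ^ (-(j : ℝ)) := by
      rw [Real.rpow_neg (by norm_num), rpow_natCast, one_div]
    have e3 : r ^ j = 2 ^ (-(1 / 5) * (j : ℝ)) := by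
      rw [hr, ← rpow_natCast, ← rpow_mul (by norm_num)]
    have h5 : (2 : ℝ) ^ ((j + 1 : ℝ) * (4 / 5)) * 2 ^ (-(j : ℝ)) ≤ 2 * 2 ^ (-(1 / 5) * (j : ℝ)) := by
      rw [← rpow_add (by norm_num)]
      nth_rewrite 2 [← rpow_one 2]
      rw [← rpow_add (by norm_num)]
      refine Real.rpow_le_rpow_of_exponent_le (by norm_num) ?_
      linarith
    rw [e1, e2, e3, mul_assoc, mul_comm 2 A, mul_assoc]
    exact mul_le_mul_of_nonneg_left h5 hA
  refine (sum_le_sum fun j _ => hj j).trans ?_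
  rw [← mul_sum]
  have h6 : ∑ j ∈ range J, r ^ j ≤ 1 / (1 - r) := by
    rw [geom_sum_eq hr1.ne, ← neg_div_neg_eq, neg_sub, neg_sub]
    refine div_le_div_of_nonneg_right ?_ hr2.le
    have : 0 < r ^ J := by positivity
    linarith
  calc 2 * A * ∑ j ∈ range J, r ^ j ≤ 2 * A * (1 / (1 - r)) :=
        mul_le_mul_of_nonneg_left h6 (by positivity)
    _ = _ := by ring

lemma exists_primitive {v : Fin n → ℤ} (hv : v ≠ 0) : ∃ w : Fin n → ℤ, ∃ c : ℤ, c ≠ 0 ∧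
    (∀ i, v i = c * w i) ∧ ∀ b : ℤ, (∀ i, b ∣ w i) → IsUnit b := by
  obtain ⟨i, hi⟩ := ne_iff.1 hv
  obtain ⟨w, hw, hg⟩ := Finset.extract_gcd v (s := univ) ⟨i, mem_univ _⟩
  refine ⟨w, univ.gcd v, ?_, fun j => hw j (mem_univ _), fun b hb => ?_⟩
  · intro h
    exact hi (Finset.gcd_eq_zero_iff.1 h i (mem_univ _))
  · exact isUnit_of_dvd_one (hg ▸ dvd_gcd fun j _ => hb j)

theorem card_short_line_points_le : ∃ C : ℝ, 0 ≤ C ∧ ∀ (f : MP 3 ℚ) (_ : Irreducible f) (_ : IsNCC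
    f) (_ : 1 ≤ f.totalDegree) (_ : RIrreducible 2 (homogeneousComponent f.totalDegree f)) (B : ℕ)
    (_ : 1 ≤ B) (T : Finset (Fin 3 → ℤ)) (_ : ∀ x ∈ T, (∀ i, |x i| ≤ B) ∧ ∃ v : Fin 3 → ℤ, v ≠ 0 ∧
    (∀ i, v i ^ 2 ≤ B) ∧ ∀ t : ℚ, eval (fun i => (x i : ℚ) + t * v i) f = 0), (T.card : ℝ) ≤ C *
    (f.totalDegree : ℝ) ^ (9 / 2 : ℝ) * B := by
  classical
  obtain ⟨C₁, hC₁, hinf⟩ := card_points_at_infinity_le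
  obtain ⟨C₂, hC₂, hsum⟩ := sum_inv_le_of_card_le
  refine ⟨5 * (C₂ * C₁), by positivity, fun f hf hN hd hF B hB T hT => ?_⟩
  set d := f.totalDegree with hdd
  have hT' : ∀ x ∈ T, ∃ v : Fin 3 → ℤ, (∀ b : ℤ, (∀ i, b ∣ v i) → IsUnit b) ∧
      (∀ i, (v i).natAbs ≤ B) ∧ ∀ t : ℚ, eval (fun i => (x i : ℚ) + t * v i) f = 0 := by
    intro x hx
    obtain ⟨-, v, hv0, hvB, hv⟩ := hT x hx
    obtain ⟨w, c, hc, hw, hprim⟩ := exists_primitive hv0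
    refine ⟨w, hprim, fun i => ?_, fun t => ?_⟩
    · have h1 : (v i).natAbs ^ 2 ≤ B := by
        have := hvB i
        rw [← Int.natAbs_sq] at this
        exact_mod_cast this
      have h2 : (v i).natAbs ≤ B := (Nat.le_self_pow two_ne_zero _).trans h1
      rw [hw i, Int.natAbs_mul] at h2
      exact (Nat.le_mul_of_pos_left _ (natAbs_pos.2 hc)).trans h2
    · rw [← hv (t / c)]
      congr 2
      funext i
      rw [hw i]
      have : (c : ℚ) ≠ 0 := mod_cast hc
      push_cast
      field_simp
  choose! dir hprim hle hline using hT'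
  let key : (Fin 3 → ℤ) → Submodule ℚ (Fin 3 → ℚ) := fun x =>
    Submodule.span ℚ {fun i => (dir x i : ℚ)}
  have hrep : ∀ κ ∈ T.image key, ∃ x ∈ T, key x = κ := fun κ hκ => mem_image.1 hκ
  choose! ρ hρT hρ using hrep
  let nrm : (Fin 3 → ℤ) → ℕ := fun v => univ.sup fun i => (v i).natAbs
  let V : Finset (Fin 3 → ℤ) := (T.image key).image fun κ => dir (ρ κ)
  have hV0 : ∀ v ∈ V, v ≠ 0 ∧ evQ v (homogeneousComponent d f) = 0 := by
    intro v hv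
    obtain ⟨κ, hκ, rfl⟩ := mem_image.1 hv
    refine ⟨fun h0 => ?_, eval_homogeneousComponent_eq_zero_of_line le_rfl (hline _ (hρT κ hκ))⟩
    have := hprim _ (hρT κ hκ) 0 fun i => by rw [h0]; exact dvd_rfl
    exact not_isUnit_zero this
  have hVn : NonProportional V := by
    intro v hv w hw a b ha hb hab
    obtain ⟨κ, hκ, rfl⟩ := mem_image.1 hv
    obtain ⟨κ', hκ', rfl⟩ := mem_image.1 hw
    suffices h : κ = κ' by rw [h]
    rw [← hρ κ hκ, ← hρ κ' hκ']
    have haQ : (a : ℚ) ≠ 0 := mod_cast ha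
    have hbQ : (b : ℚ) ≠ 0 := mod_cast hb
    refine Submodule.span_singleton_eq_span_singleton.2 ⟨Units.mk0 ((a : ℚ) / b)
      (div_ne_zero haQ hbQ), ?_⟩
    funext i
    have := hab i
    have h1 : (a : ℚ) * dir (ρ κ) i = b * dir (ρ κ') i := mod_cast this
    change (a : ℚ) / b * dir (ρ κ) i = dir (ρ κ') i
    field_simp
    exact h1
  have hnrm : ∀ v : Fin 3 → ℤ, ∃ i, (v i).natAbs = nrm v := by
    intro v
    obtain ⟨i, -, hi⟩ := Finset.exists_mem_eq_sup univ Finset.univ_nonempty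
      fun i => (v i).natAbs
    exact ⟨i, hi.symm⟩
  have hpos : ∀ v ∈ V, 1 ≤ nrm v := by
    intro v hv
    obtain ⟨j, hj⟩ := ne_iff.1 (hV0 v hv).1
    exact (natAbs_pos.2 hj).trans_le
      (le_sup (f := fun i => (v i).natAbs) (mem_univ j))
  have hS := hsum V nrm hpos (C₁ * (d : ℝ) ^ (5 / 2 : ℝ)) (by positivity) fun H hH => by
    refine hinf d _ (homogeneousComponent_isHomogeneous d f) hd
      (homogeneousComponent_totalDegree_ne_zero hf.ne_zero) hF H hH _ ?_ ?_
    · intro v hv w hw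
      exact hVn v (mem_filter.1 hv).1 w (mem_filter.1 hw).1
    · intro v hv
      obtain ⟨hv, hH⟩ := mem_filter.1 hv
      refine ⟨(hV0 v hv).1, (hV0 v hv).2, fun i => ?_⟩
      have : (v i).natAbs ≤ H := (le_sup (f := fun i => (v i).natAbs) (mem_univ i)).trans hH
      rw [Int.abs_eq_natAbs]; exact_mod_cast this
  have hfib : ∀ v ∈ V, ((T.filter fun x => dir (ρ (key x)) = v).card : ℝ) ≤
      5 * (d : ℝ) ^ 2 * B * (1 / nrm v) := by
    intro v hv
    obtain ⟨i, hi⟩ := hnrm v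
    obtain ⟨κ, hκ, hκv⟩ := mem_image.1 hv
    have h1 := hprim _ (hρT κ hκ)
    have h2 := hle _ (hρT κ hκ) i
    rw [hκv] at h1 h2
    rw [mul_one_div, ← hi]
    refine card_direction_points_le hf hN h1 i ?_ h2 _ fun x hx => ?_
    · have := hpos v hv
      rw [← hi] at this
      exact natAbs_pos.1 this
    · obtain ⟨hx, hxv⟩ := mem_filter.1 hx
      refine ⟨(hT x hx).1, fun t => ?_⟩
      have hk := hρ (key x) (mem_image_of_mem _ hx)
      obtain ⟨c, hc⟩ := Submodule.span_singleton_eq_span_singleton.1 hk.symm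
      rw [← hline x hx (t * c)]
      congr 2
      funext j
      have hcj := congrFun hc j
      rw [hxv] at hcj
      rw [← hcj, mul_assoc]
      rfl
  rw [Finset.card_eq_sum_card_fiberwise (f := fun x => dir (ρ (key x))) (t := V)
    fun x hx => mem_image_of_mem _ (mem_image_of_mem _ hx)]
  push_cast
  refine (sum_le_sum hfib).trans ?_
  rw [← mul_sum]
  have e : (d : ℝ) ^ (9 / 2 : ℝ) = (d : ℝ) ^ 2 * (d : ℝ) ^ (5 / 2 : ℝ) := by
    have hd0 : (0 : ℝ) < d := mod_cast hd
    rw [← rpow_natCast, ← rpow_add hd0]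
    norm_num
  refine (mul_le_mul_of_nonneg_left hS (by positivity)).trans (le_of_eq ?_)
  rw [e]
  ring

lemma coeff_lastPoly (b : Fin m → R) (f : MP (m + 1) R) (hd : f.totalDegree ≤ d) : (lastPoly b
    f).coeff d = coeff (single (last m) d) f := by
  classical
  rw [lastPoly, aeval_def, eval₂_eq', Polynomial.finsetSum_coeff]
  have hterm : ∀ α : Fin (m + 1) →₀ ℕ, (algebraMap R R[X] (coeff α f) *
      ∏ i, (snoc (fun i => pC (b i)) pX : Fin (m + 1) → R[X]) i ^ α i).coeff d
      = if α (last m) = d then coeff α f * ∏ i : Fin m, b i ^ α i.castSucc else 0 := by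
    intro α
    rw [Fin.prod_univ_castSucc]
    simp only [snoc_castSucc, Fin.snoc_last, Polynomial.algebraMap_eq]
    have : ∏ i : Fin m, (pC (b i) : R[X]) ^ α i.castSucc =
        pC (∏ i : Fin m, b i ^ α i.castSucc) := by
      rw [map_prod]
      simp
    rw [this, ← mul_assoc, ← Polynomial.C_mul, Polynomial.coeff_C_mul_X_pow]
    simp only [eq_comm]
  rw [sum_congr rfl fun α _ => hterm α, sum_eq_single (single (last m) d)]
  · rw [if_pos (by simp)]
    have : ∏ i : Fin m, b i ^ (single (last m) d) i.castSucc = 1 := Finset.prod_eq_one fun i _ => by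
        rw [single_eq_of_ne (Fin.castSucc_lt_last i).ne, pow_zero]
    rw [this, mul_one]
  · intro α hα hne
    rw [if_neg]
    intro h
    refine hne ?_
    have h1 := (le_totalDegree hα).trans hd
    rw [finsupp_sum_fin, Fin.sum_univ_castSucc, h] at h1
    have h2 : ∑ i : Fin m, α i.castSucc = 0 := by omega
    rw [Finset.sum_eq_zero_iff] at h2
    ext i
    refine lastCases ?_ (fun i => ?_) i
    · simp [h]
    · rw [single_eq_of_ne (Fin.castSucc_lt_last i).ne]
      exact h2 i (mem_univ _)
  · intro h
    rw [notMem_support_iff.1 h]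
    simp

lemma lastPoly_ne_zero (b : Fin m → R) {f : MP (m + 1) R} (hd : f.totalDegree ≤ d) (h : coeff
    (single (last m) d) f ≠ 0) : lastPoly b f ≠ 0 := by
  intro h0
  rw [← coeff_lastPoly b f hd, h0, Polynomial.coeff_zero] at h
  exact h rfl

lemma card_box_zeros_le {R : MP 2 ℚ} (hR : R ≠ 0) (N : ℕ) (X : Finset (Fin 2 → ℤ)) (hX : ∀ x ∈ X,
    evQ x R = 0 ∧ ∀ i, |x i| ≤ N) : X.card ≤ R.totalDegree * (2 * N + 1) := by
  classical
  set S : Finset ℚ := (Icc (-(N : ℤ)) N).image fun a : ℤ => (a : ℚ) with hS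
  have hcard : S.card = 2 * N + 1 := by
    rw [hS, card_image_of_injective _ cast_injective, Int.card_Icc]
    omega
  have h1 := schwartz_zippel_totalDegree hR S
  have h2 : X.card ≤ ((piFinset fun _ : Fin 2 => S).filter fun x => eval x R = 0).card := by
    refine card_le_card_of_injOn (fun x i => (x i : ℚ)) (fun x hx => ?_) ?_
    · refine mem_coe.2 (mem_filter.2 ⟨mem_piFinset.2 fun i => ?_, (hX x hx).1⟩)
      exact mem_image.2 ⟨x i, mem_Icc.2 (abs_le.1 ((hX x hx).2 i)), rfl⟩
    · intro x _ y _ hxy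
      funext i
      exact cast_injective (α := ℚ) (congrFun hxy i)
  have hpos : (0 : ℚ≥0) < (S.card : ℚ≥0) := by
    rw [hcard]
    positivity
  rw [div_le_div_iff₀ (by positivity) hpos, sq, ← mul_assoc] at h1
  have h3 := le_of_mul_le_mul_right h1 hpos
  rw [hcard] at h3
  refine h2.trans ?_
  exact_mod_cast h3

lemma exists_line_of_totalDegree_eq_one {φ : MP 2 ℚ} (h : φ.totalDegree = 1) : ∃ (i : Fin 2) (p w :
    Fin 2 → ℚ), w i = 1 ∧ p i = 0 ∧ (∀ x, eval x φ = 0 → x = fun j => p j + x i * w j) ∧ ∀ t, eval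
    (fun j => p j + t * w j) φ = 0 := by
  classical
  set c := coeff 0 φ with hc
  set a := coeff (single 0 1) φ with ha
  set b := coeff (single 1 1) φ with hb
  have h01 : (single 0 1 : Fin 2 →₀ ℕ) ≠ single 1 1 := by
    intro h
    simpa using dcongr h 0
  have hsub : φ.support ⊆ {0, single 0 1, single 1 1} := by
    intro α hα
    have h1 := (le_totalDegree hα).trans h.le
    rw [finsupp_sum_fin, sum_univ_two] at h1
    simp only [Finset.mem_insert, mem_singleton]
    have h2 : (α 0 = 0 ∧ α 1 = 0) ∨ (α 0 = 1 ∧ α 1 = 0) ∨ (α 0 = 0 ∧ α 1 = 1) := by omega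
    refine h2.imp ?_ (Or.imp ?_ ?_) <;> rintro ⟨h3, h4⟩ <;> ext i <;> fin_cases i <;>
      simp [h3, h4]
  have hev : ∀ x : Fin 2 → ℚ, eval x φ = c + a * x 0 + b * x 1 := by
    intro x
    rw [eval_eq', sum_subset hsub]
    · rw [Finset.sum_insert (by simp [eq_comm (a := (0 : Fin 2 →₀ ℕ))]), Finset.sum_insert (by simpa using h01),
        Finset.sum_singleton]
      simp [hc, ha, hb]
      ring
    · intro α _ hα
      rw [notMem_support_iff.1 hα, zero_mul]
  by_cases hb0 : b = 0
  · have ha0 : a ≠ 0 := by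
      intro ha0
      have : φ = C c := MvPolynomial.funext fun x => by rw [hev, ha0, hb0]; simp
      rw [this, totalDegree_C] at h
      omega
    refine ⟨1, ![-c / a, 0], ![0, 1], rfl, rfl, fun x hx => ?_, fun t => ?_⟩
    · rw [hev, hb0] at hx
      funext j
      fin_cases j
      · simp only [Fin.zero_eta, cons_val_zero, mul_zero, add_zero]
        field_simp
        linarith
      · simp
    · rw [hev, hb0]
      simp only [cons_val_zero, mul_zero, add_zero, zero_mul]
      field_simp
      ring
  · refine ⟨0, ![0, -c / b], ![1, -a / b], rfl, rfl, fun x hx => ?_, fun t => ?_⟩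
    · rw [hev] at hx
      funext j
      fin_cases j
      · simp
      · simp only [Fin.mk_one, cons_val_one, cons_val_zero]
        field_simp
        linarith
    · rw [hev]
      simp only [cons_val_zero, cons_val_one]
      field_simp
      ring

lemma card_le_of_projection {f : MP 3 ℚ} (hc : coeff (single 2 f.totalDegree) f ≠ 0) (Y : Finset
    (Fin 3 → ℤ)) (hY : ∀ x ∈ Y, evQ x f = 0) : Y.card ≤ f.totalDegree * (Y.image fun x => (init x :
    Fin 2 → ℤ)).card := by
  classical
  have hinj : Injective fun (x : Fin 3 → ℤ) (i : Fin 3) => (x i : ℚ) := fun x y hxy => by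
    funext i
    exact cast_injective (α := ℚ) (congrFun hxy i)
  have h := card_le_mul_card_init f le_rfl (Y.image fun x i => (x i : ℚ)) ?_ ?_
  · rw [card_image_of_injective _ hinj] at h
    refine h.trans (Nat.mul_le_mul_left _ ?_)
    rw [Finset.image_image]
    refine le_trans (card_le_card (t := (Y.image fun x => (init x : Fin 2 → ℤ)).image
      fun x i => (x i : ℚ)) ?_) Finset.card_image_le
    rw [Finset.image_image]
    exact le_of_eq rfl
  · intro x hx
    obtain ⟨y, hy, rfl⟩ := mem_image.1 hx
    exact hY y hy
  · intro x _
    exact lastPoly_ne_zero _ le_rfl hc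

lemma eval_eliminant {f G A D : MP 3 ℚ} {R : MP 2 ℚ} (hR : rename castSucc R = f * A + G * D) {x :
    Fin 3 → ℤ} (hf : evQ x f = 0) (hG : evQ x G = 0) : eval (fun i : Fin 2 => ((init x : Fin 2 → ℤ)
    i : ℚ)) R = 0 := by
  have h := congrArg (evQ x) hR
  rw [eval_rename, map_add, map_mul, map_mul, hf, hG, zero_mul, zero_mul, add_zero] at h
  exact h

lemma card_common_zeros_le_of_coeff {f G : MP 3 ℚ} (hG : G ≠ 0) (hrel : IsRelPrime f G) (ha : 1 ≤
    f.totalDegree) (hb : 1 ≤ G.totalDegree) (hc : coeff (single 2 f.totalDegree) f ≠ 0) (N : ℕ) (X :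
    Finset (Fin 3 → ℤ)) (hX : ∀ x ∈ X, evQ x f = 0 ∧ evQ x G = 0 ∧ ∀ i, |x i| ≤ N) : X.card ≤ 2 *
    f.totalDegree ^ 2 * G.totalDegree * (2 * N + 1) := by
  classical
  have hf : f ≠ 0 := by rintro rfl; simp at hc
  obtain ⟨R, hR0, hRd, A, D, hR⟩ := exists_eliminant hf hG hrel ha hb castSucc
    (Fin.castSucc_injective 2)
  have h1 := card_le_of_projection hc X fun x hx => (hX x hx).1
  have h2 := card_box_zeros_le hR0 N (X.image fun x => (init x : Fin 2 → ℤ)) ?_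
  · calc X.card ≤ f.totalDegree * (2 * f.totalDegree * G.totalDegree * (2 * N + 1)) :=
          h1.trans (Nat.mul_le_mul_left _ (h2.trans (Nat.mul_le_mul_right _ hRd)))
      _ = _ := by ring
  · intro y hy
    obtain ⟨x, hx, rfl⟩ := mem_image.1 hy
    exact ⟨eval_eliminant hR (hX x hx).1 (hX x hx).2.1, fun i => (hX x hx).2.2 _⟩

/-- Lines contained in the zero set of `f` carry at most `M` points of `X`. -/
def FewOnLines (f : MP 3 ℚ) (X : Finset (Fin 3 → ℤ)) (M : ℝ) : Prop :=
  ∀ Y ⊆ X, ∀ p w : Fin 3 → ℚ, (∀ t : ℚ, eval (fun i => p i + t * w i) f = 0) →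
    (∀ y ∈ Y, ∃ t : ℚ, ∀ i, (y i : ℚ) = p i + t * w i) → (Y.card : ℝ) ≤ M

lemma snoc_apply_two {α : Type*} (a : Fin 2 → α) (b : α) : (snoc a b : Fin 3 → α) 2 = b := rfl

lemma card_plane_points_le : ∃ K : ℝ, 0 ≤ K ∧ ∀ (f : MP 3 ℚ) (_ : coeff (single 2 f.totalDegree) f ≠
    0) (N : ℕ) (_ : 2 ≤ N) (Y : Finset (Fin 3 → ℤ)) (M : ℝ) (_ : 0 ≤ M) (_ : FewOnLines f Y M) (_ :
    ∀ x ∈ Y, evQ x f = 0 ∧ ∀ i, |x i| ≤ N) (i : Fin 2) (p w : Fin 2 → ℚ) (_ : w i = 1) (_ : p i = 0)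
    (_ : ∀ x ∈ Y, ∀ j : Fin 2, (x j.castSucc : ℚ) = p j + x i.castSucc * w j), (Y.card : ℝ) ≤ (K *
    ((N : ℝ) ^ (51 / 100 : ℝ) + f.totalDegree * log N) + M) * f.totalDegree := by
  classical
  obtain ⟨K, hC, hcurve⟩ := affine_curve
  refine ⟨K, hC, fun f hc N hN Y M hM0 hM hY i p w hwi hpi hline => ?_⟩
  have hN2 : (2 : ℝ) ≤ N := mod_cast hN
  have hlog : 0 ≤ log N := log_nonneg (by linarith)
  set d := f.totalDegree with hd
  set q : Fin 3 → MP 2 ℚ := snoc (fun j => C (p j) + X 0 * C (w j)) (X 1) with hq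
  set g : MP 2 ℚ := aeval q f with hg
  have hev : ∀ x : Fin 2 → ℚ, eval x g =
      eval (snoc (fun j => p j + x 0 * w j) (x 1) : Fin 3 → ℚ) f := by
    intro x
    rw [hg, eval_aeval]
    congr 2
    funext k
    refine lastCases ?_ (fun k => ?_) k <;> simp [hq, snoc_apply_two]
  have hg0 : g ≠ 0 := by
    intro h0
    refine lastPoly_ne_zero p (f := f) hd.ge hc (Polynomial.funext fun t => ?_)
    rw [eval_lastPoly, aeval_eq_eval, Polynomial.eval_zero]
    have h1 := hev ![0, t]
    rw [h0, map_zero] at h1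
    simpa using h1.symm
  have hgd : g.totalDegree ≤ d := by
    have := totalDegree_aeval_le q 1 (fun k => ?_) f
    · rwa [one_mul] at this
    · refine lastCases ?_ (fun k => ?_) k
      · simp [hq, snoc_apply_two]
      · simp only [hq, snoc_castSucc]
        refine (totalDegree_add _ _).trans (max_le (by simp) ?_)
        refine (totalDegree_mul _ _).trans ?_
        simp
  set pt : (Fin 3 → ℤ) → Fin 2 → ℤ := fun x => ![x i.castSucc, x 2] with hpt
  have hback : ∀ x ∈ Y, (fun k => (x k : ℚ)) =
      (snoc (fun j => p j + ((pt x 0 : ℤ) : ℚ) * w j) ((pt x 1 : ℤ) : ℚ) : Fin 3 → ℚ) := by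
    intro x hx
    funext k
    refine lastCases ?_ (fun k => ?_) k
    · simp [hpt, snoc_apply_two]
    · simp [hpt, hline x hx k]
  have hinj : InjOn pt Y := by
    intro x hx y hy hxy
    have h1 := hback x hx
    rw [hxy, ← hback y hy] at h1
    funext k
    exact cast_injective (α := ℚ) (congrFun h1 k)
  have key := card_le_mul_totalDegree_of_factors
    (fun x : Fin 3 → ℤ => fun k => ((pt x k : ℤ) : ℚ))
    (K * ((N : ℝ) ^ (51 / 100 : ℝ) + d * log N) + M) hg0 Y ?_ ?_
  · exact key.trans (mul_le_mul_of_nonneg_left (mod_cast hgd) (by positivity))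
  · intro x hx
    rw [hev, ← hback x hx]
    exact (hY x hx).1
  · intro ψ hψ hψg Z hZ hZψ
    have hψd : ψ.totalDegree ≤ d := (totalDegree_le_of_dvd_of_isDomain hψg hg0).trans hgd
    have hψ0 : ψ.totalDegree ≠ 0 := fun h0 => hψ.not_isUnit
      (isUnit_iff_totalDegree_of_isReduced.2 ⟨by
        rw [isUnit_iff_ne_zero]
        intro h1
        refine hψ.ne_zero ?_
        rw [totalDegree_eq_zero_iff_eq_C.1 h0, h1, C_0], h0⟩)
    rcases (show ψ.totalDegree = 1 ∨ 2 ≤ ψ.totalDegree by omega) with h1 | h2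
    · obtain ⟨i', p', w', hw', hp', hl1, hl2⟩ := exists_line_of_totalDegree_eq_one h1
      rw [h1, Nat.cast_one, mul_one]
      have h3 : (Z.card : ℝ) ≤ M := by
        refine hM Z hZ (snoc (fun j => p j + p' 0 * w j) (p' 1) : Fin 3 → ℚ)
          (snoc (fun j => w' 0 * w j) (w' 1) : Fin 3 → ℚ) (fun t => ?_) fun y hy => ?_
        · obtain ⟨r, hr⟩ := hψg
          have h4 := hev fun j => p' j + t * w' j
          rw [hr, map_mul, hl2, zero_mul] at h4
          rw [h4]
          congr 2
          funext k
          refine lastCases ?_ (fun k => ?_) k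
          · simp [snoc_apply_two]
          · simp only [snoc_castSucc]
            ring
        · have h4 := hl1 _ (hZψ y hy)
          refine ⟨((pt y i' : ℤ) : ℚ), fun k => ?_⟩
          have h5 := congrFun (hback y (hZ hy)) k
          rw [h5]
          have h6 := congrFun h4 0
          have h7 := congrFun h4 1
          rw [h6, h7]
          refine lastCases ?_ (fun k => ?_) k
          · simp [snoc_apply_two]
          · simp only [snoc_castSucc]
            ring
      have : 0 ≤ K * ((N : ℝ) ^ (51 / 100 : ℝ) + d * log N) := by positivity
      linarith
    · have h3 := hcurve ψ hψ h2 N hN (Z.image pt) ?_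
      · rw [card_image_of_injOn (hinj.mono (mod_cast hZ))] at h3
        refine h3.trans ?_
        rw [mul_right_comm]
        refine mul_le_mul_of_nonneg_right ?_ (by positivity)
        have h4 : (ψ.totalDegree : ℝ) * log N ≤ d * log N :=
          mul_le_mul_of_nonneg_right (mod_cast hψd) hlog
        have h5 := mul_le_mul_of_nonneg_left (add_le_add_right h4 ((N : ℝ) ^ (51 / 100 : ℝ))) hC
        linarith
      · intro z hz
        obtain ⟨x, hx, rfl⟩ := mem_image.1 hz
        refine ⟨hZψ x hx, fun k => ?_⟩
        have h4 := (hY x (hZ hx)).2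
        fin_cases k
        · exact h4 _
        · exact h4 _

lemma card_curve_zeros_le_of_coeff : ∃ K : ℝ, 0 ≤ K ∧ ∀ (f G : MP 3 ℚ) (_ : Irreducible f) (_ : ¬ f
    ∣ G) (_ : 1 ≤ f.totalDegree) (_ : 1 ≤ G.totalDegree) (_ : coeff (single 2 f.totalDegree) f ≠ 0)
    (N : ℕ) (_ : 2 ≤ N) (X : Finset (Fin 3 → ℤ)) (M : ℝ) (_ : 0 ≤ M) (_ : FewOnLines f X M) (_ : ∀ x
    ∈ X, evQ x f = 0 ∧ evQ x G = 0 ∧ ∀ i, |x i| ≤ N), (X.card : ℝ) ≤ 2 * (f.totalDegree : ℝ) ^ 2 *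
    G.totalDegree * (K * ((N : ℝ) ^ (51 / 100 : ℝ) + f.totalDegree * G.totalDegree * log N) + M) :=
    by
  classical
  obtain ⟨K₁, hK₁, hcurve⟩ := affine_curve
  obtain ⟨K₂, hK₂, hplane⟩ := card_plane_points_le
  refine ⟨2 * K₁ + K₂, by positivity, fun f G hf hfG ha hb hc N hN X M hM0 hM hX => ?_⟩
  have hG : G ≠ 0 := fun h => hfG (h ▸ dvd_zero _)
  obtain ⟨R, hR0, hRd, A, D, hR⟩ := exists_eliminant hf.ne_zero hG
    (hf.isRelPrime_iff_not_dvd.2 hfG) ha hb castSucc (Fin.castSucc_injective 2)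
  have hN2 : (2 : ℝ) ≤ N := mod_cast hN
  have hlog : 0 ≤ log N := log_nonneg (by linarith)
  set d := f.totalDegree with hd
  set b := G.totalDegree with hbb
  have hb1 : (1 : ℝ) ≤ b := mod_cast hb
  have hd1 : (1 : ℝ) ≤ d := mod_cast ha
  set c : ℝ := (2 * K₁ + K₂) * ((N : ℝ) ^ (51 / 100 : ℝ) + d * b * log N) + M with hcc
  have hc0 : 0 ≤ c := by positivity
  have key := card_le_mul_totalDegree_of_factors
    (fun x : Fin 3 → ℤ => fun i : Fin 2 => ((init x : Fin 2 → ℤ) i : ℚ)) (d * c) hR0 X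
    (fun x hx => eval_eliminant hR (hX x hx).1 (hX x hx).2.1) ?_
  · have h1 : (R.totalDegree : ℝ) ≤ 2 * d * b := mod_cast hRd
    calc (X.card : ℝ) ≤ d * c * (2 * d * b) :=
          key.trans (mul_le_mul_of_nonneg_left h1 (by positivity))
      _ = _ := by ring
  intro φ hφ hφR Y hYX hYφ
  have hφd : φ.totalDegree ≤ 2 * d * b := (totalDegree_le_of_dvd_of_isDomain hφR hR0).trans hRd
  have hφ0 : φ.totalDegree ≠ 0 := fun h0 => hφ.not_isUnit
    (isUnit_iff_totalDegree_of_isReduced.2 ⟨by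
      rw [isUnit_iff_ne_zero]
      intro h1
      refine hφ.ne_zero ?_
      rw [totalDegree_eq_zero_iff_eq_C.1 h0, h1, C_0], h0⟩)
  have hfib : Y.card ≤ d * (Y.image fun x => (init x : Fin 2 → ℤ)).card :=
    card_le_of_projection hc Y fun x hx => (hX x (hYX hx)).1
  rcases (show φ.totalDegree = 1 ∨ 2 ≤ φ.totalDegree by omega) with h1 | h2
  · obtain ⟨i, p, w, hw, hp, hl1, -⟩ := exists_line_of_totalDegree_eq_one h1
    have h3 := hplane f hc N hN Y M hM0 (fun Z hZ => hM Z (hZ.trans hYX))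
      (fun x hx => ⟨(hX x (hYX hx)).1, (hX x (hYX hx)).2.2⟩) i p w hw hp
      fun x hx j => congrFun (hl1 _ (hYφ x hx)) j
    rw [h1, Nat.cast_one, mul_one, mul_comm (d : ℝ)]
    refine h3.trans (mul_le_mul_of_nonneg_right ?_ (by positivity))
    have h4 : K₂ * ((N : ℝ) ^ (51 / 100 : ℝ) + d * log N) ≤
        (2 * K₁ + K₂) * ((N : ℝ) ^ (51 / 100 : ℝ) + d * b * log N) := by
      have h5 : (d : ℝ) * log N ≤ d * b * log N :=
        mul_le_mul_of_nonneg_right (le_mul_of_one_le_right (by positivity) hb1) hlog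
      exact mul_le_mul (by linarith) (by linarith) (by positivity) (by positivity)
    linarith
  · have h3 := hcurve φ hφ h2 N hN (Y.image fun x => (init x : Fin 2 → ℤ)) ?_
    · have h4 : (Y.card : ℝ) ≤ d * ((Y.image fun x => (init x : Fin 2 → ℤ)).card : ℝ) := by
        exact_mod_cast hfib
      refine h4.trans ?_
      rw [mul_assoc]
      refine mul_le_mul_of_nonneg_left (h3.trans ?_) (by positivity)
      rw [mul_right_comm]
      refine mul_le_mul_of_nonneg_right ?_ (by positivity)
      have h5 : (φ.totalDegree : ℝ) * log N ≤ 2 * d * b * log N :=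
        mul_le_mul_of_nonneg_right (mod_cast hφd) hlog
      have h6 : 0 ≤ (N : ℝ) ^ (51 / 100 : ℝ) := by positivity
      have h7 : 0 ≤ (d : ℝ) * b * log N := by positivity
      have h8 : K₁ * ((N : ℝ) ^ (51 / 100 : ℝ) + φ.totalDegree * log N) ≤
          K₁ * (2 * ((N : ℝ) ^ (51 / 100 : ℝ) + d * b * log N)) :=
        mul_le_mul_of_nonneg_left (by linarith) hK₁
      have h9 : 0 ≤ K₂ * ((N : ℝ) ^ (51 / 100 : ℝ) + d * b * log N) := by positivity
      rw [hcc]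
      linarith
    · intro y hy
      obtain ⟨x, hx, rfl⟩ := mem_image.1 hy
      exact ⟨hYφ x hx, fun i => (hX x (hYX hx)).2.2 _⟩

lemma exists_shear {f : MP 3 ℚ} (hf : f ≠ 0) : ∃ v : Fin 3 → ℕ, v 2 = 0 ∧ (∀ i, v i ≤ f.totalDegree)
    ∧ coeff (single 2 f.totalDegree) (linSub (shearMat 2 fun i => (v i : ℚ)) f) ≠ 0 := by
  obtain ⟨v, hv, hvd, h⟩ := exists_eval_ne_zero_of_isHomogeneous 2
    (homogeneousComponent_isHomogeneous f.totalDegree f) (homogeneousComponent_totalDegree_ne_zero hf)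
  exact ⟨v, hv, hvd, by rwa [coeff_single_shear]⟩

/-- The inverse of the shear along the last coordinate, on integral points. -/
def unshear (v : Fin 3 → ℕ) (x : Fin 3 → ℤ) : Fin 3 → ℤ := fun i => x i - v i * x 2

section
variable {v : Fin 3 → ℕ} (hv : v 2 = 0)
include hv

lemma shearMat_mulVec_unshear (x : Fin 3 → ℤ) :
    (shearMat 2 fun i => (v i : ℚ)).mulVec (fun i => (unshear v x i : ℚ)) = fun i => (x i : ℚ) := by
  rw [shearMat_mulVec]
  funext i
  simp [unshear, hv]

lemma unshear_injective : Injective (unshear v) := by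
  intro x y h
  have h1 := shearMat_mulVec_unshear hv x
  rw [h, shearMat_mulVec_unshear hv y] at h1
  funext i
  exact cast_injective (α := ℚ) (congrFun h1.symm i)

lemma eval_unshear (x : Fin 3 → ℤ) (f : MP 3 ℚ) : eval (fun i => (unshear v x i : ℚ)) (linSub
    (shearMat 2 fun i => (v i : ℚ)) f) = evQ x f := by
  rw [eval_linSub, shearMat_mulVec_unshear hv]

lemma FewOnLines.unshear {f : MP 3 ℚ} {X : Finset (Fin 3 → ℤ)} {M : ℝ} (h : FewOnLines f X M) :
    FewOnLines (linSub (shearMat 2 fun i => (v i : ℚ)) f) (X.image (unshear v)) M := by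
  intro Y hY p w hl hp
  have hS : ∀ t : ℚ, (shearMat 2 fun i => (v i : ℚ)).mulVec (fun i => p i + t * w i) =
      fun i => (p i + v i * p 2) + t * (w i + v i * w 2) := by
    intro t
    rw [shearMat_mulVec]
    funext i
    ring
  have h1 := h (X.filter fun x => _root_.unshear v x ∈ Y) (filter_subset _ _)
    (fun i => p i + v i * p 2) (fun i => w i + v i * w 2) (fun t => ?_) fun y hy => ?_
  · refine le_trans ?_ h1
    have : Y.card ≤ ((X.filter fun x => _root_.unshear v x ∈ Y).image (_root_.unshear v)).card := by
      refine card_le_card fun y hy => ?_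
      obtain ⟨x, hx, rfl⟩ := mem_image.1 (hY hy)
      exact mem_image_of_mem _ (mem_filter.2 ⟨hx, hy⟩)
    exact_mod_cast this.trans Finset.card_image_le
  · rw [← hS, ← eval_linSub]
    exact hl t
  · obtain ⟨t, ht⟩ := hp _ (mem_filter.1 hy).2
    refine ⟨t, fun i => ?_⟩
    have h2 := shearMat_mulVec_unshear hv y
    rw [show (fun i => (_root_.unshear v y i : ℚ)) = fun i => p i + t * w i from funext ht, hS] at h2
    exact (congrFun h2 i).symm

end

lemma abs_unshear_le {v : Fin 3 → ℕ} {B : ℕ} (hvd : ∀ i, v i ≤ d) {x : Fin 3 → ℤ}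
    (hx : ∀ i, |x i| ≤ B) (i : Fin 3) : |unshear v x i| ≤ ((d + 1) * B : ℕ) := by
  have h1 : |(v i : ℤ) * x 2| ≤ d * B := by
    rw [abs_mul, abs_cast]
    exact mul_le_mul (mod_cast hvd i) (hx 2) (abs_nonneg _) (by positivity)
  have h2 := abs_sub (x i) (v i * x 2)
  have h3 := hx i
  push_cast
  simp only [unshear]
  linarith

lemma isRelPrime_map {R S : Type*} [CommMonoid R] [CommMonoid S] (e : R ≃* S) {a b : R}
    (h : IsRelPrime a b) : IsRelPrime (e a) (e b) := fun c ha hb => by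
  have := h (d := e.symm c) (by simpa using map_dvd e.symm ha) (by simpa using map_dvd e.symm hb)
  simpa using this.map e

theorem card_common_zeros_le {f G : MP 3 ℚ} (hG : G ≠ 0) (hrel : IsRelPrime f G) (ha : 1 ≤
    f.totalDegree) {b : ℕ} (hGb : G.totalDegree ≤ b) {B : ℕ} (hB : 1 ≤ B) (X : Finset (Fin 3 → ℤ))
    (hX : ∀ x ∈ X, evQ x f = 0 ∧ evQ x G = 0 ∧ ∀ i, |x i| ≤ B) : X.card ≤ 10 * f.totalDegree ^ 3 * b
    * B := by
  classical
  have hf : f ≠ 0 := by rintro rfl; simp at ha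
  rcases Nat.eq_zero_or_pos G.totalDegree with hb | hb
  · have : X = ∅ := by
      refine Finset.eq_empty_of_forall_notMem fun x hx => ?_
      have h1 := (hX x hx).2.1
      rw [totalDegree_eq_zero_iff_eq_C.1 hb, eval_C] at h1
      exact hG (by rw [totalDegree_eq_zero_iff_eq_C.1 hb, h1, C_0])
    simp [this]
  obtain ⟨v, hv, hvd, hc⟩ := exists_shear hf
  have hMN := shearMat_mul 2 (fun i => (v i : ℚ)) (by simp [hv])
  set d := f.totalDegree with hd
  have hrel' : IsRelPrime (linSub (shearMat 2 fun i => (v i : ℚ)) f) (linSub _ G) :=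
    isRelPrime_map (linEquiv _ _ hMN).toMulEquiv hrel
  have h := card_common_zeros_le_of_coeff (linSub_ne_zero hMN hG)
    hrel' (by rwa [totalDegree_linSub hMN])
    (by rwa [totalDegree_linSub hMN]) (by rw [totalDegree_linSub hMN]; exact hc) ((d + 1) * B)
    (X.image (unshear v)) ?_
  · rw [card_image_of_injective _ (unshear_injective hv), totalDegree_linSub hMN,
      totalDegree_linSub hMN] at h
    refine h.trans ?_
    have h1 : 2 * ((d + 1) * B) + 1 ≤ 5 * d * B := by
      have : B ≤ d * B := Nat.le_mul_of_pos_left _ ha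
      nlinarith
    calc 2 * d ^ 2 * G.totalDegree * (2 * ((d + 1) * B) + 1) ≤ 2 * d ^ 2 * b * (5 * d * B) :=
          Nat.mul_le_mul (Nat.mul_le_mul_left _ hGb) h1
      _ = _ := by ring
  · intro y hy
    obtain ⟨x, hx, rfl⟩ := mem_image.1 hy
    exact ⟨by rw [eval_unshear hv]; exact (hX x hx).1, by rw [eval_unshear hv]; exact (hX x hx).2.1,
      abs_unshear_le hvd (hX x hx).2.2⟩

/-- Distinct points of `X` on a common line of the surface are far apart. -/
def Spread (f : MP 3 ℚ) (B : ℕ) (X : Finset (Fin 3 → ℤ)) : Prop :=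
  ∀ x ∈ X, ∀ y ∈ X, x ≠ y → (∀ t : ℚ, eval (fun i => (x i : ℚ) + t * (y i - x i)) f = 0) →
    ∃ i, (B : ℤ) < (y i - x i) ^ 2

lemma Spread.fewOnLines {f : MP 3 ℚ} {B : ℕ} (hB : 1 ≤ B) {X : Finset (Fin 3 → ℤ)} (h : Spread f B
    X) (hX : ∀ x ∈ X, ∀ i, |x i| ≤ B) : FewOnLines f X (2 * sqrt B + 1) := by
  classical
  intro Y hY p w hl hp
  choose! τ hτ using hp
  obtain ⟨i, -, hi⟩ := Finset.exists_max_image univ (fun i => |w i|) Finset.univ_nonempty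
  set s := Nat.sqrt B with hs
  have hgap : ∀ x ∈ Y, ∀ y ∈ Y, x ≠ y → (s : ℤ) < |y i - x i| := by
    intro x hx y hy hxy
    have hd : ∀ j, (y j : ℚ) - x j = (τ y - τ x) * w j := fun j => by
      rw [hτ y hy, hτ x hx]
      ring
    obtain ⟨j, hj⟩ := h x (hY hx) y (hY hy) hxy fun t => by
      rw [← hl (τ x + t * (τ y - τ x))]
      congr 2
      funext j
      rw [hd, hτ x hx]
      ring
    have h1 : |y j - x j| ≤ |y i - x i| := by
      have : |(y j : ℚ) - x j| ≤ |(y i : ℚ) - x i| := by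
        rw [hd, hd, abs_mul, abs_mul]
        exact mul_le_mul_of_nonneg_left (hi j (mem_univ _)) (abs_nonneg _)
      exact_mod_cast this
    refine lt_of_lt_of_le ?_ h1
    refine lt_of_pow_lt_pow_left₀ 2 (abs_nonneg _) ?_
    rw [sq_abs]
    refine lt_of_le_of_lt ?_ hj
    exact_mod_cast Nat.sqrt_le' B
  have hinj : InjOn (fun x : Fin 3 → ℤ => (x i + B) / (s + 1)) Y := by
    intro x hx y hy hxy
    by_contra hne
    have h1 := hgap x hx y hy hne
    simp only at hxy
    have h2 := Int.mul_ediv_add_emod (x i + B) (s + 1)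
    have h3 := Int.mul_ediv_add_emod (y i + B) (s + 1)
    rw [hxy] at h2
    have h4 := Int.emod_nonneg (x i + B) (b := s + 1) (by omega)
    have h5 := Int.emod_nonneg (y i + B) (b := s + 1) (by omega)
    have h6 := Int.emod_lt_of_pos (x i + B) (b := s + 1) (by omega)
    have h7 := Int.emod_lt_of_pos (y i + B) (b := s + 1) (by omega)
    rw [lt_abs] at h1
    rcases h1 with h1 | h1 <;> linarith
  have hcard : Y.card ≤ (Icc 0 ((2 * B : ℤ) / (s + 1))).card := by
    refine card_le_card_of_injOn _ (fun x hx => ?_) hinj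
    have h1 := abs_le.1 (hX x (hY hx) i)
    rw [coe_Icc, Set.mem_Icc]
    exact ⟨Int.ediv_nonneg (by linarith) (by omega), Int.ediv_le_ediv (by omega) (by linarith)⟩
  rw [Int.card_Icc, sub_zero] at hcard
  have hB0 : (0 : ℝ) < B := mod_cast hB
  have h1 : sqrt B ≤ (s : ℝ) + 1 := by
    rw [Real.sqrt_le_left (by positivity)]
    have := (Nat.lt_succ_sqrt' B).le
    exact_mod_cast this
  have h2 : (((2 * B : ℤ) / (s + 1) : ℤ) : ℝ) ≤ 2 * sqrt B := by
    have h3 : (((2 * B : ℤ) / (s + 1) : ℤ) : ℝ) * (s + 1) ≤ 2 * B := by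
      exact_mod_cast Int.ediv_mul_le (2 * B : ℤ) (b := s + 1) (by omega)
    have h4 : (0 : ℝ) ≤ (((2 * B : ℤ) / (s + 1) : ℤ) : ℝ) := by
      exact Int.cast_nonneg (Int.ediv_nonneg (by positivity) (by positivity))
    have h5 := (mul_le_mul_of_nonneg_left h1 h4).trans h3
    have h6 : (2 : ℝ) * B = 2 * sqrt B * sqrt B := by
      rw [mul_assoc, Real.mul_self_sqrt hB0.le]
    rw [h6] at h5
    exact le_of_mul_le_mul_right h5 (Real.sqrt_pos.2 hB0)
  have h3 : ((((2 * B : ℤ) / (s + 1) + 1).toNat : ℤ) : ℝ) = (((2 * B : ℤ) / (s + 1) : ℤ) : ℝ) + 1 := by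
    rw [Int.toNat_of_nonneg (add_nonneg (Int.ediv_nonneg (by positivity) (by positivity)) zero_le_one)]
    push_cast
    ring
  have h4 : (Y.card : ℝ) ≤ ((((2 * B : ℤ) / (s + 1) + 1).toNat : ℤ) : ℝ) := mod_cast hcard
  linarith

theorem card_curve_zeros_le : ∃ K : ℝ, 0 ≤ K ∧ ∀ (f G : MP 3 ℚ) (_ : Irreducible f) (_ : ¬ f ∣ G) (_
    : 1 ≤ f.totalDegree) (b : ℕ) (_ : G.totalDegree ≤ b) (B : ℕ) (_ : 2 ≤ B) (X : Finset (Fin 3 →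
    ℤ)) (_ : Spread f B X) (_ : ∀ x ∈ X, evQ x f = 0 ∧ evQ x G = 0 ∧ ∀ i, |x i| ≤ B), (X.card : ℝ) ≤
    K * (f.totalDegree : ℝ) ^ 4 * b * ((B : ℝ) ^ (51 / 100 : ℝ) + f.totalDegree * b * log B) := by
  classical
  obtain ⟨K, hK, hmain⟩ := card_curve_zeros_le_of_coeff
  refine ⟨20 * K + 6, by positivity, fun f G hf hfG ha b hGb B hB X hS hX => ?_⟩
  have hG : G ≠ 0 := fun h => hfG (h ▸ dvd_zero _)
  have hB2 : (2 : ℝ) ≤ B := mod_cast hB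
  have hlog : 0 ≤ log B := log_nonneg (by linarith)
  rcases Nat.eq_zero_or_pos G.totalDegree with hb | hb
  · have : X = ∅ := by
      refine Finset.eq_empty_of_forall_notMem fun x hx => ?_
      have h1 := (hX x hx).2.1
      rw [totalDegree_eq_zero_iff_eq_C.1 hb, eval_C] at h1
      exact hG (by rw [totalDegree_eq_zero_iff_eq_C.1 hb, h1, C_0])
    simp only [this, Finset.card_empty, Nat.cast_zero]
    positivity
  obtain ⟨v, hv, hvd, hc⟩ := exists_shear hf.ne_zero
  have hMN := shearMat_mul 2 (fun i => (v i : ℚ)) (by simp [hv])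
  set d := f.totalDegree with hd
  have h := hmain _ (linSub (shearMat 2 fun i => (v i : ℚ)) G) (irreducible_linSub hMN hf)
    (by rwa [linSub_dvd_iff hMN]) (by rwa [totalDegree_linSub hMN])
    (by rwa [totalDegree_linSub hMN]) (by rw [totalDegree_linSub hMN]; exact hc) ((d + 1) * B)
    (hB.trans (Nat.le_mul_of_pos_left _ (by omega)))
    (X.image (unshear v)) _ (by positivity)
    ((hS.fewOnLines (by omega) fun x hx => (hX x hx).2.2).unshear hv) ?_
  · rw [card_image_of_injective _ (unshear_injective hv), totalDegree_linSub hMN,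
      totalDegree_linSub hMN] at h
    refine h.trans ?_
    have hd1 : (1 : ℝ) ≤ d := mod_cast ha
    have hd4 : (d : ℝ) ^ 2 ≤ d ^ 2 * d ^ 2 := by
      refine le_mul_of_one_le_right (by positivity) (one_le_pow₀ hd1)
    have hB0 : (0 : ℝ) < B := by linarith
    set β := (B : ℝ) ^ (51 / 100 : ℝ) with hβ
    set L := log B with hL
    have hβ1 : 1 ≤ β := one_le_rpow (by linarith) (by norm_num)
    have hN : (((d + 1) * B : ℕ) : ℝ) ≤ 2 * d * B := by
      push_cast
      exact mul_le_mul_of_nonneg_right (by linarith) hB0.le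
    have hN0 : (0 : ℝ) < (((d + 1) * B : ℕ) : ℝ) := by
      push_cast
      positivity
    have h1 : (((d + 1) * B : ℕ) : ℝ) ^ (51 / 100 : ℝ) ≤ 2 * d * β := by
      refine (rpow_le_rpow hN0.le hN (by norm_num)).trans ?_
      rw [mul_rpow (by positivity) hB0.le]
      refine mul_le_mul_of_nonneg_right ?_ (by positivity)
      exact Real.rpow_le_self_of_one_le (by linarith) (by norm_num)
    have hL2 : 1 / 2 ≤ L := by
      have h2 : log 2 ≤ L := log_le_log (by norm_num) hB2
      have := log_two_gt_d9
      linarith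
    have h2 : log (((d + 1) * B : ℕ) : ℝ) ≤ 5 * d * L := by
      refine (log_le_log hN0 hN).trans ?_
      rw [log_mul (by positivity) hB0.ne']
      have h3 := Real.log_le_sub_one_of_pos (show (0 : ℝ) < 2 * d by positivity)
      have h4 : (d : ℝ) * (1 / 2) ≤ d * L := mul_le_mul_of_nonneg_left hL2 (by positivity)
      have h5 : L ≤ d * L := le_mul_of_one_le_left hlog hd1
      linarith
    have h3 : 2 * sqrt B + 1 ≤ 3 * β := by
      have : sqrt B ≤ β := by
        rw [Real.sqrt_eq_rpow]
        exact Real.rpow_le_rpow_of_exponent_le (by linarith) (by norm_num)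
      linarith
    have hGb' : (G.totalDegree : ℝ) ≤ b := mod_cast hGb
    have hb0 : (0 : ℝ) ≤ b := by positivity
    have h4 : (d : ℝ) * G.totalDegree * log (((d + 1) * B : ℕ) : ℝ) ≤ d * b * (5 * d * L) :=
      mul_le_mul (mul_le_mul_of_nonneg_left hGb' (by positivity)) h2
        (log_nonneg (mod_cast (show 1 ≤ (d + 1) * B by nlinarith))) (by positivity)
    have h5 : K * ((((d + 1) * B : ℕ) : ℝ) ^ (51 / 100 : ℝ) +
        d * G.totalDegree * log (((d + 1) * B : ℕ) : ℝ)) + (2 * sqrt B + 1) ≤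
        K * (2 * d * β + d * b * (5 * d * L)) + 3 * β :=
      add_le_add (mul_le_mul_of_nonneg_left (add_le_add h1 h4) hK) h3
    have h6 : K * (2 * d * β + d * b * (5 * d * L)) + 3 * β ≤
        (10 * K + 3) * d ^ 2 * (β + d * b * L) := by
      have e1 : (d : ℝ) * β ≤ d ^ 2 * β := by
        refine mul_le_mul_of_nonneg_right ?_ (by positivity)
        exact le_self_pow₀ hd1 two_ne_zero
      have e2 : β ≤ d ^ 2 * β := le_mul_of_one_le_left (by positivity) (one_le_pow₀ hd1)
      have e3 : (d : ℝ) * b * (d * L) ≤ d ^ 2 * (d * b * L) := by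
        have : (d : ℝ) * b * (d * L) = d * (d * b * L) := by ring
        rw [this]
        exact mul_le_mul_of_nonneg_right (le_self_pow₀ hd1 two_ne_zero) (by positivity)
      have e4 := mul_le_mul_of_nonneg_left e1 hK
      have e5 := mul_le_mul_of_nonneg_left e3 hK
      have e6 : 0 ≤ K * (d ^ 2 * β) := by positivity
      have e7 : 0 ≤ K * (d ^ 2 * (d * b * L)) := by positivity
      have e8 : 0 ≤ (d : ℝ) ^ 2 * (d * b * L) := by positivity
      have e9 : K * (2 * d * β + d * b * (5 * d * L)) + 3 * β =
        2 * (K * (d * β)) + 5 * (K * (d * b * (d * L))) + 3 * β := by ring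
      have e10 : (10 * K + 3) * d ^ 2 * (β + d * b * L) = 10 * (K * (d ^ 2 * β)) +
        10 * (K * (d ^ 2 * (d * b * L))) + 3 * (d ^ 2 * β) + 3 * (d ^ 2 * (d * b * L)) := by ring
      rw [e9, e10]
      linarith
    calc _ ≤ 2 * (d : ℝ) ^ 2 * b * ((10 * K + 3) * d ^ 2 * (β + d * b * L)) := by
          refine mul_le_mul (mul_le_mul_of_nonneg_left hGb' (by positivity)) (h5.trans h6) ?_
            (by positivity)
          have := log_nonneg (show (1 : ℝ) ≤ (((d + 1) * B : ℕ) : ℝ) by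
            exact_mod_cast (show 1 ≤ (d + 1) * B by nlinarith))
          positivity
      _ = _ := by ring
  · intro y hy
    obtain ⟨x, hx, rfl⟩ := mem_image.1 hy
    exact ⟨by rw [eval_unshear hv]; exact (hX x hx).1, by rw [eval_unshear hv]; exact (hX x hx).2.1,
      abs_unshear_le hvd (hX x hx).2.2⟩

lemma exists_smooth_multiple_three (f : MP 3 ℚ) (hf : Irreducible f) (hd : f.totalDegree = d) (hd1 :
    1 ≤ d) (hder : pderiv 2 f ≠ 0) (B : ℕ) (hB : 2 ≤ B) (S : Finset (Fin 3 → ℤ)) (hS : ∀ x ∈ S, evQ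
    x f = 0 ∧ ∀ i, |x i| ≤ B) : ∃ g h : MP 3 ℤ, g.totalDegree ≤ 2 * d ∧ h.totalDegree ≤ 2 * d ∧ ¬ f
    ∣ map (castRingHom ℚ) h ∧ (∀ x ∈ S, |eval x h| ≤ (B : ℤ) ^ (80 * d)) ∧ ((h = pderiv 2 g ∧ ∀ x ∈
    S, eval x g = 0) ∨ ∀ x ∈ S, eval x h = 0) := by
  classical
  have hpt : ∀ x : Fin 3 → ℤ, (fun i => ((1 : ℤ) : ℚ)⁻¹ * (x i : ℚ)) = fun i => (x i : ℚ) := by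
    intro x
    simp
  obtain ⟨g, h, hg, hh, -, hfh, hb, hc⟩ := exists_smooth_multiple (m := 2) le_rfl f hf hd hd1 hder
    (card_monoms_double_three hd1) B hB (S.image fun x => ((1 : ℤ), x)) (Finset.finite_toSet _) (by
      intro x hx
      obtain ⟨y, hy, rfl⟩ := mem_image.1 (mem_coe.1 hx)
      refine ⟨one_ne_zero, ?_, ?_, (hS y hy).2⟩
      · rw [hpt]
        exact (hS y hy).1
      · rw [abs_one]
        exact_mod_cast (by omega : 1 ≤ B))
  have hmem : ∀ x ∈ S, ((1 : ℤ), x) ∈ (↑(S.image fun x => ((1 : ℤ), x)) : Set (ℤ × (Fin 3 → ℤ))) :=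
    fun x hx => mem_coe.2 (mem_image_of_mem _ hx)
  refine ⟨g, h, hg, hh, hfh, fun x hx => ?_, ?_⟩
  · have := hb _ (hmem x hx)
    rwa [hval_one] at this
  · refine hc.imp (fun hc => ⟨hc.1, fun x hx => ?_⟩) fun hc x hx => ?_
    · have : evQ x (map (castRingHom ℚ) g) = 0 := by
        obtain ⟨q, hq⟩ := hc.2
        rw [hq, map_mul, (hS x hx).1, zero_mul]
      rw [eval_map_intCast] at this
      exact_mod_cast this
    · have := hc _ (hmem x hx)
      rw [hpt, eval_map_intCast] at this
      exact_mod_cast this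

lemma exists_class_polynomial {r : ℕ} (hr : 1 ≤ r) (hs : (monoms 3 (6 * r ^ 2)).card = s) (g : MP 3
    ℤ) (hp : p.Prime) {B : ℕ} (hB : 1 ≤ B) (S : Finset (Fin 3 → ℤ)) (hS : ∀ x ∈ S, eval x g = 0 ∧ ¬
    (p : ℤ) ∣ eval x (pderiv 2 g) ∧ ∀ i, |x i| ≤ B) (hcong : ∀ x ∈ S, ∀ y ∈ S, (fun i => ((x i : ℤ)
    : ZMod p)) = fun i => ((y i : ℤ) : ZMod p)) (hsize : s.factorial * B ^ (6 * r ^ 2 * s) < p ^ (3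
    * r ^ 3 * s)) : ∃ G : MP 3 ℚ, G ≠ 0 ∧ G.totalDegree ≤ 6 * r ^ 2 ∧ ∀ x ∈ S, evQ x G = 0 := by
  classical
  subst hs
  set E := monoms 3 (6 * r ^ 2) with hE
  obtain ⟨G, hG0, hGE, hG⟩ := exists_poly_of_minors E (S : Set (Fin 3 → ℤ))
    (fun x α => ∏ i, x i ^ α i) (by
      intro e he
      by_contra hne
      have hcard : (univ.image fun j => fun i => ((e j i : ℤ) : ZMod p)).card ≤ 1 := by
        refine Finset.card_le_one.2 fun a ha b hb => ?_
        obtain ⟨i, -, rfl⟩ := mem_image.1 ha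
        obtain ⟨j, -, rfl⟩ := mem_image.1 hb
        exact hcong _ (he i) _ (he j)
      have h := det_eval_dvd g p hp (6 * r ^ 3) e (fun i => monomial (E.equivFin.symm i).1 1)
        univ (fun j _ => by rw [(hS _ (he j)).1]; exact dvd_zero _)
        (fun j _ => (hS _ (he j)).2.1) (fun j i => ∏ l, e j l ^ (E.equivFin.symm i).1 l) (fun _ => 1)
        (fun j _ i => by
          rw [eval_monomial, prod_fintype _ _ (by simp)]
          simp) hcard
      rw [card_univ, card_fin, one_mul] at h
      have hle : 3 * r ^ 3 * E.card ≤ 6 * r ^ 3 * E.card - kap 2 (6 * r ^ 3) := by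
        have h1 := kap_two (6 * r ^ 3)
        have h2 : 36 * r ^ 6 ≤ E.card := by
          rw [hE, card_monoms]
          have h3 := Nat.pow_sub_le_descFactorial (6 * r ^ 2 + 2 + 1) (2 + 1)
          rw [Nat.descFactorial_eq_factorial_mul_choose] at h3
          have h4 : (6 * r ^ 2) ^ 3 ≤ (6 * r ^ 2 + 2 + 1 + 1 - (2 + 1)) ^ (2 + 1) :=
            pow_le_pow_left (by omega) _
          have h5 : (6 * r ^ 2) ^ 3 = 6 * (36 * r ^ 6) := by ring
          have h6 : (2 + 1).factorial = 6 := rfl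
          rw [h6] at h3
          omega
        set q := r ^ 3 with hq
        have h7 : 36 * q ^ 2 ≤ E.card := by rw [hq, ← pow_mul]; exact h2
        have hq1 : 1 ≤ q := one_le_pow _ _ hr
        have h8 : 6 * kap 2 (6 * q) ≤ 6 * (3 * q * E.card) := by
          rw [h1]
          have h9 : (6 * q + 1) * (6 * q + 2) ≤ 3 * E.card := by nlinarith
          calc _ = 6 * q * ((6 * q + 1) * (6 * q + 2)) := by ring
            _ ≤ 6 * q * (3 * E.card) := Nat.mul_le_mul_left _ h9
            _ = _ := by ring
        have h10 : 6 * q * E.card = 2 * (3 * q * E.card) := by ring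
        omega
      have h1 := Int.le_of_dvd (abs_pos.2 hne) ((dvd_abs _ _).2 ((pow_dvd_pow (p : ℤ) hle).trans h))
      have h2 := abs_det_le (fun j i => ∏ l, e j l ^ (E.equivFin.symm i).1 l)
        (fun _ => (B : ℤ) ^ (6 * r ^ 2)) (fun j i => (abs_prod_pow_le _ B (hS _ (he j)).2.2 _).trans
          (pow_le_pow_right₀ (mod_cast hB) (mem_monoms.1 (E.equivFin.symm i).2)))
      rw [Finset.prod_const, card_univ, card_fin, ← pow_mul] at h2
      have h3 := h1.trans h2
      have h4 : p ^ (3 * r ^ 3 * E.card) ≤ E.card.factorial * B ^ (6 * r ^ 2 * E.card) := by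
        exact_mod_cast h3
      omega)
  refine ⟨G, hG0, totalDegree_le_iff.2 hGE, fun x hx => ?_⟩
  rw [eval_eq', sum_subset hGE, ← hG x hx]
  · exact sum_congr rfl fun α _ => by push_cast; rfl
  · intro α _ hα
    rw [notMem_support_iff.1 hα, zero_mul]

lemma card_le_of_curve_bounds : ∃ K D : ℕ, 1 ≤ K ∧ ∀ (d : ℕ) (_ : D < d) (f : MP 3 ℚ) (_ :
    Irreducible f) (_ : f.totalDegree = d) (_ : pderiv 2 f ≠ 0) (B : ℕ) (_ : 2 ≤ B) (S : Finset (Fin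
    3 → ℤ)) (_ : ∀ x ∈ S, evQ x f = 0 ∧ ∀ i, |x i| ≤ B) (M₁ M₂ : ℝ) (_ : 0 ≤ M₂) (_ : ∀ G : MP 3 ℚ,
    ¬ f ∣ G → G.totalDegree ≤ 2 * d → ∀ X ⊆ S, (∀ x ∈ X, evQ x G = 0) → (X.card : ℝ) ≤ M₁) (_ : ∀ G
    : MP 3 ℚ, G ≠ 0 → G.totalDegree ≤ D → ∀ X ⊆ S, (∀ x ∈ X, evQ x G = 0) → (X.card : ℝ) ≤ M₂),
    (S.card : ℝ) ≤ M₁ + K * d ^ 3 * (B : ℝ) ^ (1 / 100 : ℝ) * M₂ := by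
  classical
  obtain ⟨r, hr⟩ : ∃ r : ℕ, r = 400 := ⟨_, rfl⟩
  obtain ⟨s, hs⟩ : ∃ s, (monoms 3 (6 * r ^ 2)).card = s := ⟨_, rfl⟩
  have hs1 : 1 ≤ s := by
    rw [← hs, card_monoms]
    exact Nat.choose_pos (by omega)
  obtain ⟨K, hK, hprime⟩ := exists_prime_avoiding
  set c := 32000 + s.factorial with hc
  refine ⟨4 * (K * (2 * c)) ^ 2, 6 * r ^ 2, Nat.mul_pos (by norm_num) (by positivity),
    fun d hD f hf hd hder B hB S hS M₁ M₂ hM₂ h₁ h₂ => ?_⟩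
  have hd1 : 1 ≤ d := by omega
  obtain ⟨g, h, hgd, hhd, hfh, hb, hcase⟩ := exists_smooth_multiple_three f hf hd hd1 hder B hB S hS
  set S₁ := S.filter fun x => ¬ eval x h = 0 with hS₁
  have hS₁S : S₁ ⊆ S := filter_subset _ _
  have hB1 : (1 : ℝ) < B := mod_cast (by omega : 1 < B)
  set β := (B : ℝ) ^ (1 / 200 : ℝ) with hβ
  have hβ1 : 1 ≤ β := one_le_rpow hB1.le (by norm_num)
  have hββ : (B : ℝ) ^ (1 / 100 : ℝ) = β ^ 2 := by
    rw [hβ, ← rpow_natCast, ← rpow_mul (by positivity)]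
    norm_num
  have hsplit : (S.card : ℝ) ≤ M₁ + S₁.card := by
    have e1 : ((S.filter fun x => eval x h = 0).card : ℝ) ≤ M₁ :=
      h₁ (map (castRingHom ℚ) h) hfh ((totalDegree_map_intCast h).le.trans hhd) _
        (filter_subset _ _) fun x hx => by
          rw [eval_map_intCast, (mem_filter.1 hx).2, cast_zero]
    have e2 := card_filter_add_card_filter_not (s := S) (fun x => eval x h = 0)
    have e3 : (S.card : ℝ) = (S.filter fun x => eval x h = 0).card + S₁.card := mod_cast e2.symm
    linarith
  suffices hmain : (S₁.card : ℝ) ≤ 4 * d * (K * (2 * (c * d * β))) ^ 2 * M₂ by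
    rw [hββ]
    push_cast
    calc (S.card : ℝ) ≤ M₁ + S₁.card := hsplit
      _ ≤ M₁ + 4 * d * (K * (2 * (c * d * β))) ^ 2 * M₂ := by linarith
      _ = _ := by ring
  rcases hcase with ⟨rfl, hg⟩ | hall
  swap
  · have : S₁ = ∅ := Finset.filter_eq_empty_iff.2 fun x hx h => h (hall x hx)
    rw [this]
    simpa using by positivity
  set P := ⌈c * d * β⌉₊ with hP
  have hd1' : (1 : ℝ) ≤ d := mod_cast hd1
  have hc1 : (1 : ℝ) ≤ c := mod_cast (by omega : 1 ≤ c)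
  have hcdβ : 1 ≤ c * d * β := one_le_mul_of_one_le_of_one_le (one_le_mul_of_one_le_of_one_le hc1 hd1') hβ1
  have hP1 : c * d * β ≤ (P : ℝ) := le_ceil _
  have hP2 : (P : ℝ) ≤ 2 * (c * d * β) := by
    have := (Nat.ceil_lt_add_one (show 0 ≤ c * d * β by positivity)).le
    linarith
  obtain ⟨p, hp, hPp, hpK, hhalf⟩ := hprime S₁ (fun x => eval x (pderiv 2 g)) (80 * d * log B) P
    (mod_cast hcdβ.trans hP1) (fun x hx => (mem_filter.1 hx).2) (by
      intro x hx
      have e1 := hb x (hS₁S hx)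
      have e2 : log |((eval x (pderiv 2 g) : ℤ) : ℝ)| ≤ log ((B : ℝ) ^ (80 * d)) := by
        apply log_le_log
        · exact abs_pos.2 (mod_cast (mem_filter.1 hx).2)
        · exact_mod_cast e1
      rw [log_pow] at e2
      exact_mod_cast e2) (by
      refine le_trans ?_ hP1
      have e1 := log_le_rpow_div (show (0 : ℝ) ≤ B by positivity) (show (0 : ℝ) < 1 / 200 by norm_num)
      rw [← hβ] at e1
      have e2 : (d : ℝ) * log B ≤ d * (200 * β) :=
        mul_le_mul_of_nonneg_left (by linarith) (by positivity)
      have e3 : (32000 : ℝ) ≤ c := mod_cast (by omega : 32000 ≤ c)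
      have e4 : (32000 : ℝ) * (d * β) ≤ c * (d * β) := mul_le_mul_of_nonneg_right e3 (by positivity)
      have e5 : 2 * (80 * d * log B) = 160 * (d * log B) := by ring
      have e6 : (c : ℝ) * d * β = c * (d * β) := by ring
      rw [e5, e6]
      linarith)
  set S₂ := S₁.filter fun x => ¬ (p : ℤ) ∣ eval x (pderiv 2 g) with hS₂
  have hS₂S : S₂ ⊆ S := (filter_subset _ _).trans hS₁S
  have hcard2 : S₁.card ≤ 2 * S₂.card := by
    have e1 : (S₁.filter fun x => (p : ℤ) ∣ eval x (pderiv 2 g)).card + S₂.card = S₁.card := by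
      convert card_filter_add_card_filter_not (s := S₁) (fun x => (p : ℤ) ∣ eval x (pderiv 2 g))
    have e2 : 2 * (S₁.filter fun x => (p : ℤ) ∣ eval x (pderiv 2 g)).card ≤ S₁.card := hhalf
    omega
  set ρ : (Fin 3 → ℤ) → Fin 3 → ZMod p := fun x i => ((x i : ℤ) : ZMod p) with hρ
  have himg : (S₂.image ρ).card ≤ 2 * d * p ^ 2 := card_image_smooth_le g hgd p hp S₂ (fun x => x)
      (fun x hx => by rw [hg x (hS₂S hx)]; exact dvd_zero _) fun x hx => (mem_filter.1 hx).2
  have hsize : s.factorial * B ^ (6 * r ^ 2 * s) < p ^ (3 * r ^ 3 * s) := by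
    have e0 : (s.factorial : ℝ) * β < p := by
      refine lt_of_le_of_lt ?_ (lt_of_le_of_lt hP1 (mod_cast hPp))
      refine mul_le_mul_of_nonneg_right ?_ (by positivity)
      have e1 : (s.factorial : ℝ) ≤ c := mod_cast (by omega : s.factorial ≤ c)
      nlinarith
    have e1 : 3 * r ^ 3 * s = 200 * (6 * r ^ 2 * s) := by rw [hr]; ring
    have e2 : (β ^ (3 * r ^ 3 * s) : ℝ) = B ^ (6 * r ^ 2 * s) := by
      rw [e1, pow_mul, hβ, ← rpow_natCast _ 200, ← rpow_mul (by positivity)]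
      norm_num
    have hr0 : 3 * r ^ 3 * s ≠ 0 := by rw [hr]; omega
    have e3 := pow_lt_pow_left₀ e0 (by positivity) hr0
    rw [mul_pow, e2] at e3
    have e4 : (s.factorial : ℝ) ≤ (s.factorial : ℝ) ^ (3 * r ^ 3 * s) :=
      le_self_pow₀ (mod_cast Nat.factorial_pos s) hr0
    have e5 : (s.factorial : ℝ) * (B : ℝ) ^ (6 * r ^ 2 * s) < (p : ℝ) ^ (3 * r ^ 3 * s) :=
      lt_of_le_of_lt (mul_le_mul_of_nonneg_right e4 (by positivity)) e3
    exact_mod_cast e5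
  have hfib : ∀ a ∈ S₂.image ρ, ((S₂.filter fun x => ρ x = a).card : ℝ) ≤ M₂ := by
    intro a _
    have hsub : (S₂.filter fun x => ρ x = a) ⊆ S₂ := filter_subset _ _
    obtain ⟨G, hG0, hGd, hG⟩ := exists_class_polynomial (r := r) (by omega) hs g hp (by omega : 1 ≤ B)
      (S₂.filter fun x => ρ x = a) (fun x hx => ⟨hg x (hS₂S (hsub hx)),
        (mem_filter.1 (hsub hx)).2, (hS x (hS₂S (hsub hx))).2⟩)
      (fun x hx y hy => (mem_filter.1 hx).2.trans (mem_filter.1 hy).2.symm) hsize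
    exact h₂ G hG0 hGd _ (hsub.trans hS₂S) hG
  have e1 : (S₂.card : ℝ) ≤ (S₂.image ρ).card * M₂ := by
    rw [Finset.card_eq_sum_card_image ρ S₂]
    push_cast
    refine (sum_le_sum hfib).trans ?_
    rw [sum_const, nsmul_eq_mul]
  have e2 : ((S₂.image ρ).card : ℝ) ≤ 2 * d * p ^ 2 := mod_cast himg
  have e3 : (p : ℝ) ≤ K * (2 * (c * d * β)) := by
    have : (p : ℝ) ≤ K * P := mod_cast hpK
    exact this.trans (mul_le_mul_of_nonneg_left hP2 (by positivity))
  have e4 : (p : ℝ) ^ 2 ≤ (K * (2 * (c * d * β))) ^ 2 := pow_le_pow_left₀ (by positivity) e3 2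
  calc (S₁.card : ℝ) ≤ 2 * S₂.card := mod_cast hcard2
    _ ≤ 2 * ((2 * d * (K * (2 * (c * d * β))) ^ 2) * M₂) := by
        refine mul_le_mul_of_nonneg_left (e1.trans ?_) zero_le_two
        exact mul_le_mul_of_nonneg_right
          (e2.trans (mul_le_mul_of_nonneg_left e4 (by positivity))) hM₂
    _ = _ := by ring

lemma IsNCC.pderiv_ne_zero {f : MP 3 ℚ} (hf : IsNCC f) : pderiv 2 f ≠ 0 := by
  refine pderiv_ne_zero_of_degreeOf 2 fun h0 => hf ⟨Pi.single 0 1, Pi.single 1 1, aeval ![X 0, X 1, 0] f, ?_⟩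
  have h1 : ∀ i : Fin 3, linForm (Pi.single i (1 : ℚ)) = X i := fun i => by
    simp [linForm, Pi.single_apply]
  rw [h1, h1, ← comp_apply, comp_aeval]
  have h2 : ∀ α ∈ f.support, α 2 = 0 := fun α hα => by
    have := degreeOf_le_iff.1 h0.le α hα
    omega
  conv_lhs => rw [f.as_sum]
  conv_rhs => rw [f.as_sum]
  rw [map_sum]
  refine sum_congr rfl fun α hα => ?_
  rw [aeval_monomial, monomial_eq, prod_fintype _ _ (by simp),
    prod_fintype _ _ (by simp), prod_univ_three, prod_univ_three, h2 α hα]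
  simp

lemma exists_spread_subset : ∃ C : ℝ, 0 ≤ C ∧ ∀ (f : MP 3 ℚ) (_ : Irreducible f) (_ : IsNCC f) (_ :
    1 ≤ f.totalDegree) (_ : RIrreducible 2 (homogeneousComponent f.totalDegree f)) (B : ℕ) (_ : 1 ≤
    B) (S : Finset (Fin 3 → ℤ)) (_ : ∀ x ∈ S, ∀ i, |x i| ≤ B), ∃ S' ⊆ S, Spread f B S' ∧ (S.card :
    ℝ) ≤ S'.card + C * (f.totalDegree : ℝ) ^ (9 / 2 : ℝ) * B := by
  classical
  obtain ⟨C, hC, h⟩ := card_short_line_points_le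
  refine ⟨C, hC, fun f hf hN hd hF B hB S hS => ?_⟩
  set Q : (Fin 3 → ℤ) → Prop := fun x => ∃ v : Fin 3 → ℤ, v ≠ 0 ∧ (∀ i, v i ^ 2 ≤ B) ∧
    ∀ t : ℚ, eval (fun i => (x i : ℚ) + t * v i) f = 0 with hQ
  refine ⟨S.filter fun x => ¬ Q x, filter_subset _ _, fun x hx y hy hxy hl => ?_, ?_⟩
  · by_contra! hcon
    refine (mem_filter.1 hx).2 ⟨fun i => y i - x i, fun h0 => hxy ?_, hcon, fun t => ?_⟩
    · funext i
      exact (sub_eq_zero.1 (congrFun h0 i)).symm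
    · rw [← hl t]
      congr 2
      funext i
      push_cast
      ring
  · have h1 := h f hf hN hd hF B hB (S.filter Q) fun x hx =>
      ⟨hS x (mem_filter.1 hx).1, (mem_filter.1 hx).2⟩
    have h2 : ((S.filter Q).card : ℝ) + (S.filter fun x => ¬ Q x).card = S.card := by
      exact_mod_cast card_filter_add_card_filter_not (s := S) Q
    linarith

theorem card_zeros_le_of_large_degree : ∃ (D : ℕ) (C : ℝ), ∀ (f : MP 3 ℚ) (_ : Irreducible f) (_ :
    IsNCC f) (_ : D ≤ f.totalDegree) (_ : RIrreducible 2 (homogeneousComponent f.totalDegree f)) (B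
    : ℕ) (_ : 2 ≤ B) (S : Finset (Fin 3 → ℤ)) (_ : ∀ x ∈ S, evQ x f = 0 ∧ ∀ i, |x i| ≤ B), (S.card :
    ℝ) ≤ C * (f.totalDegree : ℝ) ^ (9 / 2 : ℝ) * B := by
  obtain ⟨K, D, hK, hcover⟩ := card_le_of_curve_bounds
  obtain ⟨C₁, hC₁, hspread⟩ := exists_spread_subset
  obtain ⟨K₂, hK₂, hcurve⟩ := card_curve_zeros_le
  refine ⟨D + 1, (20 + 10 * K * D ^ 3) + (C₁ + 804 * K * K₂), fun f hf hN hD hF B hB S hS => ?_⟩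
  set d := f.totalDegree with hd
  have hd1 : 1 ≤ d := by omega
  have hd1' : (1 : ℝ) ≤ d := mod_cast hd1
  have hB1 : (1 : ℝ) ≤ B := mod_cast (by omega : 1 ≤ B)
  have hpd := hN.pderiv_ne_zero
  have hK1 : (1 : ℝ) ≤ K := mod_cast hK
  have hnd : ∀ G : MP 3 ℚ, G ≠ 0 → G.totalDegree ≤ D → ¬ f ∣ G := fun G hG h hfG => by
    have := totalDegree_le_of_dvd_of_isDomain hfG hG
    omega
  rcases le_total B (d ^ 50) with hBd | hBd
  · have h := hcover d (by omega) f hf rfl hpd B hB S hS (10 * d ^ 3 * (2 * d) * B) (10 * D ^ 3 * d * B)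
      (by positivity) (fun G hG hGd X hX hXG => by
        have := card_common_zeros_le (fun h0 : G = 0 => hG (h0.symm ▸ dvd_zero f)) (hf.isRelPrime_iff_not_dvd.2 hG) hd1
          hGd (by omega : 1 ≤ B) X fun x hx => ⟨(hS x (hX hx)).1, hXG x hx, (hS x (hX hx)).2⟩
        exact_mod_cast this) (fun G hG0 hGd X hX hXG => by
        have hG := hnd G hG0 hGd
        rcases Nat.eq_zero_or_pos G.totalDegree with h0 | h0
        · have : X = ∅ := Finset.eq_empty_of_forall_notMem fun x hx => hG0 (by
            have h1 := hXG x hx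
            rw [totalDegree_eq_zero_iff_eq_C.1 h0, eval_C] at h1
            rw [totalDegree_eq_zero_iff_eq_C.1 h0, h1, C_0])
          rw [this]
          simpa using by positivity
        · have := card_common_zeros_le hf.ne_zero (hf.isRelPrime_iff_not_dvd.2 hG).symm h0
            (le_refl d) (by omega : 1 ≤ B) X fun x hx => ⟨hXG x hx, (hS x (hX hx)).1, (hS x (hX hx)).2⟩
          have h2 : 10 * G.totalDegree ^ 3 * d * B ≤ 10 * D ^ 3 * d * B := by gcongr
          exact_mod_cast this.trans h2)
    have e1 : (B : ℝ) ^ (1 / 100 : ℝ) ≤ (d : ℝ) ^ (1 / 2 : ℝ) := by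
      have : (B : ℝ) ≤ (d : ℝ) ^ (50 : ℝ) := mod_cast hBd
      refine (rpow_le_rpow (by positivity) this (by norm_num)).trans_eq ?_
      rw [← rpow_mul (by positivity)]
      norm_num
    have e2 : (d : ℝ) ^ (9 / 2 : ℝ) = d ^ 4 * (d : ℝ) ^ (1 / 2 : ℝ) := by
      rw [← rpow_natCast, ← rpow_add (by positivity)]
      norm_num
    have e3 : (1 : ℝ) ≤ (d : ℝ) ^ (1 / 2 : ℝ) := one_le_rpow hd1' (by norm_num)
    have e4 : (20 : ℝ) * d ^ 4 * B ≤ 20 * (d ^ 4 * (d : ℝ) ^ (1 / 2 : ℝ)) * B := by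
      gcongr
      exact le_mul_of_one_le_right (by positivity) e3
    have e5 : (K : ℝ) * d ^ 3 * (B : ℝ) ^ (1 / 100 : ℝ) * (10 * D ^ 3 * d * B) ≤
        K * d ^ 3 * (d : ℝ) ^ (1 / 2 : ℝ) * (10 * D ^ 3 * d * B) := by gcongr
    have e6 : 0 ≤ (C₁ + 804 * K * K₂) * (d : ℝ) ^ (9 / 2 : ℝ) * B := by positivity
    rw [add_mul, add_mul, e2] at *
    have e7 : (K : ℝ) * d ^ 3 * (d : ℝ) ^ (1 / 2 : ℝ) * (10 * D ^ 3 * d * B) =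
      10 * K * D ^ 3 * (d ^ 4 * (d : ℝ) ^ (1 / 2 : ℝ)) * B := by ring
    have e8 : (10 : ℝ) * d ^ 3 * (2 * d) * B = 20 * d ^ 4 * B := by ring
    rw [add_mul, add_mul]
    linarith
  · obtain ⟨S', hS'S, hsp, hcard⟩ := hspread f hf hN hd1 hF B (by omega) S fun x hx => (hS x hx).2
    set M := K₂ * d ^ 4 * (2 * d : ℕ) * ((B : ℝ) ^ (51 / 100 : ℝ) + d * (2 * d : ℕ) * log B) with hM
    have hlog : 0 ≤ log B := log_nonneg hB1
    have hM0 : 0 ≤ M := by positivity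
    have hG : ∀ G : MP 3 ℚ, ¬ f ∣ G → G.totalDegree ≤ 2 * d → ∀ X ⊆ S',
        (∀ x ∈ X, evQ x G = 0) → (X.card : ℝ) ≤ M := fun G hG hGd X hX hXG =>
      hcurve f G hf hG hd1 (2 * d) hGd B hB X (fun x hx y hy => hsp x (hX hx) y (hX hy))
        fun x hx => ⟨(hS x (hS'S (hX hx))).1, hXG x hx, (hS x (hS'S (hX hx))).2⟩
    have h := hcover d (by omega) f hf rfl hpd B hB S' (fun x hx => hS x (hS'S hx)) M M hM0 hG
      fun G hG0 hGd => hG G (hnd G hG0 hGd) (by omega)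
    set β := (B : ℝ) ^ (1 / 100 : ℝ) with hβ
    have hβ1 : 1 ≤ β := one_le_rpow hB1 (by norm_num)
    have hlogβ : log B ≤ 100 * β := by
      have := log_le_rpow_div (show (0 : ℝ) ≤ B by positivity) (show (0 : ℝ) < 1 / 100 by norm_num)
      rw [← hβ] at this
      linarith
    have hpow : ∀ n : ℕ, (B : ℝ) ^ (n / 100 : ℝ) = β ^ n := fun n => by
      rw [hβ, ← rpow_natCast, ← rpow_mul (by positivity)]
      congr 1
      ring
    have h51 := hpow 51
    have h100 := hpow 100
    norm_num at h51 h100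
    have hdβ : (d : ℝ) ≤ β ^ 2 := by
      have e1 : ((d : ℝ) ^ 50) ≤ B := mod_cast hBd
      rw [h100] at e1
      refine le_of_pow_le_pow_left₀ (n := 50) (by norm_num) (by positivity) ?_
      rw [← pow_mul]
      exact e1
    have hMle : M ≤ 402 * K₂ * (d ^ 7 * β ^ 51) := by
      rw [hM, h51]
      have e1 : (d : ℝ) * (2 * d : ℕ) * log B ≤ 200 * (d ^ 2 * β ^ 51) := by
        push_cast
        calc (d : ℝ) * (2 * d) * log B ≤ d * (2 * d) * (100 * β ^ 51) := by
              gcongr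
              exact hlogβ.trans (by
                have := le_self_pow₀ hβ1 (show 51 ≠ 0 by norm_num)
                linarith)
          _ = _ := by ring
      have e2 : β ^ 51 ≤ d ^ 2 * β ^ 51 := le_mul_of_one_le_left (by positivity) (one_le_pow₀ hd1')
      calc _ ≤ K₂ * d ^ 4 * (2 * d : ℕ) * (201 * (d ^ 2 * β ^ 51)) := by
            gcongr
            linarith
        _ = _ := by push_cast; ring
    have hS' : (S'.card : ℝ) ≤ 804 * K * K₂ * B := by
      have e1 : M ≤ K * d ^ 3 * β * M := le_mul_of_one_le_left hM0
        (one_le_mul_of_one_le_of_one_le (one_le_mul_of_one_le_of_one_le hK1 (one_le_pow₀ hd1')) hβ1)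
      have e2 : (d : ℝ) ^ 10 * β ^ 52 ≤ β ^ 100 := by
        calc (d : ℝ) ^ 10 * β ^ 52 ≤ (β ^ 2) ^ 10 * β ^ 52 := by gcongr
          _ = β ^ 72 := by ring
          _ ≤ β ^ 100 := pow_le_pow_right₀ hβ1 (by norm_num)
      rw [h100]
      calc (S'.card : ℝ) ≤ 2 * (K * d ^ 3 * β * M) := by linarith
        _ ≤ 2 * (K * d ^ 3 * β * (402 * K₂ * (d ^ 7 * β ^ 51))) := by gcongr
        _ = 804 * K * K₂ * (d ^ 10 * β ^ 52) := by ring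
        _ ≤ _ := by gcongr
    have e3 : (1 : ℝ) ≤ (d : ℝ) ^ (9 / 2 : ℝ) := one_le_rpow hd1' (by norm_num)
    have e4 : 804 * K * K₂ * B ≤ 804 * K * K₂ * (d : ℝ) ^ (9 / 2 : ℝ) * B :=
      mul_le_mul_of_nonneg_right (le_mul_of_one_le_right (by positivity) e3) (by positivity)
    have e5 : 0 ≤ (20 + 10 * K * D ^ 3) * (d : ℝ) ^ (9 / 2 : ℝ) * B := by positivity
    rw [add_mul, add_mul, add_mul (C₁), add_mul]
    linarith

lemma log_factorial_eq_sum (n : ℕ) : log (n.factorial : ℝ) =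
    ∑ p ∈ (Ioc 0 n).filter Nat.Prime, (n.factorial.factorization p : ℝ) * log p := by
  rw [Real.log_nat_eq_sum_factorization]
  refine Finsupp.sum_of_support_subset _ (fun p hp => ?_) _ (by simp)
  rw [Nat.support_factorization, Nat.mem_primeFactors] at hp
  exact mem_filter.2 ⟨mem_Ioc.2 ⟨hp.1.pos, (hp.1.dvd_factorial).1 hp.2.1⟩, hp.1⟩

lemma exists_mertens : ∃ C : ℝ, 0 ≤ C ∧ ∀ n : ℕ, 1 ≤ n →
    |∑ p ∈ (Ioc 0 n).filter Nat.Prime, log p / p - log n| ≤ C := by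
  have hs : Summable fun k : ℕ => 4 * (1 / (k : ℝ) ^ (3 / 2 : ℝ)) :=
    (Real.summable_one_div_nat_rpow.2 (by norm_num)).mul_left 4
  refine ⟨log 4 + 1 + ∑' k : ℕ, 4 * (1 / (k : ℝ) ^ (3 / 2 : ℝ)), ?_, fun n hn => ?_⟩
  · have : 0 ≤ ∑' k : ℕ, 4 * (1 / (k : ℝ) ^ (3 / 2 : ℝ)) := tsum_nonneg fun k => by positivity
    linarith [log_nonneg (show (1 : ℝ) ≤ 4 by norm_num)]
  set Q := (Ioc 0 n).filter Nat.Prime with hQ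
  set T := ∑' k : ℕ, 4 * (1 / (k : ℝ) ^ (3 / 2 : ℝ))
  have hT : 0 ≤ T := tsum_nonneg fun k => by positivity
  have hn0 : (0 : ℝ) < n := mod_cast hn
  have h4 := log_nonneg (show (1 : ℝ) ≤ 4 by norm_num)
  have hpr : ∀ p ∈ Q, p.Prime := fun p hp => (mem_filter.1 hp).2
  have hfac := log_factorial_eq_sum n
  have hθ : ∑ p ∈ Q, log p ≤ log 4 * n := by
    have := Chebyshev.theta_le_log4_mul_x (x := n) hn0.le
    rwa [theta, Nat.floor_natCast] at this
  have hup : log (n.factorial : ℝ) ≤ n * log n := by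
    rw [← log_pow]
    exact log_le_log (mod_cast n.factorial_pos) (mod_cast Nat.factorial_le_pow n)
  have hlow : n * log n - n ≤ log (n.factorial : ℝ) := by
    have h1 : (n : ℝ) ^ n / n.factorial ≤ exp n := Real.pow_div_factorial_le_exp _ hn0.le n
    have hf : (0 : ℝ) < n.factorial := mod_cast n.factorial_pos
    have h2 := log_le_log (by positivity) h1
    rw [Real.log_exp, Real.log_div (by positivity) hf.ne', log_pow] at h2
    linarith
  have key1 : n * ∑ p ∈ Q, log p / p - ∑ p ∈ Q, log p ≤ log (n.factorial : ℝ) := by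
    rw [hfac, mul_sum, ← sum_sub_distrib]
    refine sum_le_sum fun p hp => ?_
    have h1 : n / p ≤ n.factorial.factorization p := by
      rw [Nat.factorization_factorial (hpr p hp) (b := Nat.log p n + 2) (by omega)]
      exact (by simp : n / p = n / p ^ 1).le.trans (single_le_sum (f := fun i => n / p ^ i) (fun _ _ => by positivity)
        (Finset.mem_Ico.2 ⟨le_rfl, by omega⟩))
    have h2 : (n : ℝ) / p < (n / p : ℕ) + 1 := by
      rw [← Nat.floor_div_eq_div (K := ℝ)]; exact Nat.lt_floor_add_one _
    have h3 : ((n / p : ℕ) : ℝ) ≤ n.factorial.factorization p := mod_cast h1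
    have := mul_le_mul_of_nonneg_right (show (n : ℝ) / p - 1 ≤ n.factorial.factorization p by linarith)
      (log_natCast_nonneg p)
    have e : n * (log p / p) - log p = ((n : ℝ) / p - 1) * log p := by ring
    linarith
  have key2 : log (n.factorial : ℝ) ≤ n * ∑ p ∈ Q, log p / p + n * T := by
    have hsum : ∑ p ∈ Q, 4 * (1 / (p : ℝ) ^ (3 / 2 : ℝ)) ≤ T :=
      hs.sum_le_tsum Q (fun _ _ => by positivity)
    refine le_trans ?_ (by linarith [mul_le_mul_of_nonneg_left hsum hn0.le] : n * ∑ p ∈ Q, log p / p +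
      n * ∑ p ∈ Q, 4 * (1 / (p : ℝ) ^ (3 / 2 : ℝ)) ≤ _)
    rw [hfac, mul_sum, mul_sum, ← sum_add_distrib]
    refine sum_le_sum fun p hp => ?_
    have hp2 := (hpr p hp).two_le
    have h1 : (p - 1) * n.factorial.factorization p ≤ n := by
      rw [Nat.sub_one_mul_factorization_factorial (hpr p hp)]; omega
    have hp2' : (2 : ℝ) ≤ p := mod_cast hp2
    have h1' : ((p : ℝ) - 1) * n.factorial.factorization p ≤ n := by
      rw [← Nat.cast_one, ← Nat.cast_sub (by omega)]; exact_mod_cast h1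
    have hl : log p ≤ 2 * (p : ℝ) ^ (1 / 2 : ℝ) := by
      have := log_le_rpow_div (x := p) (by positivity) (show (0 : ℝ) < 1 / 2 by norm_num)
      linarith
    have h3 : (p : ℝ) ^ (3 / 2 : ℝ) * (p : ℝ) ^ (1 / 2 : ℝ) = p * p := by
      rw [← rpow_add (by positivity)]; norm_num; ring
    have hr : 0 < (p : ℝ) ^ (3 / 2 : ℝ) := by positivity
    have hl0 := log_natCast_nonneg p
    have h5 : (n.factorial.factorization p : ℝ) * (p * p) ≤ n * (p + 2) := by nlinarith
    have h6 : log p * (p : ℝ) ^ (3 / 2 : ℝ) ≤ 2 * (p * p) := by nlinarith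
    have h7 : (n.factorial.factorization p : ℝ) ≤ n / p + n * 2 / (p * p) := by
      rw [div_add_div _ _ (by positivity) (by positivity), le_div_iff₀ (by positivity)]
      nlinarith
    have h8 : log p / (p * p) ≤ 2 * (1 / (p : ℝ) ^ (3 / 2 : ℝ)) := by
      rw [mul_one_div, div_le_div_iff₀ (by positivity) hr]; exact h6
    calc _ ≤ (n / p + n * 2 / (p * p)) * log p := mul_le_mul_of_nonneg_right h7 hl0
      _ = n * (log p / p) + 2 * n * (log p / (p * p)) := by ring
      _ ≤ _ := by linarith [mul_le_mul_of_nonneg_left h8 (by positivity : 0 ≤ 2 * (n : ℝ))]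
  rw [abs_le]
  constructor
  · refine le_of_mul_le_mul_left ?_ hn0
    nlinarith
  · refine le_of_mul_le_mul_left ?_ hn0
    nlinarith

/-- The space of restrictions to a branch of the polynomials of degree at most `e`. -/
noncomputable def jetSpace (ev : MP 2 K →ₐ[K] K⟦X⟧) (e : ℕ) : Submodule K K⟦X⟧ := (restrictTotalDegree (Fin 2) K e).map ev.toLinearMap

instance {K : Type*} [Field K] (ev : MP 2 K →ₐ[K] K⟦X⟧) (e : ℕ) :
    Module.Finite K (jetSpace ev e) := by unfold jetSpace; infer_instance

lemma mem_jetSpace (ev : MP 2 K →ₐ[K] K⟦X⟧)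
    {P : MP 2 K} (h : P.totalDegree ≤ e) : ev P ∈ jetSpace ev e :=
  ⟨P, (mem_restrictTotalDegree _ _ _).2 h, rfl⟩

lemma finrank_jetSpace {ev : MP 2 K →ₐ[K] K⟦X⟧} {φ : MP 2 K} (hφ : φ ≠ 0) (hev : ∀ P, ev P = 0 ↔ φ ∣
    P) (he : φ.totalDegree ≤ e) : 2 * finrank K (jetSpace ev e) + φ.totalDegree * φ.totalDegree =
    φ.totalDegree * (2 * e + 3) := by
  set R := restrictTotalDegree (Fin 2) K e
  have h1 := finrank_range_add_finrank_ker (ev.toLinearMap.domRestrict R)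
  rw [LinearMap.range_domRestrict, finrank_restrictTotalDegree K 1 e,
    ← finrank_map_of_injective' (f := R.subtype) val_injective] at h1
  have h2 : (ker (ev.toLinearMap.domRestrict R)).map R.subtype = mulDeg φ (e - φ.totalDegree) := by
    ext P
    rw [mem_mulDeg]
    constructor
    · rintro ⟨⟨P, hP⟩, h0, rfl⟩
      obtain ⟨h, rfl⟩ := (hev P).1 h0
      refine ⟨h, ?_, rfl⟩
      by_cases hh : h = 0
      · simp [hh]
      have := (mem_restrictTotalDegree _ _ _).1 hP
      rw [totalDegree_mul_of_isDomain hφ hh] at this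
      omega
    · rintro ⟨h, hh, rfl⟩
      exact ⟨⟨φ * h, (mem_restrictTotalDegree _ _ _).2 ((totalDegree_mul _ _).trans (by omega))⟩,
        (hev _).2 (dvd_mul_right _ _), rfl⟩
  rw [h2, finrank_mulDeg hφ] at h1
  change finrank K (jetSpace ev e) + _ = _ at h1
  have h3 := choose_two_cast e
  have h4 := choose_two_cast (e - φ.totalDegree)
  obtain ⟨k, rfl⟩ := Nat.exists_eq_add_of_le he
  rw [Nat.add_sub_cancel_left] at h1 h4
  simp only [Nat.reduceAdd, add_assoc] at h1 h3 h4 ⊢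
  nlinarith

lemma X_pow_dvd_of_curveDer [Fact p.Prime] {φ G : MP 2 (ZMod p)} {a : Fin 2 → ZMod p} {ev : MP 2
    (ZMod p) →ₐ[ZMod p] PowerSeries (ZMod p)} (hc : ∀ P, sconst (ev P) = eval a P) (hX : ev (X 0 - C
    (a 0)) = sX) (h0 : ev φ = 0) (ha : eval a (pderiv 1 φ) ≠ 0) {M : ℕ} (hM : M ≤ p) (h : ∀ j < M,
    eval a ((curveDer φ)^[j] G) = 0) : sX ^ M ∣ ev G := by
  by_cases hG : ev G = 0
  · rw [hG]; exact dvd_zero _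
  obtain ⟨r₀, hr₀⟩ := X_pow_order_dvd (φ := ev G)
  set n := (ev G).order.toNat with hn
  by_contra hcon
  have hnM : n < M := by
    by_contra hle
    exact hcon ((pow_dvd_pow _ (not_lt.1 hle)).trans ⟨r₀, hr₀⟩)
  have hu : sconst r₀ ≠ 0 := by
    have := coeff_order hG
    rw [← hn, hr₀, coeff_X_pow_mul'] at this
    simpa using this
  have hx0 : derivative (ZMod p) (ev (X 0)) = 1 := by
    rw [map_sub, sub_eq_iff_eq_add] at hX
    rw [hX, map_add, derivative_X, ← algebraMap_eq, commutes, map_algebraMap, add_zero]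
  have hch : ∀ j, (fun q => ev (pderiv 1 φ) * derivative (ZMod p) q)^[j] (ev G) =
      ev ((curveDer φ)^[j] G) := by
    intro j
    induction j with
    | zero => rfl
    | succ j ih =>
      rw [iterate_succ_apply', iterate_succ_apply', ih]
      simpa [h0] using curveDer_chain (derivative (ZMod p)) ev hx0 φ ((curveDer φ)^[j] G)
  obtain ⟨r, h1, h2⟩ := iterate_mul_derivative_eq (ev (pderiv 1 φ)) (ev G) n r₀ hr₀ n
  rw [hch] at h1
  have h3 := mul_left_cancel₀ (pow_ne_zero n PowerSeries.X_ne_zero) h1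
  rw [← h3, hc, h n hnM, hc, descPochhammer_eval_eq_descFactorial, Nat.descFactorial_self] at h2
  refine mul_ne_zero (mul_ne_zero hu (pow_ne_zero n ha)) (fun hz => ?_) h2.symm
  rw [ZMod.natCast_eq_zero_iff, (Fact.out : p.Prime).dvd_factorial] at hz
  omega

lemma curveDer_iterate_sum [Fact p.Prime] (φ : MP 2 (ZMod p)) (γ σ : Fin s → MP 2 (ZMod p)) (j : ℕ)
    : (curveDer φ)^[j] (∑ i, γ i * σ i ^ p) = ∑ i, (curveDer φ)^[j] (γ i) * σ i ^ p := by
  induction j with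
  | zero => rfl
  | succ j ih =>
    simp only [iterate_succ_apply', ih]
    simp only [curveDer, map_sum, mul_sum, ← sum_sub_distrib, leibniz,
      leibniz_pow, CharP.cast_eq_zero, zero_add, nsmul_eq_mul,
      smul_eq_mul, zero_mul, mul_zero]
    exact sum_congr rfl fun i _ => by ring

lemma stepanov_bound [Fact p.Prime] {φ : MP 2 (ZMod p)} (hφ : Irreducible φ) (hd : 1 ≤
    φ.totalDegree) (Z : Finset (Fin 2 → ZMod p)) (hZ : ∀ a ∈ Z, eval a φ = 0 ∧ eval a (pderiv 1 φ) ≠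
    0) {ν : ℕ} (hn : φ.totalDegree ≤ n) (hm : φ.totalDegree ≤ m) (hmp : φ.totalDegree * m < p) (hνp
    : ν ≤ p) (hν : 2 * ν + φ.totalDegree * φ.totalDegree = φ.totalDegree * (2 * n + 3)) (hc : 2 * ν
    * (n + ν * φ.totalDegree) + φ.totalDegree ≤ 2 * m) : Z.card * (ν - 1) ≤ φ.totalDegree * (m + p *
    n) := by
  classical
  set d := φ.totalDegree with hdd
  have hpp : p.Prime := Fact.out
  rcases Z.eq_empty_or_nonempty with rfl | ⟨a, ha⟩
  · simp
  obtain ⟨ev, hev1, hev2, hev3⟩ := exists_branch φ a (hZ a ha).1 (hZ a ha).2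
  have hker : ∀ {M : ℕ} {P}, d * P.totalDegree < M → sX ^ M ∣ ev P → φ ∣ P :=
    fun hM h => dvd_of_X_pow_dvd hφ ev a hev1 hev2 hev3 hM h
  have hev : ∀ P, ev P = 0 ↔ φ ∣ P := fun P => ⟨fun h => hker (Nat.lt_succ_self _)
    (h.symm ▸ dvd_zero _), fun ⟨Q, hQ⟩ => by rw [hQ, map_mul, hev3, zero_mul]⟩
  have hW : ∀ {e : ℕ}, d ≤ e → 2 * finrank (ZMod p) (jetSpace ev e) + d * d = d * (2 * e + 3) :=
    fun he => finrank_jetSpace hφ.ne_zero hev he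
  obtain ⟨w, o, ho, hw, hwo⟩ := exists_strictMono_order ν (jetSpace ev n) inferInstance
    (by have := hW hn; omega)
  choose s hs hsw using hw
  obtain ⟨L, hL⟩ : ∃ L : End (ZMod p) (MP 2 (ZMod p)), ⇑L = curveDer φ :=
    ⟨(mulLeft _ (pderiv 1 φ)).comp (pderiv 0).toLinearMap -
      (mulLeft _ (pderiv 0 φ)).comp (pderiv 1).toLinearMap, rfl⟩
  have hLd : ∀ j P, ((L ^ j) P).totalDegree ≤ P.totalDegree + j * d := by
    intro j P
    rw [End.pow_apply, hL]
    induction j with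
    | zero => simp
    | succ j ih =>
      rw [iterate_succ_apply']
      exact (totalDegree_curveDer_le _ _).trans (by rw [Nat.succ_mul]; omega)
  set R := restrictTotalDegree (Fin 2) (ZMod p) m
  obtain ⟨sec, hsec⟩ := LinearMap.exists_rightInverse_of_surjective
    (ev.toLinearMap.restrict (p := R) (q := jetSpace ev m) fun P hP => ⟨P, hP, rfl⟩) (by
      rw [range_eq_top]
      rintro ⟨_, P, hP, rfl⟩
      exact ⟨⟨P, hP⟩, rfl⟩)
  have hsec' : ∀ u : jetSpace ev m, ev (sec u : MP 2 (ZMod p)) = u := fun u =>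
    congrArg Subtype.val (LinearMap.congr_fun hsec u)
  have hdeg : ∀ u : jetSpace ev m, (sec u : MP 2 (ZMod p)).totalDegree ≤ m :=
    fun u => (mem_restrictTotalDegree _ _ _).1 (sec u).2
  have hdegs : ∀ i, (s i).totalDegree ≤ n := fun i => (mem_restrictTotalDegree _ _ _).1 (hs i)
  set E := m + n + ν * d
  let Ψ : Fin (ν - 1) → (Fin ν → jetSpace ev m) →ₗ[ZMod p] MP 2 (ZMod p) := fun j =>
    ∑ i, (LinearMap.mulRight _ (s i)).comp ((L ^ (j : ℕ)).comp (R.subtype.comp (sec.comp (proj i))))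
  have hΨ : ∀ j u, Ψ j u = ∑ i, (L ^ (j : ℕ)) (sec (u i)) * s i := fun j u => by simp [Ψ]
  let Φ : (Fin ν → jetSpace ev m) →ₗ[ZMod p] (Fin (ν - 1) → jetSpace ev E) :=
    pi fun j => LinearMap.codRestrict _ (ev.toLinearMap.comp (Ψ j)) fun u => by
      refine mem_jetSpace ev ?_
      rw [hΨ]
      refine totalDegree_finsetSum_le fun i _ => (totalDegree_mul _ _).trans ?_
      have h1 := hLd j (sec (u i))
      have h2 := hdeg (u i)
      have h3 := hdegs i
      have h4 : (j : ℕ) * d ≤ ν * d := Nat.mul_le_mul_right _ (by omega)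
      omega
  have hlt : finrank (ZMod p) (Fin (ν - 1) → jetSpace ev E) <
      finrank (ZMod p) (Fin ν → jetSpace ev m) := by
    rw [Module.finrank_pi_fintype, Module.finrank_pi_fintype]
    simp only [sum_const, card_univ, card_fin, smul_eq_mul]
    have h1 := hW hm
    have h2 := hW (show d ≤ E by omega)
    have hν0 : 1 ≤ ν := by nlinarith
    obtain ⟨k, rfl⟩ := Nat.exists_eq_add_of_le' hν0
    set x := finrank (ZMod p) (jetSpace ev m)
    set y := finrank (ZMod p) (jetSpace ev E)
    simp only [Nat.add_sub_cancel]
    have hyx : y = x + d * (n + (k + 1) * d) := by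
      simp only [E] at h2
      nlinarith
    have hx : 2 * x = d * (2 * m + 3 - d) := by
      rw [Nat.mul_sub]; omega
    rw [hyx]
    have h5 : 2 * (k + 1) * (n + (k + 1) * d) < 2 * m + 3 - d := by omega
    have h6 := Nat.mul_lt_mul_of_pos_left h5 hd
    rw [← hx] at h6
    nlinarith
  obtain ⟨u, hu, hu0⟩ := Submodule.exists_mem_ne_zero_of_ne_bot (LinearMap.ker_ne_bot_of_finrank_lt hlt)
  set γ : Fin ν → MP 2 (ZMod p) := fun i => sec (u i)
  have hγ : ∀ j < ν - 1, φ ∣ ∑ i, (curveDer φ)^[j] (γ i) * s i := by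
    intro j hj
    have h1 : ev (Ψ ⟨j, hj⟩ u) = 0 := congrArg Subtype.val (congrFun (show Φ u = 0 from hu) ⟨j, hj⟩)
    rw [hΨ, hev] at h1
    simpa only [End.pow_apply, hL] using h1
  set G := ∑ i, γ i * s i ^ p
  have hGd : ¬ φ ∣ G := by
    rw [← hev]
    intro h0
    obtain ⟨i, hi⟩ := ne_iff.1 hu0
    have hex : (univ.filter fun i => u i ≠ 0).Nonempty := ⟨i, by simpa using hi⟩
    set i₀ := (univ.filter fun i => u i ≠ 0).min' hex
    have hi₀ : u i₀ ≠ 0 := (mem_filter.1 (Finset.min'_mem _ hex)).2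
    have hlow : ∀ i, sX ^ o i ∣ ev (s i) := fun i => by
      have h2 := X_pow_order_dvd (φ := w i)
      rw [hwo, ENat.toNat_natCast, ← hsw i] at h2
      exact h2
    have hdv : sX ^ (p * o i₀ + p) ∣ ev (γ i₀) * ev (s i₀) ^ p := by
      have h1 : ev G = ∑ i, ev (γ i) * ev (s i) ^ p := by simp [G]
      rw [h0, ← Finset.add_sum_erase _ _ (mem_univ i₀)] at h1
      rw [← dvd_add_left (dvd_sum fun i hi => ?_), ← h1]
      · exact dvd_zero _
      by_cases hui : u i = 0
      · simp [γ, hui]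
      have hle : i₀ ≤ i := Finset.min'_le _ _ (by simpa using hui)
      have hlt := ho (lt_of_le_of_ne hle (Finset.ne_of_mem_erase hi).symm)
      have h5 := pow_dvd_pow_of_dvd (hlow i) p
      rw [← pow_mul] at h5
      exact ((pow_dvd_pow _ (by nlinarith)).trans h5).mul_left _
    obtain ⟨v, hv⟩ := hlow i₀
    have hv0 : IsUnit (v ^ p) := by
      refine IsUnit.pow p ((PowerSeries.isUnit_iff_constantCoeff).2 (Ne.isUnit fun hz => ?_))
      obtain ⟨v', rfl⟩ := X_dvd_iff.2 hz
      have h2 := coeff_order (φ := w i₀) (by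
        intro h; have := hwo i₀; rw [h, PowerSeries.order_zero] at this; exact ENat.top_ne_natCast _ this)
      rw [hwo, ENat.toNat_natCast, ← hsw i₀] at h2
      change scoeff (o i₀) (ev (s i₀)) ≠ 0 at h2
      rw [hv, coeff_X_pow_mul'] at h2
      simp at h2
    have h3 : sX ^ p ∣ ev (γ i₀) * v ^ p := by
      rw [hv, mul_pow, ← pow_mul, mul_comm (o i₀), mul_left_comm, pow_add] at hdv
      exact (mul_dvd_mul_iff_left (pow_ne_zero _ PowerSeries.X_ne_zero)).1 hdv
    have h4 := hker (lt_of_le_of_lt (Nat.mul_le_mul_left _ (hdeg (u i₀))) hmp) (hv0.dvd_mul_right.1 h3)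
    rw [← hev, hsec'] at h4
    exact hi₀ (Subtype.ext h4)
  have hrel : IsRelPrime φ G := hφ.isRelPrime_iff_not_dvd.2 hGd
  have hbr := fun a : Z => exists_branch φ a.1 (hZ a a.2).1 (hZ a a.2).2
  choose evs he1 he2 he3 using hbr
  have hfin := jets_bezout Z (ν - 1) (fun b => if h : b ∈ Z then evs ⟨b, h⟩ else ev)
    (fun b hb P => by simp only [hb, dif_pos]; exact he1 _ P)
    (fun b hb => by simp only [hb, dif_pos]; exact he2 ⟨b, hb⟩) hφ.ne_zero
    (fun h => hGd (by rw [h]; exact dvd_zero _)) hrel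
    (fun b hb => by simp only [hb, dif_pos]; rw [he3]; exact dvd_zero _)
    (fun b hb => by
      simp only [hb, dif_pos]
      refine X_pow_dvd_of_curveDer (he1 ⟨b, hb⟩) (he2 ⟨b, hb⟩) (he3 ⟨b, hb⟩) (hZ b hb).2 (by omega)
        fun j hj => ?_
      obtain ⟨Q, hQ⟩ := hγ j hj
      have h1 := congrArg (eval b) hQ
      rw [map_mul, (hZ b hb).1, zero_mul, map_sum] at h1
      rw [curveDer_iterate_sum, map_sum, ← h1]
      exact sum_congr rfl fun i _ => by rw [map_mul, map_mul, map_pow, ZMod.pow_card])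
  refine hfin.trans (Nat.mul_le_mul_left _ (totalDegree_finsetSum_le fun i _ => ?_))
  refine (totalDegree_mul _ _).trans (add_le_add (hdeg _) ((totalDegree_pow _ _).trans ?_))
  exact Nat.mul_le_mul_left _ (hdegs i)

lemma exists_stepanov (d : ℕ) (hd : 1 ≤ d) (η : ℝ) (hη : 0 < η) : ∃ p₀ : ℕ, ∀ (p : ℕ) [Fact
    p.Prime], p₀ ≤ p → ∀ φ : MP 2 (ZMod p), Irreducible φ → φ.totalDegree = d → ∀ Z : Finset (Fin 2
    → ZMod p), (∀ a ∈ Z, eval a φ = 0 ∧ eval a (pderiv 1 φ) ≠ 0) → (Z.card : ℝ) ≤ (1 + η) * p := by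
  obtain ⟨t, ht⟩ := exists_nat_gt ((1 + (d : ℝ) ^ 2) / η)
  obtain ⟨q, hq⟩ := Nat.even_mul_succ_self d
  set ν := d * t + q + d
  set n := d + t
  set m := ν * (n + ν * d) + d
  refine ⟨d * m + ν + 1, fun p _ hp φ hφ hφd Z hZ => ?_⟩
  have key := stepanov_bound hφ (by omega) Z hZ (n := n) (m := m) (ν := ν) (by omega) (by omega)
    (by rw [hφd]; omega) (by omega) (by rw [hφd]; simp only [ν, n]; nlinarith)
    (by rw [hφd]; simp only [m]; nlinarith)
  rw [hφd] at key
  have h1 : d * t ≤ ν - 1 := by omega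
  have h2 : Z.card * (d * t) ≤ p * (1 + d * d + d * t) := by
    refine (Nat.mul_le_mul_left _ h1).trans (key.trans ?_)
    have : d * m ≤ p := by omega
    simp only [n]
    nlinarith
  have h2' : (Z.card : ℝ) * (d * t) ≤ p * (1 + d * d + d * t) := mod_cast h2
  rw [div_lt_iff₀ hη] at ht
  have hd' : (1 : ℝ) ≤ d := mod_cast hd
  have ht0 : (0 : ℝ) < t := by
    by_contra h
    nlinarith [sq_nonneg (d : ℝ)]
  refine le_of_mul_le_mul_right (h2'.trans ?_) (mul_pos (by linarith : (0 : ℝ) < d) ht0)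
  have e : (1 + η) * p * (d * t) = p * (d * t) + p * (d * (t * η)) := by ring
  rw [e, mul_add, add_comm]
  have h3 : 1 + (d : ℝ) * d ≤ d * (t * η) := by nlinarith
  linarith [mul_le_mul_of_nonneg_left h3 (cast_nonneg p : (0 : ℝ) ≤ p)]

/-- An effective irreducibility criterion for `φ`, linear in its coefficients. -/
def JetIrred {K : Type*} [CommSemiring K] (d S : ℕ) (φ : MP 2 K) : Prop :=
  ∀ H : MP 2 K, H.totalDegree ≤ S →
    (∀ α ∈ monoms 2 (S + 1), d ≤ ∑ i, α i → coeff α (φ * H) = 0) → H = 0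

lemma X_pow_dvd_of_coeff (ev : MP 2 K →ₐ[K] K⟦X⟧) (hc : ∀ P, sconst (ev P) = eval 0 P) {P : MP 2 K}
    (h : ∀ α ∈ P.support, n ≤ ∑ i, α i) : (sX : K⟦X⟧) ^ n ∣ ev P := by
  rw [P.as_sum, map_sum]
  refine dvd_sum fun α hα => ?_
  rw [monomial_eq, prod_fintype _ _ (by simp), map_mul, map_prod]
  refine Dvd.dvd.mul_left ((pow_dvd_pow _ (h α hα)).trans ?_) _
  rw [← prod_pow_eq_pow_sum]
  refine Finset.prod_dvd_prod_of_dvd _ _ fun i _ => ?_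
  rw [map_pow]
  exact pow_dvd_pow_of_dvd (X_dvd_iff.2 (by rw [hc]; simp)) _

lemma order_coe_le {P : MP 2 K} (hP : P ≠ 0) :
    (P : MvPowerSeries (Fin 2) K).order ≤ P.totalDegree := by
  obtain ⟨α, hα⟩ := Finset.nonempty_of_ne_empty (mt support_eq_empty.1 hP)
  refine (order_le (d := α) (by rwa [coeff_coe, ← mem_support_iff])).trans ?_
  rw [degree_eq_sum]
  exact_mod_cast mem_monoms.1 (totalDegree_le_iff.1 le_rfl hα)

lemma coeff_single_one_eq {K : Type*} [CommRing K] (φ : MP 2 K) :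
    coeff (single 1 1) φ = eval 0 (pderiv 1 φ) := by
  rw [eval_zero, constantCoeff_eq, coeff_pderiv]
  simp

lemma Irreducible.jetIrred {φ : MP 2 K} (hφ : Irreducible φ) (hd : φ.totalDegree = d) (h0 : eval 0 φ
    = 0) (h1 : eval 0 (pderiv 1 φ) ≠ 0) (hS : d * d ≤ S) : JetIrred d S φ := by
  classical
  intro H hH hc
  by_contra hH0
  obtain ⟨ev, hev, hX, hφ0⟩ := exists_branch φ 0 h0 h1
  have hd1 : 1 ≤ d := by
    by_contra h
    rw [totalDegree_eq_zero_iff_eq_C.1 (by omega : φ.totalDegree = 0)] at h1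
    simp at h1
  set G := ∑ α ∈ monoms 2 (d - 1), monomial α (coeff α (φ * H))
  have hGd : G.totalDegree ≤ d - 1 := totalDegree_le_iff.2 (support_sum_monomial _ _)
  have hsub : ∀ α ∈ (φ * H - G).support, S + 2 ≤ ∑ i, α i := by
    intro α hα
    by_contra hlt
    rw [mem_support_iff, coeff_sub] at hα
    by_cases hm : α ∈ monoms 2 (d - 1)
    · exact hα (by rw [coeff_sum_monomial _ _ hm, sub_self])
    · rw [notMem_support_iff.1 fun h => hm (support_sum_monomial _ _ h)] at hα
      rw [mem_monoms] at hm
      exact hα (by rw [hc α (mem_monoms.2 (by omega)) (by omega), sub_zero])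
  have hdvd := X_pow_dvd_of_coeff ev hev hsub
  rw [map_sub, map_mul, hφ0, zero_mul, zero_sub, dvd_neg] at hdvd
  have hG0 : G ≠ 0 := by
    intro hG
    have h2 : ((S + 2 : ℕ) : ℕ∞) ≤ ((φ * H : MP 2 K) : MvPowerSeries (Fin 2) K).order :=
      nat_le_order fun α hα => by
        rw [coeff_coe]
        by_contra hne
        have := hsub α (by rwa [hG, sub_zero, mem_support_iff])
        rw [degree_eq_sum] at hα
        omega
    rw [coe_mul, order_mul] at h2
    have h3 : (φ : MvPowerSeries (Fin 2) K).order ≤ (1 : ℕ) := by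
      refine (order_le (d := single 1 1) ?_).trans (by simp)
      rwa [coeff_coe, coeff_single_one_eq]
    have h4 := h2.trans (add_le_add h3 ((order_coe_le hH0).trans (cast_le.2 hH)))
    rw [← Nat.cast_add, cast_le] at h4
    omega
  refine not_dvd_of_totalDegree_lt hG0 (by omega : G.totalDegree < φ.totalDegree)
    (dvd_of_X_pow_dvd hφ ev 0 hev hX hφ0 (lt_of_le_of_lt (Nat.mul_le_mul hd.le hGd) ?_) hdvd)
  have := Nat.mul_le_mul_left d (Nat.sub_le d 1)
  omega

lemma JetIrred.irreducible {φ : MP 2 K} (hc : JetIrred d S φ) (hd : φ.totalDegree ≤ d) (h0 : eval 0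
    φ = 0) (h1 : eval 0 (pderiv 1 φ) ≠ 0) : Irreducible φ := by
  classical
  have hφ0 : φ ≠ 0 := by rintro rfl; simp at h1
  refine ⟨fun hu => ?_, ?_⟩
  · have := hu.map (eval (0 : Fin 2 → K))
    rw [h0] at this
    exact not_isUnit_zero this
  have key : ∀ A B : MP 2 K, φ = A * B → eval 0 A = 0 → IsUnit B := by
    intro A B hAB hA
    by_contra hB
    have hA0 : A ≠ 0 := by rintro rfl; exact hφ0 (by rw [hAB, zero_mul])
    have hB0 : B ≠ 0 := by rintro rfl; exact hφ0 (by rw [hAB, mul_zero])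
    have hBd : B.totalDegree ≠ 0 := fun h => hB (by
      rw [totalDegree_eq_zero_iff_eq_C.1 h] at hB0 ⊢
      exact (isUnit_iff_ne_zero.2 (by rintro h; exact hB0 (by rw [h, C_0]))).map C)
    rw [hAB, totalDegree_mul_of_isDomain hA0 hB0] at hd
    have hBe : eval 0 B ≠ 0 := by
      intro h
      rw [hAB, pderiv_mul, map_add, map_mul, map_mul, hA, h, mul_zero, zero_mul, add_zero] at h1
      exact h1 rfl
    set I : MvPowerSeries (Fin 2) K := (B : MvPowerSeries (Fin 2) K)⁻¹
    have hBc : MvPowerSeries.constantCoeff (B : MvPowerSeries (Fin 2) K) ≠ 0 := by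
      rwa [← MvPowerSeries.coeff_zero_eq_constantCoeff_apply, coeff_coe, ← constantCoeff_eq,
        ← eval_zero]
    have hBI : (B : MvPowerSeries (Fin 2) K) * I = 1 := MvPowerSeries.mul_inv_cancel _ hBc
    set H := ∑ α ∈ monoms 2 S, monomial α (MvPowerSeries.coeff α I)
    have hH : H = 0 := by
      refine hc H (totalDegree_le_iff.2 (support_sum_monomial _ _)) fun α hα hdα => ?_
      have e : ((φ * H : MP 2 K) : MvPowerSeries (Fin 2) K) =
          A - (A * B : MvPowerSeries (Fin 2) K) * (I - H) := by
        rw [hAB, coe_mul, coe_mul]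
        linear_combination (A : MvPowerSeries (Fin 2) K) * hBI
      rw [← coeff_coe, e, map_sub, coeff_coe]
      rw [notMem_support_iff.1 fun h => by
        have := mem_monoms.1 (totalDegree_le_iff.1 le_rfl h)
        omega, zero_sub, neg_eq_zero]
      apply MvPowerSeries.coeff_of_lt_order
      have h2 : ((S + 1 : ℕ) : ℕ∞) ≤ (I - (H : MvPowerSeries (Fin 2) K)).order :=
        nat_le_order fun β hβ => by
          rw [degree_eq_sum] at hβ
          rw [map_sub, coeff_coe, coeff_sum_monomial _ _ (mem_monoms.2 (by omega)), sub_self]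
      have h3 : ((1 : ℕ) : ℕ∞) ≤ (A * B : MvPowerSeries (Fin 2) K).order :=
        nat_le_order fun β hβ => by
          obtain rfl : β = 0 := (Finsupp.degree_eq_zero_iff β).1 (by omega)
          rw [← coe_mul, ← hAB, coeff_coe, ← constantCoeff_eq, ← eval_zero]
          exact h0
      refine lt_of_lt_of_le ?_ ((add_le_add h3 h2).trans MvPowerSeries.le_order_mul)
      rw [degree_eq_sum, ← Nat.cast_add, Nat.cast_lt]
      have := mem_monoms.1 hα
      omega
    have h5 := congrArg (coeff 0) hH
    rw [coeff_sum_monomial _ _ (mem_monoms.2 (by simp)), coeff_zero] at h5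
    have h6 := congrArg MvPowerSeries.constantCoeff hBI
    rw [map_mul, ← MvPowerSeries.coeff_zero_eq_constantCoeff_apply I, h5, mul_zero, map_one] at h6
    exact zero_ne_one h6
  intro A B hAB
  have := h0
  rw [hAB, map_mul, mul_eq_zero] at this
  rcases this with h | h
  · exact inr (key A B hAB h)
  · exact inl (key B A (by rw [hAB, mul_comm]) h)

/-- The matrix of the linear system defining `JetIrred`. -/
noncomputable def jetMat {R : Type*} [CommSemiring R] (d S : ℕ) (φ : MP 2 R)
    (α : {α // α ∈ monoms 2 (S + 1) ∧ d ≤ ∑ i, α i}) (j : Fin (monoms 2 S).card) : R :=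
  coeff α.1 (φ * monomial ((monoms 2 S).equivFin.symm j).1 1)

lemma jetIrred_iff {K : Type*} [CommRing K] {φ : MP 2 K} : JetIrred d S φ ↔ ∀ c : Fin (monoms 2
    S).card → K, (∀ α, ∑ j, c j * jetMat d S φ α j = 0) → c = 0 := by
  classical
  have key : ∀ (c : Fin (monoms 2 S).card → K) α, coeff α (φ * ∑ j,
      monomial ((monoms 2 S).equivFin.symm j).1 (c j)) =
      ∑ j, c j * coeff α (φ * monomial ((monoms 2 S).equivFin.symm j).1 1) := by
    intro c α
    rw [mul_sum, coeff_sum]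
    refine sum_congr rfl fun j _ => ?_
    rw [← smul_eq_mul (c j), ← coeff_smul, ← mul_smul_comm, smul_monomial, smul_eq_mul, mul_one]
  have hs : ∀ h : (Fin 2 →₀ ℕ) → K, ∑ j, monomial ((monoms 2 S).equivFin.symm j).1
      (h ((monoms 2 S).equivFin.symm j).1) = ∑ α ∈ monoms 2 S, monomial α (h α) := fun h => by
    rw [← sum_coe_sort (monoms 2 S), ← (monoms 2 S).equivFin.symm.sum_comp]
  constructor
  · intro hc c hz
    set h : (Fin 2 →₀ ℕ) → K := fun α => if hα : α ∈ monoms 2 S then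
      c ((monoms 2 S).equivFin ⟨α, hα⟩) else 0
    have hcj : ∀ j, h ((monoms 2 S).equivFin.symm j).1 = c j := fun j => by simp [h]
    have e := hs h
    simp_rw [hcj] at e
    have h0 := hc _ (totalDegree_le_iff.2 (support_sum_monomial _ h)) fun α hα hdα => by
      rw [← e, key]
      exact hz ⟨α, hα, hdα⟩
    funext j
    have := congrArg (coeff ((monoms 2 S).equivFin.symm j).1) h0
    rwa [coeff_sum_monomial _ _ ((monoms 2 S).equivFin.symm j).2, hcj, coeff_zero] at this
  · intro hc H hH hz
    have e := hs fun α => coeff α H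
    have h2 : ∑ α ∈ monoms 2 S, monomial α (coeff α H) = H := by
      conv_rhs => rw [H.as_sum]
      exact (sum_subset (totalDegree_le_iff.1 hH) fun α _ h => by
        rw [notMem_support_iff.1 h, monomial_zero]).symm
    rw [h2] at e
    have h3 := hc (fun j => coeff ((monoms 2 S).equivFin.symm j).1 H) fun α => by
      rw [← hz α.1 α.2.1 α.2.2, ← e, key, e]
      rfl
    rw [← e]
    exact Finset.sum_eq_zero fun j _ => by rw [congrFun h3 j]; simp

lemma jetMat_map {R R' : Type*} [CommSemiring R] [CommSemiring R'] (ψ : R →+* R') (d S : ℕ)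
    (φ : MP 2 R) (α) (j) : jetMat d S (map ψ φ) α j = ψ (jetMat d S φ α j) := by
  rw [jetMat, jetMat, ← coeff_map, map_mul, map_monomial, ψ.map_one]

lemma jetIrred_of_det_ne_zero {φ : MP 2 K} (e : Fin (monoms 2 S).card → {α // α ∈ monoms 2 (S + 1) ∧
    d ≤ ∑ i, α i}) (h : det (of fun i j => jetMat d S φ (e i) j) ≠ 0) : JetIrred d S φ := by
  refine jetIrred_iff.2 fun c hc => Matrix.eq_zero_of_mulVec_eq_zero h ?_
  funext i
  refine Eq.trans ?_ (hc (e i))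
  simp [mulVec, dotProduct, mul_comm]

/-- The section of `f` by the plane through `P` with slope `κ`, centred at `P`. -/
noncomputable def slice {A R : Type*} [CommRing A] [CommRing R] [Algebra A R] (κ : R)
    (P : Fin 3 → ℤ) : MP 3 A →ₐ[A] MP 2 R :=
  aeval ![X 0 + C (P 0 : R), C κ * X 0 + C (P 1 : R), X 1 + C (P 2 : R)]

section
variable {A R : Type*} [CommRing A] [CommRing R] [Algebra A R] (κ : R) (P : Fin 3 → ℤ)

lemma eval_slice (f : MP 3 A) (a : Fin 2 → R) :
    eval a (slice κ P f) = aeval ![a 0 + P 0, κ * a 0 + P 1, a 1 + P 2] f := by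
  have : ((aeval a : MP 2 R →ₐ[R] R).restrictScalars A).comp (slice κ P) =
      aeval ![a 0 + P 0, κ * a 0 + P 1, a 1 + P 2] :=
    algHom_ext fun i => by fin_cases i <;> simp [slice]
  simpa [aeval_eq_eval] using congrArg (fun g => g f) this

lemma map_slice {R' : Type*} [CommRing R'] [Algebra A R'] (ψ : R →ₐ[A] R') (f : MP 3 A) :
    map (ψ : R →+* R') (slice κ P f) = slice (ψ κ) P f := by
  have : (mapAlgHom ψ).comp (slice κ P) = slice (ψ κ) P :=
    algHom_ext fun i => by fin_cases i <;> simp [slice]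
  simpa using congrArg (fun g => g f) this

lemma pderiv_slice (f : MP 3 A) : pderiv 1 (slice κ P f) = slice κ P (pderiv 2 f) := by
  induction f using MvPolynomial.induction_on with
  | C r => simp [slice, MvPolynomial.algebraMap_apply]
  | add p q hp hq => simp only [map_add, hp, hq]
  | mul_X p i hp =>
    simp only [map_mul, pderiv_mul, hp, map_add]
    congr 2
    fin_cases i <;> simp [slice, pderiv_X]

lemma totalDegree_slice_le (f : MP 3 A) : (slice κ P f).totalDegree ≤ f.totalDegree := by
  have h : ∀ i, ((![X 0 + C (P 0 : R), C κ * X 0 + C (P 1 : R), X 1 + C (P 2 : R)] :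
      Fin 3 → MP 2 R) i).totalDegree ≤ 1 := by
    have hX : ∀ i, (X i : MP 2 R).totalDegree ≤ 1 := fun i =>
      (totalDegree_monomial_le _ _).trans (by simp)
    have hC : ∀ c : R, (C c : MP 2 R).totalDegree ≤ 1 := fun c => by simp
    intro i
    fin_cases i
    · exact (totalDegree_add _ _).trans (max_le (hX 0) (hC _))
    · exact (totalDegree_add _ _).trans (max_le ((totalDegree_mul _ _).trans (by simpa using hX 0)) (hC _))
    · exact (totalDegree_add _ _).trans (max_le (hX 1) (hC _))
  rw [slice, ← aeval_map_algebraMap R]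
  exact (totalDegree_aeval_le _ 1 h _).trans (by rw [one_mul]; exact totalDegree_map_le' _ _)

end

lemma le_degreeOf_slice [Algebra ℚ K] (κ : K) (P : Fin 3 → ℤ) {f : MP 3 ℚ} (hf : coeff (single 2
    f.totalDegree) f ≠ 0) : f.totalDegree ≤ degreeOf 1 (slice κ P f) := by
  have := Algebra.charZero_of_charZero ℚ K
  set d := f.totalDegree
  set q := lastPoly (fun i : Fin 2 => (P i.castSucc : K)) (map (algebraMap ℚ K) f)
  have hd : (map (algebraMap ℚ K) f).totalDegree ≤ d := totalDegree_map_le' _ _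
  have h1 : q.coeff d ≠ 0 := by
    rw [coeff_lastPoly _ _ hd, coeff_map]
    simpa using hf
  have h2 : q.natDegree = d := le_antisymm ((natDegree_lastPoly_le _ _).trans hd)
    (Polynomial.le_natDegree_of_ne_zero h1)
  have h3 : lastPoly (fun _ : Fin 1 => (0 : K)) (slice κ P f) = q.comp (pX + pC (P 2 : K)) := by
    refine Polynomial.funext fun t => ?_
    rw [Polynomial.eval_comp, eval_lastPoly, eval_lastPoly, aeval_map_algebraMap, aeval_eq_eval,
      eval_slice]
    congr 1
    congr 1
    funext i
    fin_cases i <;> simp [snoc]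
  have h4 : (q.comp (pX + pC (P 2 : K))).coeff d ≠ 0 := by
    have h5 : (q.comp (pX + pC (P 2 : K))).natDegree = d := by
      rw [Polynomial.natDegree_comp, natDegree_X_add_C, mul_one, h2]
    rw [← h5, Polynomial.coeff_natDegree, Polynomial.leadingCoeff_comp (by
      rw [natDegree_X_add_C]; exact one_ne_zero), Polynomial.leadingCoeff_X_add_C, one_pow,
      mul_one, Polynomial.leadingCoeff, h2]
    exact h1
  rw [← h3, coeff_lastPoly _ _ (totalDegree_slice_le κ P f)] at h4
  simpa using degreeOf_le_iff.1 (le_refl (degreeOf 1 (slice κ P f))) _ (mem_support_iff.2 h4)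

/-- The generic slope. -/
noncomputable abbrev genSlope : FractionRing ℚ[X] := algebraMap ℚ[X] _ pX

lemma exists_slice_eq_mul (P : Fin 3 → ℤ) (Q : MP 2 (FractionRing ℚ[X])) : ∃ (q H : MP 3 ℚ), slice
    genSlope P q ≠ 0 ∧ degreeOf 1 (slice genSlope P q) = 0 ∧ slice genSlope P H = slice genSlope P q
    * Q := by
  set κ := genSlope with hκ
  have hx : slice κ P (X 0 - C (P 0 : ℚ)) = X 0 := by simp [slice]
  have hpoly : ∀ u : ℚ[X], ∃ (M : ℕ) (H : MP 3 ℚ),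
      slice κ P H = C (algebraMap _ _ u) * X 0 ^ M := by
    intro u
    induction u using Polynomial.induction_on' with
    | add u v hu hv =>
      obtain ⟨M, H, h⟩ := hu
      obtain ⟨M', H', h'⟩ := hv
      refine ⟨M + M', H * (X 0 - C (P 0 : ℚ)) ^ M' + H' * (X 0 - C (P 0 : ℚ)) ^ M, ?_⟩
      simp only [map_add, map_mul, map_pow, hx, h, h', pow_add]
      ring
    | monomial n a =>
      refine ⟨n, C a * (X 1 - C (P 1 : ℚ)) ^ n, ?_⟩
      have h1 : slice κ P (X 1 - C (P 1 : ℚ)) = C κ * X 0 := by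
        simp [slice]
      rw [map_mul, map_pow, h1, ← Polynomial.C_mul_X_pow_eq_monomial, map_mul, map_pow, map_mul,
        map_pow, mul_pow, ← mul_assoc]
      congr 2
      rw [← algebraMap_eq, commutes, MvPolynomial.algebraMap_apply,
        IsScalarTower.algebraMap_apply ℚ ℚ[X]]
      rfl
  have hdeg : ∀ {a b : MP 2 (FractionRing ℚ[X])}, degreeOf 1 a = 0 →
      degreeOf 1 b = 0 → degreeOf 1 (a * b) = 0 := fun ha hb =>
    Nat.le_zero.1 ((degreeOf_mul_le _ _ _).trans (by rw [ha, hb]))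
  induction Q using MvPolynomial.induction_on with
  | C a =>
    obtain ⟨u, v, hv, rfl⟩ := IsFractionRing.div_surjective (A := ℚ[X]) a
    obtain ⟨M, H, h⟩ := hpoly u
    obtain ⟨M', q, h'⟩ := hpoly v
    have hv0 : algebraMap _ (FractionRing ℚ[X]) v ≠ 0 :=
      IsFractionRing.to_map_ne_zero_of_mem_nonZeroDivisors hv
    refine ⟨q * (X 0 - C (P 0 : ℚ)) ^ M, H * (X 0 - C (P 0 : ℚ)) ^ M', ?_, ?_, ?_⟩
    · rw [map_mul, map_pow, hx, h']
      exact mul_ne_zero (mul_ne_zero (by simpa using hv0) (pow_ne_zero _ (X_ne_zero _)))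
        (pow_ne_zero _ (X_ne_zero _))
    · rw [map_mul, map_pow, hx, h']
      exact hdeg (hdeg (degreeOf_C _ _) (degreeOf_X_pow_of_ne _ (by decide)))
        (degreeOf_X_pow_of_ne _ (by decide))
    · simp only [map_mul, map_pow, hx, h, h']
      rw [show algebraMap _ (FractionRing ℚ[X]) u =
        algebraMap _ _ v * (algebraMap _ _ u / algebraMap _ _ v) from (mul_div_cancel₀ _ hv0).symm,
        C_mul]
      simp only [mul_div_cancel_left₀ _ hv0]
      ring
  | add p p' hp hp' =>
    obtain ⟨q, H, h1, h2, h3⟩ := hp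
    obtain ⟨q', H', h1', h2', h3'⟩ := hp'
    refine ⟨q * q', H * q' + H' * q, ?_, ?_, ?_⟩
    · rw [map_mul]; exact mul_ne_zero h1 h1'
    · rw [map_mul]; exact hdeg h2 h2'
    · simp only [map_mul, map_add, h3, h3']; ring
  | mul_X p i hp =>
    obtain ⟨q, H, h1, h2, h3⟩ := hp
    have : ∃ Y : MP 3 ℚ, slice κ P Y = X i := by
      fin_cases i
      · exact ⟨_, hx⟩
      · exact ⟨X 2 - C (P 2 : ℚ), by simp [slice]⟩
    obtain ⟨Y, hY⟩ := this
    exact ⟨q, H * Y, h1, h2, by rw [map_mul, hY, h3, mul_assoc]⟩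

lemma eval_branch_ne_zero {P : Fin 3 → ℤ} {f : MP 3 ℚ} (hf : Irreducible f) (hlc : coeff (single 2
    f.totalDegree) f ≠ 0) (hd : 1 ≤ f.totalDegree) (ev : MP 2 (FractionRing ℚ[X]) →ₐ[FractionRing
    ℚ[X]] PowerSeries (FractionRing ℚ[X])) (hX : ev (X 0) = sX) (hev : ev (slice genSlope P f) = 0)
    {Q : MP 2 (FractionRing ℚ[X])} (hQ : Q ≠ 0) (hQd : degreeOf 1 Q < f.totalDegree) : ev Q ≠ 0 :=
    by
  intro hQ0
  obtain ⟨q, H, hq0, hqd, hH⟩ := exists_slice_eq_mul P Q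
  have hx : slice genSlope P (X 0 - C (P 0 : ℚ)) = X 0 := by simp [slice]
  have hx0 : (X 0 - C (P 0 : ℚ) : MP 3 ℚ) ≠ 0 := fun h => by
    rw [h, map_zero] at hx
    exact X_ne_zero _ hx.symm
  have hxd : 1 ≤ (X 0 - C (P 0 : ℚ) : MP 3 ℚ).totalDegree := by
    by_contra h
    have h1 := totalDegree_slice_le genSlope P (X 0 - C (P 0 : ℚ))
    rw [hx, totalDegree_X] at h1
    omega
  have e : slice genSlope P (H * (X 0 - C (P 0 : ℚ))) = slice genSlope P q * Q * X 0 := by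
    rw [map_mul, hx, hH]
  have hG0 : slice genSlope P (H * (X 0 - C (P 0 : ℚ))) ≠ 0 := by
    rw [e]
    exact mul_ne_zero (mul_ne_zero hq0 hQ) (X_ne_zero _)
  have hdvd : ¬ f ∣ H * (X 0 - C (P 0 : ℚ)) := by
    rintro ⟨U, hU⟩
    have h1 := hG0
    have h2 : degreeOf 1 (slice genSlope P (H * (X 0 - C (P 0 : ℚ)))) < f.totalDegree := by
      rw [e]
      refine (degreeOf_mul_le _ _ _).trans_lt ?_
      rw [degreeOf_X_of_ne (by decide), add_zero]
      refine (degreeOf_mul_le _ _ _).trans_lt ?_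
      rwa [hqd, zero_add]
    rw [hU, map_mul] at h1 h2
    rw [degreeOf_mul_eq (left_ne_zero_of_mul h1) (right_ne_zero_of_mul h1)] at h2
    have := le_degreeOf_slice genSlope P hlc
    omega
  have hHx : H * (X 0 - C (P 0 : ℚ)) ≠ 0 := fun h => hG0 (by rw [h, map_zero])
  obtain ⟨R, hR0, -, A, B, hR⟩ := exists_eliminant hf.ne_zero hHx
    (hf.isRelPrime_iff_not_dvd.2 hdvd) hd
    (by rw [totalDegree_mul_of_isDomain (left_ne_zero_of_mul hHx) hx0]; omega)
    ![0, 1] (by decide)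
  have h1 : ev (slice genSlope P (rename ![0, 1] R)) = 0 := by
    rw [hR, map_add, map_add, map_mul, map_mul, map_mul, map_mul, hev, e, map_mul, map_mul, hQ0]
    simp
  set W : Polynomial (FractionRing ℚ[X]) := aeval
    ![pX + pC (P 0 : FractionRing ℚ[X]), pC genSlope * pX + pC (P 1 : FractionRing ℚ[X])] R
  have h2 : (W : PowerSeries (FractionRing ℚ[X])) = 0 := by
    rw [← h1]
    have : ((coeToPowerSeries.algHom (FractionRing ℚ[X])).restrictScalars ℚ).comp (aeval
      ![pX + pC (P 0 : FractionRing ℚ[X]),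
      pC genSlope * pX + pC (P 1 : FractionRing ℚ[X])]) =
      ((ev.restrictScalars ℚ).comp (slice genSlope P)).comp (rename ![0, 1]) :=
      algHom_ext fun i => by
        fin_cases i <;> simp [slice, hX, ← algebraMap_eq] <;>
          exact map_intCast (coeToPowerSeries.ringHom (R := FractionRing ℚ[X])) _
    exact AlgHom.congr_fun this R
  have hW : W = 0 := mod_cast h2
  have h3 : ∀ a t : ℚ, eval ![a + P 0, t * a + P 1] R = 0 := by
    intro a t
    set V : ℚ[X] := aeval ![pC (a + P 0), pX * pC a + pC (P 1 : ℚ)] R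
    have h4 : algebraMap ℚ[X] (FractionRing ℚ[X]) V = W.eval (algebraMap ℚ _ a) := by
      have : ((ofId ℚ[X] (FractionRing ℚ[X])).restrictScalars ℚ).comp
          (aeval ![pC (a + P 0), pX * pC a + pC (P 1 : ℚ)]) =
        ((Polynomial.aeval (algebraMap ℚ (FractionRing ℚ[X]) a)).restrictScalars ℚ).comp (aeval
      ![pX + pC (P 0 : FractionRing ℚ[X]),
      pC genSlope * pX + pC (P 1 : FractionRing ℚ[X])]) := algHom_ext fun i => by
          have h := eq_ratCast ((algebraMap ℚ[X] (FractionRing ℚ[X])).comp pC) a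
          rw [RingHom.comp_apply] at h
          fin_cases i <;> simp [Algebra.ofId_apply, h] <;> exact mul_comm _ _
      exact AlgHom.congr_fun this R
    rw [hW, Polynomial.eval_zero, FaithfulSMul.algebraMap_eq_zero_iff] at h4
    have h5 : V.eval t = eval ![a + P 0, t * a + P 1] R := by
      have : (Polynomial.aeval t).comp
          (aeval ![pC (a + P 0), pX * pC a + pC (P 1 : ℚ)]) =
          aeval ![a + P 0, t * a + P 1] := algHom_ext fun i => by fin_cases i <;> simp <;> exact mul_comm _ _
      exact AlgHom.congr_fun this R
    rw [← h5, h4, Polynomial.eval_zero]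
  have h5 : (X 0 - C (P 0 : ℚ)) * R = 0 := by
    refine MvPolynomial.funext fun x => ?_
    rw [map_mul, map_zero]
    by_cases hx : x 0 = P 0
    · simp [hx]
    · have h6 := h3 (x 0 - P 0) ((x 1 - P 1) / (x 0 - P 0))
      have h7 : ![x 0 - P 0 + P 0, (x 1 - P 1) / (x 0 - P 0) * (x 0 - P 0) + P 1] = x := by
        rw [div_mul_cancel₀ _ (sub_ne_zero.2 hx)]
        funext i
        fin_cases i <;> simp
      rw [h7] at h6
      rw [h6, mul_zero]
  rcases mul_eq_zero.1 h5 with h | h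
  · have := congrArg (eval fun _ => (P 0 : ℚ) + 1) h
    simp at this
  · exact hR0 h

lemma jetIrred_slice {P : Fin 3 → ℤ} {f : MP 3 ℚ} (hf : Irreducible f) (hlc : coeff (single 2
    f.totalDegree) f ≠ 0) (hd : 1 ≤ f.totalDegree) (h0 : evQ P f = 0) (h1 : evQ P (pderiv 2 f) ≠ 0)
    : JetIrred f.totalDegree (f.totalDegree * f.totalDegree) (slice genSlope P f) := by
  have hev0 : ∀ g : MP 3 ℚ, eval 0 (slice genSlope P g) =
      algebraMap ℚ (FractionRing ℚ[X]) (evQ P g) := fun g => by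
    rw [eval_slice, ← coe_aeval_eq_eval, RingHom.coe_coe, ← aeval_algebraMap_apply]
    congr 2
    funext i
    fin_cases i <;> simp
  have h0' : eval 0 (slice genSlope P f) = 0 := by rw [hev0, h0, map_zero]
  have h1' : eval 0 (pderiv 1 (slice genSlope P f)) ≠ 0 := by
    rw [pderiv_slice, hev0]
    exact (map_ne_zero _).2 h1
  have hdeg := le_degreeOf_slice genSlope P hlc
  have htd : (slice genSlope P f).totalDegree = f.totalDegree :=
    le_antisymm (totalDegree_slice_le _ _ _) (hdeg.trans (degreeOf_le_totalDegree _ _))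
  refine Irreducible.jetIrred ?_ htd h0' h1' le_rfl
  obtain ⟨ev, -, hX, hev⟩ := exists_branch _ 0 h0' h1'
  rw [Pi.zero_apply, C_0, sub_zero] at hX
  have hne : slice genSlope P f ≠ 0 := fun h => by rw [h] at h1'; simp at h1'
  have key : ∀ A B, slice genSlope P f = A * B → ev A = 0 → IsUnit B := by
    intro A B hAB hA
    have hA0 := left_ne_zero_of_mul (hAB ▸ hne)
    have hB0 := right_ne_zero_of_mul (hAB ▸ hne)
    have hAd : f.totalDegree ≤ degreeOf 1 A := by
      by_contra h
      exact eval_branch_ne_zero hf hlc hd ev hX hev hA0 (not_le.1 h) hA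
    have h2 := degreeOf_le_totalDegree A 1
    rw [hAB, totalDegree_mul_of_isDomain hA0 hB0] at htd
    exact (isUnit_iff_totalDegree_of_isReduced (P := B)).2 ⟨isUnit_iff_ne_zero.2 fun h => hB0 (by
      rw [totalDegree_eq_zero_iff_eq_C.1 (by omega : B.totalDegree = 0), h, C_0]), by omega⟩
  refine ⟨fun hu => ?_, fun A B hAB => ?_⟩
  · have := hu.map ev
    rw [hev] at this
    exact not_isUnit_zero this
  · have := hev
    rw [hAB, map_mul, mul_eq_zero] at this
    rcases this with h | h
    · exact inr (key A B hAB h)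
    · exact inl (key B A (by rw [hAB, mul_comm]) h)

lemma coeffNorm_aeval_le {σ τ : Type*} [Fintype σ] (v : σ → MvPolynomial τ ℤ) {L : ℤ} (hL : 1 ≤ L)
    (hv : ∀ i, coeffNorm (v i) ≤ L) (f : MvPolynomial σ ℤ) :
    coeffNorm (aeval v f) ≤ coeffNorm f * L ^ f.totalDegree := by
  rw [aeval_def, eval₂_eq', coeffNorm.eq_1 f, sum_mul]
  refine (coeffNorm_sum_le _ _).trans (sum_le_sum fun α hα => ?_)
  refine (coeffNorm_mul_le _ _).trans (mul_le_mul ?_ ?_ (coeffNorm_nonneg _) (abs_nonneg _))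
  · exact coeffNorm_monomial_le 0 _
  have h1 : ∀ i ∈ univ, coeffNorm (v i ^ α i) ≤ L ^ α i := fun i _ => by
    simpa using (coeffNorm_prod_le (range (α i)) fun _ => v i).trans
      (prod_le_prod (fun _ _ => coeffNorm_nonneg _) fun _ _ => hv i)
  refine (coeffNorm_prod_le _ _).trans ((prod_le_prod (fun i _ => coeffNorm_nonneg _) h1).trans ?_)
  rw [prod_pow_eq_pow_sum]
  refine pow_le_pow_right₀ hL ?_
  have := le_totalDegree hα
  rwa [sum_fintype _ _ fun _ => rfl] at this

lemma natDegree_coeff_slice_le (P : Fin 3 → ℤ) (f : MP 3 ℤ) (α : Fin 2 →₀ ℕ) :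
    (coeff α (slice (pX : ℤ[X]) P f)).natDegree ≤ f.totalDegree := by
  have hmul : ∀ {Φ Ψ : MP 2 ℤ[X]} {j k : ℕ},
      (∀ α, (coeff α Φ).natDegree ≤ j) → (∀ α, (coeff α Ψ).natDegree ≤ k) →
      ∀ α, (coeff α (Φ * Ψ)).natDegree ≤ j + k := fun h h' α => by
    rw [coeff_mul]
    exact natDegree_sum_le_of_forall_le _ _ fun x _ =>
      Polynomial.natDegree_mul_le.trans (add_le_add (h _) (h' _))
  have hv : ∀ i α, (coeff α ((![X 0 + C (P 0 : ℤ[X]), C pX * X 0 +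
      C (P 1 : ℤ[X]), X 1 + C (P 2 : ℤ[X])] :
      Fin 3 → MP 2 ℤ[X]) i)).natDegree ≤ 1 := by
    intro i α
    have h1 : ∀ (a : ℤ) α, (coeff α (C (a : ℤ[X]) : MP 2 ℤ[X])).natDegree ≤ 1 := fun a α => by
      rw [coeff_C]; split_ifs <;> simp
    have h2 : ∀ i α, (coeff α (X i : MP 2 ℤ[X])).natDegree ≤ 0 := fun i α => by
      rw [coeff_X]; split_ifs <;> simp
    fin_cases i
    · exact Polynomial.natDegree_add_le_of_degree_le ((h2 0 α).trans zero_le_one) (h1 _ _)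
    · refine Polynomial.natDegree_add_le_of_degree_le (hmul (j := 1) (k := 0) (fun α => ?_) (h2 0) α) (h1 _ _)
      rw [coeff_C]; split_ifs <;> simp
    · exact Polynomial.natDegree_add_le_of_degree_le ((h2 1 α).trans zero_le_one) (h1 _ _)
  have hpow : ∀ i k α, (coeff α ((![X 0 + C (P 0 : ℤ[X]), C pX * X 0 +
      C (P 1 : ℤ[X]), X 1 + C (P 2 : ℤ[X])] :
      Fin 3 → MP 2 ℤ[X]) i ^ k)).natDegree ≤ k := by
    intro i k
    induction k with
    | zero => intro α; rw [pow_zero, coeff_one]; split_ifs <;> simp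
    | succ k ih => rw [pow_succ]; exact hmul ih (hv i)
  rw [slice, aeval_def, eval₂_eq', coeff_sum]
  refine natDegree_sum_le_of_forall_le _ _ fun β hβ => ?_
  rw [prod_univ_three]
  have hβ' := le_totalDegree hβ
  rw [sum_fintype _ _ fun _ => rfl, Fin.sum_univ_three] at hβ'
  refine (hmul (j := 0) (fun γ => ?_) (hmul (hmul (hpow 0 (β 0)) (hpow 1 (β 1))) (hpow 2 (β 2))) α).trans (by omega)
  rw [MvPolynomial.algebraMap_apply, coeff_C]
  split_ifs <;> simp

lemma natDegree_det_le_mul {k : ℕ} (M : Matrix (Fin s) (Fin s) ℤ[X])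
    (h : ∀ i j, (M i j).natDegree ≤ k) : M.det.natDegree ≤ s * k := by
  rw [det_apply]
  refine natDegree_sum_le_of_forall_le _ _ fun σ _ => ?_
  refine (Polynomial.natDegree_smul_le _ _).trans ((Polynomial.natDegree_prod_le _ _).trans ?_)
  exact (sum_le_card_nsmul _ _ k fun i _ => h _ _).trans (by simp)

lemma slice_map_intCast [Algebra ℚ K] (κ : K) (P : Fin 3 → ℤ) (f : MP 3 ℤ) :
    slice κ P (map (castRingHom ℚ) f) = slice κ P f :=
  aeval_map_algebraMap ℚ _ f

lemma card_le_of_slices [Fact p.Prime] (f : MP 3 ℤ) (hd : f.totalDegree ≤ d) (P : Fin 3 → ℤ) (T :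
    Finset (ZMod p)) {M : ℝ} (hM : 0 ≤ M) (h : ∀ κ, κ ∉ T → ∀ Z : Finset (Fin 2 → ZMod p), (∀ a ∈ Z,
    eval a (slice κ P f) = 0 ∧ eval a (pderiv 1 (slice κ P f)) ≠ 0) → (Z.card : ℝ) ≤ M) (Z : Finset
    (Fin 3 → ZMod p)) (hZ : ∀ a ∈ Z, aeval a f = 0 ∧ aeval a (pderiv 2 f) ≠ 0) : (Z.card : ℝ) ≤ (1 +
    T.card) * (d * p) + p * M := by
  classical
  have hmap : ∀ (a : Fin 3 → ZMod p) g, aeval a g = eval a (map (castRingHom (ZMod p)) g) :=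
    fun a g => (aeval_def a g).trans (eval_map _ _ _).symm
  have h1 : (Z.filter fun a => a 0 = (P 0 : ZMod p)).card ≤ d * p := by
    have hs : ∀ a ∈ Z.filter fun a => a 0 = (P 0 : ZMod p), aeval a f = 0 ∧ aeval a (pderiv 2 f) ≠ 0 :=
      fun a ha => hZ a (mem_filter.1 ha).1
    simp_rw [hmap, pderiv_map.symm] at hs
    refine (card_le_mul_card_init (map (castRingHom (ZMod p)) f)
      ((totalDegree_map_le' _ _).trans hd) _ (fun a ha => (hs a ha).1) fun a ha h0 => (hs a ha).2
      ?_).trans (Nat.mul_le_mul_left _ ?_)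
    · exact (by rw [← eval_lastPoly_init, ← derivative_lastPoly, h0]; simp :
        eval a (pderiv (last 2) (map (castRingHom (ZMod p)) f)) = 0)
    · refine (card_le_card_of_injOn (t := univ) (fun y => y 1)
        (fun _ _ => mem_coe.2 (mem_univ _)) ?_).trans
        (by simp)
      intro y hy z hz hyz
      obtain ⟨a, ha, rfl⟩ := mem_image.1 hy
      obtain ⟨b, hb, rfl⟩ := mem_image.1 hz
      have e := (mem_filter.1 ha).2.trans (mem_filter.1 hb).2.symm
      funext i
      fin_cases i
      · exact e
      · exact hyz
  set Y := Z.filter fun a => ¬ a 0 = (P 0 : ZMod p)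
  let q : (Fin 3 → ZMod p) → ZMod p := fun a => (a 1 - P 1) / (a 0 - P 0)
  have h2 : ∀ κ, ((Y.filter (q · = κ)).card : ℝ) ≤ M + if κ ∈ T then (d * p : ℝ) else 0 := by
    intro κ
    set W := (Y.filter (q · = κ)).image
      fun a => (![a 0 - P 0, a 2 - P 2] : Fin 2 → ZMod p)
    have hb : ∀ a ∈ Y.filter (q · = κ),
        ![(![a 0 - P 0, a 2 - P 2] : Fin 2 → ZMod p) 0 + P 0, κ * (![a 0 - P 0, a 2 - P 2] :
          Fin 2 → ZMod p) 0 + P 1, (![a 0 - P 0, a 2 - P 2] : Fin 2 → ZMod p) 1 + P 2] = a := by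
      intro a ha
      obtain ⟨ha', rfl⟩ := mem_filter.1 ha
      have := sub_ne_zero.2 (mem_filter.1 ha').2
      funext i
      fin_cases i
      · simp
      · simp [q, div_mul_cancel₀ _ this]
      · simp
    have hcard : (Y.filter (q · = κ)).card = W.card := (card_image_of_injOn fun a ha b hb' hab => by
        rw [← hb a ha, ← hb b hb']
        exact congrArg (fun w : Fin 2 → ZMod p => ![w 0 + P 0, κ * w 0 + P 1, w 1 + P 2]) hab).symm
    have hW : ∀ w ∈ W, eval w (slice κ P f) = 0 ∧ eval w (pderiv 1 (slice κ P f)) ≠ 0 := by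
      intro w hw
      obtain ⟨a, ha, rfl⟩ := mem_image.1 hw
      rw [pderiv_slice, eval_slice, eval_slice, hb a ha]
      exact hZ a (mem_filter.1 (mem_filter.1 ha).1).1
    rw [hcard]
    split_ifs with hκ
    · have := card_smooth_zeros_le (m := 1) _ ((totalDegree_slice_le κ P f).trans hd) W
        (fun w hw => (hW w hw).1) fun w hw => (hW w hw).2
      rw [ZMod.card, pow_one] at this
      have : (W.card : ℝ) ≤ d * p := mod_cast this
      linarith
    · linarith [h κ hκ W hW]
  have h3 : (Y.card : ℝ) ≤ p * M + T.card * (d * p) := by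
    rw [Finset.card_eq_sum_card_fiberwise (t := univ) (f := q) fun _ _ => mem_coe.2 (mem_univ _)]
    push_cast
    refine (sum_le_sum fun κ _ => h2 κ).trans ?_
    rw [sum_add_distrib, ← sum_filter]
    simp
  have h4 := card_filter_add_card_filter_not (s := Z) fun a => a 0 = (P 0 : ZMod p)
  have h5 : (Z.card : ℝ) = (Z.filter fun a => a 0 = (P 0 : ZMod p)).card + Y.card := mod_cast h4.symm
  have h1' : ((Z.filter fun a => a 0 = (P 0 : ZMod p)).card : ℝ) ≤ d * p := mod_cast h1
  linarith

lemma exists_card_smooth_residues_le (d : ℕ) (hd : 1 ≤ d) (η : ℝ) (hη : 0 < η) : ∃ c : ℕ, ∀ f : MP 3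
    ℤ, f.totalDegree = d → Irreducible (map (castRingHom ℚ) f) → coeff (single 2 d) f ≠ 0 → ∀ H : ℤ,
    1 ≤ H → coeffNorm f ≤ H → ∀ P : Fin 3 → ℤ, (∀ i, |P i| ≤ H) → eval P f = 0 → eval P (pderiv 2 f)
    ≠ 0 → ∃ N : ℤ, N ≠ 0 ∧ |N| ≤ c * H ^ c ∧ ∀ (p : ℕ) [Fact p.Prime], c ≤ p → ¬ (p : ℤ) ∣ N → ∀ Z :
    Finset (Fin 3 → ZMod p), (∀ a ∈ Z, aeval a f = 0 ∧ aeval a (pderiv 2 f) ≠ 0) → (Z.card : ℝ) ≤ (1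
    + η) * p ^ 2 := by
  choose! p₀ hp₀ using fun (δ : ℕ) (hδ : 1 ≤ δ) => exists_stepanov δ hδ (η / 2) (half_pos hη)
  set s := (monoms 2 (d * d)).card with hs
  obtain ⟨c₁, hc₁⟩ := exists_nat_ge (2 * ((1 + (s * d : ℕ)) * d) / η)
  set c₂ := s.factorial * (s * d + 2) ^ (d * (s + 1))
  refine ⟨c₁ + c₂ + (1 + d) * (s + 1) + ∑ δ ∈ Icc 1 d, p₀ δ, ?_⟩
  set c := c₁ + c₂ + (1 + d) * (s + 1) + ∑ δ ∈ Icc 1 d, p₀ δ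
  intro f hfd hf hlc H hH hfH P hP h0 h1
  set g := map (castRingHom ℚ) f
  have hgd : g.totalDegree = d := (totalDegree_map_intCast f).trans hfd
  have hJ := jetIrred_slice (P := P) hf (by
    change coeff (single 2 g.totalDegree) g ≠ 0
    rw [hgd, coeff_map]; simpa using hlc) (by change 1 ≤ g.totalDegree; omega)
    (by rw [eval_map_intCast, h0, cast_zero])
    (by rw [pderiv_map, eval_map_intCast]; exact_mod_cast h1)
  change JetIrred g.totalDegree (g.totalDegree * g.totalDegree) _ at hJ
  rw [hgd, slice_map_intCast] at hJ
  obtain ⟨e, he⟩ := exists_minor_ne_zero _ (jetIrred_iff.1 hJ)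
  set M : Matrix (Fin s) (Fin s) ℤ[X] := of fun i j => jetMat d (d * d) (slice pX P f) (e i) j
  have hev : ∀ {R : Type} [CommRing R] (ψ : ℤ[X] →+* R), ψ M.det = det
      (of fun i j => jetMat d (d * d) (slice (ψ pX) P f) (e i) j) := by
    intro R _ ψ
    rw [map_det]
    congr 1
    ext i j
    have := map_slice pX P ψ.toIntAlgHom f
    rw [RingHom.toIntAlgHom_apply] at this
    rw [← this]
    exact (jetMat_map ψ _ _ _ _ _).symm
  have hM0 : M.det ≠ 0 := by
    intro h
    apply he
    have h2 := hev (R := FractionRing ℚ[X])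
      (eval₂RingHom (castRingHom _) genSlope)
    rw [h, map_zero, coe_eval₂RingHom, Polynomial.eval₂_X] at h2
    exact h2.symm
  have hMd : M.det.natDegree ≤ s * d := natDegree_det_le_mul M fun i j => by
    change (jetMat d (d * d) (slice pX P f) (e i) j).natDegree ≤ d
    rw [jetMat, coeff_mul_monomial', mul_one]
    split_ifs
    · exact (natDegree_coeff_slice_le P f _).trans hfd.le
    · simp
  obtain ⟨κ, hκs, hκ⟩ : ∃ κ : ℕ, κ ≤ s * d ∧ M.det.eval (κ : ℤ) ≠ 0 := by
    by_contra! hc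
    exact hM0 (Polynomial.eq_zero_of_natDegree_lt_card_of_eval_eq_zero M.det
      (f := fun k : Fin (s * d + 1) => ((k : ℕ) : ℤ)) (fun a b h => Fin.ext (Nat.cast_injective h))
      (fun k => hc k (by omega)) (by simpa using Nat.lt_succ_of_le hMd))
  set L : ℤ := (s * d + 2 : ℕ) * H
  have hL : 1 ≤ L := by
    change 1 ≤ ((s * d + 2 : ℕ) : ℤ) * H
    push_cast
    nlinarith [Nat.zero_le (s * d), (by positivity : (0 : ℤ) ≤ s * d)]
  set φ : MP 2 ℤ := slice (κ : ℤ) P f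
  have hφ : coeffNorm φ ≤ H * L ^ d := by
    have hC : ∀ a : ℤ, coeffNorm (C a : MP 2 ℤ) ≤ |a| := coeffNorm_monomial_le 0
    have hX : ∀ i, coeffNorm (X i : MP 2 ℤ) ≤ 1 := fun i => coeffNorm_monomial_le _ 1
    have hκ' : (κ : ℤ) ≤ s * d := mod_cast hκs
    have hL' : L = s * d * H + 2 * H := by
      change ((s * d + 2 : ℕ) : ℤ) * H = _
      push_cast; ring
    have h3 : (s * d : ℤ) ≤ s * d * H := le_mul_of_one_le_right (by positivity) hH
    have h4 : (0 : ℤ) ≤ s * d := by positivity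
    refine (coeffNorm_aeval_le _ hL (fun i => ?_) f).trans (by
      rw [hfd]; exact mul_le_mul_of_nonneg_right hfH (by positivity))
    fin_cases i
    · refine (coeffNorm_add_le _ _).trans ((add_le_add (hX 0) ((hC _).trans (hP 0))).trans ?_)
      linarith
    · refine (coeffNorm_add_le _ _).trans ((add_le_add ((coeffNorm_mul_le _ _).trans
        (mul_le_mul (hC _) (hX 0) (coeffNorm_nonneg _) (abs_nonneg _)))
        ((hC _).trans (hP 1))).trans ?_)
      rw [abs_cast]
      linarith
    · refine (coeffNorm_add_le _ _).trans ((add_le_add (hX 1) ((hC _).trans (hP 2))).trans ?_)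
      linarith
  have hA0 : 0 ≤ H * L ^ d := by positivity
  have hcoef : ∀ α, |coeff α φ| ≤ H * L ^ d := fun α => by
    by_cases hα : α ∈ φ.support
    · exact (single_le_sum (f := fun α => |coeff α φ|) (fun _ _ => abs_nonneg _) hα).trans hφ
    · rw [notMem_support_iff.1 hα, abs_zero]
      exact hA0
  have hev0 : ∀ h : MP 3 ℤ, eval 0 (slice (κ : ℤ) P h) = eval P h := fun h => by
    rw [eval_slice, aeval_def, eval₂_eq', eval_eq']
    simp [prod_univ_three]
  have hdetκ := hev (Polynomial.evalRingHom (κ : ℤ))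
  rw [Polynomial.coe_evalRingHom, Polynomial.eval_X] at hdetκ
  refine ⟨M.det.eval (κ : ℤ) * eval P (pderiv 2 f), mul_ne_zero hκ h1, ?_, ?_⟩
  · have h3 : |M.det.eval (κ : ℤ)| ≤ s.factorial * ∏ _i : Fin s, (H * L ^ d) := by
      rw [hdetκ]
      refine abs_det_le _ _ fun j i => ?_
      rw [of_apply, jetMat, coeff_mul_monomial', mul_one]
      split_ifs
      · exact hcoef _
      · rw [abs_zero]; exact hA0
    have h4 : |eval P (pderiv 2 f)| ≤ H * L ^ d := by
      rw [← hev0, ← pderiv_slice, ← coeff_single_one_eq]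
      exact hcoef _
    rw [abs_mul]
    refine (mul_le_mul h3 h4 (abs_nonneg _) (by positivity)).trans ?_
    have h5 : (s.factorial : ℤ) * (∏ _i : Fin s, (H * L ^ d)) * (H * L ^ d) =
        c₂ * H ^ ((1 + d) * (s + 1)) := by
      simp only [L, c₂, Finset.prod_const, card_univ, card_fin]
      rw [Nat.cast_mul, Nat.cast_pow]
      generalize ((s * d + 2 : ℕ) : ℤ) = x
      ring
    rw [h5]
    refine mul_le_mul ?_ (pow_le_pow_right₀ hH (by omega)) (by positivity) (by positivity)
    exact_mod_cast (by omega : c₂ ≤ c)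
  · intro p _ hp hpN Z hZ
    have hpM : ¬ (p : ℤ) ∣ M.det.eval (κ : ℤ) := fun h => hpN (h.mul_right _)
    set m := M.det.map (castRingHom (ZMod p))
    have hm0 : m ≠ 0 := by
      intro h
      apply hpM
      rw [← intCast_zmod_eq_zero_iff_dvd]
      have := Polynomial.eval_intCast_map (castRingHom (ZMod p)) M.det κ
      change Polynomial.eval _ m = _ at this
      rw [h] at this
      simpa using this.symm
    classical
    have hT : m.roots.toFinset.card ≤ s * d :=
      (Multiset.toFinset_card_le _).trans ((card_roots' m).trans
        ((Polynomial.natDegree_map_le).trans hMd))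
    have h1p : (0 : ℝ) < p := mod_cast (Fact.out : p.Prime).pos
    have hev0p : ∀ (k : ZMod p) (h : MP 3 ℤ),
        eval 0 (slice k P h) = ((eval P h : ℤ) : ZMod p) := fun k h => by
      rw [eval_slice]
      have : (![(0 : Fin 2 → ZMod p) 0 + P 0, k * (0 : Fin 2 → ZMod p) 0 + P 1,
          (0 : Fin 2 → ZMod p) 1 + P 2] : Fin 3 → ZMod p) = fun i => algebraMap ℤ (ZMod p) (P i) := by
        funext i
        fin_cases i <;> simp
      rw [this]
      exact (aeval_algebraMap_apply (ZMod p) P h).trans rfl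
    refine (card_le_of_slices f hfd.le P m.roots.toFinset (M := (1 + η / 2) * p) (by positivity)
      (fun k hk W hW => ?_) Z hZ).trans ?_
    · have hirr : Irreducible (slice k P f) := by
        refine (jetIrred_of_det_ne_zero (S := d * d) e ?_).irreducible
          ((totalDegree_slice_le k P f).trans hfd.le) (by rw [hev0p, h0, cast_zero]) ?_
        · have h2 := hev (R := ZMod p) (eval₂RingHom (castRingHom _) k)
          rw [coe_eval₂RingHom, Polynomial.eval₂_X] at h2
          rw [← h2, ← Polynomial.eval_map]
          intro h3
          exact hk (mem_toFinset.2 ((mem_roots hm0).2 h3))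
        · rw [pderiv_slice, hev0p]
          intro h3
          exact hpN (((intCast_zmod_eq_zero_iff_dvd _ _).1 h3).mul_left _)
      have hδ1 : 1 ≤ (slice k P f).totalDegree := by
        by_contra h3
        have h4 := totalDegree_eq_zero_iff_eq_C.1 (by omega : (slice k P f).totalDegree = 0)
        refine hirr.not_isUnit (h4 ▸ (isUnit_iff_ne_zero.2 fun h => ?_).map C)
        exact hirr.ne_zero (by rw [h4, h, C_0])
      have hδd := (totalDegree_slice_le k P f).trans hfd.le
      exact hp₀ _ hδ1 p ((single_le_sum (f := p₀) (fun _ _ => Nat.zero_le _)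
        (mem_Icc.2 ⟨hδ1, hδd⟩)).trans (by omega)) _ hirr rfl W hW
    · have h3 : 2 * ((1 + (s * d : ℕ)) * d) / η ≤ p := hc₁.trans (mod_cast (by omega : c₁ ≤ p))
      rw [div_le_iff₀ hη] at h3
      have h4 : (m.roots.toFinset.card : ℝ) ≤ (s * d : ℕ) := mod_cast hT
      have h5 : (1 + (m.roots.toFinset.card : ℝ)) * (d * p) ≤ (1 + (s * d : ℕ)) * (d * p) := by gcongr
      nlinarith

lemma exists_monomials_prism (d D : ℕ) : ∃ E : Finset (Fin 3 →₀ ℕ),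
    2 * E.card = d * ((D + 1) * (D + 2)) ∧ (∀ α ∈ E, α 2 < d ∧ ∑ i, α i ≤ D + d) ∧
    3 * ∑ α ∈ E, ∑ i, α i ≤ E.card * (2 * D + 3 * d) := by
  classical
  set T := ((range (D + 1)).sigma fun n => range (n + 1)) ×ˢ range d
  let ψ : (Σ _ : ℕ, ℕ) × ℕ → (Fin 3 →₀ ℕ) :=
    fun t => Finsupp.equivFunOnFinite.symm ![t.1.1 - t.1.2, t.1.2, t.2]
  have hT : ∀ t ∈ T, t.1.1 ≤ D ∧ t.1.2 ≤ t.1.1 ∧ t.2 < d := fun t ht => by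
    simp only [T, Finset.mem_product, Finset.mem_sigma, mem_range] at ht
    omega
  have hsum : ∀ t ∈ T, ∑ i, ψ t i = t.1.1 + t.2 := fun t ht => by
    have := hT t ht
    simp [ψ, Fin.sum_univ_three]
    omega
  have hinj : InjOn ψ T := fun t ht u hu h => by
    have h0 := dcongr h 0
    have h1 : t.1.2 = u.1.2 := dcongr h 1
    have h2 : t.2 = u.2 := dcongr h 2
    change t.1.1 - t.1.2 = u.1.1 - u.1.2 at h0
    have h3 := hT t ht
    have h4 := hT u hu
    obtain ⟨⟨a, b⟩, c⟩ := t
    obtain ⟨⟨a', b'⟩, c'⟩ := u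
    dsimp only at h0 h1 h2 h3 h4
    obtain rfl : a = a' := by omega
    rw [h1, h2]
  have hcard : 2 * T.card = d * ((D + 1) * (D + 2)) := by
    have : ∀ n, 2 * ∑ i ∈ range (n + 1), (i + 1) = (n + 1) * (n + 2) := fun n => by
      induction n with
      | zero => rfl
      | succ n ih => rw [sum_range_succ, mul_add, ih]; ring
    rw [Finset.card_product, Finset.card_sigma]
    simp only [card_range]
    rw [← mul_assoc, this]
    ring
  refine ⟨T.image ψ, by rwa [card_image_of_injOn hinj], fun α hα => ?_, ?_⟩
  · obtain ⟨t, ht, rfl⟩ := mem_image.1 hα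
    have := hT t ht
    rw [hsum t ht]
    exact ⟨this.2.2, by omega⟩
  · have : ∀ n, 3 * ∑ i ∈ range (n + 1), (i + 1) * i = n * ((n + 1) * (n + 2)) := fun n => by
      induction n with
      | zero => rfl
      | succ n ih => rw [sum_range_succ, mul_add, ih]; ring
    rw [sum_image hinj, card_image_of_injOn hinj]
    have h1 : ∑ t ∈ T, ∑ i, ψ t i ≤ ∑ t ∈ T, (t.1.1 + d) := sum_le_sum fun t ht => by
      have := hT t ht
      rw [hsum t ht]
      omega
    have h2 : ∑ t ∈ T, t.1.1 = d * ∑ i ∈ range (D + 1), (i + 1) * i := by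
      simp only [T, Finset.sum_product, Finset.sum_sigma, sum_const, card_range,
        smul_eq_mul, mul_sum, mul_left_comm]
    rw [sum_add_distrib, sum_const, smul_eq_mul, h2] at h1
    nlinarith [this D]

lemma exists_pow_dvd_det {D : ℕ} (hp : p.Prime) (f : MP 3 ℤ) (x : Fin s → Fin 3 → ℤ) (hx : ∀ j, eval
    (x j) f = 0) (hs : 5 * D ^ 2 ≤ 2 * s) (hpD : 1000 * p ≤ 3 * D) (F : Fin s → MP 3 ℤ) (hZ : ∀ Z :
    Finset (Fin 3 → ZMod p), (∀ a ∈ Z, aeval a f = 0 ∧ aeval a (pderiv 2 f) ≠ 0) → (Z.card : ℝ) ≤ (1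
    + 1 / 100) * p ^ 2) : ∃ e : ℕ, (p : ℤ) ^ e ∣ det (of fun j i => eval (x j) (F i)) ∧ 1.477 * s *
    (D / p) - 2.23 * (D / p) * (univ.filter fun j => (p : ℤ) ∣ eval (x j) (pderiv 2 f)).card ≤ (e :
    ℝ) := by
  classical
  set good := univ.filter fun j => ¬ (p : ℤ) ∣ eval (x j) (pderiv 2 f)
  set b := (univ.filter fun j => (p : ℤ) ∣ eval (x j) (pderiv 2 f)).card
  have hb : b + good.card = s := by
    simpa using card_filter_add_card_filter_not (s := univ)
      fun j => (p : ℤ) ∣ eval (x j) (pderiv 2 f)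
  have hp0 : (0 : ℝ) < p := mod_cast hp.pos
  set k := 223 * D / (100 * p)
  have hk1 : (k : ℝ) ≤ 2.23 * (D / p) := by
    have : k * (100 * p) ≤ 223 * D := Nat.div_mul_le_self _ _
    have : (k : ℝ) * (100 * p) ≤ 223 * D := mod_cast this
    rw [← mul_div_assoc, le_div_iff₀ hp0]
    linarith
  have hpD' : 1000 * (p : ℝ) ≤ 3 * D := mod_cast hpD
  have hk2 : 2.227 * (D / p : ℝ) ≤ k := by
    have : 223 * D < (k + 1) * (100 * p) := by
      have := Nat.lt_div_mul_add (a := 223 * D) (b := 100 * p) (Nat.mul_pos (by norm_num) hp.pos)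
      rwa [add_mul, one_mul]
    have : 223 * (D : ℝ) < (k + 1) * (100 * p) := mod_cast this
    rw [← mul_div_assoc, div_le_iff₀ hp0]
    linarith
  have hn : (good.image fun j => fun i => ((x j i : ℤ) : ZMod p)).card ≤
      ⌊(1 + 1 / 100) * (p : ℝ) ^ 2⌋₊ := Nat.le_floor (hZ _ fun a ha => by
    obtain ⟨j, hj, rfl⟩ := mem_image.1 ha
    have h : ∀ g, aeval (fun i => ((x j i : ℤ) : ZMod p)) g = ((eval (x j) g : ℤ) : ZMod p) :=
      fun g => (aeval_algebraMap_apply (ZMod p) (x j) g).trans rfl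
    rw [h, h, hx j, cast_zero, Ne, intCast_zmod_eq_zero_iff_dvd]
    exact ⟨rfl, (mem_filter.1 hj).2⟩)
  refine ⟨_, det_eval_dvd f p hp k x F good (fun j _ => by rw [hx j]; exact dvd_zero _)
    (fun j hj => (mem_filter.1 hj).2) _ (fun _ => 1) (fun j _ i => by simp) hn, ?_⟩
  set n := ⌊(1 + 1 / 100) * (p : ℝ) ^ 2⌋₊
  have hn' : (n : ℝ) ≤ (1 + 1 / 100) * (p : ℝ) ^ 2 := Nat.floor_le (by positivity)
  have h1 : k * good.card ≤ (k * good.card - n * kap 2 k) + n * kap 2 k := by omega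
  have h2 : (k : ℝ) * good.card ≤ ((k * good.card - n * kap 2 k : ℕ) : ℝ) + n * kap 2 k := by
    exact_mod_cast h1
  have h3 : 6 * (kap 2 k : ℝ) = k * (k + 1) * (k + 2) := mod_cast kap_two k
  have hb' : (b : ℝ) + good.card = s := mod_cast hb
  have hs' : 5 * (D : ℝ) ^ 2 ≤ 2 * s := mod_cast hs
  have hkp : (k : ℝ) * p ≤ 2.23 * D := by
    rw [← mul_div_assoc, le_div_iff₀ hp0] at hk1
    exact hk1
  have h4 : ((p : ℝ) * k + p) * (p * k + 2 * p) ≤ 2 * s := by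
    have hD0 : (0 : ℝ) ≤ D := by positivity
    have h5 : (p : ℝ) * k + p ≤ 2.233 * D := by linarith
    have h6 : (p : ℝ) * k + 2 * p ≤ 2.236 * D := by linarith
    nlinarith [mul_le_mul h5 h6 (by positivity) (by positivity)]
  have h5 : (n : ℝ) * kap 2 k ≤ (1 + 1 / 100) * (k * s / 3) := by
    have h6 : (n : ℝ) * kap 2 k ≤ (1 + 1 / 100) * (p : ℝ) ^ 2 * kap 2 k := by gcongr
    have h7 := mul_le_mul_of_nonneg_left h4 (cast_nonneg (α := ℝ) k)
    nlinarith
  have h6 := mul_le_mul_of_nonneg_right hk2 (cast_nonneg (α := ℝ) s)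
  have h7 := mul_le_mul_of_nonneg_right hk1 (cast_nonneg (α := ℝ) b)
  have h8 : (good.card : ℝ) = s - b := by linarith
  rw [h8] at h2
  have h9 : 0 ≤ (s : ℝ) * (D / p) := by positivity
  linarith

set_option maxHeartbeats 1000000 in
lemma exists_poly_of_residue_counts (d : ℕ) (hd : 5 ≤ d) (A : ℝ) : ∃ W₀ : ℕ, ∀ W, W₀ ≤ W → ∀ f : MP
    3 ℤ, f.totalDegree = d → coeff (single 2 d) f ≠ 0 → ∀ B : ℕ, 1 ≤ B → log B ≤ 200 * (log W + 1) →
    ∀ S : Finset (Fin 3 → ℤ), (∀ x ∈ S, eval x f = 0 ∧ eval x (pderiv 2 f) ≠ 0 ∧ (∀ i, |x i| ≤ B) ∧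
    log |((eval x (pderiv 2 f) : ℤ) : ℝ)| ≤ A * log W) → ∀ N : ℤ, N ≠ 0 → log |(N : ℝ)| ≤ A * log W
    → (∀ (p : ℕ) [Fact p.Prime], W < p → ¬ (p : ℤ) ∣ N → ∀ Z : Finset (Fin 3 → ZMod p), (∀ a ∈ Z,
    aeval a f = 0 ∧ aeval a (pderiv 2 f) ≠ 0) → (Z.card : ℝ) ≤ (1 + 1 / 100) * p ^ 2) → ∃ G : MP 3
    ℚ, ¬ map (castRingHom ℚ) f ∣ G ∧ G.totalDegree ≤ W ^ 97 + d ∧ ∀ x ∈ S, evQ x G = 0 := by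
  classical
  obtain ⟨c, hc0, hc⟩ := exists_mertens
  refine ⟨⌈exp (c + 30)⌉₊ + ⌈100 * A⌉₊ + 2000 * d + 1000, ?_⟩
  intro W hW
  have hW1 : 1 ≤ W := by omega
  have hWr : (1000 : ℝ) ≤ W := mod_cast (by omega : 1000 ≤ W)
  obtain ⟨l, hlW⟩ : ∃ l, l = log W := ⟨_, rfl⟩
  intro f hfd hlc B hB1 hlogB S hS N hN0 hN hcount
  obtain ⟨D, hD⟩ : ∃ D, D = W ^ 97 := ⟨_, rfl⟩
  obtain ⟨V, hV⟩ : ∃ V, V = W ^ 95 := ⟨_, rfl⟩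
  have hDV : D = V * W ^ 2 := by rw [hD, hV, ← pow_add]
  have hlV : log V = 95 * l := by rw [hV, Nat.cast_pow, log_pow, hlW]; rfl
  have hlD : log D = 97 * l := by rw [hD, Nat.cast_pow, log_pow, hlW]; rfl
  have hWV : W ≤ V := hV ▸ Nat.le_self_pow (by norm_num) W
  rw [← hD]
  rw [← hlW] at hlogB hS hN
  clear hD hV
  obtain ⟨E, hE1, hE2, hE3⟩ := exists_monomials_prism d D
  obtain ⟨G, hG0, hGE, hG⟩ := exists_poly_of_minors E (S : Set (Fin 3 → ℤ))
    (fun x α => ∏ i, x i ^ α i) (by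
    intro x hx
    by_contra hne
    have hl : c + 30 ≤ l := by
      rw [hlW, Real.le_log_iff_exp_le (by linarith)]
      exact (le_ceil _).trans (mod_cast (by omega : ⌈exp (c + 30)⌉₊ ≤ W))
    have hAW : 100 * A ≤ W := (le_ceil _).trans (mod_cast (by omega : ⌈100 * A⌉₊ ≤ W))
    have hWD : W ≤ D := by nlinarith
    have hdD : 2000 * (d : ℝ) ≤ D := mod_cast (by omega : 2000 * d ≤ D)
    have hWD' : (W : ℝ) ≤ D := mod_cast hWD
    have hs5 : 5 * D ^ 2 ≤ 2 * E.card := by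
      rw [hE1]
      exact Nat.mul_le_mul hd (by nlinarith)
    have hs0 : (0 : ℝ) < E.card := by
      have : 0 < D ^ 2 := pow_pos (by omega) 2
      exact_mod_cast (by omega : 0 < E.card)
    set Q := (Ioc W V).filter Nat.Prime
    have hQ : ∀ p ∈ Q, W < p ∧ p ≤ V ∧ p.Prime := fun p hp => by
      simp only [Q, mem_filter, mem_Ioc] at hp
      tauto
    have hQsum : 94 * l - 2 * c ≤ ∑ p ∈ Q, log p / p := by
      have h1 := (abs_le.1 (hc V (hW1.trans hWV))).1
      have h2 := (abs_le.1 (hc W hW1)).2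
      rw [sum_filter] at h1 h2 ⊢
      rw [← Finset.sum_Ioc_consecutive _ W.zero_le hWV, hlV] at h1
      rw [← hlW] at h2
      linarith
    have hdiv : ∀ a : ℤ, a ≠ 0 → log |(a : ℝ)| ≤ A * l →
        ∑ p ∈ Q.filter fun p : ℕ => (p : ℤ) ∣ a, log p / p ≤ l / 100 := by
      intro a ha hal
      have h1 := sum_log_primes_dvd_le (Q.filter fun p : ℕ => (p : ℤ) ∣ a) a ha
        (fun p hp => (hQ p (mem_filter.1 hp).1).2.2) fun p hp => (mem_filter.1 hp).2
      calc _ ≤ ∑ p ∈ Q.filter fun p : ℕ => (p : ℤ) ∣ a, log p / W :=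
            sum_le_sum fun p hp => div_le_div_of_nonneg_left (log_natCast_nonneg p)
              (by linarith) (mod_cast (hQ p (mem_filter.1 hp).1).1.le)
        _ ≤ l / 100 := by
          rw [← Finset.sum_div, div_le_div_iff₀ (by linarith) (by norm_num)]
          nlinarith [h1.trans hal]
    set Q' := Q.filter fun p : ℕ => ¬ (p : ℤ) ∣ N
    have hQ' : 94 * l - 2 * c - l / 100 ≤ ∑ p ∈ Q', log p / p := by
      have := Finset.sum_filter_add_sum_filter_not Q (fun p : ℕ => (p : ℤ) ∣ N)
        fun p => log p / p
      linarith [hdiv N hN0 hN]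
    choose! e he1 he2 using fun p (hp : p ∈ Q') => have hp' := mem_filter.1 hp
      have := Fact.mk (hQ p hp'.1).2.2
      exists_pow_dvd_det (D := D) this.out f x (fun j => (hS _ (hx j)).1) hs5 (by
        have h1 := (hQ p hp'.1).2.1
        have h3 : 1000 ≤ W := by omega
        rw [hDV]
        nlinarith [Nat.mul_le_mul_left V (by nlinarith : 1000 ≤ W ^ 2)])
        (fun i => monomial (E.equivFin.symm i).1 1) (hcount p (hQ p hp'.1).1 hp'.2)
    set M : Matrix (Fin E.card) (Fin E.card) ℤ := fun j i => ∏ l, x j l ^ (E.equivFin.symm i).1 l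
    have hM : of (fun j i => eval (x j) (monomial (E.equivFin.symm i).1 1)) = M := by
      ext j i
      rw [of_apply, eval_monomial, prod_fintype _ _ (by simp), one_mul]
    rw [hM] at he1
    have hprod : ∏ p ∈ Q', (p : ℤ) ^ e p ∣ M.det := Finset.prod_dvd_of_coprime
      (fun p hp q hq hpq => (Nat.isCoprime_iff_coprime.2 ((Nat.coprime_primes
        (hQ p (mem_filter.1 hp).1).2.2 (hQ q (mem_filter.1 hq).1).2.2).2 hpq)).pow) he1
    have hlow : ∑ p ∈ Q', e p * log p ≤ log |(M.det : ℝ)| := by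
      have h1 := Int.le_of_dvd (abs_pos.2 hne) ((dvd_abs _ _).2 hprod)
      have hpos : ∀ p ∈ Q', (0 : ℝ) < p := fun p hp => by
        exact_mod_cast (hQ p (mem_filter.1 hp).1).2.2.pos
      have h2 : ∏ p ∈ Q', (p : ℝ) ^ e p ≤ |(M.det : ℝ)| := mod_cast h1
      have h3 := log_le_log (prod_pos fun p hp => pow_pos (hpos p hp) _) h2
      rw [Real.log_prod fun p hp => (pow_pos (hpos p hp) _).ne'] at h3
      simpa only [log_pow] using h3
    have hbad : ∑ p ∈ Q', (univ.filter fun j => (p : ℤ) ∣ eval (x j) (pderiv 2 f)).card *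
        (log p / p) ≤ E.card * (l / 100) := by
      calc _ = ∑ j, ∑ p ∈ Q'.filter fun p : ℕ => (p : ℤ) ∣ eval (x j) (pderiv 2 f), log p / p := by
            simp only [sum_filter]
            rw [sum_comm]
            refine sum_congr rfl fun p _ => ?_
            rw [← sum_filter, sum_const, nsmul_eq_mul]
        _ ≤ ∑ _j : Fin E.card, l / 100 := sum_le_sum fun j _ =>
            (Finset.sum_le_sum_of_subset_of_nonneg
              (Finset.filter_subset_filter _ (filter_subset _ _)) fun p _ _ =>
              div_nonneg (log_natCast_nonneg p) (cast_nonneg p)).trans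
            (hdiv _ (hS _ (hx j)).2.1 (hS _ (hx j)).2.2.2)
        _ = _ := by simp
    have hlow2 : D * (1.477 * E.card * (94 * l - 2 * c - l / 100) - 2.23 * (E.card * (l / 100))) ≤
        log |(M.det : ℝ)| := by
      refine le_trans ?_ hlow
      calc _ ≤ D * (1.477 * E.card * ∑ p ∈ Q', log p / p - 2.23 * ∑ p ∈ Q',
              (univ.filter fun j => (p : ℤ) ∣ eval (x j) (pderiv 2 f)).card *
              (log p / p)) := by gcongr
        _ = ∑ p ∈ Q', (1.477 * E.card * (D / p) - 2.23 * (D / p) * (univ.filter fun j =>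
              (p : ℤ) ∣ eval (x j) (pderiv 2 f)).card) * log p := by
            rw [mul_sum, mul_sum, ← sum_sub_distrib, mul_sum]
            exact sum_congr rfl fun p _ => by ring
        _ ≤ _ := sum_le_sum fun p hp => mul_le_mul_of_nonneg_right (he2 p hp) (log_natCast_nonneg p)
    have hup : log |(M.det : ℝ)| ≤ E.card * log E.card + E.card * (2 * D + 3 * d) / 3 * log B := by
      have h1 := abs_det_le M (fun i => (B : ℤ) ^ (∑ l, (E.equivFin.symm i).1 l)) fun j i =>
        abs_prod_pow_le _ B (hS _ (hx j)).2.2.1 _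
      rw [prod_pow_eq_pow_sum, E.equivFin.symm.sum_comp fun α => ∑ l, α.1 l,
        sum_coe_sort E fun α => ∑ l, α l] at h1
      have h2 : |(M.det : ℝ)| ≤ (E.card : ℝ) ^ E.card * (B : ℝ) ^ (∑ α ∈ E, ∑ l, α l) :=
        (mod_cast h1 : |(M.det : ℝ)| ≤ E.card.factorial * (B : ℝ) ^ (∑ α ∈ E, ∑ l, α l)).trans
          (mul_le_mul_of_nonneg_right (mod_cast E.card.factorial_le_pow) (by positivity))
      have hBr : (1 : ℝ) ≤ B := mod_cast hB1
      have h3 := log_le_log (by rw [abs_pos]; exact_mod_cast hne) h2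
      rw [log_mul (by positivity) (by positivity), log_pow, log_pow] at h3
      have h4 : 3 * ((∑ α ∈ E, ∑ l, α l : ℕ) : ℝ) ≤ E.card * (2 * D + 3 * d) := mod_cast hE3
      have h5 : ((∑ α ∈ E, ∑ l, α l : ℕ) : ℝ) ≤ E.card * (2 * D + 3 * d) / 3 := by linarith
      linarith [mul_le_mul_of_nonneg_right h5 (log_nonneg hBr)]
    have hlogs : log E.card ≤ 3 * d + 194 * l := by
      have h1 : (E.card : ℝ) ≤ 3 * d * (D : ℝ) ^ 2 := by
        have : (D + 1) * (D + 2) ≤ 6 * D ^ 2 := by nlinarith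
        exact_mod_cast (by nlinarith [Nat.mul_le_mul_left d this] : E.card ≤ 3 * d * D ^ 2)
      have hd0 : (0 : ℝ) < 3 * d := by positivity
      have h2 := log_le_log hs0 h1
      rw [log_mul hd0.ne' (by have := hW1.trans hWD; positivity), log_pow, hlD] at h2
      have := Real.log_le_sub_one_of_pos hd0
      push_cast at h2
      linarith
    have hfin := hlow2.trans hup
    have h1 : E.card * log E.card ≤ E.card * (D * (1 / 100 + l / 5)) := by
      refine mul_le_mul_of_nonneg_left (hlogs.trans ?_) hs0.le
      have h3 : 1000 * l ≤ D * l := mul_le_mul_of_nonneg_right (hWr.trans hWD') (by linarith)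
      linarith
    have h2 : E.card * (2 * D + 3 * d) / 3 * log B ≤ E.card * (D * (133.44 * (l + 1))) := by
      have h3 : ((2 * D + 3 * d) / 3 : ℝ) ≤ D * 0.6672 := by linarith
      have h4 := mul_le_mul h3 hlogB (log_natCast_nonneg B) (by positivity)
      linarith [mul_le_mul_of_nonneg_left h4 hs0.le]
    have h3 : 0 < E.card * (D : ℝ) := mul_pos hs0 (by linarith)
    have h4 : E.card * (D : ℝ) * (1.477 * (94 * l - 2 * c - l / 100) - 2.23 * (l / 100)) ≤
        E.card * D * (1 / 100 + l / 5 + 133.44 * (l + 1)) := by linarith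
    have := le_of_mul_le_mul_left h4 h3
    linarith)
  refine ⟨G, ?_, ?_, fun x hx => ?_⟩
  · rintro ⟨q, rfl⟩
    have hne := mul_ne_zero_iff.1 hG0
    have h1 : d ≤ degreeOf 2 (map (castRingHom ℚ) f) := by
      have h2 : single 2 d ∈ (map (castRingHom ℚ) f).support := by
        rw [mem_support_iff, coeff_map]
        simpa using hlc
      simpa using (degreeOf_le_iff (n := 2)).1 le_rfl _ h2
    have h2 := degreeOf_mul_eq (n := 2) hne.1 hne.2
    have h3 : degreeOf 2 (map (castRingHom ℚ) f * q) ≤ d - 1 :=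
      degreeOf_le_iff.2 fun α hα => by have := (hE2 α (hGE hα)).1; omega
    omega
  · exact totalDegree_le_iff.2 fun α hα => mem_monoms.2 (hE2 α (hGE hα)).2
  · rw [eval_eq', sum_subset hGE, ← hG x hx]
    · exact sum_congr rfl fun α _ => by push_cast; rfl
    · intro α _ hα
      rw [notMem_support_iff.1 hα, zero_mul]

lemma exists_poly_of_coeff_ne_zero (d : ℕ) (hd : 5 ≤ d) : ∃ W₀ : ℕ, ∀ W, W₀ ≤ W → ∀ f : MP 3 ℚ,
    Irreducible f → f.totalDegree = d → coeff (single 2 d) f ≠ 0 → ∀ B : ℕ, 1 ≤ B → log B ≤ 200 *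
    (log W + 1) → ∀ S : Finset (Fin 3 → ℤ), (∀ x ∈ S, evQ x f = 0 ∧ ∀ i, |x i| ≤ B) → ∃ G : MP 3 ℚ,
    ¬ f ∣ G ∧ G.totalDegree ≤ W ^ 97 + 2 * d ∧ ∀ x ∈ S, evQ x G = 0 := by
  classical
  obtain ⟨c, hc⟩ := exists_card_smooth_residues_le d (by omega) (1 / 100) (by norm_num)
  obtain ⟨κ, hκ⟩ : ∃ κ, κ = (monoms 3 d).card := ⟨_, rfl⟩
  have hκ0 : 1 ≤ κ := hκ ▸ card_pos.2 ⟨0, by simp [mem_monoms]⟩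
  obtain ⟨a, ha⟩ : ∃ a, a = κ * κ ^ κ := ⟨_, rfl⟩
  have ha0 : 1 ≤ a := ha ▸ Nat.mul_pos hκ0 (pow_pos hκ0 _)
  obtain ⟨M, hM1, hM2, hM3, hM4⟩ : ∃ M, c * a ^ c ≤ M ∧ (d * κ + 1) * c ≤ M ∧ d * a ≤ M ∧
      d * κ + d ≤ M := ⟨c * a ^ c + (d * κ + 1) * c + d * a + (d * κ + d), by omega, by omega, by omega, by omega⟩
  obtain ⟨W₀, hW₀⟩ := exists_poly_of_residue_counts d hd (401 * M)
  refine ⟨W₀ + c + 3, fun W hW f hf hfd hlc B hB hlogB S hS => ?_⟩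
  have hl : 1 ≤ log W := by
    rw [Real.le_log_iff_exp_le (mod_cast (by omega : 0 < W))]
    exact Real.exp_one_lt_d9.le.trans ((by norm_num : (_ : ℝ) ≤ 3).trans
      (mod_cast (by omega : 3 ≤ W)))
  have hlog : ∀ (z : ℤ) (u k : ℕ), z ≠ 0 → |z| ≤ u * (B : ℤ) ^ k → u ≤ M → k ≤ M →
      log |(z : ℝ)| ≤ 401 * M * log W := by
    intro z u k hz h hu hk
    have h0 : |z| ≤ M * (B : ℤ) ^ M := h.trans (mul_le_mul (mod_cast hu)
      (pow_le_pow_right₀ (mod_cast hB) hk) (by positivity) (by positivity))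
    have h1 := log_le_log (abs_pos.2 (Int.cast_ne_zero.2 hz))
      (mod_cast h0 : |(z : ℝ)| ≤ M * (B : ℝ) ^ M)
    have hM0 : (M : ℝ) ≠ 0 := fun hM0 => hz (abs_nonpos_iff.1 (by simpa [Nat.cast_eq_zero.1 hM0] using h0))
    rw [log_mul hM0 (by positivity), log_pow] at h1
    have h2 := Real.log_le_sub_one_of_pos (lt_of_le_of_ne M.cast_nonneg hM0.symm)
    have h3 := mul_le_mul_of_nonneg_left hl (cast_nonneg (α := ℝ) M)
    have h4 := mul_le_mul_of_nonneg_left hlogB (cast_nonneg (α := ℝ) M)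
    linarith
  obtain ⟨g, hg0, hgd, hgS, hgc⟩ := exists_small_vanishing (T := d) (e := 0) (κ := κ) f hf.ne_zero
    (by omega) (by rw [← hκ, card_monoms]; simp) B hB (S.image fun x => ((1 : ℤ), x)) (Finset.finite_toSet _)
    (by
      intro y hy
      obtain ⟨x, hx, rfl⟩ := mem_image.1 (mem_coe.1 hy)
      simpa using ⟨(hS x hx).1, hB, (hS x hx).2⟩)
  have hgS' : ∀ x ∈ S, eval x g = 0 := fun x hx => by
    have := hgS (1, x) (mem_coe.2 (mem_image_of_mem _ hx))
    simp only [Int.cast_one, inv_one, one_mul] at this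
    rw [eval_map_intCast] at this
    exact_mod_cast this
  have hgn : coeffNorm g ≤ a * (B : ℤ) ^ (d * κ) := by
    refine (coeffNorm_le_card_mul g hgd _ hgc).trans (le_of_eq ?_)
    rw [← hκ, ha]
    push_cast
    ring
  set γ := map (castRingHom ℚ) g with hγ
  have hγ0 : γ ≠ 0 := (map_ne_zero_iff _ (map_injective _ (injective_int _))).2 hg0
  have hγd : γ.totalDegree = g.totalDegree := totalDegree_map_intCast g
  by_cases hfg : f ∣ γ
  swap
  · exact ⟨γ, hfg, by omega, fun x hx => by rw [eval_map_intCast, hgS' x hx, cast_zero]⟩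
  obtain ⟨q, hq⟩ := hfg
  have hq0 : q ≠ 0 := by rintro rfl; exact hγ0 (by rw [hq, mul_zero])
  have hdq := totalDegree_mul_of_isDomain hf.ne_zero hq0
  rw [← hq] at hdq
  obtain ⟨r, rfl⟩ : ∃ r, q = C r := ⟨_, totalDegree_eq_zero_iff_eq_C.1 (by omega)⟩
  have hr : r ≠ 0 := by rintro rfl; exact hq0 C_0
  have hass : Associated f γ := ⟨((isUnit_iff_ne_zero.2 hr).map C).unit, hq.symm⟩
  have hgd' : g.totalDegree = d := by rw [totalDegree_C] at hdq; omega
  have hirr : Irreducible γ := hass.irreducible hf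
  have hlcg : coeff (single 2 d) g ≠ 0 := fun h0 => by
    have h1 : coeff (single 2 d) γ = 0 := by rw [hγ, coeff_map, h0, map_zero]
    rw [hq, mul_comm, coeff_C_mul] at h1
    exact mul_ne_zero hr hlc h1
  have hp0 : pderiv 2 γ ≠ 0 := by
    refine pderiv_ne_zero_of_degreeOf 2 fun h0 => ?_
    have := degreeOf_le_iff.1 h0.le (single 2 d) (by
      rw [mem_support_iff, hγ, coeff_map]
      exact Int.cast_ne_zero.2 hlcg)
    simp at this
    omega
  have hpd : (pderiv 2 γ).totalDegree < d := by
    have := totalDegree_pderiv_le 2 γ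
    omega
  obtain ⟨G, hG, hGd, hGS⟩ : ∃ G : MP 3 ℚ, ¬ γ ∣ G ∧ G.totalDegree ≤ W ^ 97 + d ∧
      ∀ x ∈ S.filter fun x => eval x (pderiv 2 g) ≠ 0, evQ x G = 0 := by
    rcases (S.filter fun x => eval x (pderiv 2 g) ≠ 0).eq_empty_or_nonempty with h | ⟨P, hP⟩
    · exact ⟨1, fun h1 => hirr.not_isUnit (isUnit_of_dvd_one h1), by simp, by simp [h]⟩
    rw [mem_filter] at hP
    have hH : (B : ℤ) ≤ a * (B : ℤ) ^ (d * κ + 1) := by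
      exact_mod_cast (Nat.le_self_pow (by omega) B).trans (Nat.le_mul_of_pos_left _ ha0)
    have hB' : (1 : ℤ) ≤ B := mod_cast hB
    obtain ⟨N, hN0, hN, hcount⟩ := hc g hgd' hirr hlcg (a * (B : ℤ) ^ (d * κ + 1)) (hB'.trans hH)
      (hgn.trans (mul_le_mul_of_nonneg_left (pow_le_pow_right₀ hB' (Nat.le_succ _)) (by positivity)))
      P (fun i => ((hS P hP.1).2 i).trans hH) (hgS' P hP.1) hP.2
    refine hW₀ W (by omega) g hgd' hlcg B hB hlogB _ (fun x hx => ?_) N hN0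
      (hlog N (c * a ^ c) ((d * κ + 1) * c) hN0 ?_ hM1 hM2)
      fun p _ hWp => hcount p (by omega)
    · rw [mem_filter] at hx
      refine ⟨hgS' x hx.1, hx.2, (hS x hx.1).2, hlog _ (d * a) (d * κ + d) hx.2 ?_ hM3 hM4⟩
      have h1 := abs_hval_le_coeffNorm (pderiv 2 g) (T := d) (by have := totalDegree_pderiv_le 2 g; omega)
        1 x B (by simpa using hB) (hS x hx.1).2
      rw [hval_one] at h1
      refine h1.trans ?_
      calc _ ≤ d * (a * (B : ℤ) ^ (d * κ)) * (B : ℤ) ^ d := by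
            gcongr
            exact (coeffNorm_pderiv_le 2 g hgd).trans (by gcongr)
        _ = _ := by push_cast; ring
    · refine hN.trans (le_of_eq ?_)
      push_cast
      ring
  refine ⟨G * pderiv 2 γ, fun h => ?_, ?_, fun x hx => ?_⟩
  · rcases hf.prime.dvd_or_dvd h with h | h
    · exact hG (hass.dvd_iff_dvd_left.1 h)
    · exact not_dvd_of_totalDegree_lt hp0 (by omega) h
  · have := totalDegree_mul G (pderiv 2 γ)
    omega
  · rw [map_mul]
    by_cases h : eval x (pderiv 2 g) = 0
    · rw [hγ, pderiv_map, eval_map_intCast, h, cast_zero, mul_zero]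
    · rw [hGS x (mem_filter.2 ⟨hx, h⟩), zero_mul]

lemma exists_poly_of_totalDegree (d : ℕ) (hd : 5 ≤ d) : ∃ W₀ : ℕ, ∀ W, W₀ ≤ W → ∀ f : MP 3 ℚ,
    Irreducible f → f.totalDegree = d → ∀ B : ℕ, 1 ≤ B → log ((d + 1) * B) ≤ 200 * (log W + 1) → ∀ S
    : Finset (Fin 3 → ℤ), (∀ x ∈ S, evQ x f = 0 ∧ ∀ i, |x i| ≤ B) → ∃ G : MP 3 ℚ, ¬ f ∣ G ∧
    G.totalDegree ≤ W ^ 97 + 2 * d ∧ ∀ x ∈ S, evQ x G = 0 := by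
  classical
  obtain ⟨W₀, hW₀⟩ := exists_poly_of_coeff_ne_zero d hd
  refine ⟨W₀, fun W hW f hf hfd B hB hlog S hS => ?_⟩
  obtain ⟨v, hv, hvd, hlc⟩ := exists_shear hf.ne_zero
  set M := shearMat 2 fun i => (v i : ℚ)
  have hMN := shearMat_mul 2 (fun i => (v i : ℚ)) (congrArg _ hv |>.trans Nat.cast_zero)
  set N := shearMat 2 (-fun i => (v i : ℚ))
  obtain ⟨G, hG, hGd, hGS⟩ := hW₀ W hW (linSub M f) (irreducible_linSub hMN hf)
    ((totalDegree_linSub hMN f).trans hfd) (hfd ▸ hlc) ((d + 1) * B) (Nat.mul_pos d.succ_pos hB)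
    (by push_cast; exact hlog) (S.image (unshear v)) (by
      intro y hy
      obtain ⟨x, hx, rfl⟩ := mem_image.1 hy
      exact ⟨(eval_unshear hv x f).trans (hS x hx).1, abs_unshear_le (hfd ▸ hvd) (hS x hx).2⟩)
  have hback := linSub_linSub_of_mul (mul_eq_one_comm.1 hMN) G
  refine ⟨linSub N G, fun ⟨q, hq⟩ => hG ⟨linSub M q, ?_⟩, (totalDegree_linSub_le _ _).trans hGd, fun x hx => ?_⟩
  · rw [← hback, hq]
    exact map_mul (aeval _) _ _
  · rw [← eval_unshear hv, hback]
    exact hGS _ (mem_image_of_mem _ hx)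

lemma curve_term_le {K d x y z b B L : ℝ} (hK : 0 ≤ K) (hd : 5 ≤ d) (hb0 : 0 ≤ b) (hx : 0 ≤ x) (hy :
    0 ≤ y) (hL0 : 0 ≤ L) (hB : 0 ≤ B) (hb : b ≤ 4 * d * x) (hL : L ≤ 34 * z) (e1 : x * y ≤ B) (e2 :
    x * (x * z) = B) : K * d ^ 4 * b * (y + d * b * L) ≤ 500 * K * d ^ 8 * B := by
  have hKd : 0 ≤ K * d ^ 4 := by positivity
  calc _ ≤ K * d ^ 4 * (4 * d * x) * (y + d * (4 * d * x) * (34 * z)) := by gcongr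
    _ = K * d ^ 4 * (4 * d * (x * y) + 544 * d ^ 3 * (x * (x * z))) := by ring
    _ ≤ K * d ^ 4 * (4 * d * B + 544 * d ^ 3 * B) := by
        rw [e2]
        gcongr
    _ ≤ K * d ^ 4 * (500 * d ^ 4 * B) := by
        have h3 : (0 : ℝ) ≤ d * B := by positivity
        have h4 : (4 : ℝ) + 544 * d ^ 2 ≤ 500 * d ^ 3 := by nlinarith [sq_nonneg d]
        have := mul_le_mul_of_nonneg_right h4 h3
        refine mul_le_mul_of_nonneg_left ?_ hKd
        linarith
    _ = _ := by ring

lemma card_zeros_le_of_totalDegree (d : ℕ) (hd : 5 ≤ d) : ∃ C : ℝ, 0 ≤ C ∧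
    ∀ (f : MP 3 ℚ) (_ : Irreducible f) (_ : IsNCC f) (_ : f.totalDegree = d)
    (_ : RIrreducible 2 (homogeneousComponent d f)) (B : ℕ) (_ : 2 ≤ B) (S : Finset (Fin 3 → ℤ))
    (_ : ∀ x ∈ S, evQ x f = 0 ∧ ∀ i, |x i| ≤ B), (S.card : ℝ) ≤ C * B := by
  classical
  obtain ⟨W₀, hW₀⟩ := exists_poly_of_totalDegree d hd
  obtain ⟨C₁, hC₁, hspread⟩ := exists_spread_subset
  obtain ⟨K, hK, hcurve⟩ := card_curve_zeros_le
  obtain ⟨Q, hQ⟩ : ∃ Q : ℝ, Q = (W₀ + 1) ^ 200 := ⟨_, rfl⟩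
  have hQ0 : 0 ≤ Q := hQ ▸ by positivity
  refine ⟨(2 * Q + 1) ^ 3 + (C₁ * (d : ℝ) ^ (9 / 2 : ℝ) + 500 * K * d ^ 8),
    by positivity, fun f hf hN hfd hF B hB S hS => ?_⟩
  have hBr : (2 : ℝ) ≤ B := mod_cast hB
  have hd0 : (5 : ℝ) ≤ d := mod_cast hd
  obtain ⟨W, hW⟩ : ∃ W, W = ⌊((d + 1) * B : ℝ) ^ (1 / 200 : ℝ)⌋₊ := ⟨_, rfl⟩
  have hy1 : (1 : ℝ) ≤ (d + 1) * B := by nlinarith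
  have hy0 : (0 : ℝ) < (d + 1) * B := by linarith
  rw [add_mul]
  rcases lt_or_ge W W₀ with hlt | hge
  · have h1 : ((d + 1) * B : ℝ) ^ (1 / 200 : ℝ) ≤ W₀ + 1 :=
      (Nat.lt_floor_add_one _).le.trans (by rw [← hW]; exact_mod_cast (by omega : W + 1 ≤ W₀ + 1))
    have h2 : (B : ℝ) ≤ Q := by
      have h3 := pow_le_pow_left₀ (by positivity) h1 200
      rw [← Real.rpow_mul_natCast hy0.le] at h3
      norm_num at h3
      rw [← hQ] at h3
      refine le_trans (le_mul_of_one_le_left (by positivity) ?_) h3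
      linarith
    have h3 : S.card ≤ (2 * B + 1) ^ 3 := by
      have : S ⊆ piFinset fun _ => Icc (-B : ℤ) B := fun x hx =>
        mem_piFinset.2 fun i => mem_Icc.2 (abs_le.1 ((hS x hx).2 i))
      refine (card_le_card this).trans (le_of_eq ?_)
      rw [Fintype.card_piFinset]
      simp
      congr 1
      omega
    have h4 : (S.card : ℝ) ≤ (2 * Q + 1) ^ 3 :=
      (mod_cast h3 : (S.card : ℝ) ≤ (2 * B + 1) ^ 3).trans (by gcongr)
    have h5 : (0 : ℝ) ≤ (C₁ * (d : ℝ) ^ (9 / 2 : ℝ) + 500 * K * d ^ 8) * B := by positivity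
    have h6 := le_mul_of_one_le_right (h := (by linarith : (1 : ℝ) ≤ B)) (by positivity : 0 ≤ (2 * Q + 1) ^ 3)
    linarith
  · have hlogW : log ((d + 1) * B) ≤ 200 * (log W + 1) := by
      have hW1 : (1 : ℝ) ≤ W := by
        rw [hW]
        exact_mod_cast (Nat.one_le_floor_iff _).2 (one_le_rpow hy1 (by norm_num))
      have h1 : ((d + 1) * B : ℝ) ^ (1 / 200 : ℝ) ≤ W * exp 1 :=
        (Nat.lt_floor_add_one _).le.trans (by rw [← hW]; nlinarith [Real.add_one_le_exp 1])
      have h2 := log_le_log (by positivity) h1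
      rw [Real.log_rpow hy0, log_mul (by linarith) (Real.exp_pos 1).ne', Real.log_exp] at h2
      linarith
    obtain ⟨S', hS', hsp, hcard⟩ := hspread f hf hN (by omega) (by rwa [hfd]) B (by omega) S
      fun x hx => (hS x hx).2
    obtain ⟨G, hG, hGd, hGS⟩ := hW₀ W hge f hf hfd B (by omega) hlogW S hS
    have h1 := hcurve f G hf hG (by omega) _ hGd B hB S' hsp fun x hx =>
      ⟨(hS x (hS' hx)).1, hGS x (hS' hx), (hS x (hS' hx)).2⟩
    rw [hfd] at h1 hcard
    have hb : ((W ^ 97 + 2 * d : ℕ) : ℝ) ≤ 4 * d * (B : ℝ) ^ (97 / 200 : ℝ) := by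
      have h2 : (W : ℝ) ^ 97 ≤ (d + 1) * (B : ℝ) ^ (97 / 200 : ℝ) := by
        have h3 := pow_le_pow_left₀ W.cast_nonneg (hW ▸ Nat.floor_le (Real.rpow_nonneg hy0.le (1 / 200 : ℝ))) 97
        rw [← Real.rpow_mul_natCast hy0.le, mul_rpow (by positivity) (by positivity)] at h3
        have h4 : ((d : ℝ) + 1) ^ (97 / 200 : ℝ) ≤ d + 1 :=
          Real.rpow_le_self_of_one_le (by linarith) (by norm_num)
        norm_num at h3 ⊢
        exact h3.trans (mul_le_mul_of_nonneg_right h4 (by positivity))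
      have h3 : (1 : ℝ) ≤ (B : ℝ) ^ (97 / 200 : ℝ) := one_le_rpow (by linarith) (by norm_num)
      have h4 := mul_le_mul_of_nonneg_left h3 (by linarith : (0 : ℝ) ≤ 2 * d - 1 + 1)
      have h5 := mul_le_mul_of_nonneg_right hd0 (by linarith : (0 : ℝ) ≤ (B : ℝ) ^ (97 / 200 : ℝ))
      push_cast
      linarith
    have hlogB : log B ≤ 34 * (B : ℝ) ^ (3 / 100 : ℝ) := by
      have := log_le_rpow_div (x := B) (by positivity) (by norm_num : (0 : ℝ) < 3 / 100)
      have h0 : (0 : ℝ) ≤ (B : ℝ) ^ (3 / 100 : ℝ) := by positivity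
      linarith
    have e1 : (B : ℝ) ^ (97 / 200 : ℝ) * (B : ℝ) ^ (51 / 100 : ℝ) ≤ B := by
      rw [← rpow_add (by linarith)]
      exact Real.rpow_le_self_of_one_le (by linarith) (by norm_num)
    have e2 : (B : ℝ) ^ (97 / 200 : ℝ) * ((B : ℝ) ^ (97 / 200 : ℝ) * (B : ℝ) ^ (3 / 100 : ℝ)) = B := by
      rw [← rpow_add (by linarith), ← rpow_add (by linarith)]
      norm_num
    have hx : 0 ≤ (B : ℝ) ^ (97 / 200 : ℝ) := by positivity
    have hy : 0 ≤ (B : ℝ) ^ (51 / 100 : ℝ) := by positivity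
    generalize (B : ℝ) ^ (97 / 200 : ℝ) = x at hb e1 e2 hx
    generalize (B : ℝ) ^ (51 / 100 : ℝ) = y at h1 e1 hy
    generalize (B : ℝ) ^ (3 / 100 : ℝ) = z at hlogB e2
    have hb0 : (0 : ℝ) ≤ (W ^ 97 + 2 * d : ℕ) := cast_nonneg _
    generalize ((W ^ 97 + 2 * d : ℕ) : ℝ) = b at h1 hb hb0
    have h2 := h1.trans (curve_term_le (by positivity) hd0 hb0 hx hy
      (log_natCast_nonneg B) (by positivity) hb hlogB e1 e2)
    have h3 : (0 : ℝ) ≤ (2 * Q + 1) ^ 3 * (B : ℝ) := by positivity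
    linarith

theorem affine_surface_growth_deg_ge_five : ∃ c : ℝ, ∀ (f : MP 3 ℤ) (d : ℕ), f.totalDegree = d → 5 ≤
    d → Irreducible (MvPolynomial.map (castRingHom ℚ) f) → IsNCC (MvPolynomial.map (castRingHom ℚ)
    f) → RIrreducible 2 (MvPolynomial.map (castRingHom ℚ) (MvPolynomial.homogeneousComponent d f)) →
    ∀ B : ℝ, 2 ≤ B → (Naff f B : ℝ) ≤ c * (d : ℝ) ^ ((9 : ℝ) / 2) * B := by
  obtain ⟨D, C, hlarge⟩ := card_zeros_le_of_large_degree
  choose! K hK hsmall using card_zeros_le_of_totalDegree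
  have hsum : 0 ≤ ∑ d ∈ (range D).filter (5 ≤ ·), K d :=
    Finset.sum_nonneg fun d hd => hK d (mem_filter.1 hd).2
  refine ⟨|C| + ∑ d ∈ (range D).filter (5 ≤ ·), K d, fun f d hfd hd hf hN hF B hB => ?_⟩
  have hF' : map (castRingHom ℚ) (homogeneousComponent d f) =
      homogeneousComponent d (map (castRingHom ℚ) f) := by
    ext α
    rw [coeff_map, coeff_homogeneousComponent, coeff_homogeneousComponent, coeff_map]
    split_ifs <;> simp
  rw [hF'] at hF
  have hfd' := (totalDegree_map_intCast f).trans hfd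
  have hB2 : 2 ≤ ⌊B⌋₊ := Nat.le_floor (mod_cast hB)
  have hBf := Nat.floor_le (by linarith : 0 ≤ B)
  have hbox : ∀ x : Fin 3 → ℤ, (∀ i, (|x i| : ℝ) ≤ B) → ∀ i, |x i| ≤ (⌊B⌋₊ : ℤ) := fun x hx i => by
    have h1 : ((x i).natAbs : ℝ) ≤ B := by rw [Nat.cast_natAbs, Int.cast_abs]; exact hx i
    rw [Int.abs_eq_natAbs]
    exact_mod_cast Nat.le_floor h1
  have hfin : {x : Fin 3 → ℤ | eval x f = 0 ∧ ∀ i, (|x i| : ℝ) ≤ B}.Finite :=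
    (piFinset fun _ => Icc (-⌊B⌋₊ : ℤ) ⌊B⌋₊).finite_toSet.subset fun x hx =>
      mem_coe.2 (mem_piFinset.2 fun i => mem_Icc.2 (abs_le.1 (hbox x hx.2 i)))
  rw [Naff, Set.ncard_eq_toFinset_card _ hfin]
  have hS : ∀ x ∈ hfin.toFinset, evQ x (map (castRingHom ℚ) f) = 0 ∧
      ∀ i, |x i| ≤ (⌊B⌋₊ : ℤ) := fun x hx => by
    have hx := hfin.mem_toFinset.1 hx
    exact ⟨by rw [eval_map_intCast, hx.1, cast_zero], hbox x hx.2⟩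
  have hd1 : (1 : ℝ) ≤ (d : ℝ) ^ ((9 : ℝ) / 2) :=
    one_le_rpow (mod_cast (by omega : 1 ≤ d)) (by norm_num)
  have hdB : 0 ≤ (d : ℝ) ^ ((9 : ℝ) / 2) * B := by positivity
  rw [mul_assoc]
  rcases lt_or_ge d D with h | h
  · have h1 := hsmall d hd _ hf hN hfd' hF _ hB2 _ hS
    refine (h1.trans (mul_le_mul_of_nonneg_left (hBf.trans (le_mul_of_one_le_left (by linarith) hd1))
      (hK d hd))).trans (mul_le_mul_of_nonneg_right ?_ hdB)
    have := single_le_sum (f := K) (s := (range D).filter (5 ≤ ·))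
      (fun d hd => hK d (mem_filter.1 hd).2) (a := d) (by simp [h, hd])
    linarith [abs_nonneg C]
  · have h1 := hlarge _ hf hN (by omega) (by rwa [hfd']) _ hB2 _ hS
    rw [hfd', mul_assoc] at h1
    refine h1.trans ((mul_le_mul_of_nonneg_right ((le_abs_self C).trans (le_add_of_nonneg_right hsum))
      (by positivity)).trans (mul_le_mul_of_nonneg_left ?_ (by positivity)))
    gcongr
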